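/- The iterated commutator map c₃ : SU(2) × SU(2) × SU(2) → SU(2), sending (g₁,g₂,g₃) to [g₃,[g₂,g₁]] where [x,y] = xyx⁻¹y⁻¹, is a continuous map which is not null-homotopic. -/

import Mathlib

/-- The special unitary group `SU(n)`: the subgroup of the unitary group
`U(n) = Matrix.unitaryGroup (Fin n) ℂ` consisting of matrices of determinant `1`. -/
def SU (n : ℕ) : Subgroup (Matrix.unitaryGroup (Fin n) ℂ) where
  carrier := {A | (A : Matrix (Fin n) (Fin n) ℂ).det = 1}
  mul_mem' := by
    intro a b ha hb
    simp only [Set.mem_setOf_eq] at *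
    simp [Matrix.UnitaryGroup.mul_val, Matrix.det_mul, ha, hb]
  one_mem' := by simp
  inv_mem' := by
    intro a ha
    simp only [Set.mem_setOf_eq] at *
    show ((a⁻¹ : Matrix.unitaryGroup (Fin n) ℂ) : Matrix (Fin n) (Fin n) ℂ).det = 1
    rw [Matrix.UnitaryGroup.inv_val, Matrix.star_eq_conjTranspose, Matrix.det_conjTranspose, ha]
    simp

set_option linter.all false
set_option autoImplicit false

namespace PK

abbrev Mat (ι : Type) := Matrix ι ι ℂ

section basic
variable {X Y : Type} [TopologicalSpace X] [TopologicalSpace Y]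
variable {ι κ α β ν : Type} [Fintype ι] [DecidableEq ι] [Fintype κ] [DecidableEq κ]
  [Fintype α] [DecidableEq α] [Fintype β] [DecidableEq β] [Fintype ν] [DecidableEq ν]

/-- continuous family of invertible matrices -/
def GLc (u : X → Mat ι) : Prop := Continuous u ∧ ∀ x, IsUnit (u x)

/-- block sum -/
def ds (A : Mat ι) (B : Mat κ) : Mat (ι ⊕ κ) := Matrix.fromBlocks A 0 0 B

/-- reindexing -/
def ri (e : ι ≃ κ) (A : Mat ι) : Mat κ := A.submatrix e.symm e.symm

theorem ds_mul (A A' : Mat ι) (B B' : Mat κ) : ds A B * ds A' B' = ds (A * A') (B * B') := by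
  simp [ds, Matrix.fromBlocks_multiply]

@[simp] theorem ds_one : ds (1 : Mat ι) (1 : Mat κ) = 1 := Matrix.fromBlocks_one

theorem ri_mul (e : ι ≃ κ) (A B : Mat ι) : ri e (A * B) = ri e A * ri e B := by
  simp [ri, Matrix.submatrix_mul_equiv]

@[simp] theorem ri_one (e : ι ≃ κ) : ri e (1 : Mat ι) = 1 := by simp [ri]

theorem isUnit_mk {A B : Mat ι} (h : A * B = 1) : IsUnit A :=
  (Matrix.isUnit_iff_isUnit_det _).2 (Matrix.isUnit_det_of_right_inverse h)

theorem isUnit_ds {A : Mat ι} {B : Mat κ} (hA : IsUnit A) (hB : IsUnit B) : IsUnit (ds A B) := by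
  obtain ⟨a, ha⟩ := hA.exists_right_inv
  obtain ⟨b, hb⟩ := hB.exists_right_inv
  exact isUnit_mk (B := ds a b) (by rw [ds_mul, ha, hb, ds_one])

theorem isUnit_ri {A : Mat ι} (e : ι ≃ κ) (hA : IsUnit A) : IsUnit (ri e A) := by
  obtain ⟨a, ha⟩ := hA.exists_right_inv
  exact isUnit_mk (B := ri e a) (by rw [← ri_mul, ha, ri_one])

theorem continuous_ds {u : X → Mat ι} {v : X → Mat κ} (hu : Continuous u) (hv : Continuous v) :
    Continuous fun x => ds (u x) (v x) :=
  hu.matrix_fromBlocks continuous_const continuous_const hv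

theorem GLc.ds {u : X → Mat ι} {v : X → Mat κ} (hu : GLc u) (hv : GLc v) :
    GLc fun x => ds (u x) (v x) :=
  ⟨continuous_ds hu.1 hv.1, fun x => isUnit_ds (hu.2 x) (hv.2 x)⟩

theorem GLc.ri {u : X → Mat ι} (e : ι ≃ κ) (hu : GLc u) : GLc fun x => ri e (u x) :=
  ⟨hu.1.matrix_submatrix _ _, fun x => isUnit_ri e (hu.2 x)⟩

theorem GLc.mul {u v : X → Mat ι} (hu : GLc u) (hv : GLc v) : GLc fun x => u x * v x :=
  ⟨hu.1.matrix_mul hv.1, fun x => (hu.2 x).mul (hv.2 x)⟩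

theorem GLc.const {A : Mat ι} (h : IsUnit A) : GLc (fun _ : X => A) := ⟨continuous_const, fun _ => h⟩

theorem GLc.one : GLc (fun _ : X => (1 : Mat ι)) := GLc.const isUnit_one

theorem GLc.comp {u : Y → Mat ι} (hu : GLc u) {f : X → Y} (hf : Continuous f) :
    GLc fun x => u (f x) := ⟨hu.1.comp hf, fun x => hu.2 _⟩

theorem GLc.inv {u : X → Mat ι} (hu : GLc u) : GLc fun x => (u x)⁻¹ := by
  refine ⟨?_, fun x => ?_⟩
  · simp only [Matrix.inv_def, Ring.inverse_eq_inv']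
    exact (hu.1.matrix_det.inv₀ fun x => ((Matrix.isUnit_iff_isUnit_det _).1 (hu.2 x)).ne_zero).smul
      hu.1.matrix_adjugate
  · have := Matrix.nonsing_inv_mul (u x) ((Matrix.isUnit_iff_isUnit_det _).1 (hu.2 x))
    exact isUnit_mk this

theorem mul_inv' {A : Mat ι} (h : IsUnit A) : A * A⁻¹ = 1 :=
  Matrix.mul_nonsing_inv A ((Matrix.isUnit_iff_isUnit_det _).1 h)
theorem inv_mul' {A : Mat ι} (h : IsUnit A) : A⁻¹ * A = 1 :=
  Matrix.nonsing_inv_mul A ((Matrix.isUnit_iff_isUnit_det _).1 h)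

theorem GLc.of_inv {u v : X → Mat ι} (hu : Continuous u) (h : ∀ x, u x * v x = 1) : GLc u :=
  ⟨hu, fun x => isUnit_mk (h x)⟩

theorem GLc.of_inv' {u v : X → Mat ι} (hu : Continuous u) (h : ∀ x, v x * u x = 1) : GLc u :=
  ⟨hu, fun x => (Matrix.isUnit_iff_isUnit_det _).2 (Matrix.isUnit_det_of_left_inverse (h x))⟩

/-- homotopy through invertible families -/
def Htpy (u v : X → Mat ι) : Prop :=
  ∃ H : X × ℝ → Mat ι, GLc H ∧ (∀ x, H (x, 0) = u x) ∧ ∀ x, H (x, 1) = v x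

theorem Htpy.left {u v : X → Mat ι} (h : Htpy u v) : GLc u := by
  obtain ⟨H, hH, h0, h1⟩ := h
  have := hH.comp (f := fun x : X => (x, (0:ℝ))) (by fun_prop)
  simpa only [h0] using this

theorem Htpy.right {u v : X → Mat ι} (h : Htpy u v) : GLc v := by
  obtain ⟨H, hH, h0, h1⟩ := h
  have := hH.comp (f := fun x : X => (x, (1:ℝ))) (by fun_prop)
  simpa only [h1] using this

theorem Htpy.refl {u : X → Mat ι} (h : GLc u) : Htpy u u :=
  ⟨fun p => u p.1, h.comp continuous_fst, fun _ => rfl, fun _ => rfl⟩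

theorem Htpy.of_eq {u v : X → Mat ι} (h : GLc u) (e : ∀ x, u x = v x) : Htpy u v := by
  rw [← funext e]; exact Htpy.refl h

theorem Htpy.symm {u v : X → Mat ι} (h : Htpy u v) : Htpy v u := by
  obtain ⟨H, hH, h0, h1⟩ := h
  exact ⟨fun p => H (p.1, 1 - p.2), hH.comp (by fun_prop), by simp [h1], by simp [h0]⟩

/-- constructor: only need invertibility for parameter in [0,1] -/
theorem Htpy.mk {u v : X → Mat ι} (H : X × ℝ → Mat ι) (hc : Continuous H)
    (hu : ∀ x, ∀ s, 0 ≤ s → s ≤ 1 → IsUnit (H (x, s))) (h0 : ∀ x, H (x, 0) = u x)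
    (h1 : ∀ x, H (x, 1) = v x) : Htpy u v := by
  refine ⟨fun p => H (p.1, max 0 (min 1 p.2)), ⟨hc.comp (by fun_prop), fun p => hu _ _ ?_ ?_⟩, ?_, ?_⟩
  · exact le_max_left _ _
  · exact max_le zero_le_one (min_le_left _ _)
  · simp [h0]
  · simp [h1]

theorem Htpy.trans {u v w : X → Mat ι} (h : Htpy u v) (h' : Htpy v w) : Htpy u w := by
  obtain ⟨H, hH, h0, h1⟩ := h
  obtain ⟨K, hK, k0, k1⟩ := h'
  refine ⟨fun p => if p.2 ≤ 1/2 then H (p.1, 2 * p.2) else K (p.1, 2 * p.2 - 1), ⟨?_, ?_⟩, ?_, ?_⟩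
  · refine Continuous.if_le (hH.1.comp (by fun_prop)) (hK.1.comp (by fun_prop)) continuous_snd
      continuous_const ?_
    rintro ⟨x, s⟩ hs
    simp only at hs
    subst hs
    norm_num [h1, k0]
  · intro p
    dsimp only
    split_ifs
    · exact hH.2 _
    · exact hK.2 _
  · intro x; norm_num [h0]
  · intro x; norm_num [k1]

theorem Htpy.ds {u u' : X → Mat ι} {v v' : X → Mat κ} (h : Htpy u u') (h' : Htpy v v') :
    Htpy (fun x => ds (u x) (v x)) (fun x => PK.ds (u' x) (v' x)) := by
  obtain ⟨H, hH, h0, h1⟩ := h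
  obtain ⟨K, hK, k0, k1⟩ := h'
  exact ⟨fun p => PK.ds (H p) (K p), hH.ds hK, by simp [h0, k0], by simp [h1, k1]⟩

theorem Htpy.mul {u u' v v' : X → Mat ι} (h : Htpy u u') (h' : Htpy v v') :
    Htpy (fun x => u x * v x) (fun x => u' x * v' x) := by
  obtain ⟨H, hH, h0, h1⟩ := h
  obtain ⟨K, hK, k0, k1⟩ := h'
  exact ⟨fun p => H p * K p, hH.mul hK, by simp [h0, k0], by simp [h1, k1]⟩

theorem Htpy.inv {u u' : X → Mat ι} (h : Htpy u u') :
    Htpy (fun x => (u x)⁻¹) (fun x => (u' x)⁻¹) := by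
  obtain ⟨H, hH, h0, h1⟩ := h
  exact ⟨fun p => (H p)⁻¹, hH.inv, by simp [h0], by simp [h1]⟩

theorem Htpy.ri {u u' : X → Mat ι} (e : ι ≃ κ) (h : Htpy u u') :
    Htpy (fun x => ri e (u x)) (fun x => PK.ri e (u' x)) := by
  obtain ⟨H, hH, h0, h1⟩ := h
  exact ⟨fun p => PK.ri e (H p), hH.ri e, by simp [h0], by simp [h1]⟩

theorem Htpy.comp {u u' : Y → Mat ι} (h : Htpy u u') {f : X → Y} (hf : Continuous f) :
    Htpy (fun x => u (f x)) (fun x => u' (f x)) := by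
  obtain ⟨H, hH, h0, h1⟩ := h
  exact ⟨fun p => H (f p.1, p.2), hH.comp (by fun_prop), by simp [h0], by simp [h1]⟩

/-! ### stable equivalence -/

theorem ri_ri (e : ι ≃ κ) (f : κ ≃ α) (A : Mat ι) : ri f (ri e A) = ri (e.trans f) A := rfl
theorem ri_refl (A : Mat ι) : ri (Equiv.refl ι) A = A := rfl

theorem ri_ds (e : ι ≃ κ) (f : α ≃ β) (A : Mat ι) (B : Mat α) :
    ri (e.sumCongr f) (ds A B) = ds (ri e A) (ri f B) := by
  ext (i | i) (j | j) <;> rfl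

theorem ri_comm (A : Mat ι) (B : Mat κ) : ri (Equiv.sumComm ι κ) (ds A B) = ds B A := by
  ext (i | i) (j | j) <;> rfl

theorem ri_assoc (A : Mat ι) (B : Mat κ) (C : Mat α) :
    ri (Equiv.sumAssoc ι κ α) (ds (ds A B) C) = ds A (ds B C) := by
  ext (i | i | i) (j | j | j) <;> rfl

theorem ri_assoc_symm (A : Mat ι) (B : Mat κ) (C : Mat α) :
    ri (Equiv.sumAssoc ι κ α).symm (ds A (ds B C)) = ds (ds A B) C := by
  ext ((i | i) | i) ((j | j) | j) <;> rfl

def SEq (u : X → Mat ι) (v : X → Mat κ) : Prop :=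
  ∃ (a b : ℕ) (e : ι ⊕ Fin a ≃ κ ⊕ Fin b),
    Htpy (fun x => ri e (ds (u x) (1 : Mat (Fin a)))) (fun x => ds (v x) (1 : Mat (Fin b)))

theorem SEq.mk' (u : X → Mat ι) (v : X → Mat κ) (e : ι ⊕ α ≃ κ ⊕ β)
    (h : Htpy (fun x => ri e (ds (u x) (1 : Mat α))) (fun x => ds (v x) (1 : Mat β))) :
    SEq u v := by
  refine ⟨Fintype.card α, Fintype.card β,
    ((Equiv.refl ι).sumCongr (Fintype.equivFin α).symm).trans
      (e.trans ((Equiv.refl κ).sumCongr (Fintype.equivFin β))), ?_⟩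
  have := h.ri ((Equiv.refl κ).sumCongr (Fintype.equivFin β))
  simp only [ri_ds, ri_refl, ri_one] at this
  simpa only [← ri_ri, ri_ds, ri_one, ri_refl] using this

theorem SEq.symm {u : X → Mat ι} {v : X → Mat κ} (h : SEq u v) : SEq v u := by
  obtain ⟨a, b, e, h⟩ := h
  refine ⟨b, a, e.symm, ?_⟩
  have := (h.ri e.symm).symm
  simpa only [ri_ri, Equiv.self_trans_symm, ri_refl] using this

theorem SEq.trans {u : X → Mat ι} {v : X → Mat κ} {w : X → Mat ν} (h : SEq u v) (h' : SEq v w) :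
    SEq u w := by
  obtain ⟨a, b, e, h⟩ := h
  obtain ⟨c, d, f, h'⟩ := h'
  let e1 := (Equiv.sumAssoc ι (Fin a) (Fin c)).symm
  let e2 := e.sumCongr (Equiv.refl (Fin c))
  let e3 := Equiv.sumAssoc κ (Fin b) (Fin c)
  let e4 := (Equiv.refl κ).sumCongr (Equiv.sumComm (Fin b) (Fin c))
  let e5 := (Equiv.sumAssoc κ (Fin c) (Fin b)).symm
  let e6 := f.sumCongr (Equiv.refl (Fin b))
  let e7 := Equiv.sumAssoc ν (Fin d) (Fin b)
  refine SEq.mk' u w (e1.trans (e2.trans (e3.trans (e4.trans (e5.trans (e6.trans e7)))))) ?_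
  simp only [← ri_ri]
  have g1 := (h.ds (Htpy.refl (GLc.one (X := X) (ι := Fin c))))
  have g2 := (((g1.ri e3).ri e4).ri e5).ri e6
  have g3 := (h'.ds (Htpy.refl (GLc.one (X := X) (ι := Fin b))))
  simp only [e3, e4, e5, e6, ri_assoc, ri_ds, ri_refl, ri_comm, ri_assoc_symm] at g2
  have g4 := (g2.trans g3).ri e7
  simp only [e7, ri_assoc, ds_one] at g4
  simp only [e1, e2, ← ds_one (ι := Fin a) (κ := Fin c), ri_assoc_symm, ri_ds, ri_refl]
  exact g4

theorem SEq.of_htpy {u v : X → Mat ι} (h : Htpy u v) : SEq u v :=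
  SEq.mk' u v (Equiv.refl (ι ⊕ Fin 0)) (by
    simpa only [ri_refl] using h.ds (Htpy.refl (GLc.one (X := X) (ι := Fin 0))))

theorem SEq.refl {u : X → Mat ι} (h : GLc u) : SEq u u := SEq.of_htpy (Htpy.refl h)

theorem SEq.reindex {u : X → Mat ι} (h : GLc u) (e : ι ≃ κ) : SEq u (fun x => ri e (u x)) :=
  SEq.mk' _ _ (e.sumCongr (Equiv.refl (Fin 0))) (by
    simp only [ri_ds, ri_refl]
    exact Htpy.refl ((h.ri e).ds GLc.one))

theorem SEq.stab {u : X → Mat ι} (h : GLc u) : SEq u (fun x => PK.ds (u x) (1 : Mat α)) :=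
  SEq.mk' (α := α ⊕ Fin 0) (β := Fin 0) _ _ (Equiv.sumAssoc _ _ _).symm (by
    simp only [← ds_one (ι := α) (κ := Fin 0), ri_assoc_symm]
    exact Htpy.refl ((h.ds GLc.one).ds GLc.one))

theorem SEq.ds_right {u : X → Mat ι} {u' : X → Mat κ} (h : SEq u u') {v : X → Mat α} (hv : GLc v) :
    SEq (fun x => PK.ds (v x) (u x)) (fun x => PK.ds (v x) (u' x)) := by
  obtain ⟨a, b, e, h⟩ := h
  refine ⟨a, b, (Equiv.sumAssoc _ _ _).trans (((Equiv.refl α).sumCongr e).trans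
    (Equiv.sumAssoc _ _ _).symm), ?_⟩
  simp only [← ri_ri, ri_assoc, ri_ds, ri_refl]
  have := ((Htpy.refl hv).ds h).ri (Equiv.sumAssoc _ _ _).symm
  simpa only [ri_assoc_symm] using this

theorem SEq.comm {u : X → Mat ι} {v : X → Mat κ} (hu : GLc u) (hv : GLc v) :
    SEq (fun x => PK.ds (u x) (v x)) (fun x => PK.ds (v x) (u x)) := by
  have := SEq.reindex (hu.ds hv) (Equiv.sumComm _ _)
  simpa only [ri_comm] using this

theorem SEq.comp {u : Y → Mat ι} {v : Y → Mat κ} (h : SEq u v) {f : X → Y} (hf : Continuous f) :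
    SEq (fun x => u (f x)) (fun x => v (f x)) := by
  obtain ⟨a, b, e, h⟩ := h
  exact ⟨a, b, e, h.comp hf⟩

end basic
end PK

namespace PK

section rot
variable {X Y : Type} [TopologicalSpace X] [TopologicalSpace Y]
variable {ι κ α β ν : Type} [Fintype ι] [DecidableEq ι] [Fintype κ] [DecidableEq κ]
  [Fintype α] [DecidableEq α] [Fintype β] [DecidableEq β] [Fintype ν] [DecidableEq ν]

/-- rotation by angle `π s / 2` in `ℂ² ⊗ ℂ^ι` -/
noncomputable def rot (ι : Type) [Fintype ι] [DecidableEq ι] (s : ℝ) : Mat (ι ⊕ ι) :=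
  Matrix.fromBlocks ((Real.cos (Real.pi * s / 2) : ℂ) • 1) (-(Real.sin (Real.pi * s / 2) : ℂ) • 1)
    ((Real.sin (Real.pi * s / 2) : ℂ) • 1) ((Real.cos (Real.pi * s / 2) : ℂ) • 1)

theorem cs_sq (t : ℝ) : (Real.cos t : ℂ) * Real.cos t + (Real.sin t : ℂ) * Real.sin t = 1 := by
  have := Real.cos_sq_add_sin_sq t
  have h2 : ((Real.cos t ^ 2 + Real.sin t ^ 2 : ℝ) : ℂ) = 1 := by rw [this]; simp
  push_cast at h2 ⊢
  linear_combination h2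

theorem rot_mul_neg (s : ℝ) : rot ι s * rot ι (-s) = 1 := by
  have h := cs_sq (Real.pi * s / 2)
  have e : Real.pi * (-s) / 2 = -(Real.pi * s / 2) := by ring
  rw [rot, rot, e, Real.cos_neg, Real.sin_neg, Matrix.fromBlocks_multiply]
  rw [← Matrix.fromBlocks_one]
  congr 1 <;> simp only [Matrix.smul_mul, Matrix.mul_smul, Matrix.one_mul, smul_smul, ← add_smul,
    Complex.ofReal_neg, neg_neg]
  · convert one_smul ℂ (1 : Mat ι) using 2; linear_combination h
  · convert zero_smul ℂ (1 : Mat ι) using 2; ring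
  · convert zero_smul ℂ (1 : Mat ι) using 2; ring
  · convert one_smul ℂ (1 : Mat ι) using 2; linear_combination h

theorem rot_neg_mul (s : ℝ) : rot ι (-s) * rot ι s = 1 := by
  have := rot_mul_neg (ι := ι) (-s)
  rwa [neg_neg] at this

@[simp] theorem rot_zero : rot ι 0 = 1 := by
  simp [rot, Matrix.fromBlocks_one]

theorem continuous_rot : Continuous (rot ι) := by
  unfold rot
  have hc : Continuous fun s : ℝ => ((Real.cos (Real.pi * s / 2) : ℝ) : ℂ) := by fun_prop
  have hs : Continuous fun s : ℝ => ((Real.sin (Real.pi * s / 2) : ℝ) : ℂ) := by fun_prop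
  exact Continuous.matrix_fromBlocks (hc.smul continuous_const) (hs.neg.smul continuous_const)
    (hs.smul continuous_const) (hc.smul continuous_const)

theorem rot_one : rot ι 1 = Matrix.fromBlocks 0 (-1) 1 0 := by
  simp [rot]

theorem rot_neg_one : rot ι (-1) = Matrix.fromBlocks 0 1 (-1) 0 := by
  simp [rot, neg_div]

theorem rot_one_conj (A B : Mat ι) : rot ι 1 * ds A B * rot ι (-1) = ds B A := by
  rw [rot_one, rot_neg_one, ds, Matrix.fromBlocks_multiply, Matrix.fromBlocks_multiply, ds]
  simp

theorem GLc_rot {f : X → ℝ} (hf : Continuous f) : GLc fun x => rot ι (f x) :=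
  GLc.of_inv (v := fun x => rot ι (-f x)) (continuous_rot.comp hf) (fun x => rot_mul_neg _)

theorem Htpy.mul_ds {u v : X → Mat ι} (hu : GLc u) (hv : GLc v) :
    Htpy (fun x => PK.ds (u x * v x) (1 : Mat ι)) (fun x => PK.ds (u x) (v x)) := by
  refine ⟨fun p => PK.ds (u p.1) 1 * (rot ι p.2 * PK.ds (v p.1) 1 * rot ι (-p.2)), ?_, ?_, ?_⟩
  · exact ((hu.comp continuous_fst).ds GLc.one).mul
      (((GLc_rot continuous_snd).mul ((hv.comp continuous_fst).ds GLc.one)).mul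
        (GLc_rot continuous_snd.neg))
  · intro x
    simp [ds_mul]
  · intro x
    simp only [rot_one_conj, ds_mul, mul_one, one_mul]

end rot

/-! ### the group K1 -/
section grp
variable (X : Type) [TopologicalSpace X]

structure Obj where
  n : ℕ
  u : X → Mat (Fin n)
  h : GLc u

instance setoidObj : Setoid (Obj X) where
  r a b := SEq a.u b.u
  iseqv := ⟨fun a => SEq.refl a.h, fun h => h.symm, fun h h' => h.trans h'⟩

def K1 : Type := Quotient (setoidObj X)

variable {X}

def K1.q (a : Obj X) : K1 X := Quotient.mk _ a

theorem K1.sound {a b : Obj X} (h : SEq a.u b.u) : K1.q a = K1.q b := Quotient.sound h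
theorem K1.exact {a b : Obj X} (h : K1.q a = K1.q b) : SEq a.u b.u := Quotient.exact h
theorem K1.ind {p : K1 X → Prop} (h : ∀ a, p (K1.q a)) (c : K1 X) : p c := Quotient.inductionOn c h

variable {Y : Type} [TopologicalSpace Y]
variable {ι κ α β ν : Type} [Fintype ι] [DecidableEq ι] [Fintype κ] [DecidableEq κ]
  [Fintype α] [DecidableEq α] [Fintype β] [DecidableEq β] [Fintype ν] [DecidableEq ν]

noncomputable def Obj.mk' {u : X → Mat ι} (h : GLc u) : Obj X :=
  ⟨Fintype.card ι, _, h.ri (Fintype.equivFin ι)⟩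

theorem Obj.mk'_seq {u : X → Mat ι} (h : GLc u) : SEq (Obj.mk' h).u u :=
  (SEq.reindex h (Fintype.equivFin ι)).symm

noncomputable def Obj.add (a b : Obj X) : Obj X := Obj.mk' (a.h.ds b.h)

noncomputable instance : Zero (K1 X) := ⟨K1.q (Obj.mk' (GLc.one (ι := Fin 0)))⟩

open Classical in
noncomputable def cls (u : X → Mat ι) : K1 X :=
  if h : GLc u then K1.q (Obj.mk' h) else 0

theorem cls_eq_of_seq {u : X → Mat ι} {v : X → Mat κ} (hu : GLc u) (hv : GLc v) (h : SEq u v) :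
    cls u = cls v := by
  rw [cls, dif_pos hu, cls, dif_pos hv]
  exact K1.sound (((Obj.mk'_seq hu).trans h).trans (Obj.mk'_seq hv).symm)

theorem seq_of_cls_eq {u : X → Mat ι} {v : X → Mat κ} (hu : GLc u) (hv : GLc v)
    (h : cls u = cls v) : SEq u v := by
  rw [cls, dif_pos hu, cls, dif_pos hv] at h
  have := K1.exact h
  exact ((Obj.mk'_seq hu).symm.trans this).trans (Obj.mk'_seq hv)

theorem exists_cls (c : K1 X) : ∃ (n : ℕ) (u : X → Mat (Fin n)), GLc u ∧ cls u = c := by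
  induction c using K1.ind with
  | h a =>
    refine ⟨a.n, a.u, a.h, ?_⟩
    rw [cls, dif_pos a.h]
    exact K1.sound (Obj.mk'_seq a.h)

theorem SEq.ds {u : X → Mat ι} {u' : X → Mat κ} {v : X → Mat α} {v' : X → Mat β}
    (hu : GLc u) (hu' : GLc u') (hv : GLc v) (hv' : GLc v') (h : SEq u u') (h' : SEq v v') :
    SEq (fun x => PK.ds (u x) (v x)) (fun x => PK.ds (u' x) (v' x)) :=
  (SEq.ds_right h' hu).trans
    ((SEq.comm hu hv').trans ((SEq.ds_right h hv').trans (SEq.comm hv' hu')))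

noncomputable instance : Add (K1 X) :=
  ⟨Quotient.map₂ (fun a b => Obj.mk' (a.h.ds b.h)) (fun a a' h b b' h' =>
    (Obj.mk'_seq _).trans ((SEq.ds a.h a'.h b.h b'.h h h').trans (Obj.mk'_seq _).symm))⟩

theorem cls_ds {u : X → Mat ι} {v : X → Mat κ} (hu : GLc u) (hv : GLc v) :
    cls (fun x => PK.ds (u x) (v x)) = cls u + cls v := by
  rw [cls, dif_pos (hu.ds hv), cls, dif_pos hu, cls, dif_pos hv]
  refine K1.sound ((Obj.mk'_seq _).trans (SEq.trans ?_ (Obj.mk'_seq _).symm))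
  exact SEq.ds hu (Obj.h _) hv (Obj.h _) (Obj.mk'_seq hu).symm (Obj.mk'_seq hv).symm

theorem cls_htpy {u v : X → Mat ι} (h : Htpy u v) : cls u = cls v :=
  cls_eq_of_seq h.left h.right (SEq.of_htpy h)

theorem cls_ri {u : X → Mat ι} (hu : GLc u) (e : ι ≃ κ) : cls (fun x => ri e (u x)) = cls u :=
  (cls_eq_of_seq hu (hu.ri e) (SEq.reindex hu e)).symm

theorem cls_one : cls (fun _ : X => (1 : Mat ι)) = 0 := by
  have : (0 : K1 X) = cls (fun _ : X => (1 : Mat (Fin 0))) := by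
    rw [cls, dif_pos GLc.one]; rfl
  rw [this]
  refine cls_eq_of_seq GLc.one GLc.one ?_
  refine SEq.mk' (α := Fin 0) (β := ι) _ _ (Equiv.sumComm _ _) ?_
  simp only [ds_one, ri_one]
  exact Htpy.refl GLc.one

theorem cls_ds_one {u : X → Mat ι} (hu : GLc u) :
    cls (fun x => PK.ds (u x) (1 : Mat κ)) = cls u :=
  (cls_eq_of_seq hu (hu.ds GLc.one) (SEq.stab hu)).symm

theorem cls_mul' {u v : X → Mat ι} (hu : GLc u) (hv : GLc v) :
    cls (fun x => u x * v x) = cls (fun x => PK.ds (u x) (v x)) := by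
  rw [← cls_htpy (Htpy.mul_ds hu hv), cls_ds_one (hu.mul hv)]

noncomputable instance : Neg (K1 X) :=
  ⟨Quotient.map (fun a => ⟨a.n, fun x => (a.u x)⁻¹, a.h.inv⟩) (by
    rintro a b ⟨m, n, e, h⟩
    refine ⟨m, n, e, ?_⟩
    have := h.inv
    have ds_inv : ∀ {ι κ : Type} [Fintype ι] [DecidableEq ι] [Fintype κ] [DecidableEq κ] (A : Mat ι),
        IsUnit A → (PK.ds A (1 : Mat κ))⁻¹ = PK.ds A⁻¹ 1 := by
      intro ι κ _ _ _ _ A hA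
      refine Matrix.inv_eq_right_inv ?_
      rw [ds_mul, mul_inv' hA, one_mul, ds_one]
    refine Eq.mp ?_ this
    congr 1
    · funext x
      refine Matrix.inv_eq_right_inv ?_
      rw [← ri_mul, ds_mul, mul_inv' (a.h.2 x), one_mul, ds_one, ri_one]
    · funext x
      exact ds_inv _ (b.h.2 x))⟩

theorem add_assoc_K1 (a b c : K1 X) : a + b + c = a + (b + c) := by
  obtain ⟨_, u, hu, rfl⟩ := exists_cls a
  obtain ⟨_, v, hv, rfl⟩ := exists_cls b
  obtain ⟨_, w, hw, rfl⟩ := exists_cls c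
  rw [← cls_ds hu hv, ← cls_ds (hu.ds hv) hw, ← cls_ds hv hw, ← cls_ds hu (hv.ds hw),
    ← cls_ri ((hu.ds hv).ds hw) (Equiv.sumAssoc _ _ _)]
  simp only [ri_assoc]

theorem add_comm_K1 (a b : K1 X) : a + b = b + a := by
  obtain ⟨_, u, hu, rfl⟩ := exists_cls a
  obtain ⟨_, v, hv, rfl⟩ := exists_cls b
  rw [← cls_ds hu hv, ← cls_ds hv hu, ← cls_ri (hu.ds hv) (Equiv.sumComm _ _)]
  simp only [ri_comm]

theorem add_zero_K1 (a : K1 X) : a + 0 = a := by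
  obtain ⟨_, u, hu, rfl⟩ := exists_cls a
  rw [← cls_one (ι := Fin 0), ← cls_ds hu GLc.one, cls_ds_one hu]

theorem neg_add_K1 (a : K1 X) : -a + a = 0 := by
  induction a using K1.ind with
  | h a =>
    have e1 : (-(K1.q a)) = cls (fun x => (a.u x)⁻¹) := by
      rw [cls, dif_pos a.h.inv]
      exact K1.sound (Obj.mk'_seq a.h.inv).symm
    have e2 : (K1.q a) = cls a.u := by
      rw [cls, dif_pos a.h]
      exact K1.sound (Obj.mk'_seq a.h).symm
    change (-(K1.q a)) + (K1.q a) = 0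
    rw [e1, e2, ← cls_ds a.h.inv a.h, ← cls_mul' a.h.inv a.h, ← cls_one (ι := Fin a.n)]
    congr 1
    funext x
    exact inv_mul' (a.h.2 x)

noncomputable instance : AddCommGroup (K1 X) where
  add_assoc := add_assoc_K1
  zero_add a := by rw [add_comm_K1, add_zero_K1]
  add_zero := add_zero_K1
  nsmul := nsmulRec
  zsmul := zsmulRec
  neg_add_cancel := neg_add_K1
  add_comm := add_comm_K1

theorem cls_mul {u v : X → Mat ι} (hu : GLc u) (hv : GLc v) :
    cls (fun x => u x * v x) = cls u + cls v := by rw [cls_mul' hu hv, cls_ds hu hv]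

theorem cls_inv {u : X → Mat ι} (hu : GLc u) : cls (fun x => (u x)⁻¹) = - cls u := by
  rw [eq_neg_iff_add_eq_zero, ← cls_mul hu.inv hu, ← cls_one (ι := ι)]
  congr 1; funext x; exact inv_mul' (hu.2 x)

theorem cls_conj {u g k : X → Mat ι} (hu : GLc u) (hg : Continuous g) (hk : Continuous k)
    (h : ∀ x, g x * k x = 1) : cls (fun x => g x * u x * k x) = cls u := by
  have hg' : GLc g := GLc.of_inv hg h
  have hk' : GLc k := GLc.of_inv' hk h
  have : cls g + cls k = 0 := by
    rw [← cls_mul hg' hk', ← cls_one (ι := ι)]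
    congr 1; funext x; exact h x
  rw [cls_mul (hg'.mul hu) hk', cls_mul hg' hu]
  rw [add_right_comm, this, zero_add]

theorem cls_eq_zero {u : X → Mat ι} (hu : GLc u) (h : cls u = 0) :
    ∃ m : ℕ, Htpy (fun x => PK.ds (u x) (1 : Mat (Fin m))) (fun _ => 1) := by
  rw [← cls_one (ι := Fin 0)] at h
  obtain ⟨a, b, e, h⟩ := seq_of_cls_eq hu GLc.one h
  refine ⟨a, ?_⟩
  have := h.ri e.symm
  simpa only [ri_ri, Equiv.self_trans_symm, ri_refl, ds_one, ri_one] using this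

/-- universal property -/
noncomputable def K1.lift {Γ : Type} [AddCommGroup Γ] (F : ∀ n : ℕ, (X → Mat (Fin n)) → Γ)
    (hF : ∀ m n (u : X → Mat (Fin m)) (v : X → Mat (Fin n)), GLc u → GLc v → SEq u v → F m u = F n v)
    (hadd : ∀ m n (u : X → Mat (Fin m)) (v : X → Mat (Fin n)), GLc u → GLc v →
      F (m + n) (fun x => ri finSumFinEquiv (PK.ds (u x) (v x))) = F m u + F n v) : K1 X →+ Γ :=
  AddMonoidHom.mk' (Quotient.lift (fun a : Obj X => F a.n a.u) (fun a b h => hF _ _ _ _ a.h b.h h))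
    (by
      intro a b
      induction a using K1.ind with
      | h a =>
      induction b using K1.ind with
      | h b =>
        change F _ _ = F a.n a.u + F b.n b.u
        rw [← hadd _ _ a.u b.u a.h b.h]
        refine hF _ _ _ _ (Obj.h _) ((a.h.ds b.h).ri _) ?_
        exact (Obj.mk'_seq _).trans (SEq.reindex (a.h.ds b.h) finSumFinEquiv))

theorem K1.lift_cls {Γ : Type} [AddCommGroup Γ] (F : ∀ n : ℕ, (X → Mat (Fin n)) → Γ) (hF) (hadd)
    {n : ℕ} {u : X → Mat (Fin n)} (hu : GLc u) : K1.lift F hF hadd (cls u) = F n u := by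
  rw [cls, dif_pos hu]
  exact hF _ _ _ _ (Obj.h _) hu (Obj.mk'_seq hu)

noncomputable def K1.map (f : C(X, Y)) : K1 Y →+ K1 X :=
  K1.lift (fun n u => cls (fun x => u (f x)))
    (fun m n u v hu hv h => cls_eq_of_seq (hu.comp f.continuous) (hv.comp f.continuous)
      (h.comp f.continuous))
    (fun m n u v hu hv => by
      rw [← cls_ds (hu.comp f.continuous) (hv.comp f.continuous)]
      exact cls_ri ((hu.comp f.continuous).ds (hv.comp f.continuous)) _)

theorem K1.map_cls (f : C(X, Y)) {u : Y → Mat ι} (hu : GLc u) :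
    K1.map f (cls u) = cls (fun x => u (f x)) := by
  rw [← cls_ri hu (Fintype.equivFin ι)]
  rw [K1.map, K1.lift_cls _ _ _ (hu.ri _)]
  exact cls_ri (hu.comp f.continuous) _

theorem K1.map_comp {Z : Type} [TopologicalSpace Z] (f : C(X, Y)) (g : C(Y, Z)) (c : K1 Z) :
    K1.map f (K1.map g c) = K1.map (g.comp f) c := by
  obtain ⟨_, u, hu, rfl⟩ := exists_cls c
  rw [K1.map_cls g hu, K1.map_cls f (hu.comp g.continuous), K1.map_cls _ hu]
  rfl

theorem K1.map_congr {f g : C(X, Y)} (h : ∀ x, f x = g x) (c : K1 Y) :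
    K1.map f c = K1.map g c := by
  rw [ContinuousMap.ext h]

end grp
end PK

namespace PK
open scoped Kronecker

section corner
variable {X Y : Type} [TopologicalSpace X] [TopologicalSpace Y]
variable {ι κ α β ν : Type} [Fintype ι] [DecidableEq ι] [Fintype κ] [DecidableEq κ]
  [Fintype α] [DecidableEq α] [Fintype β] [DecidableEq β] [Fintype ν] [DecidableEq ν]

/-- corner of `U` at the idempotent `E` -/
def cr (U E : Mat ι) : Mat ι := E * U + (1 - E)

structure Cor (U E : X → Mat ι) : Prop where
  hU : GLc U
  hE : Continuous E
  idem : ∀ x, E x * E x = E x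
  comm : ∀ x, E x * U x = U x * E x

noncomputable def kc (U E : X → Mat ι) : K1 X := cls fun x => cr (U x) (E x)

theorem cr_mul {U V E : Mat ι} (hE : E * E = E) (hU : E * U = U * E) :
    cr U E * cr V E = cr (U * V) E := by
  have h1 : U * E * E = U * E := by rw [mul_assoc, hE]
  have h2 : U * E * (E * V) = U * E * V := by rw [← mul_assoc, h1]
  have h3 : E * (E * V) = E * V := by rw [← mul_assoc, hE]
  simp only [cr, hU]
  have h4 : E * (U * V) = U * E * V := by rw [← mul_assoc, hU]
  simp only [mul_add, add_mul, mul_sub, sub_mul, h1, h2, h3, h4, hE, mul_one, one_mul]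
  abel

theorem cr_one_left (E : Mat ι) : cr 1 E = 1 := by simp [cr]
theorem cr_one_right (U : Mat ι) : cr U 1 = U := by simp [cr]
theorem cr_zero (U : Mat ι) : cr U 0 = 1 := by simp [cr]

theorem Cor.inv_comm {U E : X → Mat ι} (h : Cor U E) (x : X) : E x * (U x)⁻¹ = (U x)⁻¹ * E x := by
  have h1 := mul_inv' (h.hU.2 x)
  have h2 := inv_mul' (h.hU.2 x)
  calc E x * (U x)⁻¹ = (U x)⁻¹ * U x * E x * (U x)⁻¹ := by rw [h2, one_mul]
    _ = (U x)⁻¹ * (E x * U x) * (U x)⁻¹ := by rw [h.comm]; simp only [mul_assoc]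
    _ = (U x)⁻¹ * E x := by simp only [mul_assoc, h1, mul_one]

theorem Cor.continuous {U E : X → Mat ι} (h : Cor U E) : Continuous fun x => cr (U x) (E x) :=
  (h.hE.matrix_mul h.hU.1).add (continuous_const.sub h.hE)

theorem Cor.glc {U E : X → Mat ι} (h : Cor U E) : GLc fun x => cr (U x) (E x) := by
  refine GLc.of_inv (v := fun x => cr (U x)⁻¹ (E x)) h.continuous fun x => ?_
  rw [cr_mul (h.idem x) (h.comm x), mul_inv' (h.hU.2 x), cr_one_left]

theorem Cor.compl {U E : X → Mat ι} (h : Cor U E) : Cor U fun x => 1 - E x where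
  hU := h.hU
  hE := continuous_const.sub h.hE
  idem x := by simp [mul_sub, sub_mul, h.idem]
  comm x := by rw [mul_sub, sub_mul, h.comm]; simp

theorem Cor.one {U : X → Mat ι} (h : GLc U) : Cor U fun _ => 1 where
  hU := h
  hE := continuous_const
  idem x := by simp
  comm x := by simp

theorem Cor.comp {U E : Y → Mat ι} (h : Cor U E) {f : X → Y} (hf : Continuous f) :
    Cor (fun x => U (f x)) (fun x => E (f x)) :=
  ⟨h.hU.comp hf, h.hE.comp hf, fun x => h.idem _, fun x => h.comm _⟩

theorem kc_one_right {U : X → Mat ι} : kc U (fun _ => 1) = cls U := by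
  simp [kc, cr_one_right]

theorem kc_zero {U : X → Mat ι} : kc U (fun _ => 0) = 0 := by
  simp [kc, cr_zero, cls_one]

theorem kc_one_left {E : X → Mat ι} : kc (fun _ => 1) E = 0 := by
  simp [kc, cr_one_left, cls_one]

theorem kc_mul {U V E : X → Mat ι} (h : Cor U E) (h' : Cor V E) :
    kc (fun x => U x * V x) E = kc U E + kc V E := by
  rw [kc, kc, kc, ← cls_mul h.glc h'.glc]
  congr 1; funext x
  rw [cr_mul (h.idem x) (h.comm x)]

theorem Cor.mul_left {U V E : X → Mat ι} (h : Cor U E) (h' : Cor V E) :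
    Cor (fun x => U x * V x) E where
  hU := h.hU.mul h'.hU
  hE := h.hE
  idem := h.idem
  comm x := by rw [← mul_assoc, h.comm, mul_assoc, h'.comm, mul_assoc]

theorem Cor.mul_right {U E F : X → Mat ι} (h : Cor U E) (h' : Cor U F)
    (hc : ∀ x, E x * F x = F x * E x) :
    Cor U (fun x => E x * F x) where
  hU := h.hU
  hE := h.hE.matrix_mul h'.hE
  idem x := by
    calc E x * F x * (E x * F x) = E x * (F x * E x) * F x := by simp only [mul_assoc]
      _ = (E x * E x) * (F x * F x) := by rw [← hc]; simp only [mul_assoc]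
      _ = _ := by rw [h.idem, h'.idem]
  comm x := by rw [mul_assoc, h'.comm, ← mul_assoc, h.comm, mul_assoc]

theorem Cor.add {U E F : X → Mat ι} (h : Cor U E) (h' : Cor U F)
    (h1 : ∀ x, E x * F x = 0) (h2 : ∀ x, F x * E x = 0) : Cor U (fun x => E x + F x) where
  hU := h.hU
  hE := h.hE.add h'.hE
  idem x := by rw [mul_add, add_mul, add_mul, h.idem, h'.idem, h1, h2]; simp
  comm x := by rw [mul_add, add_mul, h.comm, h'.comm]

theorem kc_add {U E F : X → Mat ι} (h : Cor U E) (h' : Cor U F)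
    (h1 : ∀ x, E x * F x = 0) (h2 : ∀ x, F x * E x = 0) :
    kc U (fun x => E x + F x) = kc U E + kc U F := by
  rw [kc, kc, kc, ← cls_mul h.glc h'.glc]
  congr 1; funext x
  have e1 : E x * (U x * F x) = 0 := by rw [← h'.comm, ← mul_assoc, h1, zero_mul]
  have e2 : E x * (U x * (F x * U x)) = 0 := by
    rw [← mul_assoc (U x), ← mul_assoc, e1, zero_mul]
  have e3 : E x * (F x * U x) = 0 := by rw [← mul_assoc, h1, zero_mul]
  simp only [cr, mul_add, add_mul, mul_sub, sub_mul, mul_one, one_mul, mul_assoc, e1, e2, e3, h1]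
  abel

theorem Cor.sum {L : Type} [DecidableEq L] {U : X → Mat ι} {D : L → X → Mat ι} (hU : GLc U)
    (h : ∀ l, Cor U (D l))
    (ho : ∀ l m, l ≠ m → ∀ x, D l x * D m x = 0) (s : Finset L) :
    Cor U (fun x => ∑ l ∈ s, D l x) where
  hU := hU
  hE := continuous_finsetSum s fun l _ => (h l).hE
  idem x := by
    rw [Finset.sum_mul_sum]
    refine Finset.sum_congr rfl fun l hl => ?_
    rw [Finset.sum_eq_single l, (h l).idem]
    · intro m _ hm; exact ho _ _ hm.symm x
    · intro h; exact absurd hl h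
  comm x := by
    rw [Finset.sum_mul, Finset.mul_sum]
    exact Finset.sum_congr rfl fun l _ => (h l).comm x

theorem kc_sum {L : Type} [DecidableEq L] {U : X → Mat ι} {D : L → X → Mat ι} (hU : GLc U)
    (h : ∀ l, Cor U (D l))
    (ho : ∀ l m, l ≠ m → ∀ x, D l x * D m x = 0) (s : Finset L) :
    kc U (fun x => ∑ l ∈ s, D l x) = ∑ l ∈ s, kc U (D l) := by
  induction s using Finset.induction_on with
  | empty => simp [kc_zero]
  | insert a s ha ih =>
    simp only [Finset.sum_insert ha]
    rw [← ih, kc_add (h a) (Cor.sum hU h ho s)]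
    · intro x
      rw [Finset.mul_sum]
      refine Finset.sum_eq_zero fun m hm => ho _ _ ?_ x
      rintro rfl; exact ha hm
    · intro x
      rw [Finset.sum_mul]
      refine Finset.sum_eq_zero fun m hm => ho _ _ ?_ x
      rintro rfl; exact ha hm

theorem kc_equiv {U : X → Mat ι} {U' : X → Mat κ} {E : X → Mat ι} {E' : X → Mat κ}
    (h : Cor U E) (h' : Cor U' E')
    {x : X → Matrix ι κ ℂ} {y : X → Matrix κ ι ℂ} (hx : Continuous x) (hy : Continuous y)
    (hE : ∀ p, x p * y p = E p) (hE' : ∀ p, y p * x p = E' p)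
    (hxx : ∀ p, x p * E' p = x p) (hyy : ∀ p, E' p * y p = y p)
    (hUx : ∀ p, U p * x p = x p * U' p) (hUy : ∀ p, y p * U p = U' p * y p) :
    kc U E = kc U' E' := by
  rw [kc, kc, ← cls_ds_one (κ := κ) h.glc, ← zero_add (cls fun x => cr (U' x) (E' x)),
    ← cls_one (ι := ι), ← cls_ds GLc.one h'.glc]
  let S : X → Mat (ι ⊕ κ) := fun p => Matrix.fromBlocks (1 - E p) (x p) (y p) (1 - E' p)
  have hS : Continuous S := Continuous.matrix_fromBlocks (continuous_const.sub h.hE) hx hy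
    (continuous_const.sub h'.hE)
  have hxx' : ∀ p, E p * x p = x p := fun p => by rw [← hE, Matrix.mul_assoc, hE', hxx]
  have hyy' : ∀ p, y p * E p = y p := fun p => by rw [← hE, ← Matrix.mul_assoc, hE', hyy]
  have hSS : ∀ p, S p * S p = 1 := by
    intro p
    simp only [S, Matrix.fromBlocks_multiply]
    rw [← Matrix.fromBlocks_one]
    congr 1
    · simp [hE, mul_sub, sub_mul, h.idem]
    · rw [Matrix.sub_mul, Matrix.mul_sub, hxx, hxx']; simp
    · rw [Matrix.sub_mul, Matrix.mul_sub, hyy, hyy']; simp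
    · simp [hE', mul_sub, sub_mul, h'.idem]
  rw [← cls_conj (h.glc.ds (GLc.one (ι := κ))) hS hS hSS]
  congr 1; funext p
  have e0 : PK.ds (cr (U p) (E p)) (1 : Mat κ) = 1 + Matrix.fromBlocks (E p * (U p - 1)) 0 0 0 := by
    rw [← Matrix.fromBlocks_one, Matrix.fromBlocks_add, ds, cr]
    congr 1
    · rw [mul_sub]; simp; abel
    all_goals simp
  have e1 : PK.ds (1 : Mat ι) (cr (U' p) (E' p)) = 1 + Matrix.fromBlocks 0 0 0 (E' p * (U' p - 1)) := by
    rw [← Matrix.fromBlocks_one, Matrix.fromBlocks_add, ds, cr]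
    congr 1
    any_goals simp
    rw [mul_sub]; simp; abel
  rw [e0, e1, mul_add, add_mul, mul_one, hSS]
  congr 1
  simp only [S, Matrix.fromBlocks_multiply]
  have z1 : (1 - E p) * (E p * (U p - 1)) = 0 := by
    rw [← mul_assoc, sub_mul, h.idem]; simp
  have z2 : y p * (E p * (U p - 1)) = (U' p - 1) * y p := by
    rw [← Matrix.mul_assoc, hyy', Matrix.mul_sub, Matrix.sub_mul, hUy]; simp
  have z3 : y p * (1 - E p) = 0 := by rw [Matrix.mul_sub, hyy']; simp
  rw [z1, z2]
  congr 1
  any_goals simp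
  · rw [Matrix.mul_assoc, z3]; simp
  · rw [Matrix.mul_assoc, hE', mul_sub, sub_mul, h'.comm]; simp

/-- congruence of corners: only `E * U` matters -/
theorem kc_congr {U U' E : X → Mat ι} (h : ∀ x, E x * U x = E x * U' x) : kc U E = kc U' E := by
  rw [kc, kc]; congr 1; funext x; rw [cr, cr, h]

theorem kc_map (f : C(X, Y)) {U E : Y → Mat ι} (h : Cor U E) :
    K1.map f (kc U E) = kc (fun x => U (f x)) (fun x => E (f x)) := by
  rw [kc, K1.map_cls f h.glc]; rfl

/-- `cls (u ⊗ 1) = |κ| cls u` -/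
theorem cls_kron_one {u : X → Mat ι} (hu : GLc u) :
    cls (fun x => (u x) ⊗ₖ (1 : Mat κ)) = Fintype.card κ • cls u := by
  have hU : GLc (fun x => (u x) ⊗ₖ (1 : Mat κ)) := by
    refine GLc.of_inv (v := fun x => (u x)⁻¹ ⊗ₖ (1 : Mat κ)) ?_ ?_
    · refine continuous_matrix ?_
      rintro ⟨i, j⟩ ⟨i', j'⟩
      simp only [Matrix.kroneckerMap_apply]
      exact (hu.1.matrix_elem _ _).mul continuous_const
    · intro x
      have := Matrix.mul_kronecker_mul (u x) (u x)⁻¹ (1 : Mat κ) (1 : Mat κ)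
      rw [mul_inv' (hu.2 x), mul_one] at this
      rw [← Matrix.one_kronecker_one]; exact this.symm
  let D : κ → X → Mat (ι × κ) := fun l _ => (1 : Mat ι) ⊗ₖ (Matrix.single l l (1:ℂ) : Mat κ)
  have hD : ∀ l, Cor (fun x => (u x) ⊗ₖ (1 : Mat κ)) (D l) := by
    intro l
    refine ⟨hU, continuous_const, fun x => ?_, fun x => ?_⟩
    · simp only [D]; rw [← Matrix.mul_kronecker_mul]; simp
    · simp only [D]
      rw [← Matrix.mul_kronecker_mul, ← Matrix.mul_kronecker_mul]; simp
  have ho : ∀ l m, l ≠ m → ∀ x, D l x * D m x = 0 := by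
    intro l m hlm x
    simp only [D]
    rw [← Matrix.mul_kronecker_mul]; simp [hlm]
  have hs : (fun x => ∑ l, D l x) = fun _ : X => (1 : Mat (ι × κ)) := by
    funext x
    ext ⟨i, j⟩ ⟨i', j'⟩
    simp only [D, Matrix.sum_apply, Matrix.kroneckerMap_apply, Matrix.single_apply, Matrix.one_apply,
      Prod.mk.injEq]
    by_cases h1 : i = i' <;> by_cases h2 : j = j' <;> simp [h1, h2, ite_and]
  have := kc_sum hU hD ho Finset.univ
  rw [hs, kc_one_right] at this
  rw [this, ← Finset.card_univ, ← Finset.sum_const]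
  refine Finset.sum_congr rfl fun l _ => ?_
  rw [← kc_one_right (U := u)]
  refine kc_equiv (hD l) (Cor.one hu) (x := fun _ => Matrix.of fun (p : ι × κ) i => if p = (i, l) then 1 else 0)
    (y := fun _ => Matrix.of fun i (p : ι × κ) => if p = (i, l) then 1 else 0)
    continuous_const continuous_const ?_ ?_ (by simp) (by simp) ?_ ?_
  · intro x
    ext ⟨i, j⟩ ⟨i', j'⟩
    simp only [D, Matrix.mul_apply, Matrix.kroneckerMap_apply, Matrix.single_apply, Matrix.one_apply,
      Matrix.of_apply, Prod.mk.injEq]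
    by_cases h1 : j = l <;> by_cases h2 : j' = l <;> by_cases h3 : i = i' <;>
      simp [h1, h2, h3, ite_and] <;> grind
  · intro x
    ext i j
    simp only [Matrix.mul_apply, Matrix.of_apply, Fintype.sum_prod_type, Matrix.one_apply, Prod.mk.injEq]
    simp [ite_and, eq_comm]
  · intro x
    ext ⟨i, j⟩ k
    simp [Matrix.mul_apply, Matrix.of_apply, Fintype.sum_prod_type, Matrix.one_apply, ite_and]
  · intro x
    ext k ⟨i, j⟩
    simp [Matrix.mul_apply, Matrix.of_apply, Fintype.sum_prod_type, Matrix.one_apply, ite_and, eq_comm]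

end corner
end PK

namespace PK
section lift2
variable {X Y : Type} [TopologicalSpace X] [TopologicalSpace Y]

/-- data of an additive invariant of invertible matrix families -/
structure Inv (X : Type) [TopologicalSpace X] (Γ : Type) [AddCommGroup Γ] where
  F : ∀ (ι : Type) [Fintype ι] [DecidableEq ι], (X → Mat ι) → Γ
  htpy : ∀ (ι : Type) [Fintype ι] [DecidableEq ι] (u v : X → Mat ι), Htpy u v → F ι u = F ι v
  ri : ∀ (ι κ : Type) [Fintype ι] [DecidableEq ι] [Fintype κ] [DecidableEq κ] (e : ι ≃ κ)
    (u : X → Mat ι), GLc u → F κ (fun x => PK.ri e (u x)) = F ι u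
  ds : ∀ (ι κ : Type) [Fintype ι] [DecidableEq ι] [Fintype κ] [DecidableEq κ]
    (u : X → Mat ι) (v : X → Mat κ), GLc u → GLc v → F (ι ⊕ κ) (fun x => PK.ds (u x) (v x)) = F ι u + F κ v
  one : ∀ (ι : Type) [Fintype ι] [DecidableEq ι], F ι (fun _ => 1) = 0

variable {Γ : Type} [AddCommGroup Γ]
variable {ι κ : Type} [Fintype ι] [DecidableEq ι] [Fintype κ] [DecidableEq κ]

theorem Inv.seq (I : Inv X Γ) {u : X → Mat ι} {v : X → Mat κ} (hu : GLc u) (hv : GLc v) (h : SEq u v) :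
    I.F ι u = I.F κ v := by
  obtain ⟨a, b, e, h⟩ := h
  have := I.htpy _ _ _ h
  rw [I.ri _ _ e _ (hu.ds GLc.one), I.ds _ _ _ _ hu GLc.one, I.ds _ _ _ _ hv GLc.one, I.one, I.one] at this
  simpa using this

noncomputable def Inv.hom (I : Inv X Γ) : K1 X →+ Γ :=
  K1.lift (fun n u => I.F (Fin n) u) (fun m n u v hu hv h => I.seq hu hv h)
    (fun m n u v hu hv => by rw [I.ri _ _ _ _ (hu.ds hv), I.ds _ _ _ _ hu hv])

theorem Inv.hom_cls (I : Inv X Γ) {u : X → Mat ι} (hu : GLc u) : I.hom (cls u) = I.F ι u := by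
  rw [← cls_ri hu (Fintype.equivFin ι), Inv.hom, K1.lift_cls _ _ _ (hu.ri _)]
  exact I.ri _ _ _ _ hu

theorem kc_htpy {U E : X × ℝ → Mat ι} (h : Cor U E) :
    kc (fun x => U (x, 0)) (fun x => E (x, 0)) = kc (fun x => U (x, 1)) (fun x => E (x, 1)) :=
  cls_htpy ⟨fun q => cr (U q) (E q), h.glc, fun _ => rfl, fun _ => rfl⟩
end lift2

section tens
variable {J : Type} [Fintype J] [DecidableEq J]
variable {ι κ ν : Type} [Fintype ι] [DecidableEq ι] [Fintype κ] [DecidableEq κ] [Fintype ν] [DecidableEq ν]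

def tensF (M : J → Matrix ι κ ℂ) : Matrix (J → ι) (J → κ) ℂ :=
  Matrix.of fun f g => ∏ j, M j (f j) (g j)

theorem tensF_apply (M : J → Matrix ι κ ℂ) (f : J → ι) (g : J → κ) :
    tensF M f g = ∏ j, M j (f j) (g j) := rfl

theorem tensF_mul (M : J → Matrix ι κ ℂ) (N : J → Matrix κ ν ℂ) :
    tensF M * tensF N = tensF fun j => M j * N j := by
  ext f g
  simp only [Matrix.mul_apply, tensF_apply, Finset.prod_univ_sum, ← Finset.prod_mul_distrib,
    Fintype.piFinset_univ]

theorem tensF_one : tensF (fun _ : J => (1 : Mat ι)) = 1 := by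
  ext f g
  simp only [tensF_apply, Matrix.one_apply]
  by_cases h : f = g
  · subst h; simp
  · rw [if_neg h]
    obtain ⟨j, hj⟩ := Function.ne_iff.1 h
    exact Finset.prod_eq_zero (Finset.mem_univ j) (if_neg hj)

theorem tensF_zero (M : J → Matrix ι κ ℂ) (j : J) (h : M j = 0) : tensF M = 0 := by
  ext f g
  exact Finset.prod_eq_zero (Finset.mem_univ j) (by rw [h]; rfl)

theorem continuous_tensF {X : Type} [TopologicalSpace X] {M : X → J → Matrix ι κ ℂ}
    (h : ∀ j, Continuous fun x => M x j) : Continuous fun x => tensF (M x) := by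
  refine continuous_matrix fun f g => ?_
  simp only [tensF_apply]
  exact continuous_finsetProd _ fun j _ => (h j).matrix_elem _ _

variable (J) in
abbrev tens (M : Matrix ι κ ℂ) : Matrix (J → ι) (J → κ) ℂ := tensF fun _ : J => M

theorem tens_mul (M : Matrix ι κ ℂ) (N : Matrix κ ν ℂ) : tens J M * tens J N = tens J (M * N) := tensF_mul _ _

def pm (ι : Type) [Fintype ι] [DecidableEq ι] (σ : Equiv.Perm J) : Mat (J → ι) :=
  Matrix.of fun f g => if g = f ∘ σ then 1 else 0

theorem pm_apply (σ : Equiv.Perm J) (f g : J → ι) : pm ι σ f g = if g = f ∘ σ then 1 else 0 := rfl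

theorem pm_one : pm ι (1 : Equiv.Perm J) = 1 := by
  ext f g
  simp [pm_apply, Matrix.one_apply, eq_comm]

theorem pm_mul (σ τ : Equiv.Perm J) : pm ι (σ * τ) = pm ι σ * pm ι τ := by
  ext f g
  simp only [Matrix.mul_apply, pm_apply, ite_mul, one_mul, zero_mul]
  rw [Finset.sum_ite_eq' Finset.univ, if_pos (Finset.mem_univ _)]
  rfl

theorem pm_mul_tensF (σ : Equiv.Perm J) (M : J → Matrix ι κ ℂ) :
    pm ι σ * tensF M = tensF (fun j => M (σ.symm j)) * pm κ σ := by
  ext f g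
  simp only [Matrix.mul_apply, pm_apply, tensF_apply, ite_mul, one_mul, zero_mul, mul_ite, mul_one, mul_zero]
  rw [Finset.sum_ite_eq' Finset.univ, if_pos (Finset.mem_univ _)]
  rw [Finset.sum_eq_single (g ∘ σ.symm)]
  · rw [if_pos (by funext j; simp)]
    rw [← Equiv.prod_comp σ (fun j => M (σ.symm j) (f j) _)]
    simp
  · intro b _ hb
    rw [if_neg]
    rintro rfl
    apply hb; funext j; simp
  · intro h; exact absurd (Finset.mem_univ _) h

theorem pm_mul_tens (σ : Equiv.Perm J) (M : Matrix ι κ ℂ) :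
    pm ι σ * tens J M = tens J M * pm κ σ := pm_mul_tensF σ fun _ => M

theorem GLc.tens {X : Type} [TopologicalSpace X] {u : X → Mat ι} (h : GLc u) : GLc fun x => tens J (u x) := by
  refine GLc.of_inv (v := fun x => PK.tens J (u x)⁻¹) (continuous_tensF fun _ => h.1) fun x => ?_
  rw [tens_mul, mul_inv' (h.2 x)]; exact tensF_one
end tens

section ep
variable {p : ℕ} [Fact p.Prime] {ν : Type} [Fintype ν] [DecidableEq ν]

noncomputable abbrev χ (a : ZMod p) : ℂ := ZMod.stdAddChar a

structure Rep (P : ZMod p → Mat ν) : Prop where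
  zero : P 0 = 1
  add : ∀ a b, P (a + b) = P a * P b

noncomputable def ep (P : ZMod p → Mat ν) (j : ZMod p) : Mat ν :=
  (p : ℂ)⁻¹ • ∑ k, χ (-(j * k)) • P k

theorem p_ne : (p : ℂ) ≠ 0 := Nat.cast_ne_zero.2 (Fact.out : p.Prime).ne_zero

theorem sum_χ (i : ZMod p) : ∑ k : ZMod p, χ (i * k) = if i = 0 then (p : ℂ) else 0 := by
  have := AddChar.sum_mulShift i (ZMod.isPrimitive_stdAddChar p)
  simpa [mul_comm] using this

theorem χ_add (a b : ZMod p) : χ (a + b) = χ a * χ b := AddChar.map_add_eq_mul _ _ _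
theorem χ_zero : χ (0 : ZMod p) = 1 := AddChar.map_zero_eq_one _

theorem Rep.mul_ep {P : ZMod p → Mat ν} (h : Rep P) (a j : ZMod p) : P a * ep P j = χ (j * a) • ep P j := by
  rw [ep, Matrix.mul_smul, smul_comm]
  congr 1
  rw [Finset.mul_sum, Finset.smul_sum, ← Equiv.sum_comp (Equiv.addLeft a) (fun k => χ (j * a) • χ (-(j * k)) • P k)]
  refine Finset.sum_congr rfl fun k _ => ?_
  simp only [Equiv.coe_addLeft]
  rw [h.add, Matrix.mul_smul, smul_smul, ← χ_add]
  congr 2; ring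

theorem Rep.ep_mul_ep {P : ZMod p → Mat ν} (h : Rep P) (i j : ZMod p) :
    ep P i * ep P j = if i = j then ep P j else 0 := by
  conv_lhs => rw [ep]
  rw [Matrix.smul_mul, Finset.sum_mul]
  have : ∀ k ∈ Finset.univ, (χ (-(i * k)) • P k) * ep P j = χ ((j - i) * k) • ep P j := by
    intro k _
    rw [Matrix.smul_mul, h.mul_ep, smul_smul, ← χ_add]
    congr 2; ring
  rw [Finset.sum_congr rfl this, ← Finset.sum_smul, sum_χ, smul_smul]
  by_cases hij : i = j
  · subst hij; simp [p_ne]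
  · rw [if_neg hij, if_neg (sub_ne_zero.2 (Ne.symm hij))]; simp

theorem Rep.ep_idem {P : ZMod p → Mat ν} (h : Rep P) (i : ZMod p) : ep P i * ep P i = ep P i := by
  rw [h.ep_mul_ep, if_pos rfl]

theorem Rep.sum_ep {P : ZMod p → Mat ν} (h : Rep P) : ∑ j, ep P j = 1 := by
  simp only [ep]
  rw [← Finset.smul_sum, Finset.sum_comm]
  have : ∀ k ∈ Finset.univ, ∑ j, χ (-(j * k)) • P k = (if k = 0 then (p : ℂ) else 0) • P k := by
    intro k _
    rw [← Finset.sum_smul]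
    congr 1
    have := sum_χ (-k)
    simpa [mul_comm] using this
  rw [Finset.sum_congr rfl this]
  simp only [ite_smul, zero_smul, Finset.sum_ite_eq', Finset.mem_univ, if_true, h.zero]
  rw [smul_smul, inv_mul_cancel₀ p_ne, one_smul]

theorem ep_comm {P : ZMod p → Mat ν} {Q : ZMod p → Mat ν} {A B : Mat ν} (h : ∀ k, P k * A = B * Q k) (j : ZMod p) :
    ep P j * A = B * ep Q j := by
  rw [ep, ep, Matrix.smul_mul, Matrix.mul_smul, Finset.sum_mul, Finset.mul_sum]
  congr 1
  refine Finset.sum_congr rfl fun k _ => ?_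
  rw [Matrix.smul_mul, Matrix.mul_smul, h]

theorem ep_comm' {μ : Type} [Fintype μ] [DecidableEq μ] {P : ZMod p → Mat ν} {Q : ZMod p → Mat μ} {A : Matrix ν μ ℂ}
   (h : ∀ k, P k * A = A * Q k) (j : ZMod p) :
    ep P j * A = A * ep Q j := by
  rw [ep, ep, Matrix.smul_mul, Matrix.mul_smul, Matrix.sum_mul, Matrix.mul_sum]
  congr 1
  refine Finset.sum_congr rfl fun k _ => ?_
  rw [Matrix.smul_mul, Matrix.mul_smul, h]

/-- twisted commutation -/
theorem ep_twist {P : ZMod p → Mat ν} {A : Mat ν} (a : ZMod p) (h : ∀ k, P k * A = χ (a * k) • (A * P k)) (j : ZMod p) :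
    ep P j * A = A * ep P (j - a) := by
  rw [ep, ep, Matrix.smul_mul, Matrix.mul_smul, Finset.sum_mul, Finset.mul_sum]
  congr 1
  refine Finset.sum_congr rfl fun k _ => ?_
  rw [Matrix.smul_mul, Matrix.mul_smul, h, smul_smul, ← χ_add]
  congr 2; ring

/-- cyclic shift representation -/
def sh (p : ℕ) [Fact p.Prime] (ι : Type) [Fintype ι] [DecidableEq ι] (k : ZMod p) : Mat (ZMod p → ι) :=
  pm ι (Equiv.addRight k)

variable {ι κ : Type} [Fintype ι] [DecidableEq ι] [Fintype κ] [DecidableEq κ]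
theorem rep_sh : Rep (sh p ι) where
  zero := by rw [sh, ← pm_one]; congr 1; ext x; simp
  add a b := by rw [sh, sh, sh, ← pm_mul]; congr 1; ext x; simp [add_comm, add_left_comm]

theorem sh_tens (k : ZMod p) (M : Matrix ι κ ℂ) : sh p ι k * tens (ZMod p) M = tens (ZMod p) M * sh p κ k :=
  pm_mul_tens _ _

noncomputable abbrev ec (p : ℕ) [Fact p.Prime] (ι : Type) [Fintype ι] [DecidableEq ι] (j : ZMod p) : Mat (ZMod p → ι) :=
  ep (sh p ι) j

theorem ec_tens (j : ZMod p) (M : Matrix ι κ ℂ) :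
    ec p ι j * tens (ZMod p) M = tens (ZMod p) M * ec p κ j := ep_comm' (fun k => sh_tens k M) j

end ep
end PK

namespace PK
section orb
variable {p : ℕ} [Fact p.Prime] {L : Type}

def shf (k : ZMod p) (f : ZMod p → L) : ZMod p → L := fun j => f (j + k)

theorem shf_shf (k l : ZMod p) (f : ZMod p → L) : shf k (shf l f) = shf (k + l) f := by
  funext j; simp [shf, add_assoc]
theorem shf_zero (f : ZMod p → L) : shf 0 f = f := by funext j; simp [shf]

theorem const_of_shf {a : ZMod p} (ha : a ≠ 0) {f : ZMod p → L} (h : shf a f = f) (j : ZMod p) : f j = f 0 := by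
  have h1 : ∀ n : ℕ, ∀ x, f (x + n * a) = f x := by
    intro n
    induction n with
    | zero => intro x; simp
    | succ n ih =>
      intro x
      have := congrFun h (x + n * a)
      simp only [shf] at this
      rw [← ih x, ← this]; congr 1; push_cast; ring
  have := h1 (j * a⁻¹).val 0
  rw [ZMod.natCast_zmod_val, mul_assoc, inv_mul_cancel₀ ha, mul_one, zero_add] at this
  exact this

def orbS (p : ℕ) [Fact p.Prime] (L : Type) : Setoid (ZMod p → L) where
  r f g := ∃ k, g = shf k f
  iseqv := ⟨fun f => ⟨0, (shf_zero f).symm⟩, fun {f g} ⟨k, hk⟩ => ⟨-k, by rw [hk, shf_shf]; simp [shf_zero]⟩,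
    fun {f g h} ⟨k, hk⟩ ⟨l, hl⟩ => ⟨l + k, by rw [hl, hk, shf_shf]⟩⟩

/-- position in orbit -/
theorem exists_pos : ∃ c : (ZMod p → L) → ZMod p, ∀ f k, (∃ j, f j ≠ f 0) → c (shf k f) = c f + k := by
  let r : (ZMod p → L) → (ZMod p → L) := fun f => (Quotient.mk (orbS p L) f).out
  have hr : ∀ f, ∃ k, f = shf k (r f) := fun f => Quotient.exact (Quotient.out_eq (Quotient.mk (orbS p L) f))
  choose c hc using hr
  refine ⟨c, fun f k hf => ?_⟩
  have h1 : r (shf k f) = r f := by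
    simp only [r]
    congr 1
    exact (Quotient.sound (s := orbS p L) (show ∃ k, _ = shf k f from ⟨k, rfl⟩)).symm
  have h2 := hc (shf k f)
  rw [h1] at h2
  by_contra hne
  obtain ⟨j, hj⟩ := hf
  apply hj
  have h3 : shf (c f + k) (r f) = shf k f := by
    conv_rhs => rw [hc f, shf_shf]
    rw [add_comm]
  have h4 : shf (c (shf k f) - (c f + k)) (r f) = r f := by
    have := congrArg (shf (-(c f + k))) (h2.symm.trans h3.symm)
    rw [shf_shf, shf_shf, neg_add_cancel, shf_zero] at this
    rw [← this]
    conv_lhs => rw [this]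
    congr 1; ring
  have h5 := const_of_shf (sub_ne_zero.2 hne) h4
  rw [hc f]
  simp only [shf]
  rw [h5, h5 (0 + c f)]
end orb

section lemA
variable {X : Type} [TopologicalSpace X]
variable {p : ℕ} [Fact p.Prime] {L : Type} [Fintype L] [DecidableEq L]
variable {ι κ : Type} [Fintype ι] [DecidableEq ι] [Fintype κ] [DecidableEq κ]

theorem sh_tensF (k : ZMod p) (M : ZMod p → Mat ι) :
    sh p ι k * tensF M = tensF (shf (-k) M) * sh p ι k := by
  rw [sh, pm_mul_tensF]
  rfl

/-- `e_j * Q` -/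
theorem Cor.ec {u : X → Mat ι} {Q : X → Mat (ZMod p → ι)} (h : Cor (fun x => tens (ZMod p) (u x)) Q)
    (hc : ∀ x k, sh p ι k * Q x = Q x * sh p ι k) (j : ZMod p) :
    Cor (fun x => tens (ZMod p) (u x)) (fun x => ec p ι j * Q x) where
  hU := h.hU
  hE := continuous_const.mul h.hE
  idem x := by
    have := ep_comm (hc x) j
    rw [Matrix.mul_assoc, ← Matrix.mul_assoc (Q x), ← this, Matrix.mul_assoc, h.idem, ← Matrix.mul_assoc, rep_sh.ep_idem]
  comm x := by
    rw [Matrix.mul_assoc, h.comm, ← Matrix.mul_assoc, ec_tens, Matrix.mul_assoc]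

structure Orth (u : X → Mat ι) (D : L → X → Mat ι) : Prop where
  hU : GLc u
  cor : ∀ l, Cor u (D l)
  orth : ∀ l m, l ≠ m → ∀ x, D l x * D m x = 0

variable {u : X → Mat ι} {D : L → X → Mat ι}

def tD (D : L → X → Mat ι) (f : ZMod p → L) (x : X) : Mat (ZMod p → ι) := tensF fun j => D (f j) x

theorem Orth.tD (h : Orth u D) : Orth (fun x => tens (ZMod p) (u x)) (tD (p := p) D) where
  hU := h.hU.tens
  cor f :=
   { hU := h.hU.tens
     hE := continuous_tensF fun j => (h.cor _).hE
     idem := fun x => by simp only [PK.tD, tensF_mul, (h.cor _).idem]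
     comm := fun x => by simp only [PK.tD, tensF_mul, (h.cor _).comm] }
  orth f g hfg x := by
    obtain ⟨j, hj⟩ := Function.ne_iff.1 hfg
    simp only [PK.tD, tensF_mul]
    exact tensF_zero _ j (h.orth _ _ hj x)

theorem sh_tD (k : ZMod p) (f : ZMod p → L) (x : X) :
    sh p ι k * tD D f x = tD D (shf (-k) f) x * sh p ι k := sh_tensF _ _

def tQ (D : L → X → Mat ι) (B : Finset (ZMod p → L)) (x : X) : Mat (ZMod p → ι) := ∑ f ∈ B, tD D f x

/-- weighted shift intertwining -/
theorem sh_wsum (B : Finset (ZMod p → L)) (hB : ∀ k f, f ∈ B → shf k f ∈ B) (c : (ZMod p → L) → ℂ) (a : ZMod p)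
    (hc : ∀ f ∈ B, ∀ k, c (shf k f) = χ (a * k) * c f) (k : ZMod p) (x : X) :
    sh p ι k * (∑ f ∈ B, c f • tD D f x) = χ (a * k) • ((∑ f ∈ B, c f • tD D f x) * sh p ι k) := by
  rw [Finset.mul_sum, Finset.sum_mul, Finset.smul_sum]
  refine Finset.sum_bij' (fun f _ => shf (-k) f) (fun f _ => shf k f) (fun f hf => hB _ f hf) (fun f hf => hB _ f hf)
    (fun f hf => by rw [shf_shf]; simp [shf_zero]) (fun f hf => by rw [shf_shf]; simp [shf_zero]) ?_
  intro f hf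
  rw [Matrix.mul_smul, sh_tD, Matrix.smul_mul, smul_smul, hc f hf, ← mul_assoc, ← χ_add]
  simp [χ_zero]

theorem wsum_mul (h : Orth u D) (B : Finset (ZMod p → L)) (c c' : (ZMod p → L) → ℂ) (x : X) :
    (∑ f ∈ B, c f • tD D f x) * (∑ f ∈ B, c' f • tD D f x) = ∑ f ∈ B, (c f * c' f) • tD D f x := by
  rw [Finset.sum_mul_sum]
  refine Finset.sum_congr rfl fun f hf => ?_
  rw [Finset.sum_eq_single f]
  · rw [Matrix.smul_mul, Matrix.mul_smul, smul_smul, (h.tD.cor f).idem]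
  · intro g _ hg
    rw [Matrix.smul_mul, Matrix.mul_smul, h.tD.orth f g hg.symm]; simp
  · intro h; exact absurd hf h

theorem tQ_sh (B : Finset (ZMod p → L)) (hB : ∀ k f, f ∈ B → shf k f ∈ B) (x : X) (k : ZMod p) :
    sh p ι k * tQ D B x = tQ D B x * sh p ι k := by
  have := sh_wsum (D := D) B hB (fun _ => 1) 0 (by simp [χ_zero]) k x
  simpa [χ_zero, tQ] using this

theorem Orth.tQ (h : Orth u D) (B : Finset (ZMod p → L)) : Cor (fun x => tens (ZMod p) (u x)) (tQ D B) :=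
  Cor.sum h.tD.hU h.tD.cor h.tD.orth B

theorem cont_wsum (h : Orth u D) (B : Finset (ZMod p → L)) (c : (ZMod p → L) → ℂ) :
    Continuous fun x => ∑ f ∈ B, c f • tD D f x := by
  refine continuous_finsetSum _ fun f _ => ?_
  have h1 : Continuous (fun x => tD D f x) := (h.tD.cor f).hE
  exact h1.const_smul (c f)

theorem kc_free (h : Orth u D) (B : Finset (ZMod p → L)) (hB : ∀ k f, f ∈ B → shf k f ∈ B)
    (hn : ∀ f ∈ B, ∃ j, f j ≠ f 0) :
    kc (fun x => tens (ZMod p) (u x)) (fun x => ec p ι 1 * tQ D B x) =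
    kc (fun x => tens (ZMod p) (u x)) (fun x => ec p ι 0 * tQ D B x) := by
  obtain ⟨c, hc⟩ := exists_pos (p := p) (L := L)
  let w : X → Mat (ZMod p → ι) := fun x => ∑ f ∈ B, χ (c f) • tD D f x
  let w' : X → Mat (ZMod p → ι) := fun x => ∑ f ∈ B, χ (-c f) • tD D f x
  have hw : ∀ x, ec p ι 1 * w x = w x * ec p ι 0 := by
    intro x
    have := ep_twist 1 (fun k => sh_wsum (D := D) B hB (fun f => χ (c f)) 1
      (fun f hf k => by rw [hc f k (hn f hf), ← χ_add]; congr 1; ring) k x) 1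
    simpa using this
  have hw' : ∀ x, ec p ι 0 * w' x = w' x * ec p ι 1 := by
    intro x
    have := ep_twist (-1) (fun k => sh_wsum (D := D) B hB (fun f => χ (-c f)) (-1)
      (fun f hf k => by rw [hc f k (hn f hf), ← χ_add]; congr 1; ring) k x) 0
    simpa using this
  have e1 : ∀ x, w x * w' x = tQ D B x := by
    intro x; simp only [w, w', wsum_mul h, ← χ_add, tQ]; simp [χ_zero]
  have e2 : ∀ x, w' x * w x = tQ D B x := by
    intro x; simp only [w, w', wsum_mul h, ← χ_add, tQ]; simp [χ_zero]
  have q : ∀ x, tQ D B x = ∑ f ∈ B, (1:ℂ) • tD D f x := by intro x; simp [tQ]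
  have e3 : ∀ x, w x * tQ D B x = w x := by
    intro x; rw [q]; simp only [w, wsum_mul h]; simp
  have e4 : ∀ x, tQ D B x * w' x = w' x := by
    intro x; rw [q]; simp only [w', wsum_mul h]; simp
  have hw0 : ∀ x j, ec p ι j * tQ D B x = tQ D B x * ec p ι j := fun x j => ep_comm (tQ_sh B hB x) j
  have cw : Continuous w := cont_wsum h B _
  have cw' : Continuous w' := cont_wsum h B _
  have i1 := rep_sh (p := p) (ι := ι) |>.ep_idem 1
  have i0 := rep_sh (p := p) (ι := ι) |>.ep_idem 0
  have C1 := (h.tQ B).ec (tQ_sh B hB) 1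
  have C0 := (h.tQ B).ec (tQ_sh B hB) 0
  have uw : ∀ x, tens (ZMod p) (u x) * w x = w x * tens (ZMod p) (u x) := by
    intro x; simp only [w]; rw [Finset.mul_sum, Finset.sum_mul]
    refine Finset.sum_congr rfl fun f _ => ?_
    rw [Matrix.mul_smul, Matrix.smul_mul, (h.tD.cor f).comm]
  have uw' : ∀ x, tens (ZMod p) (u x) * w' x = w' x * tens (ZMod p) (u x) := by
    intro x; simp only [w']; rw [Finset.mul_sum, Finset.sum_mul]
    refine Finset.sum_congr rfl fun f _ => ?_
    rw [Matrix.mul_smul, Matrix.smul_mul, (h.tD.cor f).comm]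
  refine kc_equiv C1 C0 (x := fun x => ec p ι 1 * w x) (y := fun x => w' x * ec p ι 1)
    (continuous_const.mul cw) (cw'.mul continuous_const) ?_ ?_ ?_ ?_ ?_ ?_
  · intro x
    rw [Matrix.mul_assoc, ← Matrix.mul_assoc (w x), e1, ← hw0, ← Matrix.mul_assoc, i1]
  · intro x
    rw [← Matrix.mul_assoc, Matrix.mul_assoc (w' x), i1, Matrix.mul_assoc, hw, ← Matrix.mul_assoc, e2, hw0]
  · intro x
    rw [hw, ← Matrix.mul_assoc, Matrix.mul_assoc (w x), i0, ← hw, Matrix.mul_assoc, e3]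
  · intro x
    rw [← hw', ← Matrix.mul_assoc, hw0, Matrix.mul_assoc (tQ D B x), i0, ← hw0, Matrix.mul_assoc, e4]
  · intro x
    rw [← Matrix.mul_assoc, ← ec_tens, Matrix.mul_assoc, uw, Matrix.mul_assoc]
  · intro x
    rw [Matrix.mul_assoc, ec_tens, ← Matrix.mul_assoc, ← uw', Matrix.mul_assoc]

noncomputable def psiE (p : ℕ) [Fact p.Prime] (u E : X → Mat ι) : K1 X :=
  kc (fun x => tens (ZMod p) (u x)) (fun x => ec p ι 0 * tens (ZMod p) (E x)) -
  kc (fun x => tens (ZMod p) (u x)) (fun x => ec p ι 1 * tens (ZMod p) (E x))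

theorem Cor.tens {E : X → Mat ι} (h : Cor u E) : Cor (fun x => tens (ZMod p) (u x)) (fun x => tens (ZMod p) (E x)) where
  hU := h.hU.tens
  hE := continuous_tensF fun j => h.hE
  idem x := by rw [tens_mul, h.idem]
  comm x := by rw [tens_mul, tens_mul, h.comm]

theorem Cor.ectens {E : X → Mat ι} (h : Cor u E) (j : ZMod p) :
    Cor (fun x => PK.tens (ZMod p) (u x)) (fun x => PK.ec p ι j * PK.tens (ZMod p) (E x)) :=
  h.tens.ec (fun x k => sh_tens k _) j

theorem lemA (h : Orth u D) (B : Finset (ZMod p → L)) (hB : ∀ k f, f ∈ B → shf k f ∈ B) :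
    kc (fun x => tens (ZMod p) (u x)) (fun x => ec p ι 0 * tQ D B x) -
    kc (fun x => tens (ZMod p) (u x)) (fun x => ec p ι 1 * tQ D B x) =
    ∑ l with (fun _ : ZMod p => l) ∈ B, psiE p u (D l) := by
  classical
  let B' := B.filter fun f => ∃ j, f j ≠ f 0
  have hB' : ∀ k f, f ∈ B' → shf k f ∈ B' := by
    intro k f hf
    rw [Finset.mem_filter] at hf ⊢
    refine ⟨hB k f hf.1, ?_⟩
    by_contra hcon
    push Not at hcon
    obtain ⟨j, hj⟩ := hf.2
    apply hj
    have h1 := hcon (j - k); have h2 := hcon (-k)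
    simp only [shf, sub_add_cancel, neg_add_cancel] at h1 h2
    rw [h1, ← h2]
  let C := Finset.univ.filter fun l : L => (fun _ : ZMod p => l) ∈ B
  have hq : ∀ x, tQ D B x = tQ D B' x + ∑ l ∈ C, tens (ZMod p) (D l x) := by
    intro x
    rw [tQ, tQ, ← Finset.sum_filter_add_sum_filter_not B (fun f => ∃ j, f j ≠ f 0)]
    congr 1
    refine Finset.sum_bij' (fun f _ => f 0) (fun l _ => fun _ => l) ?_ ?_ ?_ ?_ ?_
    · intro f hf
      rw [Finset.mem_filter] at hf
      have : (fun _ => f 0) = f := by funext j; have := hf.2; push Not at this; exact (this j).symm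
      simp only [C, Finset.mem_filter, Finset.mem_univ, true_and]; rw [this]; exact hf.1
    · intro l hl
      simp only [C, Finset.mem_filter, Finset.mem_univ, true_and] at hl
      simp [hl]
    · intro f hf
      rw [Finset.mem_filter] at hf
      funext j; have := hf.2; push Not at this; exact (this j).symm
    · intro l hl; rfl
    · intro f hf
      rw [Finset.mem_filter] at hf
      have : f = (fun _ => f 0) := by funext j; have := hf.2; push Not at this; exact (this j)
      conv_lhs => rw [this]
      rfl
  have ho : ∀ l m, l ≠ m → ∀ x, tens (ZMod p) (D l x) * tens (ZMod p) (D m x) = 0 := by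
    intro l m hlm x
    rw [tens_mul]; exact tensF_zero _ 0 (h.orth _ _ hlm x)
  have ho1 : ∀ (j : ZMod p) l m, l ≠ m → ∀ x, (ec p ι j * tens (ZMod p) (D l x)) * (ec p ι j * tens (ZMod p) (D m x)) = 0 := by
    intro j l m hlm x
    rw [Matrix.mul_assoc, ← Matrix.mul_assoc (tens _ (D l x)), ← ec_tens, Matrix.mul_assoc (ec p ι j) (tens _ (D l x)), ho l m hlm]
    simp
  have hcs : ∀ j : ZMod p, Cor (fun x => tens (ZMod p) (u x)) (fun x => ∑ l ∈ C, ec p ι j * tens (ZMod p) (D l x)) :=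
    fun j => Cor.sum h.tD.hU (fun l => (h.cor l).ectens j) (ho1 j) C
  have hz : ∀ f ∈ B', ∀ l x, tD D f x * tens (ZMod p) (D l x) = 0 := by
    intro f hf l x
    have := h.tD.orth f (fun _ => l) (by
      rintro rfl; simp [B'] at hf) x
    exact this
  have hz' : ∀ f ∈ B', ∀ l x, tens (ZMod p) (D l x) * tD D f x = 0 := by
    intro f hf l x
    have := h.tD.orth (fun _ => l) f (by
      rintro rfl; simp [B'] at hf) x
    exact this
  have key : ∀ j : ZMod p, kc (fun x => tens (ZMod p) (u x)) (fun x => ec p ι j * tQ D B x) =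
      kc (fun x => tens (ZMod p) (u x)) (fun x => ec p ι j * tQ D B' x) +
      ∑ l ∈ C, kc (fun x => tens (ZMod p) (u x)) (fun x => ec p ι j * tens (ZMod p) (D l x)) := by
    intro j
    rw [← kc_sum h.tD.hU (fun l => (h.cor l).ectens j) (ho1 j) C,
      ← kc_add ((h.tQ B').ec (tQ_sh B' hB') j) (hcs j)]
    · congr 1; funext x; rw [hq, Matrix.mul_add, Finset.mul_sum]
    · intro x
      rw [Finset.mul_sum]
      refine Finset.sum_eq_zero fun l _ => ?_
      rw [ec_tens, ← Matrix.mul_assoc, Matrix.mul_assoc (ec p ι j)]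
      have : tQ D B' x * tens (ZMod p) (D l x) = 0 := by
        rw [tQ, Finset.sum_mul]; exact Finset.sum_eq_zero fun f hf => hz f hf l x
      rw [this]; simp
    · intro x
      rw [Finset.sum_mul]
      refine Finset.sum_eq_zero fun l _ => ?_
      have hw0 : ec p ι j * tQ D B' x = tQ D B' x * ec p ι j := ep_comm (tQ_sh B' hB' x) j
      rw [hw0, ← Matrix.mul_assoc, Matrix.mul_assoc (ec p ι j)]
      have : tens (ZMod p) (D l x) * tQ D B' x = 0 := by
        rw [tQ, Finset.mul_sum]; exact Finset.sum_eq_zero fun f hf => hz' f hf l x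
      rw [this]; simp
  rw [key, key, kc_free h B' hB' (fun f hf => (Finset.mem_filter.1 hf).2), add_sub_add_left_eq_sub, ← Finset.sum_sub_distrib]
  rfl
end lemA
end PK

namespace PK
section psi
variable {X Y : Type} [TopologicalSpace X] [TopologicalSpace Y]
variable {p : ℕ} [Fact p.Prime]
variable {ι κ : Type} [Fintype ι] [DecidableEq ι] [Fintype κ] [DecidableEq κ]

theorem psiE_equiv {U : X → Mat ι} {U' : X → Mat κ} {E : X → Mat ι} {E' : X → Mat κ}
    (h : Cor U E) (h' : Cor U' E')
    {x : X → Matrix ι κ ℂ} {y : X → Matrix κ ι ℂ} (hx : Continuous x) (hy : Continuous y)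
    (hE : ∀ p, x p * y p = E p) (hE' : ∀ p, y p * x p = E' p)
    (hxx : ∀ p, x p * E' p = x p) (hyy : ∀ p, E' p * y p = y p)
    (hUx : ∀ p, U p * x p = x p * U' p) (hUy : ∀ p, y p * U p = U' p * y p) :
    psiE p U E = psiE p U' E' := by
  have key : ∀ j : ZMod p, kc (fun x => tens (ZMod p) (U x)) (fun x => ec p ι j * tens (ZMod p) (E x)) =
     kc (fun x => tens (ZMod p) (U' x)) (fun x => ec p κ j * tens (ZMod p) (E' x)) := by
    intro j
    have ii := rep_sh (p := p) (ι := ι) |>.ep_idem j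
    have ik := rep_sh (p := p) (ι := κ) |>.ep_idem j
    refine kc_equiv (h.ectens j) (h'.ectens j) (x := fun q => ec p ι j * tens (ZMod p) (x q))
      (y := fun q => ec p κ j * tens (ZMod p) (y q))
      (continuous_const.matrix_mul (continuous_tensF fun _ => hx))
      (continuous_const.matrix_mul (continuous_tensF fun _ => hy)) ?_ ?_ ?_ ?_ ?_ ?_
    · intro q
      rw [Matrix.mul_assoc, ← Matrix.mul_assoc (tens _ (x q)), ← ec_tens, Matrix.mul_assoc, tens_mul, hE,
        ← Matrix.mul_assoc, ii]
    · intro q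
      rw [Matrix.mul_assoc, ← Matrix.mul_assoc (tens _ (y q)), ← ec_tens, Matrix.mul_assoc, tens_mul, hE',
        ← Matrix.mul_assoc, ik]
    · intro q
      rw [Matrix.mul_assoc, ← Matrix.mul_assoc (tens _ (x q)), ← ec_tens, Matrix.mul_assoc, tens_mul, hxx,
        ← Matrix.mul_assoc, ii]
    · intro q
      rw [Matrix.mul_assoc, ← Matrix.mul_assoc (tens _ (E' q)), ← ec_tens, Matrix.mul_assoc, tens_mul, hyy,
        ← Matrix.mul_assoc, ik]
    · intro q
      rw [← Matrix.mul_assoc, ← ec_tens, Matrix.mul_assoc, Matrix.mul_assoc, tens_mul, tens_mul, hUx]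
    · intro q
      rw [← Matrix.mul_assoc, ← ec_tens, Matrix.mul_assoc, Matrix.mul_assoc, tens_mul, tens_mul, hUy]
  rw [psiE, psiE, key, key]

theorem psiE_congr {U U' E : X → Mat ι} (h : ∀ x, E x * U x = E x * U' x) : psiE p U E = psiE p U' E := by
  rw [psiE, psiE]
  congr 1 <;> refine kc_congr fun x => ?_ <;> rw [Matrix.mul_assoc, Matrix.mul_assoc, tens_mul, tens_mul, h]

theorem psiE_zero_left {E : X → Mat ι} : psiE p (fun _ => 1) E = 0 := by
  rw [psiE]
  have : (fun _ : X => tens (ZMod p) (1 : Mat ι)) = fun _ => 1 := by funext x; exact tensF_one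
  rw [this, kc_one_left, kc_one_left, sub_zero]

theorem psiE_one {u : X → Mat ι} : psiE p u (fun _ => 1) =
    kc (fun x => tens (ZMod p) (u x)) (fun x => ec p ι 0) - kc (fun x => tens (ZMod p) (u x)) (fun x => ec p ι 1) := by
  rw [psiE]
  have : tens (ZMod p) (1 : Mat ι) = 1 := tensF_one
  simp only [this, mul_one]

/-- additivity over complementary idempotents -/
theorem psiE_split {u E : X → Mat ι} (h : Cor u E) :
    psiE p u (fun _ => 1) = psiE p u E + psiE p u (fun x => 1 - E x) := by
  let D : Bool → X → Mat ι := fun b => if b then E else fun x => 1 - E x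
  have hD : Orth u D := by
    refine ⟨h.hU, ?_, ?_⟩
    · intro l; cases l
      · simpa [D] using h.compl
      · simpa [D] using h
    · intro l m hlm x
      cases l <;> cases m <;> simp [D] at hlm ⊢
      · rw [sub_mul, h.idem]; simp
      · rw [mul_sub, h.idem]; simp
  have hall : ∀ x, tQ D (Finset.univ : Finset (ZMod p → Bool)) x = 1 := by
    intro x
    have h1 : ∀ f g : ZMod p → ι, tQ D (Finset.univ : Finset (ZMod p → Bool)) x f g =
        tens (ZMod p) (1 : Mat ι) f g := by
      intro f g
      simp only [tQ, tD, Matrix.sum_apply, tensF_apply]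
      have := Finset.prod_univ_sum (fun _ : ZMod p => (Finset.univ : Finset Bool)) (fun j b => D b x (f j) (g j))
      rw [Fintype.piFinset_univ] at this
      rw [← this]
      refine Finset.prod_congr rfl fun j _ => ?_
      simp [D]
    ext f g
    rw [h1]; exact congrFun (congrFun tensF_one f) g
  have := lemA hD (Finset.univ : Finset (ZMod p → Bool)) (fun _ _ _ => Finset.mem_univ _)
  simp only [hall, mul_one] at this
  rw [psiE_one, this]
  simp [D]

theorem psi_cr {u E : X → Mat ι} (h : Cor u E) :
    psiE p (fun x => cr (u x) (E x)) (fun _ => 1) = psiE p u E := by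
  have h1 : ∀ x, E x * cr (u x) (E x) = E x * u x := by
    intro x; rw [cr, mul_add, mul_sub, ← mul_assoc, h.idem]; simp
  have h2 : ∀ x, (1 - E x) * cr (u x) (E x) = (1 - E x) := by
    intro x; rw [sub_mul, h1, cr]; simp
  have hc : Cor (fun x => cr (u x) (E x)) E := by
    refine ⟨h.glc, h.hE, h.idem, fun x => ?_⟩
    rw [h1, cr, add_mul, sub_mul, mul_assoc, ← h.comm, ← mul_assoc, h.idem]; simp
  rw [psiE_split hc, psiE_congr h1, psiE_congr (U' := fun _ => 1) (E := fun x => 1 - E x), psiE_zero_left, add_zero]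
  intro x; rw [h2, mul_one]

theorem psi_ds {u : X → Mat ι} {v : X → Mat κ} (hu : GLc u) (hv : GLc v) :
    psiE p (fun x => ds (u x) (v x)) (fun _ => 1) = psiE p u (fun _ => 1) + psiE p v (fun _ => 1) := by
  have h : Cor (fun x => ds (u x) (v x)) (fun _ => (ds 1 0 : Mat (ι ⊕ κ))) :=
    ⟨hu.ds hv, continuous_const, fun x => by simp [ds_mul], fun x => by simp [ds_mul]⟩
  rw [psiE_split h]
  have e2 : (1 : Mat (ι ⊕ κ)) - ds 1 0 = ds 0 1 := by
    rw [← ds_one, ds, ds, ds, sub_eq_iff_eq_add, Matrix.fromBlocks_add]; simp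
  congr 1
  · refine psiE_equiv h (Cor.one hu) (x := fun _ => Matrix.fromRows 1 0) (y := fun _ => Matrix.fromCols 1 0)
      continuous_const continuous_const ?_ ?_ ?_ ?_ ?_ ?_ <;> intro q
    · rw [Matrix.fromRows_mul_fromCols]; simp [ds]
    · rw [Matrix.fromCols_mul_fromRows]; simp
    · simp
    · simp
    · ext (i | i) j <;> simp [ds, Matrix.mul_apply, Fintype.sum_sum_type, Matrix.one_apply]
    · ext j (i | i) <;> simp [ds, Matrix.mul_apply, Fintype.sum_sum_type, Matrix.one_apply]
  · refine psiE_equiv h.compl (Cor.one hv) (x := fun _ => Matrix.fromRows 0 1) (y := fun _ => Matrix.fromCols 0 1)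
      continuous_const continuous_const ?_ ?_ ?_ ?_ ?_ ?_ <;> intro q
    · rw [Matrix.fromRows_mul_fromCols, e2]; simp [ds]
    · rw [Matrix.fromCols_mul_fromRows]; simp
    · simp
    · simp
    · ext (i | i) j <;> simp [ds, Matrix.mul_apply, Fintype.sum_sum_type, Matrix.one_apply]
    · ext j (i | i) <;> simp [ds, Matrix.mul_apply, Fintype.sum_sum_type, Matrix.one_apply]

theorem psi_ri {u : X → Mat ι} (hu : GLc u) (e : ι ≃ κ) :
    psiE p (fun x => ri e (u x)) (fun _ => 1) = psiE p u (fun _ => 1) := by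
  refine psiE_equiv (Cor.one (hu.ri e)) (Cor.one hu) (x := fun _ => (1 : Mat ι).submatrix e.symm id)
    (y := fun _ => (1 : Mat ι).submatrix id e.symm) continuous_const continuous_const ?_ ?_ ?_ ?_ ?_ ?_ <;> intro q
  · ext i j; simp [Matrix.mul_apply, Matrix.one_apply]
  · simp
  · simp
  · simp
  · ext i j
    simp only [ri, Matrix.mul_apply, Matrix.one_apply, Matrix.submatrix_apply, id]
    rw [← Equiv.sum_comp e]; simp
  · ext i j
    simp only [ri, Matrix.mul_apply, Matrix.one_apply, Matrix.submatrix_apply, id]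
    rw [← Equiv.sum_comp e]; simp

noncomputable def PsiI (p : ℕ) [Fact p.Prime] (X : Type) [TopologicalSpace X] : Inv X (K1 X) where
  F ι _ _ u := psiE p u (fun _ => 1)
  htpy ι _ _ u v h := by
    obtain ⟨H, hH, h0, h1⟩ := h
    have key : ∀ j : ZMod p, kc (fun x => tens (ZMod p) (u x)) (fun _ => ec p ι j) =
       kc (fun x => tens (ZMod p) (v x)) (fun _ => ec p ι j) := by
      intro j
      have hc := (Cor.one hH).ectens j
      have := kc_htpy hc
      simp only [h0, h1, show tens (ZMod p) (1 : Mat ι) = 1 from tensF_one, mul_one] at this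
      exact this
    rw [psiE_one, psiE_one, key, key]
  ri ι κ _ _ _ _ e u hu := psi_ri hu e
  ds ι κ _ _ _ _ u v hu hv := psi_ds hu hv
  one ι _ _ := psiE_zero_left

noncomputable def Psi (p : ℕ) [Fact p.Prime] : K1 X →+ K1 X := (PsiI p X).hom

theorem Psi_cls {u : X → Mat ι} (hu : GLc u) : Psi p (cls u) = psiE p u (fun _ => 1) := (PsiI p X).hom_cls hu

theorem Psi_kc {u E : X → Mat ι} (h : Cor u E) : Psi p (kc u E) = psiE p u E := by
  rw [kc, Psi_cls h.glc, psi_cr h]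

theorem Psi_map (f : C(X, Y)) (c : K1 Y) : K1.map f (Psi p c) = Psi p (K1.map f c) := by
  obtain ⟨n, u, hu, rfl⟩ := exists_cls c
  rw [K1.map_cls f hu, Psi_cls hu, Psi_cls (hu.comp f.continuous), psiE, psiE, map_sub,
    kc_map f ((Cor.one hu).ectens _), kc_map f ((Cor.one hu).ectens _)]
end psi
end PK

open scoped Kronecker
namespace PK
section div
variable {X Y : Type} [TopologicalSpace X] [TopologicalSpace Y]
variable {J : Type} [Fintype J] [DecidableEq J]
variable {p : ℕ} [Fact p.Prime]
variable {ι κ : Type} [Fintype ι] [DecidableEq ι] [Fintype κ] [DecidableEq κ]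

theorem kc_conj {U E E' : X → Mat ι} (h : Cor U E) {g k : Mat ι} (hgk : g * k = 1)
    (hg : ∀ x, g * U x = U x * g) (hE : ∀ x, g * E x = E' x * g) : kc U E' = kc U E := by
  rw [kc, kc, ← cls_conj h.glc (continuous_const (y := g)) (continuous_const (y := k)) (fun _ => hgk)]
  congr 1; funext x
  have : g * cr (U x) (E x) = cr (U x) (E' x) * g := by
    rw [cr, cr, mul_add, add_mul, ← mul_assoc, hE, mul_assoc, hg, ← mul_assoc, mul_sub, sub_mul, hE]; simp
  rw [this, mul_assoc, hgk, mul_one]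

theorem kc_ri {U E : X → Mat ι} (h : Cor U E) (e : ι ≃ κ) :
    kc (fun x => ri e (U x)) (fun x => ri e (E x)) = kc U E := by
  rw [kc, kc, ← cls_ri h.glc e]
  congr 1; funext x
  rw [cr, cr, ← ri_mul, ← ri_one e]; rfl

theorem cls_slot {u : X → Mat ι} (hu : GLc u) (j : J) :
    GLc (fun x => tensF fun i => if i = j then u x else 1) ∧
    cls (fun x => tensF fun i => if i = j then u x else 1) = Fintype.card ι ^ (Fintype.card J - 1) • cls u := by
  have hg : GLc (fun x => tensF fun i : J => if i = j then u x else 1) := by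
    refine GLc.of_inv (v := fun x => tensF fun i => if i = j then (u x)⁻¹ else 1) ?_ ?_
    · refine continuous_tensF fun i => ?_
      by_cases h : i = j
      · simpa [h] using hu.1
      · simpa [h] using continuous_const
    · intro x
      rw [tensF_mul, ← tensF_one]
      congr 1; funext i
      by_cases h : i = j <;> simp [h, mul_inv' (hu.2 x)]
  refine ⟨hg, ?_⟩
  rw [← cls_ri hg (Equiv.funSplitAt j ι)]
  have hc : Fintype.card ({i // i ≠ j} → ι) = Fintype.card ι ^ (Fintype.card J - 1) := by
    rw [Fintype.card_fun, Fintype.card_subtype_compl, Fintype.card_subtype_eq]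
  rw [← hc, ← cls_kron_one hu]
  congr 1; funext x
  ext ⟨a, f⟩ ⟨b, g⟩
  simp only [ri, Matrix.submatrix_apply, tensF_apply, Matrix.kroneckerMap_apply]
  rw [Fintype.prod_eq_mul_prod_subtype_ne _ j]
  congr 1
  · simp [Equiv.funSplitAt, Equiv.piSplitAt]
  · have := congrFun (congrFun (tensF_one (J := {i // i ≠ j}) (ι := ι)) f) g
    refine Eq.trans ?_ this
    rw [tensF_apply]
    refine Finset.prod_congr rfl fun i _ => ?_
    have hi := i.2
    have e1 : ∀ (c : ι) (h : {k // k ≠ j} → ι), (Equiv.funSplitAt j ι).symm (c, h) i = h i := by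
      intro c h; simp [Equiv.funSplitAt, Equiv.piSplitAt, hi]
    rw [if_neg hi, e1, e1]

theorem cls_tens {u : X → Mat ι} (hu : GLc u) :
    cls (fun x => tens J (u x)) = (Fintype.card J * Fintype.card ι ^ (Fintype.card J - 1)) • cls u := by
  have key : ∀ s : Finset J, GLc (fun x => tensF fun i => if i ∈ s then u x else 1) ∧
      cls (fun x => tensF fun i => if i ∈ s then u x else 1) =
        (s.card * Fintype.card ι ^ (Fintype.card J - 1)) • cls u := by
    intro s
    induction s using Finset.induction_on with
    | empty =>
      simp only [Finset.notMem_empty, if_false, tensF_one, Finset.card_empty, zero_mul, zero_smul]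
      exact ⟨GLc.one, cls_one⟩
    | insert a s ha ih =>
      have h1 := cls_slot hu a
      have : (fun x => tensF fun i => if i ∈ insert a s then u x else 1) = fun x =>
        (tensF fun i => if i ∈ s then u x else 1) * (tensF fun i => if i = a then u x else 1) := by
        funext x
        rw [tensF_mul]; congr 1; funext i
        by_cases hi : i = a
        · subst hi; simp [ha]
        · simp [hi]
      rw [this]
      refine ⟨ih.1.mul h1.1, ?_⟩
      rw [cls_mul ih.1 h1.1, ih.2, h1.2, Finset.card_insert_of_notMem ha, add_mul, add_smul, one_mul]
  have := (key Finset.univ).2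
  simpa using this

theorem pm_sh (m : ZMod p) (hm : m ≠ 0) (k : ZMod p) :
    pm ι (Equiv.mulLeft₀ m hm) * sh p ι k = sh p ι (m * k) * pm ι (Equiv.mulLeft₀ m hm) := by
  rw [sh, sh, ← pm_mul, ← pm_mul]
  congr 1; ext x; simp [mul_add]

theorem pm_inv (σ : Equiv.Perm J) : pm ι σ * pm ι σ⁻¹ = 1 := by rw [← pm_mul, mul_inv_cancel, pm_one]

theorem ep_dil {ν : Type} [Fintype ν] [DecidableEq ν] {P : ZMod p → Mat ν} {g : Mat ν} (m : ZMod p) (hm : m ≠ 0)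
    (h : ∀ k, g * P k = P (m * k) * g) : g * ep P m = ep P 1 * g := by
  rw [ep, ep, Matrix.mul_smul, Matrix.smul_mul, Finset.mul_sum, Finset.sum_mul]
  congr 1
  rw [← Equiv.sum_comp (Equiv.mulLeft₀ m hm) (fun k => (χ (-(1 * k)) • P k) * g)]
  refine Finset.sum_congr rfl fun k _ => ?_
  rw [Matrix.mul_smul, h, Matrix.smul_mul]; simp

theorem kc_ec_ne {u : X → Mat ι} (hu : GLc u) (m : ZMod p) (hm : m ≠ 0) :
    kc (fun x => tens (ZMod p) (u x)) (fun _ => ec p ι m) = kc (fun x => tens (ZMod p) (u x)) (fun _ => ec p ι 1) := by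
  have hc := (Cor.one hu).ectens m
  simp only [show tens (ZMod p) (1 : Mat ι) = 1 from tensF_one, mul_one] at hc
  symm
  exact kc_conj hc (pm_inv (Equiv.mulLeft₀ m hm)) (fun x => pm_mul_tens _ _) (fun x => ep_dil m hm (pm_sh m hm))

theorem Cor.ec1 {u : X → Mat ι} (hu : GLc u) (m : ZMod p) :
    Cor (fun x => PK.tens (ZMod p) (u x)) (fun _ => PK.ec p ι m) := by
  have hc := (Cor.one hu).ectens m
  simpa only [show PK.tens (ZMod p) (1 : Mat ι) = 1 from tensF_one, mul_one] using hc

theorem Psi_div {u : X → Mat ι} (hu : GLc u) : Psi p (cls u) =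
    p • (Fintype.card ι ^ (p - 1) • cls u - kc (fun x => tens (ZMod p) (u x)) (fun _ => ec p ι 1)) := by
  have h1 := kc_sum (U := fun x => tens (ZMod p) (u x)) (D := fun (j : ZMod p) _ => ec p ι j) hu.tens
    (fun j => Cor.ec1 hu j) (fun l m hlm x => by rw [rep_sh.ep_mul_ep, if_neg hlm]) Finset.univ
  rw [show (fun x : X => ∑ l, ec p ι l) = fun _ => 1 from by funext x; exact rep_sh.sum_ep, kc_one_right,
    cls_tens hu, ZMod.card, ← Finset.add_sum_erase _ _ (Finset.mem_univ (0 : ZMod p)),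
    Finset.sum_congr rfl (fun j hj => kc_ec_ne hu j (Finset.ne_of_mem_erase hj)), Finset.sum_const,
    Finset.card_erase_of_mem (Finset.mem_univ _), Finset.card_univ, ZMod.card] at h1
  rw [Psi_cls hu, psiE_one, smul_sub, smul_smul, h1, eq_sub_iff_add_eq, sub_add_eq_add_sub, sub_eq_iff_eq_add,
    add_assoc]
  congr 1
  have : p = (p - 1) + 1 := (Nat.succ_pred_prime Fact.out).symm
  generalize (kc (fun x => tens (ZMod p) (u x)) fun x => ec p ι 1) = c
  conv_lhs => rw [this]
  rw [add_smul, one_smul]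
end div

section comm
variable {X : Type} [TopologicalSpace X]
variable {p q : ℕ} [Fact p.Prime] [Fact q.Prime]
variable {ι κ : Type} [Fintype ι] [DecidableEq ι] [Fintype κ] [DecidableEq κ]

/-- diagonal inner shift -/
def dg (p q : ℕ) [Fact p.Prime] [Fact q.Prime] (ι : Type) [Fintype ι] [DecidableEq ι] (k : ZMod q) :
    Mat (ZMod p → ZMod q → ι) := tens (ZMod p) (sh q ι k)

theorem rep_dg : Rep (dg p q ι) where
  zero := by rw [dg, rep_sh.zero]; exact tensF_one
  add a b := by rw [dg, dg, dg, tens_mul, rep_sh.add]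

theorem Rep.recon {ν : Type} [Fintype ν] [DecidableEq ν] {P : ZMod p → Mat ν} (h : Rep P) (k : ZMod p) :
    P k = ∑ l, χ (l * k) • ep P l := by
  calc P k = P k * ∑ l, ep P l := by rw [h.sum_ep, mul_one]
    _ = _ := by rw [Finset.mul_sum]; exact Finset.sum_congr rfl fun l _ => h.mul_ep k l

theorem χ_sum {α : Type} (s : Finset α) (f : α → ZMod q) : χ (∑ i ∈ s, f i) = ∏ i ∈ s, χ (f i) := by
  classical
  induction s using Finset.induction_on with
  | empty => simp [χ_zero]
  | insert a s ha ih => rw [Finset.sum_insert ha, Finset.prod_insert ha, χ_add, ih]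

theorem dg_eq (k : ZMod q) (x : X) : dg p q ι k =
    ∑ f : ZMod p → ZMod q, χ ((∑ j, f j) * k) • tD (fun l (_ : X) => ec q ι l) f x := by
  ext a b
  rw [Matrix.sum_apply]
  change ∏ j, (sh q ι k) (a j) (b j) = _
  simp only [rep_sh.recon k, Matrix.sum_apply]
  rw [Finset.prod_univ_sum, Fintype.piFinset_univ]
  refine Finset.sum_congr rfl fun f _ => ?_
  rw [Finset.sum_mul, χ_sum, Matrix.smul_apply, tD, tensF_apply, smul_eq_mul, ← Finset.prod_mul_distrib]
  rfl

theorem ep_dg (m : ZMod q) (x : X) : ep (dg p q ι) m =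
    tQ (fun l (_ : X) => ec q ι l) (Finset.univ.filter fun f : ZMod p → ZMod q => ∑ j, f j = m) x := by
  rw [ep, tQ, Finset.sum_filter]
  simp only [dg_eq (X := X) _ x, Finset.smul_sum]
  rw [Finset.sum_comm]
  refine Finset.sum_congr rfl fun f _ => ?_
  simp only [smul_smul, mul_assoc, ← χ_add]
  rw [← Finset.sum_smul, ← Finset.mul_sum]
  have : ∀ k, -(m * k) + (∑ j, f j) * k = (∑ j, f j - m) * k := by intro k; ring
  simp only [this, sum_χ, sub_eq_zero]
  split_ifs with h
  · rw [inv_mul_cancel₀ p_ne, one_smul]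
  · simp

noncomputable def Yc (p q : ℕ) [Fact p.Prime] [Fact q.Prime] (u : X → Mat ι) (i : ZMod p) (m : ZMod q) : K1 X :=
  kc (fun x => tens (ZMod p) (tens (ZMod q) (u x))) (fun _ => ec p (ZMod q → ι) i * ep (dg p q ι) m)

theorem Cor.Yc {u : X → Mat ι} (hu : GLc u) (i : ZMod p) (m : ZMod q) :
    Cor (fun x => PK.tens (ZMod p) (PK.tens (ZMod q) (u x))) (fun _ => PK.ec p (ZMod q → ι) i * ep (dg p q ι) m) := by
  have hc : Cor (fun x => PK.tens (ZMod p) (PK.tens (ZMod q) (u x))) (fun _ => ep (dg p q ι) m) := by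
    refine ⟨hu.tens.tens, continuous_const, fun x => rep_dg.ep_idem m, fun x => ?_⟩
    exact ep_comm (fun k => by rw [dg, tens_mul, sh_tens, tens_mul]) m
  refine hc.ec (fun x k => ?_) i
  exact (ep_comm (fun l => by rw [dg, sh_tens]) m).symm

theorem psiE_Yc {u : X → Mat ι} (hu : GLc u) (hpq : p ≠ q) (l : ZMod q) :
    psiE p (fun x => tens (ZMod q) (u x)) (fun _ => ec q ι l) = Yc p q u 0 (p * l) - Yc p q u 1 (p * l) := by
  have ho : Orth (fun x => tens (ZMod q) (u x)) (fun l (_ : X) => ec q ι l) :=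
    ⟨hu.tens, fun l => Cor.ec1 hu l, fun l m hlm x => by rw [rep_sh.ep_mul_ep, if_neg hlm]⟩
  have h := lemA (p := p) ho (Finset.univ.filter fun f : ZMod p → ZMod q => ∑ j, f j = p * l) (by
    intro k f hf
    rw [Finset.mem_filter] at hf ⊢
    refine ⟨Finset.mem_univ _, ?_⟩
    rw [← hf.2]
    exact Equiv.sum_comp (Equiv.addRight k) f)
  simp only [← ep_dg] at h
  have hp0 : (p : ZMod q) ≠ 0 := by
    rw [Ne, ZMod.natCast_eq_zero_iff]
    intro hd
    exact hpq ((Nat.prime_dvd_prime_iff_eq Fact.out Fact.out).1 hd).symm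
  rw [Yc, Yc, h, Finset.sum_eq_single l]
  · intro b hb hbl
    exfalso
    simp only [Finset.mem_filter, Finset.mem_univ, true_and, Finset.sum_const, Finset.card_univ, ZMod.card, nsmul_eq_mul] at hb
    exact hbl (mul_left_cancel₀ hp0 hb)
  · intro hb; exfalso; apply hb; simp

theorem Psi_Psi {u : X → Mat ι} (hu : GLc u) (hpq : p ≠ q) : Psi p (Psi q (cls u)) =
    Yc p q u 0 0 - Yc p q u 1 0 - (Yc p q u 0 p - Yc p q u 1 p) := by
  rw [Psi_cls hu, psiE_one, map_sub, Psi_kc (Cor.ec1 hu 0), Psi_kc (Cor.ec1 hu 1), psiE_Yc hu hpq, psiE_Yc hu hpq]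
  simp

theorem Yc_ne {u : X → Mat ι} (hu : GLc u) (i : ZMod p) (m : ZMod q) (hm : m ≠ 0) : Yc p q u i m = Yc p q u i 1 := by
  symm
  refine kc_conj (Cor.Yc hu i m) (g := tens (ZMod p) (pm ι (Equiv.mulLeft₀ m hm)))
    (k := tens (ZMod p) (pm ι (Equiv.mulLeft₀ m hm)⁻¹)) ?_ ?_ ?_
  · rw [tens_mul, pm_inv]; exact tensF_one
  · intro x; rw [tens_mul, tens_mul, pm_mul_tens]
  · intro x
    rw [← mul_assoc, ← ec_tens, mul_assoc, mul_assoc]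
    congr 1
    refine ep_dil m hm fun k => ?_
    rw [dg, dg, tens_mul, pm_sh, tens_mul]

theorem ri_tens (M : Mat ι) : ri (Equiv.piComm fun (_ : ZMod p) (_ : ZMod q) => ι) (tens (ZMod p) (tens (ZMod q) M)) =
    tens (ZMod q) (tens (ZMod p) M) := by
  ext f g
  simp only [ri, Matrix.submatrix_apply, tensF_apply, Equiv.piComm_symm, Equiv.piComm_apply]
  exact Finset.prod_comm

theorem ri_sh (k : ZMod p) : ri (Equiv.piComm fun (_ : ZMod p) (_ : ZMod q) => ι) (sh p (ZMod q → ι) k) = dg q p ι k := by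
  ext f g
  simp only [ri, Matrix.submatrix_apply, dg, tensF_apply, sh, pm_apply]
  rw [Finset.prod_ite_zero]
  simp only [Finset.prod_const_one]
  congr 1
  simp only [funext_iff, eq_iff_iff, Equiv.piComm_symm, Equiv.piComm_apply, Function.comp, Finset.mem_univ, true_imp_iff, Function.swap]
  exact forall_comm

theorem ri_ep {P : ZMod p → Mat ι} (e : ι ≃ κ) (j : ZMod p) : ri e (ep P j) = ep (fun k => ri e (P k)) j := by
  ext a b
  simp [ri, ep, Matrix.sum_apply]

theorem Yc_swap {u : X → Mat ι} (hu : GLc u) (i : ZMod p) (m : ZMod q) : Yc q p u m i = Yc p q u i m := by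
  rw [Yc, Yc, ← kc_ri (Cor.Yc hu i m) (Equiv.piComm fun (_ : ZMod p) (_ : ZMod q) => ι)]
  have h1 : ri (Equiv.piComm fun (_ : ZMod p) (_ : ZMod q) => ι) (ec p (ZMod q → ι) i) = ep (dg q p ι) i := by
    rw [ri_ep]; congr 1; funext k; exact ri_sh k
  have h2 : ri (Equiv.piComm fun (_ : ZMod p) (_ : ZMod q) => ι) (ep (dg p q ι) m) = ec q (ZMod p → ι) m := by
    rw [ri_ep]; congr 1; funext k; rw [← ri_sh, ri_ri]; rfl
  simp only [ri_tens, ri_mul, h1, h2]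
  congr 1; funext x
  exact (ep_comm (fun l => by rw [dg, ec_tens]) i).symm

instance : Fact (Nat.Prime 2) := ⟨Nat.prime_two⟩
instance : Fact (Nat.Prime 3) := ⟨Nat.prime_three⟩

theorem Psi_comm (c : K1 X) : Psi 2 (Psi 3 c) = Psi 3 (Psi 2 c) := by
  obtain ⟨n, u, hu, rfl⟩ := exists_cls c
  rw [Psi_Psi hu (by decide), Psi_Psi hu (by decide)]
  simp only [Yc_swap (p := 2) (q := 3) hu]
  rw [Yc_ne hu (0 : ZMod 2) ((2:ℕ) : ZMod 3) (by decide), Yc_ne hu (1 : ZMod 2) ((2:ℕ) : ZMod 3) (by decide)]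
  rw [show ((3:ℕ) : ZMod 2) = 1 from rfl]
  abel

end comm
end PK

namespace PK
section pencil
variable {X Y : Type} [TopologicalSpace X] [TopologicalSpace Y]
variable {ι κ : Type} [Fintype ι] [DecidableEq ι] [Fintype κ] [DecidableEq κ]

noncomputable def ee (t : ℝ) : ℂ := Complex.exp (2 * Real.pi * Complex.I * t)

theorem ee_norm (t : ℝ) : ‖ee t‖ = 1 := by
  rw [ee, show (2 * Real.pi * Complex.I * t : ℂ) = ((2 * Real.pi * t : ℝ) : ℂ) * Complex.I by push_cast; ring]
  exact Complex.norm_exp_ofReal_mul_I _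

theorem ee_ne (t : ℝ) : ee t ≠ 0 := Complex.exp_ne_zero _

theorem continuous_ee : Continuous ee := by unfold ee; fun_prop

/-- entrywise integral over the unit interval -/
noncomputable def mint (F : ℝ → Mat ι) : Mat ι := Matrix.of fun i k => ∫ t in (0:ℝ)..1, F t i k

theorem mint_mul_left (A : Mat ι) {F : ℝ → Mat ι} (hF : Continuous F) :
    A * mint F = mint fun t => A * F t := by
  ext i k
  simp only [mint, Matrix.mul_apply, Matrix.of_apply]
  rw [intervalIntegral.integral_finset_sum]
  · simp [intervalIntegral.integral_const_mul]
  · intro j _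
    exact (continuous_const.mul (hF.matrix_elem j k)).intervalIntegrable _ _

theorem mint_mul_right (A : Mat ι) {F : ℝ → Mat ι} (hF : Continuous F) :
    mint F * A = mint fun t => F t * A := by
  ext i k
  simp only [mint, Matrix.mul_apply, Matrix.of_apply]
  rw [intervalIntegral.integral_finset_sum]
  · simp [intervalIntegral.integral_mul_const]
  · intro j _
    exact ((hF.matrix_elem i j).mul continuous_const).intervalIntegrable _ _

theorem mint_add {F G : ℝ → Mat ι} (hF : Continuous F) (hG : Continuous G) :
    mint F + mint G = mint fun t => F t + G t := by
  ext i k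
  simp only [mint, Matrix.add_apply, Matrix.of_apply]
  rw [intervalIntegral.integral_add]
  · exact (hF.matrix_elem i k).intervalIntegrable _ _
  · exact (hG.matrix_elem i k).intervalIntegrable _ _

theorem continuous_mint {F : X → ℝ → Mat ι} (hF : Continuous fun p : X × ℝ => F p.1 p.2) :
    Continuous fun x => mint (F x) := by
  refine continuous_matrix fun i k => ?_
  exact intervalIntegral.continuous_parametric_intervalIntegral_of_continuous' (hF.matrix_elem i k) _ _

theorem mint_ee (j : ℤ) (M : Mat ι) : (mint fun t => ee t ^ j • M) = if j = 0 then M else 0 := by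
  ext i k
  simp only [mint, Matrix.smul_apply, Matrix.of_apply, smul_eq_mul, intervalIntegral.integral_mul_const]
  have : ∫ t in (0:ℝ)..1, ee t ^ j = if j = 0 then 1 else 0 := by
    split_ifs with h
    · simp [h]
    · have hc : (2 * Real.pi * Complex.I * j : ℂ) ≠ 0 := by
        simp [h, Real.pi_ne_zero, Complex.I_ne_zero]
      have := integral_exp_mul_complex (a := 0) (b := 1) hc
      have h2 : ∀ t : ℝ, ee t ^ j = Complex.exp (2 * Real.pi * Complex.I * j * t) := by
        intro t
        rw [ee, ← Complex.exp_int_mul]; congr 1; ring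
      simp only [h2, this]
      have : Complex.exp (2 * Real.pi * Complex.I * j * (1:ℝ)) = 1 := by
        rw [Complex.exp_eq_one_iff]; exact ⟨j, by push_cast; ring⟩
      rw [this]; simp
  rw [this]; split_ifs <;> simp

open Filter Topology in
theorem mint_RL {F : ℝ → Mat ι} (hF : Continuous F) (i k : ι) :
    Tendsto (fun j : ℤ => (mint fun t => ee t ^ (-j) • F t) i k) cofinite (𝓝 0) := by
  have h := Real.tendsto_integral_exp_smul_cocompact
    (fun t => Set.indicator (Set.Ioc (0:ℝ) 1) (fun t => F t i k) t)
  have h2 : Tendsto (fun j : ℤ => (j : ℝ)) cofinite (cocompact ℝ) := Int.tendsto_coe_cofinite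
  refine (h.comp h2).congr fun j => ?_
  simp only [mint, Function.comp, Matrix.of_apply, Matrix.smul_apply]
  rw [intervalIntegral.integral_of_le zero_le_one, ← MeasureTheory.integral_indicator measurableSet_Ioc]
  congr 1; ext t
  by_cases ht : t ∈ Set.Ioc (0:ℝ) 1
  · simp only [ht, Set.indicator_of_mem]
    rw [Circle.smul_def, Real.fourierChar_apply, ee, ← Complex.exp_int_mul]
    congr 2; push_cast; ring
  · simp [ht]

/-- resolvent moments of the pencil a + z b -/
noncomputable def cm (a b : Mat ι) (j : ℤ) : Mat ι := mint fun t => ee t ^ (-j) • (a + ee t • b)⁻¹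

def PU (a b : Mat ι) : Prop := ∀ z : ℂ, ‖z‖ = 1 → IsUnit (a + z • b)

theorem continuous_ee_zpow (j : ℤ) : Continuous fun t => ee t ^ j :=
  continuous_ee.zpow₀ j fun t => Or.inl (ee_ne t)

theorem PU.cont {a b : Mat ι} (h : PU a b) : Continuous fun t => (a + ee t • b)⁻¹ :=
  (GLc.inv (X := ℝ) (u := fun t => a + ee t • b)
    ⟨continuous_const.add (continuous_ee.smul continuous_const), fun t => h _ (ee_norm t)⟩).1

theorem PU.cont' {a b : Mat ι} (h : PU a b) (j : ℤ) : Continuous fun t => ee t ^ j • (a + ee t • b)⁻¹ :=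
  (continuous_ee_zpow j).smul h.cont

theorem cm_left {a b : Mat ι} (h : PU a b) (j : ℤ) :
    a * cm a b j + b * cm a b (j - 1) = if j = 0 then 1 else 0 := by
  rw [cm, cm, mint_mul_left _ (h.cont' _), mint_mul_left _ (h.cont' _), mint_add
    (continuous_const.matrix_mul (h.cont' _)) (continuous_const.matrix_mul (h.cont' _))]
  have : ∀ t, a * ee t ^ (-j) • (a + ee t • b)⁻¹ + b * ee t ^ (-(j-1)) • (a + ee t • b)⁻¹
      = ee t ^ (-j) • (1 : Mat ι) := by
    intro t
    rw [← mul_inv' (h _ (ee_norm t)), show -(j-1) = -j + 1 by ring, zpow_add₀ (ee_ne t), zpow_one,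
      Matrix.add_mul, smul_add, Matrix.mul_smul, Matrix.mul_smul, Matrix.smul_mul, smul_smul]
  simp only [this, mint_ee, neg_eq_zero]

theorem cm_right {a b : Mat ι} (h : PU a b) (j : ℤ) :
    cm a b j * a + cm a b (j - 1) * b = if j = 0 then 1 else 0 := by
  rw [cm, cm, mint_mul_right _ (h.cont' _), mint_mul_right _ (h.cont' _), mint_add
    ((h.cont' _).matrix_mul continuous_const) ((h.cont' _).matrix_mul continuous_const)]
  have : ∀ t, ee t ^ (-j) • (a + ee t • b)⁻¹ * a + ee t ^ (-(j-1)) • (a + ee t • b)⁻¹ * b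
      = ee t ^ (-j) • (1 : Mat ι) := by
    intro t
    rw [← inv_mul' (h _ (ee_norm t)), show -(j-1) = -j + 1 by ring, zpow_add₀ (ee_ne t), zpow_one,
      Matrix.mul_add, smul_add, Matrix.smul_mul, Matrix.smul_mul, Matrix.mul_smul, smul_smul]
  simp only [this, mint_ee, neg_eq_zero]

open Filter Topology

theorem mat_tendsto {L : Type} {l : Filter L} {F : L → Mat ι} {A : Mat ι} :
    Tendsto F l (𝓝 A) ↔ ∀ i k, Tendsto (fun n => F n i k) l (𝓝 (A i k)) := by
  constructor
  · intro h i k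
    exact ((continuous_id (X := Mat ι)).matrix_elem i k).continuousAt.tendsto.comp h
  · intro h
    exact tendsto_pi_nhds.2 fun i => tendsto_pi_nhds.2 fun k => h i k

theorem cm_tendsto {a b : Mat ι} (h : PU a b) : Tendsto (cm a b) cofinite (𝓝 0) := by
  rw [mat_tendsto]; intro i k
  exact mint_RL h.cont i k

theorem cm_shift {a b : Mat ι} (h : PU a b) (p q : ℤ) (hp : p ≠ 0) (hq : q + 1 ≠ 0) :
    cm a b p * b * cm a b q = cm a b (p-1) * b * cm a b (q+1) := by
  have h1 := cm_left h (q+1)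
  have h2 := cm_right h p
  rw [if_neg hq, add_sub_cancel_right] at h1
  rw [if_neg hp] at h2
  have e1 := eq_neg_of_add_eq_zero_right h1
  have e2 := eq_neg_of_add_eq_zero_right h2
  rw [Matrix.mul_assoc, e1, e2, Matrix.mul_neg, Matrix.neg_mul, Matrix.mul_assoc]

/-- spectral idempotent -/
noncomputable def sp (a b : Mat ι) : Mat ι := cm a b (-1) * b

theorem sp_compl {a b : Mat ι} (h : PU a b) : 1 - sp a b = cm a b 0 * a := by
  have := cm_right h 0
  simp only [if_true, zero_sub] at this
  rw [sp, ← this]; abel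

theorem tend_aux {a b : Mat ι} (h : PU a b) (C : Mat ι) {f g : ℕ → ℤ} (hf : Function.Injective f)
    (hg : Function.Injective g) (hc : ∀ n, cm a b (f n) * b * cm a b (g n) = C) : C = 0 := by
  have h1 : Tendsto (fun n => cm a b (f n)) atTop (𝓝 0) := by
    rw [← Nat.cofinite_eq_atTop]
    exact (cm_tendsto h).comp hf.tendsto_cofinite
  have h2 : Tendsto (fun n => cm a b (g n)) atTop (𝓝 0) := by
    rw [← Nat.cofinite_eq_atTop]
    exact (cm_tendsto h).comp hg.tendsto_cofinite
  have h3 := (h1.mul (tendsto_const_nhds (x := b))).mul h2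
  simp only [hc, zero_mul] at h3
  exact tendsto_nhds_unique tendsto_const_nhds h3

theorem sp_mul_cm {a b : Mat ι} (h : PU a b) (j : ℕ) : sp a b * cm a b j = 0 := by
  refine tend_aux h _ (f := fun n => -1 - (n:ℤ)) (g := fun n => j + (n:ℤ)) ?_ ?_ ?_
  · intro m n h; simpa using h
  · intro m n h; simpa using h
  · intro n
    induction n with
    | zero => simp [sp]
    | succ n ih =>
      rw [← ih, cm_shift h (-1 - (n:ℤ)) _ (by omega) (by omega)]
      push_cast
      rw [show (-1 - (n:ℤ) - 1) = -1 - (n + 1) by ring, show (j + (n:ℤ) + 1) = j + (n+1) by ring]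

theorem sp_mul_cm' {a b : Mat ι} (h : PU a b) (j : ℕ) : (1 - sp a b) * cm a b (-1 - j) = 0 := by
  rw [sp_compl h, Matrix.mul_assoc]
  have := cm_left h (-1 - j)
  rw [if_neg (by omega)] at this
  rw [eq_neg_of_add_eq_zero_left this, Matrix.mul_neg, neg_eq_zero, ← Matrix.mul_assoc]
  refine tend_aux h _ (f := fun n => (n:ℤ)) (g := fun n => -2 - j - (n:ℤ)) ?_ ?_ ?_
  · intro m n h; simpa using h
  · intro m n h; simpa using h
  · intro n
    induction n with
    | zero => simp only [Nat.cast_zero, sub_zero]; congr 2; ring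
    | succ n ih =>
      rw [← ih, cm_shift h ((n+1 : ℕ):ℤ) _ (by push_cast; omega) (by push_cast; omega)]
      push_cast
      rw [add_sub_cancel_right]; congr 2; ring

theorem sp_idem {a b : Mat ι} (h : PU a b) : sp a b * sp a b = sp a b := by
  have : sp a b * (1 - sp a b) = 0 := by
    rw [sp_compl h, ← Matrix.mul_assoc]
    have := sp_mul_cm h 0
    rw [Nat.cast_zero] at this
    rw [this, Matrix.zero_mul]
  rw [Matrix.mul_sub, Matrix.mul_one] at this
  exact (sub_eq_zero.1 this).symm

theorem continuous_sp {a b : X → Mat ι} (ha : Continuous a) (hb : Continuous b) (h : ∀ x, PU (a x) (b x)) :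
    Continuous fun x => sp (a x) (b x) := by
  refine Continuous.matrix_mul ?_ hb
  refine continuous_mint (F := fun x t => ee t ^ (-(-1:ℤ)) • (a x + ee t • b x)⁻¹) ?_
  refine ((continuous_ee_zpow _).comp continuous_snd).smul ?_
  exact (GLc.inv (X := X × ℝ) (u := fun p => a p.1 + ee p.2 • b p.1)
    ⟨(ha.comp continuous_fst).add ((continuous_ee.comp continuous_snd).smul (hb.comp continuous_fst)),
      fun t => h _ _ (ee_norm _)⟩).1

/-- the deformation of a pencil to its split form -/
noncomputable def Lp (a b : Mat ι) (z : ℂ) (s : ℝ) : Mat ι :=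
  (a + ((s:ℂ) * z) • b) * (1 - sp a b) + ((s:ℂ) • a + z • b) * sp a b

theorem Lp_unit {a b : Mat ι} (h : PU a b) {z : ℂ} (hz : ‖z‖ = 1) {s : ℝ} (h0 : 0 ≤ s) (h1 : s ≤ 1) :
    IsUnit (Lp a b z s) := by
  have hz0 : z ≠ 0 := by rintro rfl; simp at hz
  set w : ℂ := s * z with hw
  set v : ℂ := s * z⁻¹ with hv
  let S : ℕ → Mat ι := fun N => ∑ j ∈ Finset.range N, w ^ j • cm a b j
  let S' : ℕ → Mat ι := fun N => ∑ j ∈ Finset.range N, (z⁻¹ * v ^ j) • cm a b (-1 - j)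
  have e1 : ∀ N, (1 - sp a b) * S N = S N := by
    intro N
    rw [Finset.mul_sum]; refine Finset.sum_congr rfl fun j _ => ?_
    rw [Matrix.mul_smul, Matrix.sub_mul, sp_mul_cm h, Matrix.one_mul, sub_zero]
  have e1' : ∀ N, sp a b * S N = 0 := by
    intro N
    rw [Finset.mul_sum]; refine Finset.sum_eq_zero fun j _ => ?_
    rw [Matrix.mul_smul, sp_mul_cm h, smul_zero]
  have e2 : ∀ N, (1 - sp a b) * S' N = 0 := by
    intro N
    rw [Finset.mul_sum]; refine Finset.sum_eq_zero fun j _ => ?_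
    rw [Matrix.mul_smul, sp_mul_cm' h, smul_zero]
  have e2' : ∀ N, sp a b * S' N = S' N := by
    intro N
    have := e2 N
    rw [Matrix.sub_mul, Matrix.one_mul, sub_eq_zero] at this
    exact this.symm
  have f1 : ∀ N, (a + w • b) * S N = (if N = 0 then 0 else 1) - b * cm a b (-1) + w ^ N • (b * cm a b (N - 1)) := by
    intro N
    induction N with
    | zero => simp [S]
    | succ N ih =>
      have hS : S (N+1) = S N + w ^ N • cm a b N := Finset.sum_range_succ _ _
      rw [hS, Matrix.mul_add, ih, Matrix.mul_smul, Matrix.add_mul]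
      have hl := cm_left h N
      have : a * cm a b N = (if N = 0 then 1 else 0) - b * cm a b (N - 1) := by
        simp only [Nat.cast_eq_zero] at hl
        rw [← hl]; abel
      rw [this, Matrix.smul_mul, smul_add, smul_sub, smul_smul, ← pow_succ]
      push_cast
      rw [add_sub_cancel_right]
      rcases Nat.eq_zero_or_pos N with rfl | hN
      · simp
      · simp [hN.ne']
  have f2 : ∀ N, ((s:ℂ) • a + z • b) * S' N = (if N = 0 then 0 else b * cm a b (-1)) -
      (if N = 0 then 0 else v ^ N • (b * cm a b (-1 - N))) := by
    intro N
    induction N with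
    | zero => simp [S']
    | succ N ih =>
      have hS : S' (N+1) = S' N + (z⁻¹ * v ^ N) • cm a b (-1 - N) := Finset.sum_range_succ _ _
      rw [hS, Matrix.mul_add, ih, Matrix.mul_smul, Matrix.add_mul]
      have hl := cm_left h (-1 - N)
      rw [if_neg (by omega)] at hl
      have : a * cm a b (-1 - N) = - (b * cm a b (-1 - (N + 1))) := by
        rw [eq_neg_of_add_eq_zero_left hl]; congr 3; ring
      rw [Matrix.smul_mul, this, Matrix.smul_mul, smul_add, smul_smul, smul_smul]
      have g1 : z⁻¹ * v ^ N * s = v ^ (N+1) := by rw [pow_succ, hv]; ring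
      have g2 : z⁻¹ * v ^ N * z = v ^ N := by field_simp
      rw [g1, g2]
      push_cast
      rcases Nat.eq_zero_or_pos N with rfl | hN
      · simp; abel
      · simp [hN.ne']; abel
  have f3 : ∀ N, Lp a b z s * (S (N+1) + S' (N+1)) =
      1 + (w ^ (N+1) • (b * cm a b N) - v ^ (N+1) • (b * cm a b (-1 - (N + 1)))) := by
    intro N
    have q1 := f1 (N+1)
    have q2 := f2 (N+1)
    simp only [Nat.succ_ne_zero, if_false] at q1 q2
    push_cast at q1 q2
    rw [add_sub_cancel_right] at q1
    rw [Lp, Matrix.add_mul, Matrix.mul_assoc, Matrix.mul_assoc, Matrix.mul_add, Matrix.mul_add (sp a b),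
      e1, e1', e2, e2', add_zero, zero_add, q1, q2]
    abel
  have hwn : ‖w‖ ≤ 1 := by rw [hw, norm_mul, hz]; simp [abs_of_nonneg h0, h1]
  have hvn : ‖v‖ ≤ 1 := by rw [hv, norm_mul, norm_inv, hz]; simp [abs_of_nonneg h0, h1]
  have aux : ∀ (w : ℂ), ‖w‖ ≤ 1 → ∀ f : ℕ → ℤ, Function.Injective f →
      Tendsto (fun N => w ^ (N+1) • (b * cm a b (f N))) atTop (𝓝 0) := by
    intro w hw f hf
    have h1 : Tendsto (fun n => b * cm a b (f n)) atTop (𝓝 0) := by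
      have : Tendsto (fun n => cm a b (f n)) atTop (𝓝 0) := by
        rw [← Nat.cofinite_eq_atTop]
        exact (cm_tendsto h).comp hf.tendsto_cofinite
      simpa using (tendsto_const_nhds (x := b)).mul this
    rw [mat_tendsto] at h1 ⊢; intro i k
    refine squeeze_zero_norm (a := fun N => ‖(b * cm a b (f N)) i k‖) (fun N => ?_) (by simpa using (h1 i k).norm)
    simp only [Matrix.smul_apply, norm_smul, norm_pow]
    exact mul_le_of_le_one_left (norm_nonneg _) (pow_le_one₀ (norm_nonneg _) hw)
  have lim : Tendsto (fun N => Lp a b z s * (S (N+1) + S' (N+1))) atTop (𝓝 1) := by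
    simp only [f3]
    simpa using tendsto_const_nhds.add ((aux w hwn (fun N => N) Nat.cast_injective).sub
      (aux v hvn (fun N => -1 - (N+1)) (fun m n h => by simpa using h)))
  have hdet : Tendsto (fun N => (Lp a b z s * (S (N+1) + S' (N+1))).det) atTop (𝓝 1) := by
    have hc : Continuous fun M : Mat ι => M.det := Continuous.matrix_det continuous_id
    have := (hc.tendsto 1).comp lim
    rw [Matrix.det_one] at this
    exact this
  obtain ⟨N, hN⟩ := (hdet.eventually_ne one_ne_zero).exists
  rw [Matrix.det_mul] at hN
  exact (Matrix.isUnit_iff_isUnit_det _).2 (isUnit_iff_ne_zero.2 (left_ne_zero_of_mul hN))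

theorem Lp_one (a b : Mat ι) (z : ℂ) : Lp a b z 1 = a + z • b := by
  simp [Lp, Matrix.mul_sub]

theorem Lp_zero {a b : Mat ι} (h : PU a b) (z : ℂ) :
    Lp a b z 0 = (a * (1 - sp a b) + b * sp a b) * ((1 - sp a b) + z • sp a b) := by
  have h1 := sp_idem h
  have h2 : (1 - sp a b) * sp a b = 0 := by rw [Matrix.sub_mul, Matrix.one_mul, h1, sub_self]
  have h3 : sp a b * (1 - sp a b) = 0 := by rw [Matrix.mul_sub, Matrix.mul_one, h1, sub_self]
  have h4 : (1 - sp a b) * (1 - sp a b) = 1 - sp a b := by rw [Matrix.mul_sub, h2, Matrix.mul_one, sub_zero]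
  simp only [Lp, Complex.ofReal_zero, zero_mul, zero_smul, add_zero, zero_add]
  rw [Matrix.mul_add, Matrix.add_mul, Matrix.mul_smul, Matrix.add_mul, Matrix.mul_assoc, Matrix.mul_assoc,
    Matrix.mul_assoc, Matrix.mul_assoc, h4, h3, h2, h1]
  simp [Matrix.smul_mul]

theorem Lp_zero_unit {a b : Mat ι} (h : PU a b) : IsUnit (a * (1 - sp a b) + b * sp a b) := by
  have := Lp_unit h (z := 1) (by simp) le_rfl zero_le_one
  rw [Lp_zero h] at this
  simpa using this
end pencil
end PK

namespace PK
section higman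
variable {X Y : Type} [TopologicalSpace X] [TopologicalSpace Y]
variable {ι κ : Type} [Fintype ι] [DecidableEq ι] [Fintype κ] [DecidableEq κ]

theorem mint_ri (e : ι ≃ κ) (F : ℝ → Mat ι) : (mint fun t => ri e (F t)) = ri e (mint F) := rfl

theorem mint_ds (F : ℝ → Mat ι) (G : ℝ → Mat κ) : (mint fun t => ds (F t) (G t)) = ds (mint F) (mint G) := by
  ext i k
  rcases i with i | i <;> rcases k with k | k <;> simp [mint, ds]

theorem inv_ds {A : Mat ι} {B : Mat κ} (hA : IsUnit A) (hB : IsUnit B) : (ds A B)⁻¹ = ds A⁻¹ B⁻¹ :=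
  Matrix.inv_eq_right_inv (by rw [ds_mul, mul_inv' hA, mul_inv' hB, ds_one])

theorem inv_ri {A : Mat ι} (e : ι ≃ κ) (hA : IsUnit A) : (ri e A)⁻¹ = ri e A⁻¹ :=
  Matrix.inv_eq_right_inv (by rw [← ri_mul, mul_inv' hA, ri_one])

theorem ds_add (A A' : Mat ι) (B B' : Mat κ) : ds A B + ds A' B' = ds (A + A') (B + B') := by
  simp [ds, Matrix.fromBlocks_add]
theorem ds_smul (z : ℂ) (A : Mat ι) (B : Mat κ) : z • ds A B = ds (z • A) (z • B) := by
  simp [ds, Matrix.fromBlocks_smul]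
theorem ri_add (e : ι ≃ κ) (A B : Mat ι) : ri e A + ri e B = ri e (A + B) := rfl
theorem ri_smul (e : ι ≃ κ) (z : ℂ) (A : Mat ι) : z • ri e A = ri e (z • A) := rfl

theorem sp_ds {a b : Mat ι} {a' b' : Mat κ} (h : PU a b) (h' : PU a' b') :
    sp (ds a a') (ds b b') = ds (sp a b) (sp a' b') := by
  rw [sp, cm, sp, sp, cm, cm, ← ds_mul, ← mint_ds]
  congr 2; ext1 t
  rw [ds_smul, ds_add, inv_ds (h _ (ee_norm t)) (h' _ (ee_norm t)), ds_smul]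

theorem sp_ri {a b : Mat ι} (e : ι ≃ κ) (h : PU a b) : sp (ri e a) (ri e b) = ri e (sp a b) := by
  rw [sp, cm, sp, cm, ri_mul, ← mint_ri]
  congr 2; ext1 t
  rw [ri_smul, ri_add, inv_ri e (h _ (ee_norm t)), ri_smul]

theorem sp_zero (a : Mat ι) : sp a 0 = 0 := by simp [sp]

theorem sp_self {E : Mat ι} (h : E * E = E) : sp (1 - E) E = E := by
  have key : ∀ t, ee t ^ (-(-1:ℤ)) • ((1 - E) + ee t • E)⁻¹ = (ee t ^ (1:ℤ)) • (1 - E) + (ee t ^ (0:ℤ)) • E := by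
    intro t
    have : ((1 - E) + ee t • E)⁻¹ = (1 - E) + (ee t)⁻¹ • E := by
      apply Matrix.inv_eq_right_inv
      have h2 : (1 - E) * E = 0 := by rw [Matrix.sub_mul, Matrix.one_mul, h, sub_self]
      have h3 : E * (1 - E) = 0 := by rw [Matrix.mul_sub, Matrix.mul_one, h, sub_self]
      have h4 : (1 - E) * (1 - E) = 1 - E := by rw [Matrix.mul_sub, h2, Matrix.mul_one, sub_zero]
      rw [Matrix.add_mul, Matrix.mul_add, Matrix.mul_add]
      simp only [Matrix.mul_smul, Matrix.smul_mul, h, h2, h3, h4, smul_smul]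
      simp [ee_ne t]
    rw [this]
    simp [smul_smul, ee_ne t]
  rw [sp, cm]
  simp only [key]
  have := mint_add (F := fun t => ee t ^ (1:ℤ) • (1 - E)) (G := fun t => ee t ^ (0:ℤ) • E)
    ((continuous_ee_zpow _).smul continuous_const) ((continuous_ee_zpow _).smul continuous_const)
  rw [← this, mint_ee, mint_ee]
  simp [h]

/-- additive invariants of continuous idempotent families -/
structure IdemInv (X : Type) [TopologicalSpace X] (Γ : Type) [AddCommGroup Γ] where
  F : ∀ (ι : Type) [Fintype ι] [DecidableEq ι], (X → Mat ι) → Γ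
  htpy : ∀ (ι : Type) [Fintype ι] [DecidableEq ι] (H : X × ℝ → Mat ι), Continuous H →
    (∀ p, H p * H p = H p) → F ι (fun x => H (x, 0)) = F ι (fun x => H (x, 1))
  ri : ∀ (ι κ : Type) [Fintype ι] [DecidableEq ι] [Fintype κ] [DecidableEq κ] (e : ι ≃ κ)
    (u : X → Mat ι), Continuous u → (∀ x, u x * u x = u x) → F κ (fun x => PK.ri e (u x)) = F ι u
  ds : ∀ (ι κ : Type) [Fintype ι] [DecidableEq ι] [Fintype κ] [DecidableEq κ]
    (u : X → Mat ι) (v : X → Mat κ), Continuous u → (∀ x, u x * u x = u x) → Continuous v →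
    (∀ x, v x * v x = v x) → F (ι ⊕ κ) (fun x => PK.ds (u x) (v x)) = F ι u + F κ v
  zero : ∀ (ι : Type) [Fintype ι] [DecidableEq ι], F ι (fun _ => 0) = 0

/-- polynomial of degree ≤ N+1 -/
noncomputable def pv (N : ℕ) (a : ℕ → Mat ι) (z : ℂ) : Mat ι := ∑ k ∈ Finset.range (N+2), z ^ k • a k

def Hig (a : ℕ → Mat ι) : ℕ → Mat (ι ⊕ ι)
  | 0 => Matrix.fromBlocks (a 0) (a 1) 0 1
  | 1 => Matrix.fromBlocks 0 (a 2) (-1) 0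
  | k+2 => Matrix.fromBlocks 0 (a (k+3)) 0 0

noncomputable def pq (N : ℕ) (a : ℕ → Mat ι) (z : ℂ) : Mat ι := ∑ k ∈ Finset.range (N+2), z ^ k • a (k+1)

theorem pv_succ (N : ℕ) (a : ℕ → Mat ι) (z : ℂ) : pv (N+1) a z = a 0 + z • pq N a z := by
  rw [pv, Finset.sum_range_succ', pq, Finset.smul_sum, add_comm]
  simp [smul_smul, pow_succ']

theorem pv_Hig (N : ℕ) (a : ℕ → Mat ι) (z : ℂ) :
    pv N (Hig a) z = Matrix.fromBlocks (a 0) (pq N a z) (-(z • 1)) 1 := by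
  induction N with
  | zero => simp [pv, pq, Hig, Finset.sum_range_succ, Matrix.fromBlocks_smul, Matrix.fromBlocks_add]
  | succ N ih =>
    rw [pv, Finset.sum_range_succ, ← pv, ih, show pq (N+1) a z = pq N a z + z ^ (N+2) • a (N+2+1) from Finset.sum_range_succ _ _]
    simp [Hig, Matrix.fromBlocks_smul, Matrix.fromBlocks_add]

/-- Higman deformation matrix -/
noncomputable def hd (p q : Mat ι) (z s : ℂ) : Mat (ι ⊕ ι) :=
  Matrix.fromBlocks (p - (s ^ 2 * z) • q) (s • q) (-((s * z) • 1)) 1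

theorem hd_unit {p : Mat ι} (hp : IsUnit p) (q : Mat ι) (z s : ℂ) : IsUnit (hd p q z s) := by
  have h1 : hd p q z s = Matrix.fromBlocks 1 (s • q) 0 1 * ds p 1 * Matrix.fromBlocks 1 0 (-((s * z) • 1)) 1 := by
    simp [hd, ds, Matrix.fromBlocks_multiply, smul_smul, sub_eq_add_neg, pow_two]; ring_nf
  rw [h1]
  refine (IsUnit.mul ?_ (isUnit_ds hp isUnit_one)).mul ?_
  · exact isUnit_mk (B := Matrix.fromBlocks 1 (-(s • q)) 0 1) (by simp [Matrix.fromBlocks_multiply])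
  · exact isUnit_mk (B := Matrix.fromBlocks 1 0 ((s*z) • 1) 1) (by simp [Matrix.fromBlocks_multiply])

theorem hd_zero (p q : Mat ι) (z : ℂ) : hd p q z 0 = ds p 1 := by simp [hd, ds]

theorem hd_one (N : ℕ) (a : ℕ → Mat ι) (z : ℂ) : hd (pv (N+1) a z) (pq N a z) z 1 = pv N (Hig a) z := by
  rw [pv_Hig, pv_succ]; simp [hd]

def PG (N : ℕ) (a : X → ℕ → Mat ι) : Prop :=
  (∀ k, Continuous fun x => a x k) ∧ ∀ x z, ‖z‖ = 1 → IsUnit (pv N (a x) z)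

theorem PG.Hig {N : ℕ} {a : X → ℕ → Mat ι} (h : PG (N+1) a) : PG N fun x => Hig (a x) := by
  refine ⟨fun k => ?_, fun x z hz => ?_⟩
  · rcases k with _ | _ | k
    · exact (h.1 0).matrix_fromBlocks (h.1 1) continuous_const continuous_const
    · exact continuous_const.matrix_fromBlocks (h.1 2) continuous_const continuous_const
    · exact continuous_const.matrix_fromBlocks (h.1 (k+3)) continuous_const continuous_const
  · rw [← hd_one]; exact hd_unit (h.2 x z hz) _ _ _

theorem PG.PU {a : X → ℕ → Mat ι} (h : PG 0 a) (x : X) : PU (a x 0) (a x 1) := by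
  intro z hz
  have := h.2 x z hz
  simpa [pv, Finset.sum_range_succ] using this

theorem PG.comp {N : ℕ} {a : Y → ℕ → Mat ι} (h : PG N a) {f : X → Y} (hf : Continuous f) :
    PG N fun x => a (f x) := ⟨fun k => (h.1 k).comp hf, fun x z hz => h.2 _ z hz⟩

variable {Γ : Type} [AddCommGroup Γ]

noncomputable def EC (Θ : IdemInv X Γ) : ∀ (N : ℕ) (ι : Type) [Fintype ι] [DecidableEq ι] (a : X → ℕ → Mat ι), Γ
  | 0, ι, _, _, a => Θ.F ι fun x => sp (a x 0) (a x 1)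
  | N+1, ι, _, _, a => EC Θ N (ι ⊕ ι) fun x => Hig (a x)

theorem EC_htpy (Θ : IdemInv X Γ) (N : ℕ) {a : X × ℝ → ℕ → Mat ι} (h : PG N a) :
    EC Θ N ι (fun x => a (x, 0)) = EC Θ N ι (fun x => a (x, 1)) := by
  induction N generalizing ι with
  | zero =>
    exact Θ.htpy ι (fun p => sp (a p 0) (a p 1)) (continuous_sp (h.1 0) (h.1 1) h.PU)
      (fun p => sp_idem (h.PU p))
  | succ N ih => exact ih h.Hig

theorem Hig_ri (e : ι ≃ κ) (a : ℕ → Mat ι) :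
    Hig (fun k => ri e (a k)) = fun k => ri (e.sumCongr e) (Hig a k) := by
  ext k i j
  rcases k with _ | _ | k <;> rcases i with i | i <;> rcases j with j | j <;>
    simp [Hig, ri, Matrix.one_apply]

theorem EC_ri (Θ : IdemInv X Γ) (N : ℕ) {a : X → ℕ → Mat ι} (h : PG N a) (e : ι ≃ κ) :
    EC Θ N κ (fun x k => ri e (a x k)) = EC Θ N ι a := by
  induction N generalizing ι κ with
  | zero =>
    simp only [EC, sp_ri e (h.PU _)]
    exact Θ.ri _ _ e _ (continuous_sp (h.1 0) (h.1 1) h.PU) fun p => sp_idem (h.PU p)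
  | succ N ih =>
    simp only [EC, Hig_ri]
    exact ih h.Hig _

theorem Hig_ds (a : ℕ → Mat ι) (b : ℕ → Mat κ) :
    Hig (fun k => ds (a k) (b k)) = fun k => ri (Equiv.sumSumSumComm ι ι κ κ) (ds (Hig a k) (Hig b k)) := by
  ext k i j
  rcases k with _ | _ | k <;> rcases i with (i | i) | (i | i) <;> rcases j with (j | j) | (j | j) <;>
    simp [Hig, ri, ds, Matrix.one_apply]

theorem pv_ds (N : ℕ) (a : ℕ → Mat ι) (b : ℕ → Mat κ) (z : ℂ) :
    pv N (fun k => ds (a k) (b k)) z = ds (pv N a z) (pv N b z) := by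
  simp only [pv]
  generalize N + 2 = M
  induction M with
  | zero => simp [ds]
  | succ M ih => rw [Finset.sum_range_succ, ih, Finset.sum_range_succ, Finset.sum_range_succ, ← ds_add, ds_smul]

theorem PG.ds {N : ℕ} {a : X → ℕ → Mat ι} {b : X → ℕ → Mat κ} (h : PG N a) (h' : PG N b) :
    PG N fun x k => ds (a x k) (b x k) :=
  ⟨fun k => continuous_ds (h.1 k) (h'.1 k), fun x z hz => by
    rw [pv_ds]; exact isUnit_ds (h.2 x z hz) (h'.2 x z hz)⟩

theorem EC_ds (Θ : IdemInv X Γ) (N : ℕ) {a : X → ℕ → Mat ι} {b : X → ℕ → Mat κ} (h : PG N a) (h' : PG N b) :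
    EC Θ N (ι ⊕ κ) (fun x k => ds (a x k) (b x k)) = EC Θ N ι a + EC Θ N κ b := by
  induction N generalizing ι κ with
  | zero =>
    simp only [EC, sp_ds (h.PU _) (h'.PU _)]
    exact Θ.ds _ _ _ _ (continuous_sp (h.1 0) (h.1 1) h.PU) (fun p => sp_idem (h.PU p))
      (continuous_sp (h'.1 0) (h'.1 1) h'.PU) fun p => sp_idem (h'.PU p)
  | succ N ih =>
    simp only [EC, Hig_ds]
    rw [EC_ri _ _ (h.Hig.ds h'.Hig)]
    exact ih h.Hig h'.Hig

theorem pv_top {N : ℕ} {a : ℕ → Mat ι} (h : a (N+2) = 0) (z : ℂ) : pv (N+1) a z = pv N a z := by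
  rw [pv, Finset.sum_range_succ, h]; simp [pv]

theorem EC_top (Θ : IdemInv X Γ) (N : ℕ) {a : X → ℕ → Mat ι} (h : PG N a) (h0 : ∀ x, a x (N+2) = 0) :
    EC Θ (N+1) ι a = EC Θ N ι a := by
  induction N generalizing ι with
  | zero =>
    have hP : PG 0 (fun (p : X × ℝ) (k : ℕ) => (if k = 0 then
        Matrix.fromBlocks (a p.1 0) ((p.2 : ℂ) • a p.1 1) 0 1
        else Matrix.fromBlocks ((1 - (p.2:ℂ)^2) • a p.1 1) 0 (-((p.2 : ℂ) • 1)) 0 : Mat (ι ⊕ ι))) := by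
      refine ⟨fun k => ?_, fun p z hz => ?_⟩
      · have cs : Continuous fun p : X × ℝ => (p.2 : ℂ) := by fun_prop
        have cs2 : Continuous fun p : X × ℝ => (1 - (p.2 : ℂ)^2) := by fun_prop
        have c0 := (h.1 0).comp (continuous_fst (X := X) (Y := ℝ))
        have c1 := (h.1 1).comp (continuous_fst (X := X) (Y := ℝ))
        by_cases hk : k = 0
        · simp only [hk, if_true]
          refine c0.matrix_fromBlocks (cs.smul c1) continuous_const continuous_const
        · simp only [hk, if_false]
          refine (cs2.smul c1).matrix_fromBlocks continuous_const
            (cs.smul continuous_const).neg continuous_const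
      · have := hd_unit (h.2 p.1 z hz) (a p.1 1) z p.2
        convert this using 1
        simp only [pv, hd, Finset.sum_range_succ, Finset.range_zero, Finset.sum_empty]
        simp only [if_true, one_ne_zero, if_false, pow_zero, pow_one, one_smul, zero_add, Matrix.fromBlocks_smul,
          Matrix.fromBlocks_add]
        congr 1
        · rw [sub_smul, smul_sub, one_smul, smul_smul, add_sub_assoc, mul_comm z]
        · simp
        · rw [smul_neg, smul_smul, mul_comm z]
        · simp
    have key := EC_htpy Θ 0 hP
    simp only [EC, if_true, one_ne_zero, if_false] at key ⊢
    have e0 : ∀ x, Hig (a x) 0 = Matrix.fromBlocks (a x 0) (((1:ℝ):ℂ) • a x 1) 0 1 := by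
      intro x; simp [Hig]
    have e1 : ∀ x, Hig (a x) 1 = Matrix.fromBlocks ((1 - ((1:ℝ):ℂ)^2) • a x 1) 0 (-(((1:ℝ) : ℂ) • 1)) 0 := by
      intro x
      simp [Hig]
      have := h0 x
      simp at this
      simp [this]
    simp only [e0, e1]
    rw [← key]
    have e2 : ∀ x, sp (Matrix.fromBlocks (a x 0) (((0:ℝ):ℂ) • a x 1) 0 1)
        (Matrix.fromBlocks ((1 - ((0:ℝ):ℂ)^2) • a x 1) 0 (-(((0:ℝ) : ℂ) • 1)) 0) =
        ds (sp (a x 0) (a x 1)) (0 : Mat ι) := by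
      intro x
      have : PU (1 : Mat ι) 0 := by intro z _; simp
      have h2 := sp_ds (h.PU x) this
      rw [sp_zero] at h2
      rw [← h2]
      simp [ds]
    simp only [e2]
    have := Θ.ds ι ι _ (fun _ => 0) (continuous_sp (h.1 0) (h.1 1) h.PU) (fun p => sp_idem (h.PU p))
      continuous_const (by simp)
    rw [Θ.zero, add_zero] at this
    exact this
  | succ N ih =>
    have h1 : ∀ x, Hig (a x) (N+2) = 0 := by
      intro x; rw [Hig, h0]; simp
    exact ih h.Hig h1

/-- multiplication by z -/
def sft (a : ℕ → Mat ι) : ℕ → Mat ι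
  | 0 => 0
  | k+1 => a k

theorem pv_sft (N : ℕ) (a : ℕ → Mat ι) (z : ℂ) : pv (N+1) (sft a) z = z • pv N a z := by
  rw [pv_succ]; simp [sft, pq, pv]

/-- the monomial z -/
def zpl (ι : Type) [DecidableEq ι] (k : ℕ) : Mat ι := if k = 1 then 1 else 0

theorem pv_zpl (N : ℕ) (z : ℂ) : pv N (zpl ι) z = z • 1 := by
  rw [pv, Finset.sum_eq_single 1] <;> simp +contextual [zpl]

theorem PG_zpl (N : ℕ) : PG N fun _ : X => zpl ι :=
  ⟨fun k => continuous_const, fun x z hz => by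
    rw [pv_zpl]
    have : z ≠ 0 := by rintro rfl; simp at hz
    exact isUnit_mk (B := z⁻¹ • 1) (by simp [smul_smul, this])⟩

theorem EC_zpl (Θ : IdemInv X Γ) (N : ℕ) : EC Θ N ι (fun _ => zpl ι) = Θ.F ι fun _ => 1 := by
  induction N with
  | zero =>
    have := sp_self (E := (1 : Mat ι)) (by simp)
    simp only [sub_self] at this
    simp [EC, zpl, this]
  | succ N ih => rw [EC_top Θ N (PG_zpl N) (fun _ => by simp [zpl]), ih]

theorem pv_mul (N : ℕ) (a : ℕ → Mat ι) (M : Mat ι) (z : ℂ) : pv N (fun k => a k * M) z = pv N a z * M := by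
  simp [pv, Finset.sum_mul]

theorem EC_sft (Θ : IdemInv X Γ) (N : ℕ) {a : X → ℕ → Mat ι} (h : PG N a) :
    EC Θ (N+1) ι (fun x => sft (a x)) = EC Θ N ι a + Θ.F ι fun _ => 1 := by
  have hq : ∀ (x : X) z, pq N (sft (a x)) z = pv N (a x) z := fun x z => by simp [pq, pv, sft]
  have hz0 : ∀ z : ℂ, ‖z‖ = 1 → z ≠ 0 := by rintro z hz rfl; simp at hz
  -- first path
  have hP : PG N (fun (p : X × ℝ) (k : ℕ) => Hig (sft (a p.1)) k -
      (if k = 0 then Matrix.fromBlocks 0 0 0 ((p.2:ℂ) • 1) else 0 : Mat (ι ⊕ ι))) := by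
    have hH : ∀ k, Continuous fun x => Hig (sft (a x)) k := by
      intro k
      rcases k with _ | _ | k
      · exact continuous_const.matrix_fromBlocks (h.1 0) continuous_const continuous_const
      · exact continuous_const.matrix_fromBlocks (h.1 1) continuous_const continuous_const
      · exact continuous_const.matrix_fromBlocks (h.1 (k+2)) continuous_const continuous_const
    refine ⟨fun k => ((hH k).comp continuous_fst).sub ?_, fun p z hz => ?_⟩
    · by_cases hk : k = 0
      · simp only [hk, if_true]
        exact continuous_const.matrix_fromBlocks continuous_const continuous_const
          (Continuous.smul (show Continuous fun p : X × ℝ => (p.2 : ℂ) by fun_prop) continuous_const)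
      · simp only [hk, if_false]; exact continuous_const
    · have e : pv N (fun k => Hig (sft (a p.1)) k -
          (if k = 0 then Matrix.fromBlocks 0 0 0 ((p.2:ℂ) • 1) else 0 : Mat (ι ⊕ ι))) z =
          Matrix.fromBlocks 0 (pv N (a p.1) z) (-(z • 1)) ((1 - (p.2:ℂ)) • 1) := by
        simp only [pv, smul_sub, Finset.sum_sub_distrib]
        rw [← pv, pv_Hig, hq, Finset.sum_eq_single (a := 0) (s := Finset.range (N+2))
          (f := fun k => z ^ k • (if k = 0 then Matrix.fromBlocks 0 0 0 ((p.2:ℂ) • 1) else 0 : Mat (ι ⊕ ι)))]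
        · simp [sft, sub_eq_add_neg, Matrix.fromBlocks_neg, Matrix.fromBlocks_add, add_smul, pv]
        · intro b _ hb; simp [hb]
        · simp
      rw [e]
      refine isUnit_mk (B := Matrix.fromBlocks ((z⁻¹ * (1 - (p.2:ℂ))) • (pv N (a p.1) z)⁻¹) (-(z⁻¹ • 1)) ((pv N (a p.1) z)⁻¹) 0) ?_
      have hz := hz0 z hz
      have hz' : IsUnit (pv N (a p.1) z) := h.2 _ _ ‹_›
      have e3 : z⁻¹ * (1 - (p.2:ℂ)) * z = 1 - p.2 := by field_simp
      simp [Matrix.fromBlocks_multiply, mul_inv' hz', smul_smul, inv_mul_cancel₀ hz, e3]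
  have k1 := EC_htpy Θ N hP
  -- second path
  have hQ : PG N (fun (p : X × ℝ) (k : ℕ) => ds (a p.1 k) (zpl ι k) * rot ι (-p.2)) := by
    have := (h.comp (continuous_fst (X := X) (Y := ℝ))).ds (PG_zpl (X := X × ℝ) (ι := ι) N)
    refine ⟨fun k => (this.1 k).matrix_mul (continuous_rot.comp (by fun_prop)), fun p z hz => ?_⟩
    rw [pv_mul]
    exact (this.2 p z hz).mul (isUnit_mk (rot_neg_mul _))
  have k2 := EC_htpy Θ N hQ
  simp only [neg_zero, rot_zero, Matrix.mul_one] at k2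
  rw [EC_ds Θ N h (PG_zpl N), EC_zpl] at k2
  rw [k2]
  simp only [EC]
  refine Eq.trans ?_ (k1.trans ?_)
  · congr 1; ext x k : 2; simp
  · congr 1; ext x k : 2
    rw [rot_neg_one]
    rcases k with _ | _ | k <;>
      simp [Hig, sft, zpl, ds, Matrix.fromBlocks_multiply, sub_eq_add_neg, Matrix.fromBlocks_neg, Matrix.fromBlocks_add]

end higman
end PK

namespace PK
abbrev T1 : Type := UnitAddCircle

noncomputable def zz (t : T1) : ℂ := fourier 1 t

section laurent
variable {X Y : Type} [TopologicalSpace X] [TopologicalSpace Y]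
variable {ι κ : Type} [Fintype ι] [DecidableEq ι] [Fintype κ] [DecidableEq κ]

theorem continuous_zz : Continuous zz := (fourier 1).continuous

theorem zz_norm (t : T1) : ‖zz t‖ = 1 := by
  rw [zz, fourier_apply]; exact Circle.norm_coe _

theorem zz_ne (t : T1) : zz t ≠ 0 := by
  intro h; have := zz_norm t; rw [h] at this; simp at this

theorem zz_zpow (t : T1) (k : ℤ) : zz t ^ k = fourier k t := by
  rw [zz, fourier_apply, fourier_apply, one_smul, AddCircle.toCircle_zsmul]
  simp

theorem zz_coe (t : ℝ) : zz (t : T1) = ee t := by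
  rw [zz, fourier_coe_apply, ee]; congr 1; push_cast; ring

theorem zz_zero : zz 0 = 1 := by simp [zz]

theorem zz_surj {z : ℂ} (hz : ‖z‖ = 1) : ∃ t : T1, zz t = z := by
  obtain ⟨t, ht⟩ := (AddCircle.homeomorphCircle (T := (1:ℝ)) one_ne_zero).surjective
    ⟨z, by simpa [Submonoid.unitSphere] using hz⟩
  refine ⟨t, ?_⟩
  rw [zz, fourier_apply, one_smul, ← AddCircle.homeomorphCircle_apply one_ne_zero, ht]

theorem scalar_approx [CompactSpace X] {f : X × T1 → ℂ} (hf : Continuous f) {ε : ℝ} (hε : 0 < ε) :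
    ∃ (n : ℕ) (c : ℤ → X → ℂ), (∀ k, Continuous (c k)) ∧ (∀ k x, (n:ℤ) < |k| → c k x = 0) ∧
      ∀ m : ℕ, n ≤ m → ∀ x t, ‖f (x, t) - ∑ k ∈ Finset.Icc (-(m:ℤ)) m, c k x * zz t ^ k‖ < ε := by
  let F : C(X, C(T1, ℂ)) := ContinuousMap.curry ⟨f, hf⟩
  have hFa : ∀ x t, F x t = f (x, t) := fun x t => rfl
  have dense : ∀ x, ∃ c : ℤ →₀ ℂ, ‖F x - c.sum fun k a => a • fourier k‖ < ε := by
    intro x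
    have : F x ∈ (Submodule.span ℂ (Set.range (@fourier (1:ℝ)))).topologicalClosure := by
      rw [span_fourier_closure_eq_top]; trivial
    rw [← SetLike.mem_coe, Submodule.topologicalClosure_coe, Metric.mem_closure_iff] at this
    obtain ⟨g, hg, hd⟩ := this ε hε
    rw [SetLike.mem_coe, Finsupp.mem_span_range_iff_exists_finsupp] at hg
    obtain ⟨c, rfl⟩ := hg
    exact ⟨c, by rwa [← dist_eq_norm]⟩
  let P : (ℤ →₀ ℂ) → C(T1, ℂ) := fun c => c.sum fun k a => a • fourier k
  have hP : ∀ c t, P c t = c.sum fun k a => a * zz t ^ k := by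
    intro c t
    simp only [P, Finsupp.sum, ContinuousMap.coe_sum, Finset.sum_apply, ContinuousMap.coe_smul, Pi.smul_apply,
      smul_eq_mul, zz_zpow]
  obtain ⟨S, hS⟩ := isCompact_univ.elim_finite_subcover (fun c : ℤ →₀ ℂ => {x | ‖F x - P c‖ < ε})
    (fun c => isOpen_lt ((F.continuous.sub continuous_const).norm) continuous_const)
    (fun x _ => by obtain ⟨c, hc⟩ := dense x; exact Set.mem_iUnion.2 ⟨c, hc⟩)
  let w : (ℤ →₀ ℂ) → X → ℝ := fun c x => max 0 (ε - ‖F x - P c‖)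
  have hw : ∀ c, Continuous (w c) := fun c =>
    continuous_const.max (continuous_const.sub (F.continuous.sub continuous_const).norm)
  have hw0 : ∀ c x, 0 ≤ w c x := fun c x => le_max_left _ _
  let W : X → ℝ := fun x => ∑ c ∈ S, w c x
  have hW : Continuous W := continuous_finset_sum _ fun c _ => hw c
  have hWpos : ∀ x, 0 < W x := by
    intro x
    obtain ⟨c, hcS, hc⟩ := Set.mem_iUnion₂.1 (hS (Set.mem_univ x))
    refine Finset.sum_pos' (fun c _ => hw0 c x) ⟨c, hcS, ?_⟩
    exact lt_max_of_lt_right (sub_pos.2 hc)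
  let n : ℕ := S.sup fun c => c.support.sup fun k => k.natAbs
  have hn : ∀ c ∈ S, ∀ k : ℤ, (n:ℤ) < |k| → c k = 0 := by
    intro c hc k hk
    by_contra h
    have h1 : k.natAbs ≤ c.support.sup fun k => k.natAbs :=
      Finset.le_sup (f := fun k : ℤ => k.natAbs) (Finsupp.mem_support_iff.2 h)
    have h2 : (c.support.sup fun k => k.natAbs) ≤ n :=
      Finset.le_sup (f := fun c : ℤ →₀ ℂ => c.support.sup fun k => k.natAbs) hc
    have : k.natAbs ≤ n := h1.trans h2
    rw [Int.abs_eq_natAbs] at hk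
    omega
  refine ⟨n, fun k x => ∑ c ∈ S, ((w c x / W x : ℝ) : ℂ) * c k, ?_, ?_, ?_⟩
  · intro k
    refine continuous_finset_sum _ fun c _ => ?_
    exact (Complex.continuous_ofReal.comp ((hw c).div hW fun x => (hWpos x).ne')).mul continuous_const
  · intro k x hk
    exact Finset.sum_eq_zero fun c hc => by rw [hn c hc k hk, mul_zero]
  · intro m hm x t
    have e1 : ∀ c ∈ S, ∑ k ∈ Finset.Icc (-(m:ℤ)) m, c k * zz t ^ k = P c t := by
      intro c hc
      rw [hP, Finsupp.sum]
      symm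
      refine Finset.sum_subset ?_ ?_
      · intro k hk
        rw [Finset.mem_Icc, ← abs_le]
        by_contra hlt
        exact Finsupp.mem_support_iff.1 hk (hn c hc k (by push Not at hlt; omega))
      · intro k _ hk; rw [Finsupp.notMem_support_iff.1 hk, zero_mul]
    have e2 : ∑ k ∈ Finset.Icc (-(m:ℤ)) m, (∑ c ∈ S, ((w c x / W x : ℝ) : ℂ) * c k) * zz t ^ k =
        ∑ c ∈ S, ((w c x / W x : ℝ) : ℂ) * P c t := by
      simp only [Finset.sum_mul]
      rw [Finset.sum_comm]
      refine Finset.sum_congr rfl fun c hc => ?_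
      rw [← e1 c hc, Finset.mul_sum]
      simp only [mul_assoc]
    have e3 : f (x, t) = ∑ c ∈ S, ((w c x / W x : ℝ) : ℂ) * f (x, t) := by
      rw [← Finset.sum_mul, ← Complex.ofReal_sum, ← Finset.sum_div, div_self (hWpos x).ne']; simp
    rw [e2, e3, ← Finset.sum_sub_distrib]
    have e4 : ∀ c ∈ S, ‖((w c x / W x : ℝ) : ℂ) * f (x, t) - ((w c x / W x : ℝ) : ℂ) * P c t‖ ≤
        (w c x / W x) * ‖F x - P c‖ := by
      intro c _
      rw [← mul_sub, norm_mul, Complex.norm_real, Real.norm_of_nonneg (div_nonneg (hw0 c x) (hWpos x).le)]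
      refine mul_le_mul_of_nonneg_left ?_ (div_nonneg (hw0 c x) (hWpos x).le)
      exact (F x - P c).norm_coe_le_norm t
    refine (norm_sum_le_of_le _ e4).trans_lt ?_
    have e5 : ε = ∑ c ∈ S, (w c x / W x) * ε := by
      rw [← Finset.sum_mul, ← Finset.sum_div, div_self (hWpos x).ne', one_mul]
    rw [e5]
    obtain ⟨c, hcS, hc⟩ := Set.mem_iUnion₂.1 (hS (Set.mem_univ x))
    refine Finset.sum_lt_sum (fun c _ => ?_) ⟨c, hcS, ?_⟩
    · by_cases h : ‖F x - P c‖ ≤ ε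
      · exact mul_le_mul_of_nonneg_left h (div_nonneg (hw0 c x) (hWpos x).le)
      · have : w c x = 0 := max_eq_left (by linarith)
        simp [this]
    · have hc' : ‖F x - P c‖ < ε := hc
      exact mul_lt_mul_of_pos_left hc' (div_pos (lt_max_of_lt_right (sub_pos.2 hc')) (hWpos x))

/-- Laurent approximation data -/
structure Apx (u : X × T1 → Mat ι) (n N : ℕ) (a : X → ℕ → Mat ι) : Prop where
  cont : ∀ k, Continuous fun x => a x k
  van : ∀ x k, N + 2 ≤ k → a x k = 0
  close : ∀ x t i, ∑ j, ‖((u (x, t))⁻¹ * (zz t ^ (-(n:ℤ)) • pv N (a x) (zz t)) - 1) i j‖ < 1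

theorem row_unit {A : Mat ι} (h : ∀ i, ∑ j, ‖(A - 1) i j‖ < 1) : IsUnit A := by
  rw [Matrix.isUnit_iff_isUnit_det, isUnit_iff_ne_zero]
  refine det_ne_zero_of_sum_row_lt_diag fun i => ?_
  have h1 := h i
  rw [← Finset.add_sum_erase _ _ (Finset.mem_univ i)] at h1
  have h2 : ∑ j ∈ Finset.univ.erase i, ‖(A - 1) i j‖ = ∑ j ∈ Finset.univ.erase i, ‖A i j‖ := by
    refine Finset.sum_congr rfl fun j hj => ?_
    rw [Matrix.sub_apply, Matrix.one_apply_ne (Finset.ne_of_mem_erase hj).symm, sub_zero]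
  rw [h2, Matrix.sub_apply, Matrix.one_apply_eq] at h1
  have h3 : 1 ≤ ‖A i i - 1‖ + ‖A i i‖ := by
    have := norm_sub_le (A i i) (A i i - 1)
    simp only [sub_sub_cancel, norm_one] at this
    linarith
  linarith

theorem row_convex {A B : Mat ι} (hA : ∀ i, ∑ j, ‖(A - 1) i j‖ < 1) (hB : ∀ i, ∑ j, ‖(B - 1) i j‖ < 1)
    {s : ℝ} (h0 : 0 ≤ s) (h1 : s ≤ 1) (i : ι) : ∑ j, ‖(((1 - s : ℝ):ℂ) • A + (s:ℂ) • B - 1) i j‖ < 1 := by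
  have e : ∀ j, ‖(((1 - s : ℝ):ℂ) • A + (s:ℂ) • B - 1) i j‖ ≤ (1 - s) * ‖(A - 1) i j‖ + s * ‖(B - 1) i j‖ := by
    intro j
    have : (((1 - s : ℝ):ℂ) • A + (s:ℂ) • B - 1) i j = ((1 - s : ℝ):ℂ) * (A - 1) i j + (s:ℂ) * (B - 1) i j := by
      simp only [Matrix.sub_apply, Matrix.add_apply, Matrix.smul_apply, smul_eq_mul]; push_cast; ring
    rw [this]
    refine (norm_add_le _ _).trans (le_of_eq ?_)
    rw [norm_mul, norm_mul, Complex.norm_real, Complex.norm_real, Real.norm_of_nonneg h0,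
      Real.norm_of_nonneg (by linarith)]
  refine (Finset.sum_le_sum fun j _ => e j).trans_lt ?_
  rw [Finset.sum_add_distrib, ← Finset.mul_sum, ← Finset.mul_sum]
  rcases eq_or_lt_of_le h0 with rfl | hs
  · simpa using hA i
  · have := mul_lt_mul_of_pos_left (hB i) hs
    have := mul_le_mul_of_nonneg_left (hA i).le (sub_nonneg.2 h1)
    linarith

theorem Apx.unit {u : X × T1 → Mat ι} {n N : ℕ} {a : X → ℕ → Mat ι} (h : Apx u n N a) (hu : GLc u) : PG N a := by
  refine ⟨h.cont, fun x z hz => ?_⟩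
  obtain ⟨t, rfl⟩ := zz_surj hz
  have h1 := row_unit (h.close x t)
  rw [Matrix.mul_smul, ← Matrix.smul_mul] at h1
  rw [Matrix.isUnit_iff_isUnit_det, Matrix.det_mul] at h1
  exact (Matrix.isUnit_iff_isUnit_det _).2 (isUnit_of_mul_isUnit_right h1)

theorem exists_apx [CompactSpace X] {u : X × T1 → Mat ι} (hu : GLc u) : ∃ n N a, Apx u n N a := by
  have hi := hu.inv
  obtain ⟨C, hC0, hC⟩ : ∃ C : ℝ, 0 < C ∧ ∀ p i j, ‖(u p)⁻¹ i j‖ ≤ C := by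
    have : ∀ i j, ∃ C : ℝ, ∀ p, ‖(u p)⁻¹ i j‖ ≤ C := by
      intro i j
      obtain ⟨C, hC⟩ := isCompact_univ.exists_bound_of_continuousOn (f := fun p => (u p)⁻¹ i j)
        (hi.1.matrix_elem i j).continuousOn
      exact ⟨C, fun p => hC p trivial⟩
    choose C hC using this
    refine ⟨1 + ∑ i, ∑ j, |C i j|, by positivity, fun p i j => (hC i j p).trans ?_⟩
    have h1 : |C i j| ≤ ∑ j, |C i j| := Finset.single_le_sum (f := fun j => |C i j|) (fun _ _ => abs_nonneg _) (Finset.mem_univ j)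
    have h2 : ∑ j, |C i j| ≤ ∑ i, ∑ j, |C i j| := Finset.single_le_sum (f := fun i => ∑ j, |C i j|)
      (fun _ _ => Finset.sum_nonneg fun _ _ => abs_nonneg _) (Finset.mem_univ i)
    linarith [le_abs_self (C i j)]
  set d : ℝ := (Fintype.card ι : ℝ) with hd
  have hd0 : 0 ≤ d := by positivity
  set ε : ℝ := 1 / (d * d * C + 1) with hε
  have hε0 : 0 < ε := by positivity
  have hεd : d * (d * (C * ε)) < 1 := by
    rw [hε, mul_one_div, mul_div, mul_div, div_lt_one (by positivity)]; nlinarith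
  choose n c hc hv happ using fun i j => scalar_approx (hu.1.matrix_elem i j) hε0
  let m : ℕ := ∑ i, ∑ j, n i j
  have hm : ∀ i j, n i j ≤ m := by
    intro i j
    have h1 : n i j ≤ ∑ j, n i j := Finset.single_le_sum (f := fun j => n i j) (fun _ _ => Nat.zero_le _) (Finset.mem_univ j)
    have h2 : ∑ j, n i j ≤ m := Finset.single_le_sum (f := fun i => ∑ j, n i j)
      (fun _ _ => Nat.zero_le _) (Finset.mem_univ i)
    exact h1.trans h2
  refine ⟨m, 2 * m, fun x k => Matrix.of fun i j => c i j (k - m) x, ?_, ?_, ?_⟩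
  · intro k; exact continuous_matrix fun i j => hc i j _
  · intro x k hk; ext i j
    refine hv i j _ x ?_
    have := hm i j
    rw [lt_abs]; left; omega
  · intro x t i
    set A := zz t ^ (-(m:ℤ)) • pv (2*m) (fun k => Matrix.of fun i j => c i j (k - m) x) (zz t) with hA
    have hAe : ∀ l j, ‖(A - u (x, t)) l j‖ ≤ ε := by
      intro l j
      have e : A l j = ∑ k ∈ Finset.Icc (-(m:ℤ)) m, c l j k x * zz t ^ k := by
        rw [hA, pv, Finset.sum_range_succ]
        have z0 : c l j ((2*m+1 : ℕ) - (m:ℤ)) x = 0 := hv l j _ x (by have := hm l j; rw [lt_abs]; left; push_cast; omega)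
        simp only [Matrix.smul_apply, Matrix.add_apply, Matrix.sum_apply, Matrix.of_apply, z0, smul_zero, add_zero,
          smul_eq_mul, mul_zero, add_zero, Finset.mul_sum]
        refine Finset.sum_bij (fun (k : ℕ) _ => (k:ℤ) - (m:ℤ)) ?_ ?_ ?_ ?_
        · intro k hk; rw [Finset.mem_range] at hk; rw [Finset.mem_Icc]; omega
        · intro k _ k' _ h; simpa using h
        · intro k hk; rw [Finset.mem_Icc] at hk
          exact ⟨(k + m).toNat, by rw [Finset.mem_range]; omega, by omega⟩
        · intro k _
          rw [zpow_sub₀ (zz_ne t), zpow_natCast, zpow_neg, zpow_natCast]; field_simp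
      rw [Matrix.sub_apply, e, norm_sub_rev]
      exact (happ l j m (hm l j) x t).le
    have e : (u (x,t))⁻¹ * A - 1 = (u (x,t))⁻¹ * (A - u (x,t)) := by
      rw [Matrix.mul_sub, inv_mul' (hu.2 _)]
    rw [e]
    refine lt_of_le_of_lt ?_ hεd
    have : ∀ j, ‖((u (x,t))⁻¹ * (A - u (x,t))) i j‖ ≤ d * (C * ε) := by
      intro j
      rw [Matrix.mul_apply]
      refine (norm_sum_le_of_le (f := fun l => (u (x,t))⁻¹ i l * (A - u (x,t)) l j) _ (n := fun _ => C * ε) ?_).trans ?_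
      · intro l _
        rw [norm_mul]
        exact mul_le_mul (hC _ _ _) (hAe _ _) (norm_nonneg _) hC0.le
      · simp [hd]
    refine (Finset.sum_le_sum fun j _ => this j).trans ?_
    simp [hd]
end laurent
end PK

namespace PK
section hat
variable {X Y : Type} [TopologicalSpace X] [TopologicalSpace Y]
variable {ι κ : Type} [Fintype ι] [DecidableEq ι] [Fintype κ] [DecidableEq κ]
variable {Γ : Type} [AddCommGroup Γ]

noncomputable def Va (Θ : IdemInv X Γ) (n N : ℕ) (a : X → ℕ → Mat ι) : Γ :=
  EC Θ N ι a - n • Θ.F ι fun _ => 1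

theorem Apx.sft {u : X × T1 → Mat ι} {n N : ℕ} {a : X → ℕ → Mat ι} (h : Apx u n N a) :
    Apx u (n+1) (N+1) fun x => sft (a x) where
  cont k := by
    rcases k with _ | k
    · exact continuous_const
    · exact h.cont k
  van x k hk := by
    rcases k with _ | k
    · rfl
    · exact h.van x k (by omega)
  close x t i := by
    have : zz t ^ (-((n+1 : ℕ):ℤ)) • pv (N+1) (PK.sft (a x)) (zz t) = zz t ^ (-(n:ℤ)) • pv N (a x) (zz t) := by
      rw [pv_sft, smul_smul]; congr 1
      push_cast
      rw [neg_add, zpow_add₀ (zz_ne t)]; simp [zz_ne t]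
    rw [this]; exact h.close x t i

theorem Va_sft (Θ : IdemInv X Γ) {n N : ℕ} {a : X → ℕ → Mat ι} (h : PG N a) :
    Va Θ (n+1) (N+1) (fun x => sft (a x)) = Va Θ n N a := by
  rw [Va, EC_sft Θ N h, Va, succ_nsmul]; abel

theorem Apx.top {u : X × T1 → Mat ι} {n N : ℕ} {a : X → ℕ → Mat ι} (h : Apx u n N a) :
    Apx u n (N+1) a where
  cont := h.cont
  van x k hk := h.van x k (by omega)
  close x t i := by
    rw [pv_top (h.van x _ le_rfl)]; exact h.close x t i

theorem Apx.raise (Θ : IdemInv X Γ) {u : X × T1 → Mat ι} (hu : GLc u) {n N : ℕ} {a : X → ℕ → Mat ι} (h : Apx u n N a)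
    (m l : ℕ) : ∃ a', Apx u (n+m) (N+m+l) a' ∧ Va Θ (n+m) (N+m+l) a' = Va Θ n N a := by
  have h1 : ∃ a', Apx u (n+m) (N+m) a' ∧ Va Θ (n+m) (N+m) a' = Va Θ n N a := by
    induction m with
    | zero => exact ⟨a, h, rfl⟩
    | succ m ih =>
      obtain ⟨a', h', e⟩ := ih
      exact ⟨_, h'.sft, by rw [← e]; exact Va_sft Θ (h'.unit hu)⟩
  obtain ⟨a', h', e⟩ := h1
  refine ⟨a', ?_, ?_⟩
  · clear e
    induction l with
    | zero => exact h'
    | succ l ih => exact ih.top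
  · rw [← e]
    have : ∀ l, Apx u (n+m) (N+m+l) a' ∧ Va Θ (n+m) (N+m+l) a' = Va Θ (n+m) (N+m) a' := by
      intro l
      induction l with
      | zero => exact ⟨h', rfl⟩
      | succ l ih =>
        refine ⟨ih.1.top, ?_⟩
        rw [← ih.2, Va, Va, ← add_assoc, EC_top Θ _ (ih.1.unit hu) (fun x => ih.1.van x _ le_rfl)]
    exact (this l).2

theorem pv_lin (N : ℕ) (a b : ℕ → Mat ι) (r s z : ℂ) :
    pv N (fun k => r • a k + s • b k) z = r • pv N a z + s • pv N b z := by
  simp only [pv, Finset.smul_sum, ← Finset.sum_add_distrib, smul_add]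
  refine Finset.sum_congr rfl fun k _ => ?_
  rw [smul_comm, smul_comm _ s]

theorem EC_htpy' (Θ : IdemInv X Γ) (N : ℕ) {a : X × unitInterval → ℕ → Mat ι} (h : PG N a) :
    EC Θ N ι (fun x => a (x, 0)) = EC Θ N ι (fun x => a (x, 1)) := by
  have := EC_htpy Θ N (h.comp (f := fun p : X × ℝ => (p.1, Set.projIcc 0 1 zero_le_one p.2))
    (continuous_fst.prodMk (continuous_projIcc.comp continuous_snd)))
  simpa using this

theorem Va_indep (Θ : IdemInv X Γ) {u : X × T1 → Mat ι} (hu : GLc u) {n N n' N' : ℕ} {a a' : X → ℕ → Mat ι}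
    (h : Apx u n N a) (h' : Apx u n' N' a') : Va Θ n N a = Va Θ n' N' a' := by
  obtain ⟨b, hb, e⟩ := h.raise Θ hu n' (N' + n)
  obtain ⟨b', hb', e'⟩ := h'.raise Θ hu n (N + n')
  rw [← e, ← e']
  have e1 : n' + n = n + n' := add_comm _ _
  have e2 : N' + n + (N + n') = N + n' + (N' + n) := by ring
  rw [e1, e2] at hb' ⊢
  generalize n + n' = m at *
  generalize N + n' + (N' + n) = M at *
  rw [Va, Va]
  congr 1
  have hP : PG M fun (p : X × unitInterval) k => ((1 - (p.2:ℝ) : ℝ):ℂ) • b p.1 k + ((p.2:ℝ):ℂ) • b' p.1 k := by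
    refine ⟨fun k => ?_, fun p z hz => ?_⟩
    · have c1 : Continuous fun p : X × unitInterval => ((1 - (p.2:ℝ) : ℝ):ℂ) := by fun_prop
      have c2 : Continuous fun p : X × unitInterval => (((p.2:ℝ) : ℝ):ℂ) := by fun_prop
      exact (c1.smul ((hb.cont k).comp continuous_fst)).add (c2.smul ((hb'.cont k).comp continuous_fst))
    · obtain ⟨t, rfl⟩ := zz_surj hz
      have := row_unit (row_convex (hb.close p.1 t) (hb'.close p.1 t) p.2.2.1 p.2.2.2)
      rw [← Matrix.mul_smul, ← Matrix.mul_smul, ← Matrix.mul_add, smul_comm, smul_comm _ (zz t ^ (-(m:ℤ))), ← smul_add,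
        ← pv_lin, Matrix.mul_smul, ← Matrix.smul_mul, Matrix.isUnit_iff_isUnit_det, Matrix.det_mul] at this
      exact (Matrix.isUnit_iff_isUnit_det _).2 (isUnit_of_mul_isUnit_right this)
  have := EC_htpy' Θ M hP
  simpa using this

open Classical in
noncomputable def hatF (Θ : IdemInv X Γ) (ι : Type) [Fintype ι] [DecidableEq ι] (u : X × T1 → Mat ι) : Γ :=
  if h : ∃ d : ℕ × ℕ × (X → ℕ → Mat ι), Apx u d.1 d.2.1 d.2.2 then
    Va Θ h.choose.1 h.choose.2.1 h.choose.2.2 else 0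

theorem hatF_eq (Θ : IdemInv X Γ) {u : X × T1 → Mat ι} (hu : GLc u) {n N : ℕ} {a : X → ℕ → Mat ι}
    (h : Apx u n N a) : hatF Θ ι u = Va Θ n N a := by
  have h' : ∃ d : ℕ × ℕ × (X → ℕ → Mat ι), Apx u d.1 d.2.1 d.2.2 := ⟨(n, N, a), h⟩
  rw [hatF, dif_pos h']
  exact Va_indep Θ hu h'.choose_spec h

theorem Apx.exact {u : X × T1 → Mat ι} (hu : GLc u) {n N : ℕ} {a : X → ℕ → Mat ι} (hc : ∀ k, Continuous fun x => a x k)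
    (hv : ∀ x k, N + 2 ≤ k → a x k = 0) (he : ∀ x t, u (x, t) = zz t ^ (-(n:ℤ)) • pv N (a x) (zz t)) :
    Apx u n N a where
  cont := hc
  van := hv
  close x t i := by rw [← he, inv_mul' (hu.2 _)]; simp

/-- extension of an invariant of idempotents on X to an invariant of K1 (X × T) -/
noncomputable def hatInv [CompactSpace X] (Θ : IdemInv X Γ) : Inv (X × T1) Γ where
  F ι _ _ u := hatF Θ ι u
  htpy ι _ _ u v h := by
    have hu := h.left
    have hv := h.right
    obtain ⟨H, hH, H0, H1⟩ := h
    let K : (X × unitInterval) × T1 → Mat ι := fun p => H ((p.1.1, p.2), (p.1.2 : ℝ))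
    have hK : GLc K := hH.comp (f := fun p : (X × unitInterval) × T1 => ((p.1.1, p.2), (p.1.2 : ℝ))) (by fun_prop)
    obtain ⟨n, N, a, ha⟩ := exists_apx hK
    have a0 : Apx u n N fun x => a (x, 0) := by
      refine ⟨fun k => (ha.cont k).comp (by fun_prop), fun x k hk => ha.van _ k hk, fun x t i => ?_⟩
      have := ha.close (x, 0) t i
      simpa [K, H0] using this
    have a1 : Apx v n N fun x => a (x, 1) := by
      refine ⟨fun k => (ha.cont k).comp (by fun_prop), fun x k hk => ha.van _ k hk, fun x t i => ?_⟩
      have := ha.close (x, 1) t i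
      simpa [K, H1] using this
    rw [hatF_eq Θ hu a0, hatF_eq Θ hv a1, Va, Va, EC_htpy' Θ N (ha.unit hK)]
  ri ι κ _ _ _ _ e u hu := by
    obtain ⟨n, N, a, ha⟩ := exists_apx hu
    have hp : ∀ x z, pv N (fun k => PK.ri e (a x k)) z = PK.ri e (pv N (a x) z) := by
      intro x z; ext i j; simp [pv, PK.ri, Matrix.sum_apply]
    have hb : Apx (fun p => PK.ri e (u p)) n N fun x k => PK.ri e (a x k) := by
      refine ⟨fun k => (ha.cont k).matrix_submatrix _ _, fun x k hk => by rw [ha.van x k hk]; rfl, fun x t i => ?_⟩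
      rw [hp, inv_ri e (hu.2 _), ri_smul, ← ri_mul, ← ri_one e]
      have := ha.close x t (e.symm i)
      refine lt_of_eq_of_lt ?_ this
      exact Fintype.sum_equiv e.symm _ _ fun j => rfl
    rw [hatF_eq Θ hu ha, hatF_eq Θ (hu.ri e) hb, Va, Va, EC_ri Θ N (ha.unit hu)]
    congr 2
    have := Θ.ri ι κ e (fun _ => 1) continuous_const (by simp)
    simpa using this
  ds ι κ _ _ _ _ u v hu hv := by
    obtain ⟨n, N, a, ha⟩ := exists_apx hu
    obtain ⟨n', N', a', ha'⟩ := exists_apx hv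
    obtain ⟨b, hb, e⟩ := ha.raise Θ hu n' (N' + n)
    obtain ⟨b', hb', e'⟩ := ha'.raise Θ hv n (N + n')
    have e1 : n' + n = n + n' := add_comm _ _
    have e2 : N' + n + (N + n') = N + n' + (N' + n) := by ring
    rw [e1, e2] at hb'
    clear e e'
    generalize n + n' = m at *
    generalize N + n' + (N' + n) = M at *
    have hc : Apx (fun p => PK.ds (u p) (v p)) m M fun x k => PK.ds (b x k) (b' x k) := by
      refine ⟨fun k => continuous_ds (hb.cont k) (hb'.cont k), fun x k hk => ?_, fun x t i => ?_⟩
      · rw [hb.van x k hk, hb'.van x k hk]; simp [PK.ds]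
      · rw [pv_ds, inv_ds (hu.2 _) (hv.2 _), ds_smul, ds_mul, ← ds_one, sub_eq_add_neg,
          show -(PK.ds (1 : Mat ι) (1 : Mat κ)) = PK.ds (-1) (-1) by simp only [PK.ds, Matrix.fromBlocks_neg, neg_zero], ds_add,
          Fintype.sum_sum_type, ← sub_eq_add_neg, ← sub_eq_add_neg]
        rcases i with i | i
        · simpa [PK.ds] using hb.close x t i
        · simpa [PK.ds] using hb'.close x t i
    rw [hatF_eq Θ hu hb, hatF_eq Θ hv hb', hatF_eq Θ (hu.ds hv) hc, Va, Va, Va, EC_ds Θ M (hb.unit hu) (hb'.unit hv)]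
    have := Θ.ds ι κ (fun _ => 1) (fun _ => 1) continuous_const (by simp) continuous_const (by simp)
    simp only [ds_one] at this
    rw [this, smul_add]; abel
  one ι _ _ := by
    have hb : Apx (fun p : X × T1 => (1 : Mat ι)) 0 0 fun x k => if k = 0 then 1 else 0 := by
      refine Apx.exact GLc.one (fun k => continuous_const) (fun x k hk => if_neg (by omega)) fun x t => ?_
      simp [pv, Finset.sum_range_succ]
    rw [hatF_eq Θ GLc.one hb]
    simp [Va, EC, sp_zero, Θ.zero]

noncomputable def hat [CompactSpace X] (Θ : IdemInv X Γ) : K1 (X × T1) →+ Γ := (hatInv Θ).hom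

/-- class of 1 - E + z E -/
noncomputable def zc (E : X → Mat ι) : K1 (X × T1) := kc (fun p => zz p.2 • (1 : Mat ι)) (fun p => E p.1)

theorem GLc_zz : GLc fun p : X × T1 => zz p.2 • (1 : Mat ι) := by
  refine ⟨(continuous_zz.comp continuous_snd).smul continuous_const, fun p => ?_⟩
  exact isUnit_mk (B := (zz p.2)⁻¹ • 1) (by simp [smul_smul, zz_ne])

theorem Cor_zc {E : X → Mat ι} (hE : Continuous E) (hi : ∀ x, E x * E x = E x) :
    Cor (fun p : X × T1 => zz p.2 • (1 : Mat ι)) (fun p => E p.1) where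
  hU := GLc_zz
  hE := hE.comp continuous_fst
  idem p := hi _
  comm p := by simp

theorem hat_zc [CompactSpace X] (Θ : IdemInv X Γ) {E : X → Mat ι} (hE : Continuous E) (hi : ∀ x, E x * E x = E x) :
    hat Θ (zc E) = Θ.F ι E := by
  have hg := (Cor_zc hE hi).glc
  rw [zc, kc, hat, Inv.hom_cls _ hg]
  have : Apx (fun p : X × T1 => cr (zz p.2 • (1 : Mat ι)) (E p.1)) 0 0
      (fun x k => if k = 0 then 1 - E x else if k = 1 then E x else 0) := by
    refine Apx.exact hg (fun k => ?_) (fun x k hk => ?_) fun x t => ?_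
    · rcases k with _ | _ | k
      · exact continuous_const.sub hE
      · simpa using hE
      · simpa using continuous_const
    · rw [if_neg (by omega), if_neg (by omega)]
    · simp [pv, Finset.sum_range_succ, cr, add_comm]
  refine (hatF_eq Θ hg this).trans ?_
  simp [Va, EC, sp_self (hi _)]

theorem hat_pr [CompactSpace X] (Θ : IdemInv X Γ) (c : K1 X) : hat Θ (K1.map ⟨Prod.fst, continuous_fst⟩ c) = 0 := by
  obtain ⟨n, u, hu, rfl⟩ := exists_cls c
  rw [K1.map_cls _ hu]
  have hg : GLc fun p : X × T1 => u p.1 := hu.comp continuous_fst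
  have : Apx (fun p : X × T1 => u p.1) 0 0 (fun x k => if k = 0 then u x else 0) := by
    refine Apx.exact hg (fun k => ?_) (fun x k hk => if_neg (by omega)) fun x t => ?_
    · rcases k with _ | k
      · simpa using hu.1
      · simpa using continuous_const
    · simp [pv, Finset.sum_range_succ]
  rw [hat]
  refine (Inv.hom_cls _ hg).trans ?_
  refine (hatF_eq Θ hg this).trans ?_
  simp [Va, EC, sp_zero, Θ.zero]

theorem PG.glc {N : ℕ} {a : X → ℕ → Mat ι} (h : PG N a) : GLc fun p : X × T1 => pv N (a p.1) (zz p.2) := by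
  refine ⟨?_, fun p => h.2 _ _ (zz_norm _)⟩
  refine continuous_finset_sum _ fun k _ => ?_
  exact ((continuous_zz.comp continuous_snd).pow k).smul ((h.1 k).comp continuous_fst)

theorem sf_pencil {a b : X → Mat ι} (ha : Continuous a) (hb : Continuous b) (h : ∀ x, PU (a x) (b x)) :
    ∃ (E : X → Mat ι) (c : K1 X), Continuous E ∧ (∀ x, E x * E x = E x) ∧
      cls (fun p : X × T1 => a p.1 + zz p.2 • b p.1) = zc E + K1.map ⟨Prod.fst, continuous_fst⟩ c := by
  have cE := continuous_sp ha hb h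
  have iE : ∀ x, sp (a x) (b x) * sp (a x) (b x) = sp (a x) (b x) := fun x => sp_idem (h x)
  have hg : GLc fun x => a x * (1 - sp (a x) (b x)) + b x * sp (a x) (b x) :=
    ⟨(ha.matrix_mul (continuous_const.sub cE)).add (hb.matrix_mul cE), fun x => Lp_zero_unit (h x)⟩
  refine ⟨fun x => sp (a x) (b x), cls fun x => a x * (1 - sp (a x) (b x)) + b x * sp (a x) (b x), cE, iE, ?_⟩
  have hc := Cor_zc cE iE
  rw [K1.map_cls _ hg, zc, kc, add_comm, ← cls_mul]
  · symm
    refine cls_htpy (Htpy.mk (fun q => Lp (a q.1.1) (b q.1.1) (zz q.1.2) q.2) ?_ ?_ ?_ ?_)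
    · have c1 : Continuous fun q : (X × T1) × ℝ => (q.2:ℂ) := by fun_prop
      have c2 : Continuous fun q : (X × T1) × ℝ => zz q.1.2 := continuous_zz.comp (by fun_prop)
      have c3 : Continuous fun q : (X × T1) × ℝ => q.1.1 := by fun_prop
      exact (((ha.comp c3).add ((c1.mul c2).smul (hb.comp c3))).matrix_mul (continuous_const.sub (cE.comp c3))).add
        (((c1.smul (ha.comp c3)).add (c2.smul (hb.comp c3))).matrix_mul (cE.comp c3))
    · intro p s h0 h1; exact Lp_unit (h _) (zz_norm _) h0 h1
    · intro p
      simp only [Lp_zero (h _), cr, ContinuousMap.coe_mk]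
      congr 1
      rw [Matrix.mul_smul, Matrix.mul_one, add_comm]
    · intro p; simp [Lp_one]
  · exact hg.comp (f := fun p : X × T1 => p.1) continuous_fst
  · exact hc.glc

theorem sf_poly (N : ℕ) {a : X → ℕ → Mat ι} (h : PG N a) :
    ∃ (κ : Type) (_ : Fintype κ) (_ : DecidableEq κ) (E : X → Mat κ) (c : K1 X), Continuous E ∧ (∀ x, E x * E x = E x) ∧
      cls (fun p : X × T1 => pv N (a p.1) (zz p.2)) = zc E + K1.map ⟨Prod.fst, continuous_fst⟩ c := by
  induction N generalizing ι with
  | zero =>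
    obtain ⟨E, c, hE, hi, e⟩ := sf_pencil (h.1 0) (h.1 1) h.PU
    refine ⟨ι, inferInstance, inferInstance, E, c, hE, hi, ?_⟩
    rw [← e]; congr 1; ext1 p; simp [pv, Finset.sum_range_succ]
  | succ N ih =>
    obtain ⟨κ, i1, i2, E, c, hE, hi, e⟩ := ih h.Hig
    refine ⟨κ, i1, i2, E, c, hE, hi, ?_⟩
    rw [← e, ← cls_ds_one (κ := ι) h.glc]
    have c0 : Continuous fun p : X × T1 => pv (N+1) (a p.1) (zz p.2) := h.glc.1
    have c1 : Continuous fun p : X × T1 => pq N (a p.1) (zz p.2) := continuous_finset_sum _ fun k _ =>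
      ((continuous_zz.comp continuous_snd).pow k).smul ((h.1 (k+1)).comp continuous_fst)
    have cs : Continuous fun q : (X × T1) × ℝ => (q.2:ℂ) := by fun_prop
    have cz : Continuous fun q : (X × T1) × ℝ => zz q.1.2 := continuous_zz.comp (by fun_prop)
    refine cls_htpy ⟨fun q => hd (pv (N+1) (a q.1.1) (zz q.1.2)) (pq N (a q.1.1) (zz q.1.2)) (zz q.1.2) q.2,
      ⟨?_, fun q => hd_unit (h.2 _ _ (zz_norm _)) _ _ _⟩, fun p => ?_, fun p => ?_⟩
    · exact ((c0.comp continuous_fst).sub (((cs.pow 2).mul cz).smul (c1.comp continuous_fst))).matrix_fromBlocks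
        (cs.smul (c1.comp continuous_fst)) (((cs.mul cz).smul continuous_const).neg) continuous_const
    · simp [hd_zero]
    · simp [hd_one]

theorem cls_zpow (n : ℕ) : cls (fun p : X × T1 => zz p.2 ^ (-(n:ℤ)) • (1 : Mat ι)) = - (n • zc fun _ : X => (1 : Mat ι)) := by
  rw [zc, kc_one_right]
  induction n with
  | zero => simp [cls_one]
  | succ n ih =>
    have hi : GLc fun p : X × T1 => (zz p.2 • (1 : Mat ι))⁻¹ := GLc_zz.inv
    have hn : GLc fun p : X × T1 => zz p.2 ^ (-(n:ℤ)) • (1 : Mat ι) := by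
      refine ⟨((continuous_zz.comp continuous_snd).zpow₀ _ fun p => Or.inl (zz_ne _)).smul continuous_const, fun p => ?_⟩
      exact isUnit_mk (B := zz p.2 ^ (n:ℤ) • 1) (by simp [smul_smul, zz_ne])
    rw [succ_nsmul, neg_add, ← ih, ← cls_inv GLc_zz, ← cls_mul hn hi]
    congr 1; ext1 p
    have : (zz p.2 • (1 : Mat ι))⁻¹ = (zz p.2)⁻¹ • 1 := Matrix.inv_eq_right_inv (by simp [smul_smul, zz_ne])
    rw [this, Matrix.mul_smul, Matrix.mul_one, smul_smul]
    congr 1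
    push_cast; rw [neg_add, zpow_add₀ (zz_ne _), zpow_neg_one, mul_comm]

theorem sf [CompactSpace X] (C : K1 (X × T1)) :
    ∃ (κ : Type) (_ : Fintype κ) (_ : DecidableEq κ) (E : X → Mat κ) (c : K1 X) (n m : ℕ), Continuous E ∧
      (∀ x, E x * E x = E x) ∧
      C = zc E + K1.map ⟨Prod.fst, continuous_fst⟩ c - n • zc (fun _ : X => (1 : Mat (Fin m))) := by
  obtain ⟨m, u, hu, rfl⟩ := exists_cls C
  obtain ⟨n, N, a, ha⟩ := exists_apx hu
  have hP := ha.unit hu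
  obtain ⟨κ, i1, i2, E, c, hE, hi, e⟩ := sf_poly N hP
  refine ⟨κ, i1, i2, E, c, n, m, hE, hi, ?_⟩
  have hn : GLc fun p : X × T1 => zz p.2 ^ (-(n:ℤ)) • (1 : Mat (Fin m)) := by
    refine ⟨((continuous_zz.comp continuous_snd).zpow₀ _ fun p => Or.inl (zz_ne _)).smul continuous_const, fun p => ?_⟩
    exact isUnit_mk (B := zz p.2 ^ (n:ℤ) • 1) (by simp [smul_smul, zz_ne])
  rw [sub_eq_add_neg, ← e, ← cls_zpow, ← cls_mul hP.glc hn]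
  refine cls_htpy (Htpy.mk (fun q => ((1 - q.2 : ℝ):ℂ) • u q.1 + (q.2:ℂ) • (pv N (a q.1.1) (zz q.1.2) * zz q.1.2 ^ (-(n:ℤ)) • 1)) ?_ ?_ ?_ ?_)
  · have c1 : Continuous fun q : (X × T1) × ℝ => ((1 - q.2 : ℝ):ℂ) := by fun_prop
    have c2 : Continuous fun q : (X × T1) × ℝ => (q.2:ℂ) := by fun_prop
    exact (c1.smul (hu.1.comp continuous_fst)).add (c2.smul ((hP.glc.mul hn).1.comp continuous_fst))
  · intro p s h0 h1
    have := row_unit (row_convex (A := 1) (B := (u p)⁻¹ * (zz p.2 ^ (-(n:ℤ)) • pv N (a p.1) (zz p.2)))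
      (fun i => by simp) (ha.close p.1 p.2) h0 h1)
    have := (hu.2 p).mul this
    rw [Matrix.mul_add, Matrix.mul_smul, Matrix.mul_one, Matrix.mul_smul, ← Matrix.mul_assoc, mul_inv' (hu.2 p),
      Matrix.one_mul] at this
    simpa using this
  · intro p; simp
  · intro p; simp
end hat
end PK

namespace PK
open Topology
section cl
variable {X Y : Type} [TopologicalSpace X] [TopologicalSpace Y]
variable {ι κ : Type} [Fintype ι] [DecidableEq ι] [Fintype κ] [DecidableEq κ]

noncomputable def cI (t : ℝ) : ℝ := max 0 (min t 1)
theorem continuous_cI : Continuous cI := by unfold cI; fun_prop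
theorem cI_nonneg (t : ℝ) : 0 ≤ cI t := le_max_left _ _
theorem cI_le (t : ℝ) : cI t ≤ 1 := max_le zero_le_one (min_le_right _ _)
theorem cI_of {t : ℝ} (h0 : 0 ≤ t) (h1 : t ≤ 1) : cI t = t := by rw [cI, min_eq_left h1, max_eq_right h0]
theorem cI_zero : cI 0 = 0 := cI_of le_rfl zero_le_one
theorem cI_one : cI 1 = 1 := cI_of zero_le_one le_rfl
theorem cI_cI (t : ℝ) : cI (cI t) = cI t := cI_of (cI_nonneg t) (cI_le t)

def Wm (P Q : Mat ι) : Mat ι := P * Q + (1 - P) * (1 - Q)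

theorem Wm_self {P : Mat ι} (h : P * P = P) : Wm P P = 1 := by
  rw [Wm, mul_sub, sub_mul, sub_mul, h]; simp
theorem Wm_mul {P Q : Mat ι} (hP : P * P = P) (hQ : Q * Q = Q) : Wm P Q * Q = P * Wm P Q := by
  have h1 : (1 - Q) * Q = 0 := by rw [sub_mul, hQ]; simp
  have h2 : P * (1 - P) = 0 := by rw [mul_sub, hP]; simp
  rw [Wm, add_mul, mul_add, mul_assoc, hQ, mul_assoc, h1, ← mul_assoc, hP, ← mul_assoc, h2]; simp

theorem isOpen_unit : IsOpen {A : Mat ι | IsUnit A} := by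
  have : {A : Mat ι | IsUnit A} = {A : Mat ι | A.det ≠ 0} := by
    ext A; simp only [Set.mem_setOf_eq]; rw [Matrix.isUnit_iff_isUnit_det, isUnit_iff_ne_zero]
  rw [this]
  exact isOpen_ne_fun (continuous_id.matrix_det) continuous_const

theorem isOpen_forall_compact [CompactSpace X] {s : Set (X × Y)} (hs : IsOpen s) : IsOpen {y : Y | ∀ x, (x, y) ∈ s} := by
  have := isClosedMap_snd_of_compactSpace (X := X) (Y := Y) _ hs.isClosed_compl
  have e : {y : Y | ∀ x, (x, y) ∈ s} = (Prod.snd '' sᶜ)ᶜ := by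
    ext y; simp
  rw [e]; exact this.isOpen_compl

theorem exists_lift_path [CompactSpace X] {P : X × ℝ → Mat ι} (hP : Continuous P) (hi : ∀ q, P q * P q = P q) :
    ∃ k : X × ℝ → Mat ι, GLc k ∧ (∀ x, k (x, 0) = 1) ∧ ∀ x t, k (x, t) * P (x, 0) = P (x, cI t) * k (x, t) := by
  have hW : Continuous fun q : X × (ℝ × ℝ) => Wm (P (q.1, q.2.1)) (P (q.1, q.2.2)) := by
    unfold Wm; fun_prop
  have ho := isOpen_forall_compact (isOpen_unit.preimage hW)
  set O := {y : ℝ × ℝ | ∀ x : X, (x, y) ∈ (fun q : X × (ℝ × ℝ) => Wm (P (q.1, q.2.1)) (P (q.1, q.2.2))) ⁻¹' {A : Mat ι | IsUnit A}} with hO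
  have hcomp : IsCompact ((fun t : ℝ => (t, t)) '' Set.Icc 0 1) := isCompact_Icc.image (by fun_prop)
  obtain ⟨δ, hδ, hsub⟩ := hcomp.exists_thickening_subset_open ho (by
    rintro _ ⟨t, ht, rfl⟩ x
    simp [Wm_self (hi _)])
  have hd : 0 < δ / 2 := by linarith
  have key : ∀ j : ℕ, ∃ k : X × ℝ → Mat ι, GLc k ∧ (∀ x, k (x, 0) = 1) ∧
      ∀ x t, k (x, t) * P (x, 0) = P (x, min (cI t) (j * (δ/2))) * k (x, t) := by
    intro j
    induction j with
    | zero => exact ⟨fun _ => 1, GLc.one, fun _ => rfl, fun x t => by simp [min_eq_right (cI_nonneg t)]⟩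
    | succ j ih =>
      obtain ⟨k, hk, h0, h1⟩ := ih
      refine ⟨fun q => Wm (P (q.1, min (cI q.2) ((j+1 : ℕ) * (δ/2)))) (P (q.1, min (cI q.2) (j * (δ/2)))) * k q,
        ?_, fun x => ?_, fun x t => ?_⟩
      · refine GLc.mul ⟨?_, fun q => ?_⟩ hk
        · have := continuous_cI
          unfold Wm; fun_prop
        · have : (min (cI q.2) ((j+1 : ℕ) * (δ/2)), min (cI q.2) (j * (δ/2))) ∈ O := by
            apply hsub
            rw [Metric.mem_thickening_iff]
            refine ⟨_, ⟨min (cI q.2) (j * (δ/2)), ⟨le_min (cI_nonneg _) (by positivity), (min_le_left _ _).trans (cI_le _)⟩, rfl⟩, ?_⟩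
            rw [Prod.dist_eq, dist_self, max_eq_left dist_nonneg, Real.dist_eq, abs_lt]
            push_cast
            have := min_le_left (cI q.2) ((j+1) * (δ/2))
            have := min_le_right (cI q.2) ((j+1) * (δ/2))
            have h3 : min (cI q.2) (j * (δ/2)) ≤ min (cI q.2) ((j+1) * (δ/2)) := min_le_min_left _ (by nlinarith)
            rcases min_choice (cI q.2) (j * (δ/2)) with h | h <;> rw [h] at h3 ⊢ <;> constructor <;> nlinarith
          exact this q.1
      · simp only [cI_zero]
        rw [min_eq_left (by positivity), min_eq_left (by positivity), Wm_self (hi _), h0, mul_one]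
      · simp only
        rw [mul_assoc, h1, ← mul_assoc, Wm_mul (hi _) (hi _), mul_assoc]
  obtain ⟨j, hj⟩ := exists_nat_ge (1 / (δ / 2))
  obtain ⟨k, hk, h0, h1⟩ := key j
  refine ⟨k, hk, h0, fun x t => ?_⟩
  rw [h1, min_eq_left]
  rw [div_le_iff₀ hd] at hj
  exact (cI_le t).trans hj

structure Lift (E : X × T1 → Mat ι) (k : X × ℝ → Mat ι) : Prop where
  glc : GLc k
  zero : ∀ x, k (x, 0) = 1
  int : ∀ x t, k (x, t) * E (x, 0) = E (x, ((cI t : ℝ) : T1)) * k (x, t)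

theorem exists_lift [CompactSpace X] {E : X × T1 → Mat ι} (hE : Continuous E) (hi : ∀ q, E q * E q = E q) :
    ∃ k, Lift E k := by
  obtain ⟨k, h1, h2, h3⟩ := exists_lift_path (P := fun q : X × ℝ => E (q.1, (q.2 : T1)))
    (hE.comp (continuous_fst.prodMk ((AddCircle.continuous_mk' _).comp continuous_snd))) (fun q => hi _)
  exact ⟨k, h1, h2, fun x t => h3 x t⟩

theorem T1_one : ((1 : ℝ) : T1) = 0 := AddCircle.coe_period 1

theorem Lift.cor {E : X × T1 → Mat ι} {k : X × ℝ → Mat ι} (hk : Lift E k) (hE : Continuous E)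
    (hi : ∀ q, E q * E q = E q) : Cor (fun x => k (x, 1)) (fun x => E (x, 0)) where
  hU := hk.glc.comp (by fun_prop)
  hE := hE.comp (by fun_prop)
  idem x := hi _
  comm x := by rw [hk.int x 1, cI_one, T1_one]

theorem Lift.indep {E : X × T1 → Mat ι} {k k' : X × ℝ → Mat ι} (hk : Lift E k) (hk' : Lift E k') (hE : Continuous E)
    (hi : ∀ q, E q * E q = E q) :
    kc (fun x => k (x, 1)) (fun x => E (x, 0)) = kc (fun x => k' (x, 1)) (fun x => E (x, 0)) := by
  have hc : Cor (fun q : X × ℝ => (k q)⁻¹ * k' q) (fun q => E (q.1, 0)) := by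
    refine ⟨hk.glc.inv.mul hk'.glc, hE.comp (by fun_prop), fun x => hi _, fun q => ?_⟩
    have h1 := hk.int q.1 q.2
    have h2 := hk'.int q.1 q.2
    have h3 := inv_mul' (hk.glc.2 q)
    have h4 := mul_inv' (hk.glc.2 q)
    have : E (q.1, 0) * (k q)⁻¹ = (k q)⁻¹ * E (q.1, ((cI q.2 : ℝ) : T1)) := by
      calc _ = (k q)⁻¹ * (k q * E (q.1, 0)) * (k q)⁻¹ := by rw [← mul_assoc, h3, one_mul]
        _ = _ := by rw [show k q * E (q.1, 0) = _ from h1, mul_assoc, mul_assoc, h4, mul_one]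
    rw [← mul_assoc, this, mul_assoc, mul_assoc]
    congr 1
    exact h2.symm
  have := kc_htpy hc
  simp only [hk.zero, hk'.zero] at this
  rw [show ((1 : Mat ι)⁻¹ * 1) = 1 by simp, kc_one_left] at this
  have h5 := kc_mul (hk.cor hE hi) (hc.comp (f := fun x => (x, (1:ℝ))) (by fun_prop))
  rw [← this, add_zero] at h5
  rw [← h5]
  refine kc_congr fun x => ?_
  rw [← mul_assoc (k (x, 1)), mul_inv' (hk.glc.2 _), one_mul]

open Classical in
noncomputable def clF (E : X × T1 → Mat ι) : K1 X :=
  if h : ∃ k, Lift E k then kc (fun x => h.choose (x, 1)) (fun x => E (x, 0)) else 0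

theorem clF_eq {E : X × T1 → Mat ι} {k : X × ℝ → Mat ι} (hk : Lift E k) (hE : Continuous E)
    (hi : ∀ q, E q * E q = E q) : clF E = kc (fun x => k (x, 1)) (fun x => E (x, 0)) := by
  have h : ∃ k, Lift E k := ⟨k, hk⟩
  rw [clF, dif_pos h]
  exact h.choose_spec.indep hk hE hi

theorem Lift.const {E : X → Mat ι} : Lift (fun q : X × T1 => E q.1) (fun _ => 1) :=
  ⟨GLc.one, fun _ => rfl, fun x t => by simp⟩

theorem clF_const {E : X → Mat ι} (hE : Continuous E) (hi : ∀ q, E q * E q = E q) :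
    clF (fun q : X × T1 => E q.1) = 0 := by
  rw [clF_eq Lift.const (hE.comp continuous_fst) (fun q => hi _), kc_one_left]

theorem Lift.comp {E : Y × T1 → Mat ι} {k : Y × ℝ → Mat ι} (hk : Lift E k) {f : X → Y} (hf : Continuous f) :
    Lift (fun q : X × T1 => E (f q.1, q.2)) (fun q => k (f q.1, q.2)) :=
  ⟨hk.glc.comp (by fun_prop), fun x => hk.zero _, fun x t => hk.int _ _⟩

theorem Lift.ds {E : X × T1 → Mat ι} {k : X × ℝ → Mat ι} {E' : X × T1 → Mat κ} {k' : X × ℝ → Mat κ}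
    (hk : Lift E k) (hk' : Lift E' k') : Lift (fun q => ds (E q) (E' q)) (fun q => ds (k q) (k' q)) :=
  ⟨hk.glc.ds hk'.glc, fun x => by rw [hk.zero, hk'.zero, ds_one], fun x t => by rw [ds_mul, ds_mul, hk.int, hk'.int]⟩

theorem Lift.ri {E : X × T1 → Mat ι} {k : X × ℝ → Mat ι} (e : ι ≃ κ)
    (hk : Lift E k) : Lift (fun q => ri e (E q)) (fun q => ri e (k q)) :=
  ⟨hk.glc.ri e, fun x => by rw [hk.zero, ri_one], fun x t => by rw [← ri_mul, ← ri_mul, hk.int]⟩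

theorem cr_ds (U E : Mat ι) (U' E' : Mat κ) : cr (ds U U') (ds E E') = ds (cr U E) (cr U' E') := by
  simp only [cr, ds_mul, ← ds_one, sub_eq_add_neg]
  rw [show -(ds E E') = ds (-E) (-E') by simp only [ds, Matrix.fromBlocks_neg, neg_zero], ds_add, ds_add]

theorem kc_ds {U E : X → Mat ι} {U' E' : X → Mat κ} (h : Cor U E) (h' : Cor U' E') :
    kc (fun x => ds (U x) (U' x)) (fun x => ds (E x) (E' x)) = kc U E + kc U' E' := by
  rw [kc, kc, kc, ← cls_ds h.glc h'.glc]
  congr 1; funext x; exact cr_ds _ _ _ _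

noncomputable def cl (X : Type) [TopologicalSpace X] [CompactSpace X] : IdemInv (X × T1) (K1 X) where
  F ι _ _ E := clF E
  htpy ι _ _ H hc hi := by
    have hc' : Continuous fun q : (X × Set.Icc (0:ℝ) 1) × T1 => H ((q.1.1, q.2), (q.1.2 : ℝ)) := by fun_prop
    obtain ⟨k, hk⟩ := exists_lift hc' (fun q => hi _)
    have hcor := hk.cor hc' (fun q => hi _)
    have hp : Continuous fun q : X × ℝ => ((q.1, Set.projIcc (0:ℝ) 1 zero_le_one q.2) : X × Set.Icc (0:ℝ) 1) :=
      continuous_fst.prodMk (continuous_projIcc.comp continuous_snd)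
    have := kc_htpy (hcor.comp hp)
    simp only [Set.projIcc_left, Set.projIcc_right] at this
    rw [clF_eq (hk.comp (f := fun x : X => ((x, ⟨0, by simp⟩) : X × Set.Icc (0:ℝ) 1)) (by fun_prop)) (hc.comp (by fun_prop)) (fun q => hi _),
      clF_eq (hk.comp (f := fun x : X => ((x, ⟨1, by simp⟩) : X × Set.Icc (0:ℝ) 1)) (by fun_prop)) (hc.comp (by fun_prop)) (fun q => hi _)]
    exact this
  ri ι κ _ _ _ _ e u hc hi := by
    obtain ⟨k, hk⟩ := exists_lift hc hi
    rw [clF_eq hk hc hi, clF_eq (hk.ri e) (hc.matrix_submatrix _ _) (fun q => by rw [← ri_mul, hi]), kc_ri (hk.cor hc hi) e]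
  ds ι κ _ _ _ _ u v cu iu cv iv := by
    obtain ⟨k, hk⟩ := exists_lift cu iu
    obtain ⟨k', hk'⟩ := exists_lift cv iv
    rw [clF_eq hk cu iu, clF_eq hk' cv iv, clF_eq (hk.ds hk') (continuous_ds cu cv) (fun q => by rw [ds_mul, iu, iv]),
      kc_ds (hk.cor cu iu) (hk'.cor cv iv)]
  zero ι _ _ := clF_const (E := fun _ => 0) continuous_const (by simp)

theorem clF_map [CompactSpace Y] (f : C(X, Y)) {E : Y × T1 → Mat ι} (hE : Continuous E) (hi : ∀ q, E q * E q = E q) :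
    K1.map f (clF E) = clF fun q : X × T1 => E (f q.1, q.2) := by
  obtain ⟨k, hk⟩ := exists_lift hE hi
  rw [clF_eq hk hE hi, clF_eq (hk.comp f.continuous) (hE.comp (by fun_prop)) (fun q => hi _), kc_map f (hk.cor hE hi)]

/-- the double suspension homomorphism -/
noncomputable def sus (X : Type) [TopologicalSpace X] [CompactSpace X] : K1 ((X × T1) × T1) →+ K1 X := hat (cl X)

theorem sus_zc [CompactSpace X] {E : X × T1 → Mat ι} (hE : Continuous E) (hi : ∀ q, E q * E q = E q) :
    sus X (zc E) = clF E := hat_zc _ hE hi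

theorem sus_pr [CompactSpace X] (c : K1 (X × T1)) : sus X (K1.map ⟨Prod.fst, continuous_fst⟩ c) = 0 := hat_pr _ c

theorem sus_one [CompactSpace X] : sus X (zc (fun _ : X × T1 => (1 : Mat ι))) = 0 := by
  rw [sus_zc continuous_const (by simp)]
  exact clF_const (E := fun _ => 1) continuous_const (by simp)

def m2 (f : C(X, Y)) : C((X × T1) × T1, (Y × T1) × T1) :=
  ⟨fun q => ((f q.1.1, q.1.2), q.2), by fun_prop⟩

theorem zc_map (f : C(X, Y)) {E : Y → Mat ι} (hE : Continuous E) (hi : ∀ q, E q * E q = E q) (F : C(X × T1, Y × T1))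
    (hF : ∀ q, F q = (f q.1, q.2)) : K1.map F (zc E) = zc fun x => E (f x) := by
  rw [zc, zc, kc_map F (Cor_zc hE hi)]
  simp only [hF]

theorem sus_map [CompactSpace X] [CompactSpace Y] (f : C(X, Y)) (c : K1 ((Y × T1) × T1)) :
    K1.map f (sus Y c) = sus X (K1.map (m2 f) c) := by
  obtain ⟨κ, _, _, E, c', n, m, hE, hi, rfl⟩ := sf c
  let g : C(X × T1, Y × T1) := ⟨fun q => (f q.1, q.2), by fun_prop⟩
  have e1 := zc_map g hE hi (m2 f) (fun q => rfl)
  have e2 := zc_map g (E := fun _ => (1 : Mat (Fin m))) continuous_const (by simp) (m2 f) (fun q => rfl)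
  have e3 : K1.map (m2 f) (K1.map ⟨Prod.fst, continuous_fst⟩ c') =
      K1.map (⟨Prod.fst, continuous_fst⟩ : C((X × T1) × T1, X × T1)) (K1.map g c') := by
    rw [K1.map_comp, K1.map_comp]; exact K1.map_congr (fun x => rfl) _
  simp only [map_add, map_sub, map_nsmul, e1, e2, e3, sus_pr, sus_one, sus_zc hE hi]
  rw [sus_zc (E := fun x => E (g x)) (hE.comp g.continuous) (fun q => hi _), clF_map f hE hi]
  simp [g]

section psi
variable {p : ℕ} [Fact p.Prime]

theorem Lift.tens {E : X × T1 → Mat ι} {k : X × ℝ → Mat ι} (hk : Lift E k) (j : ZMod p) :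
    Lift (fun q => ec p ι j * PK.tens (ZMod p) (E q)) (fun q => PK.tens (ZMod p) (k q)) where
  glc := hk.glc.tens
  zero x := by rw [hk.zero]; exact tensF_one
  int x t := by rw [← mul_assoc, ← ec_tens, mul_assoc, tens_mul, mul_assoc, tens_mul, hk.int]

theorem sus_Psi_zc [CompactSpace X] {E : X × T1 → Mat ι} (hE : Continuous E) (hi : ∀ q, E q * E q = E q) :
    sus X (Psi p (zc E)) = p • Psi p (sus X (zc E)) := by
  obtain ⟨k, hk⟩ := exists_lift hE hi
  have hcor := Cor_zc hE hi
  have hE' : ∀ j : ZMod p, Continuous fun q => ec p ι j * PK.tens (ZMod p) (E q) := fun j =>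
    continuous_const.mul (continuous_tensF fun _ => hE)
  have hi' : ∀ j : ZMod p, ∀ q, (ec p ι j * PK.tens (ZMod p) (E q)) * (ec p ι j * PK.tens (ZMod p) (E q)) = ec p ι j * PK.tens (ZMod p) (E q) :=
    fun j q => (hcor.ectens j).idem (q, 0)
  have key : ∀ j : ZMod p, kc (fun q : (X × T1) × T1 => PK.tens (ZMod p) (zz q.2 • (1 : Mat ι))) (fun q => ec p ι j * PK.tens (ZMod p) (E q.1))
      = p • zc (fun q => ec p ι j * PK.tens (ZMod p) (E q)) := by
    intro j
    have hcz := Cor_zc (hE' j) (hi' j)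
    have : ∀ n : ℕ, Cor (fun q : (X × T1) × T1 => (zz q.2)^n • (1 : Mat (ZMod p → ι))) (fun q => ec p ι j * PK.tens (ZMod p) (E q.1)) ∧
       kc (fun q : (X × T1) × T1 => (zz q.2)^n • (1 : Mat (ZMod p → ι))) (fun q => ec p ι j * PK.tens (ZMod p) (E q.1))
      = n • zc (fun q => ec p ι j * PK.tens (ZMod p) (E q)) := by
      intro n
      induction n with
      | zero =>
        constructor
        · refine ⟨by simpa using GLc.one, hcz.hE, hcz.idem, fun q => by simp⟩
        · simp only [pow_zero, one_smul, zero_smul]; exact kc_one_left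
      | succ n ih =>
        have e : (fun q : (X × T1) × T1 => (zz q.2)^(n+1) • (1 : Mat (ZMod p → ι))) = fun q => ((zz q.2)^n • (1 : Mat (ZMod p → ι))) * (zz q.2 • 1) := by
          funext q; rw [smul_mul_smul_comm, pow_succ, one_mul]
        rw [e]
        refine ⟨ih.1.mul_left hcz, ?_⟩
        rw [kc_mul ih.1 hcz, ih.2, succ_nsmul]; rfl
    rw [← (this p).2]
    congr 1; funext q
    ext f g
    rw [show PK.tens (ZMod p) (zz q.2 • (1 : Mat ι)) f g = ∏ j, (zz q.2 • (1 : Mat ι)) (f j) (g j) from rfl]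
    simp only [Matrix.smul_apply, smul_eq_mul, Finset.prod_mul_distrib, Finset.prod_const, Finset.card_univ, ZMod.card]
    congr 1
    exact congrFun (congrFun (tensF_one (J := ZMod p) (ι := ι)) f) g
  rw [sus_zc hE hi, zc, Psi_kc hcor, psiE, key, key, clF_eq hk hE hi, Psi_kc (hk.cor hE hi), psiE, map_sub, map_nsmul, map_nsmul,
    sus_zc (hE' _) (hi' _), sus_zc (hE' _) (hi' _), clF_eq (hk.tens _) (hE' _) (hi' _), clF_eq (hk.tens _) (hE' _) (hi' _), smul_sub]

theorem sus_Psi [CompactSpace X] (c : K1 ((X × T1) × T1)) : sus X (Psi p c) = p • Psi p (sus X c) := by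
  obtain ⟨κ, _, _, E, c', n, m, hE, hi, rfl⟩ := sf c
  simp only [map_add, map_sub, map_nsmul, ← Psi_map, sus_pr, sus_Psi_zc hE hi, sus_Psi_zc (E := fun _ => (1 : Mat (Fin m))) continuous_const (by simp), sus_one]
  simp
end psi
end cl
end PK

namespace PK
open Topology
section inj
variable {X Y Z : Type} [TopologicalSpace X] [TopologicalSpace Y] [TopologicalSpace Z]
variable {ι κ α β : Type} [Fintype ι] [DecidableEq ι] [Fintype κ] [DecidableEq κ]
  [Fintype α] [DecidableEq α] [Fintype β] [DecidableEq β]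

/-- representative in [0,1) -/
noncomputable def rep (c : T1) : ℝ := (AddCircle.equivIco 1 0 c).1
theorem rep_nonneg (c : T1) : 0 ≤ rep c := (AddCircle.equivIco 1 0 c).2.1
theorem rep_lt (c : T1) : rep c < 1 := by
  have : rep c < 0 + 1 := (AddCircle.equivIco 1 0 c).2.2
  linarith
theorem coe_rep (c : T1) : ((rep c : ℝ) : T1) = c := AddCircle.coe_equivIco
theorem rep_coe {t : ℝ} (h0 : 0 ≤ t) (h1 : t < 1) : rep (t : T1) = t := by
  have : t ∈ Set.Ico (0:ℝ) (0 + 1) := ⟨h0, by simpa using h1⟩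
  rw [rep, AddCircle.equivIco_coe_eq this]
theorem rep_zero : rep 0 = 0 := rep_coe le_rfl one_pos

theorem quot_T1 : IsQuotientMap (fun q : X × Set.Icc (0:ℝ) 1 => (q.1, ((q.2 : ℝ) : T1))) := by
  have hc : Continuous fun t : Set.Icc (0:ℝ) 1 => ((t : ℝ) : T1) := (AddCircle.continuous_mk' _).comp continuous_subtype_val
  have h : IsProperMap (Prod.map (id : X → X) fun t : Set.Icc (0:ℝ) 1 => ((t : ℝ) : T1)) :=
    isProperMap_id.prodMap hc.isProperMap
  refine h.isClosedMap.isQuotientMap h.continuous fun q => ?_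
  exact ⟨(q.1, ⟨rep q.2, rep_nonneg _, (rep_lt _).le⟩), by simp [coe_rep]⟩

theorem continuous_rep {f : X × ℝ → Z} (hf : Continuous f) (h : ∀ x, f (x, 0) = f (x, 1)) :
    Continuous fun q : X × T1 => f (q.1, rep q.2) := by
  rw [quot_T1.continuous_iff]
  have : ((fun q : X × T1 => f (q.1, rep q.2)) ∘ fun q : X × Set.Icc (0:ℝ) 1 => (q.1, ((q.2 : ℝ) : T1))) =
      fun q => f (q.1, (q.2 : ℝ)) := by
    funext ⟨x, t, h0, h1⟩
    simp only [Function.comp]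
    rcases h1.lt_or_eq with h1 | h1
    · rw [rep_coe h0 h1]
    · subst h1; rw [T1_one, rep_zero, h]
  rw [this]; fun_prop

theorem zc_conj {E E' G : X → Mat ι} (hE : Continuous E) (hi : ∀ x, E x * E x = E x) (hG : GLc G)
    (h : ∀ x, G x * E x = E' x * G x) : zc E' = zc E := by
  have hgc : GLc fun p : X × T1 => G p.1 := hG.comp continuous_fst
  have := cls_conj (Cor_zc hE hi).glc hgc.1 hgc.inv.1 (fun x => mul_inv' (hG.2 _))
  rw [zc, zc, kc, kc, ← this]
  congr 1; funext p
  have e : G p.1 * cr (zz p.2 • 1) (E p.1) = cr (zz p.2 • 1) (E' p.1) * G p.1 := by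
    simp only [cr]
    rw [mul_add, add_mul, mul_sub, sub_mul, ← mul_assoc, h]; simp [h]
  rw [e, mul_assoc, mul_inv' (hG.2 _), mul_one]

theorem zc_ds {E : X → Mat ι} {E' : X → Mat κ} (hE : Continuous E) (hi : ∀ x, E x * E x = E x)
    (hE' : Continuous E') (hi' : ∀ x, E' x * E' x = E' x) : zc (fun x => ds (E x) (E' x)) = zc E + zc E' := by
  have := kc_ds (Cor_zc hE hi) (Cor_zc hE' hi')
  rw [zc, zc, zc, ← this]
  congr 1; funext p
  rw [← ds_smul, ds_one]

theorem zc_ri {E : X → Mat ι} (hE : Continuous E) (hi : ∀ x, E x * E x = E x) (e : ι ≃ κ) :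
    zc (fun x => ri e (E x)) = zc E := by
  rw [zc, zc, ← kc_ri (Cor_zc hE hi) e]
  congr 1; funext p
  rw [← ri_smul, ri_one]

theorem zc_zero : zc (fun _ : X => (0 : Mat ι)) = 0 := kc_zero

theorem zc_add_compl {E : X → Mat ι} (hE : Continuous E) (hi : ∀ x, E x * E x = E x) :
    zc E + zc (fun x => 1 - E x) = zc (fun _ : X => (1 : Mat ι)) := by
  have h := Cor_zc hE hi
  have := kc_add h h.compl (fun x => by simp [mul_sub, hi]) (fun x => by simp [sub_mul, hi])
  rw [zc, zc, zc, ← this]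
  congr 1; funext p; simp

/-- if the monodromy is null-homotopic in the commutant then E is conjugate to E₀ -/
theorem zc_loop {E : X × T1 → Mat ι} (hE : Continuous E) (hi : ∀ x, E x * E x = E x) {k L : X × ℝ → Mat ι} (hk : Lift E k)
    (hL : GLc L) (hc : ∀ x t, L (x, t) * E (x, 0) = E (x, 0) * L (x, t)) (h0 : ∀ x, L (x, 0) = 1)
    (h1 : ∀ x, L (x, 1) = k (x, 1)) : zc E = zc fun q : X × T1 => E (q.1, 0) := by
  have hg : GLc fun q : X × ℝ => k q * (L q)⁻¹ := hk.glc.mul hL.inv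
  have hG : GLc fun q : X × T1 => k (q.1, rep q.2) * (L (q.1, rep q.2))⁻¹ :=
    ⟨continuous_rep (f := fun q => k q * (L q)⁻¹) hg.1
      (fun x => by rw [hk.zero, h0, h1, mul_inv' (hk.glc.2 _)]; simp), fun q => hg.2 _⟩
  refine zc_conj (hE.comp (by fun_prop)) (fun q => hi _) hG fun q => ?_
  have hInt := hk.int q.1 (rep q.2)
  rw [cI_of (rep_nonneg _) (rep_lt _).le, coe_rep] at hInt
  have hLi : (L (q.1, rep q.2))⁻¹ * E (q.1, 0) = E (q.1, 0) * (L (q.1, rep q.2))⁻¹ := by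
    have a := mul_inv' (hL.2 (q.1, rep q.2))
    have b := inv_mul' (hL.2 (q.1, rep q.2))
    calc _ = (L (q.1, rep q.2))⁻¹ * (E (q.1, 0) * L (q.1, rep q.2)) * (L (q.1, rep q.2))⁻¹ := by
          rw [mul_assoc, mul_assoc, a, mul_one]
      _ = _ := by rw [← hc, ← mul_assoc, b, one_mul]
  rw [mul_assoc, hLi, ← mul_assoc, hInt, mul_assoc]

theorem ri_ssc (A : Mat ι) (B : Mat κ) (C : Mat α) (D : Mat β) :
    ri (Equiv.sumSumSumComm ι κ α β) (ds (ds A B) (ds C D)) = ds (ds A C) (ds B D) := by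
  ext i j; rcases i with (i | i) | (i | i) <;> rcases j with (j | j) | (j | j) <;> rfl

theorem unit_ds_left {A : Mat ι} {B : Mat κ} (h : IsUnit (ds A B)) : IsUnit A ∧ IsUnit B := by
  rw [Matrix.isUnit_iff_isUnit_det, ds, Matrix.det_fromBlocks_zero₂₁] at h
  rw [Matrix.isUnit_iff_isUnit_det, Matrix.isUnit_iff_isUnit_det]
  exact ⟨isUnit_of_mul_isUnit_left h, isUnit_of_mul_isUnit_right h⟩

theorem comm_ds {A : Mat (ι ⊕ κ)} (h : A * ds (1 : Mat ι) (0 : Mat κ) = ds 1 0 * A) :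
    A = ds A.toBlocks₁₁ A.toBlocks₂₂ := by
  conv_lhs => rw [← Matrix.fromBlocks_toBlocks A]
  rw [← Matrix.fromBlocks_toBlocks A, ds, Matrix.fromBlocks_multiply, Matrix.fromBlocks_multiply, Matrix.fromBlocks_inj] at h
  simp at h
  rw [ds, h.1, h.2]

theorem inj0 [CompactSpace X] {E : X × T1 → Mat (ι ⊕ κ)} (hE : Continuous E) (hi : ∀ x, E x * E x = E x)
    (hz : ∀ x, E (x, 0) = ds 1 0) (hcl : clF E = 0) : zc E = zc fun _ : X × T1 => (1 : Mat ι) := by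
  obtain ⟨k, hk⟩ := exists_lift hE hi
  have hcor := hk.cor hE hi
  set v1 : X → Mat ι := fun x => (k (x, 1)).toBlocks₁₁ with hv1
  set v2 : X → Mat κ := fun x => (k (x, 1)).toBlocks₂₂ with hv2
  have hk1 : ∀ x, k (x, 1) = ds (v1 x) (v2 x) := fun x => comm_ds (by
    have := hcor.comm x
    rw [hz] at this; exact this.symm)
  have hu1 : ∀ x, IsUnit (ds (v1 x) (v2 x)) := fun x => by rw [← hk1]; exact hcor.hU.2 x
  have g1 : GLc v1 := ⟨by
    refine continuous_matrix fun i j => ?_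
    exact hcor.hU.1.matrix_elem (Sum.inl i) (Sum.inl j), fun x => (unit_ds_left (hu1 x)).1⟩
  have g2 : GLc v2 := ⟨by
    refine continuous_matrix fun i j => ?_
    exact hcor.hU.1.matrix_elem (Sum.inr i) (Sum.inr j), fun x => (unit_ds_left (hu1 x)).2⟩
  have c1 : cls v1 = 0 := by
    rw [clF_eq hk hE hi, kc] at hcl
    rw [← hcl, ← cls_ds_one (κ := κ) g1]
    congr 1; funext x
    rw [hk1, hz, cr_ds, cr_one_right, cr_zero]
  have c2 : cls v2 = 0 := by
    have h0 : cls (fun x => k (x, 1)) = 0 := by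
      have : Htpy (fun _ : X => (1 : Mat (ι ⊕ κ))) (fun x => k (x, 1)) := ⟨k, hk.glc, hk.zero, fun x => rfl⟩
      rw [← cls_htpy this, cls_one]
    simp only [hk1] at h0
    rw [cls_ds g1 g2, c1, zero_add] at h0
    exact h0
  obtain ⟨a, L1, hL1, e10, e11⟩ := cls_eq_zero g1 c1
  obtain ⟨b, L2, hL2, e20, e21⟩ := cls_eq_zero g2 c2
  let e := Equiv.sumSumSumComm ι κ (Fin a) (Fin b)
  let C : X × T1 → Mat (Fin a ⊕ Fin b) := fun _ => ds 1 0
  have hCi : ∀ q, C q * C q = C q := fun q => by simp only [C]; rw [ds_mul]; simp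
  have hCc : Continuous C := continuous_const
  have hk' := (hk.ds (Lift.const (E := fun _ : X => (ds 1 0 : Mat (Fin a ⊕ Fin b))))).ri e
  have hEc : Continuous fun q => ds (E q) (C q) := continuous_ds hE hCc
  have hEi : ∀ q, ds (E q) (C q) * ds (E q) (C q) = ds (E q) (C q) := fun q => by rw [ds_mul, hi, hCi q]
  have hEr : Continuous fun q => ri e (ds (E q) (C q)) := hEc.matrix_submatrix _ _
  have hEri : ∀ q, ri e (ds (E q) (C q)) * ri e (ds (E q) (C q)) = ri e (ds (E q) (C q)) := fun q => by rw [← ri_mul, hEi]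
  have hf : Continuous fun q : X × ℝ => ((q.1, 1 - q.2) : X × ℝ) := by fun_prop
  have hE0 : ∀ x, ri e (ds (E (x, 0)) (C (x, 0))) = ds 1 0 := fun x => by
    rw [hz]; simp only [C]; rw [ri_ssc, ds_one]; simp [ds]
  have key := zc_loop hEr hEri hk' (L := fun q => ds (L1 (q.1, 1 - q.2)) (L2 (q.1, 1 - q.2))) ((hL1.comp hf).ds (hL2.comp hf))
    (fun x t => by rw [hE0, ds_mul, ds_mul]; simp) (fun x => by simp [e11, e21, ds_one]) (fun x => by
      simp only [sub_self]
      rw [e10, e20, hk1, ← ds_one, ri_ssc])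
  rw [zc_ri hEc hEi, zc_ds hE hi hCc hCi] at key
  simp only [hE0] at key
  rw [zc_ds (E := fun _ => 1) (E' := fun _ => 0) continuous_const (by simp) continuous_const (by simp), zc_zero] at key
  have h2 := zc_ds (X := X × T1) (E := fun _ => (1 : Mat (ι ⊕ Fin a))) (E' := fun _ => (0 : Mat (κ ⊕ Fin b))) continuous_const (by simp) continuous_const (by simp)
  rw [h2, zc_zero, add_zero, add_zero] at key
  have h3 := zc_ds (X := X × T1) (E := fun _ => (1 : Mat ι)) (E' := fun _ => (1 : Mat (Fin a))) continuous_const (by simp) continuous_const (by simp)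
  simp only [ds_one] at h3
  rw [h3] at key
  exact add_right_cancel key

theorem inj1 [CompactSpace X] {E : X × T1 → Mat ι} (hE : Continuous E) (hi : ∀ x, E x * E x = E x)
    (hcl : clF E = 0) : zc E = zc fun q : X × T1 => E (q.1, 0) := by
  let E0 : X × T1 → Mat ι := fun q => E (q.1, 0)
  have hE0 : Continuous E0 := hE.comp (by fun_prop)
  have hE0i : ∀ q, E0 q * E0 q = E0 q := fun q => hi _
  have hE1 : Continuous fun q => 1 - E0 q := continuous_const.sub hE0
  have hE1i : ∀ q, (1 - E0 q) * (1 - E0 q) = 1 - E0 q := fun q => by simp [mul_sub, sub_mul, hE0i]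
  have hE2 : ∀ q, E0 q * (1 - E0 q) = 0 := fun q => by simp [mul_sub, hE0i]
  have hE3 : ∀ q, (1 - E0 q) * E0 q = 0 := fun q => by simp [sub_mul, hE0i]
  let S : X × T1 → Mat (ι ⊕ ι) := fun q => Matrix.fromBlocks (E0 q) (1 - E0 q) (1 - E0 q) (E0 q)
  have hS2 : ∀ q, S q * S q = 1 := fun q => by
    simp only [S]
    rw [Matrix.fromBlocks_multiply, hE0i, hE1i, hE2, hE3]; simp
  have hS : GLc S := GLc.of_inv (hE0.matrix_fromBlocks hE1 hE1 hE0) hS2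
  let E' : X × T1 → Mat (ι ⊕ ι) := fun q => ds (E q) (1 - E0 q)
  have hE' : Continuous E' := continuous_ds hE hE1
  have hE'i : ∀ q, E' q * E' q = E' q := fun q => by simp only [E']; rw [ds_mul, hi, hE1i]
  have hSi : ∀ A q, (S q * A * S q) * S q = S q * A := fun A q => by rw [mul_assoc _ (S q), hS2, mul_one]
  have hc := zc_conj (E' := fun q => S q * E' q * S q) hE' hE'i hS (fun q => (hSi _ _).symm)
  have hd := zc_ds hE hi hE1 hE1i
  have hcc : Continuous fun q => S q * E' q * S q := (hS.1.mul hE').mul hS.1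
  have hci : ∀ q, (S q * E' q * S q) * (S q * E' q * S q) = S q * E' q * S q := fun q => by
    rw [mul_assoc (S q * E' q), ← mul_assoc (S q) (S q * E' q), ← mul_assoc (S q) (S q), hS2, one_mul, ← mul_assoc, mul_assoc (S q) (E' q), hE'i]
  have hz : ∀ x, S (x, 0) * E' (x, 0) * S (x, 0) = ds 1 0 := fun x => by
    have e : E (x, 0) = E0 (x, 0) := rfl
    simp only [S, E', ds]
    rw [e, Matrix.fromBlocks_multiply, Matrix.fromBlocks_multiply]
    simp only [mul_zero, zero_mul, add_zero, zero_add, hE0i, hE1i, hE2, hE3]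
    simp
  have hcl2 : clF (fun q => S q * E' q * S q) = 0 := by
    rw [← sus_zc hcc hci, hc, hd, map_add, sus_zc hE hi, hcl, zero_add, sus_zc hE1 hE1i]
    exact clF_const (E := fun x => 1 - E (x, 0)) (continuous_const.sub (hE.comp (by fun_prop))) (fun x => hE1i (x, 0))
  have := inj0 hcc hci hz hcl2
  rw [hc, hd, ← zc_add_compl hE0 hE0i] at this
  exact add_right_cancel this

theorem inj_sus [CompactSpace X] (c : K1 ((X × T1) × T1))
    (hz : K1.map (⟨fun q => (q, 0), by fun_prop⟩ : C(X × T1, (X × T1) × T1)) c = 0)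
    (ht : K1.map (⟨fun q => ((q.1, 0), q.2), by fun_prop⟩ : C(X × T1, (X × T1) × T1)) c = 0)
    (hs : sus X c = 0) : c = 0 := by
  obtain ⟨κ, _, _, E, c', n, m, hE, hi, rfl⟩ := sf c
  have r1 : ∀ {ι : Type} [Fintype ι] [DecidableEq ι] {E : X × T1 → Mat ι} (hE : Continuous E) (hi : ∀ x, E x * E x = E x),
      K1.map (⟨fun q => (q, 0), by fun_prop⟩ : C(X × T1, (X × T1) × T1)) (zc E) = 0 := by
    intro ι _ _ E hE hi
    rw [zc, kc_map _ (Cor_zc hE hi)]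
    simp only [ContinuousMap.coe_mk, zz_zero, one_smul]
    exact kc_one_left
  have hc' : c' = 0 := by
    rw [map_sub, map_add, map_nsmul, r1 hE hi, r1 continuous_const (by simp), K1.map_comp] at hz
    simp only [smul_zero, sub_zero, zero_add] at hz
    rw [← hz]
    obtain ⟨N, u, hu, rfl⟩ := exists_cls c'
    rw [K1.map_cls _ hu]; rfl
  subst hc'
  simp only [map_zero, add_zero] at hs ht ⊢
  have e1 : sus X (zc E) = 0 := by
    rw [map_sub, map_nsmul, sus_one] at hs; simpa using hs
  rw [sus_zc hE hi] at e1
  rw [inj1 hE hi e1]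
  let g : C((X × T1) × T1, X × T1) := ⟨fun q => (q.1.1, q.2), by fun_prop⟩
  let f0 : C(X, X × T1) := ⟨fun x => (x, 0), by fun_prop⟩
  rw [map_sub, map_nsmul, zc_map f0 hE hi _ (fun q => rfl),
    zc_map f0 (E := fun _ => (1 : Mat (Fin m))) continuous_const (by simp) _ (fun q => rfl)] at ht
  have := congrArg (K1.map g) ht
  rw [map_sub, map_nsmul, map_zero, zc_map ⟨Prod.fst, continuous_fst⟩ (E := fun x => E (f0 x)) (hE.comp f0.continuous) (fun q => hi _) g (fun q => rfl),
    zc_map ⟨Prod.fst, continuous_fst⟩ (E := fun _ => (1 : Mat (Fin m))) continuous_const (by simp) g (fun q => rfl)] at this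
  exact this
end inj
end PK

namespace PK
open Topology
section deg
variable {X Y Z : Type} [TopologicalSpace X] [TopologicalSpace Y] [TopologicalSpace Z]
variable {ι κ α β : Type} [Fintype ι] [DecidableEq ι] [Fintype κ] [DecidableEq κ]

theorem K1_unit (c : K1 Unit) : c = 0 := by
  obtain ⟨n, u, hu, rfl⟩ := exists_cls c
  let A := u ()
  have hA : IsUnit A := hu.2 ()
  let P : Polynomial ℂ := (Matrix.of fun i j => Polynomial.C ((1 : Mat (Fin n)) i j) + Polynomial.X * Polynomial.C ((A - 1) i j)).det
  have hP : ∀ z : ℂ, P.eval z = (1 + z • (A - 1)).det := by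
    intro z
    simp only [P]
    rw [← Polynomial.coe_evalRingHom, RingHom.map_det]
    congr 1
    ext i j
    simp [Matrix.map_apply]
  have hP0 : P ≠ 0 := by
    intro h
    have := hP 0
    rw [h] at this; simp at this
  have hfin : Set.Countable {z : ℂ | P.eval z = 0} := by
    have : {z : ℂ | P.eval z = 0} ⊆ (P.roots.toFinset : Set ℂ) := by
      intro z hz
      simp [hP0]; exact hz
    exact (P.roots.toFinset.finite_toSet.subset this).countable
  have hpc := hfin.isPathConnected_compl_of_one_lt_rank (by rw [Complex.rank_real_complex]; norm_num)
  obtain ⟨γ, hγ⟩ := hpc.joinedIn 0 (by simp [hP]) 1 (by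
    simp [hP]; exact (Matrix.isUnit_iff_isUnit_det _).1 hA |>.ne_zero)
  have h : Htpy (fun _ : Unit => (1 : Mat (Fin n))) u := by
    refine Htpy.mk (fun q => 1 + γ.extend q.2 • (A - 1)) ?_ ?_ ?_ ?_
    · have : Continuous γ.extend := γ.continuous_extend
      fun_prop
    · intro x s h0 h1
      have := hγ ⟨s, h0, h1⟩
      rw [Matrix.isUnit_iff_isUnit_det, isUnit_iff_ne_zero]
      simp only [Set.mem_compl_iff, Set.mem_setOf_eq, hP] at this
      simpa [Path.extend_apply γ (t := s) ⟨h0, h1⟩] using this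
    · intro x; simp
    · intro x; simp [A]
  rw [← cls_htpy h, cls_one]

theorem idem_split {E : Mat ι} (h : E * E = E) : ∃ (r : ℕ) (x : Matrix ι (Fin r) ℂ) (y : Matrix (Fin r) ι ℂ), x * y = E ∧ y * x = 1 := by
  let f := Matrix.toLin' E
  have hf : f ∘ₗ f = f := by simp only [f]; rw [← Matrix.toLin'_mul, h]
  let b := Module.finBasis ℂ (LinearMap.range f)
  let g : (ι → ℂ) →ₗ[ℂ] LinearMap.range f := f.rangeRestrict
  let Y : (ι → ℂ) →ₗ[ℂ] (Fin _ → ℂ) := b.equivFun.toLinearMap ∘ₗ g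
  let Xx : (Fin _ → ℂ) →ₗ[ℂ] (ι → ℂ) := (LinearMap.range f).subtype ∘ₗ b.equivFun.symm.toLinearMap
  refine ⟨_, LinearMap.toMatrix' Xx, LinearMap.toMatrix' Y, ?_, ?_⟩
  · rw [← LinearMap.toMatrix'_comp]
    have : Xx ∘ₗ Y = f := by
      ext v; simp [Xx, Y, g]
    rw [this]; simp [f]
  · rw [← LinearMap.toMatrix'_comp]
    have : Y ∘ₗ Xx = LinearMap.id := by
      refine LinearMap.ext fun v => ?_
      have hg : g ((b.equivFun.symm v : LinearMap.range f) : ι → ℂ) = b.equivFun.symm v := by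
        obtain ⟨w, hw⟩ := (b.equivFun.symm v).2
        apply Subtype.ext
        show f _ = _
        rw [← hw]
        exact LinearMap.congr_fun hf w
      simp only [Y, Xx, LinearMap.comp_apply, Submodule.subtype_apply, LinearEquiv.coe_coe, hg, LinearMap.id_apply]
      exact b.equivFun.apply_symm_apply v
    rw [this, LinearMap.toMatrix'_id]

theorem idem_trace {E : Mat ι} (h : E * E = E) : ∃ r : ℤ, E.trace = r := by
  obtain ⟨r, x, y, h1, h2⟩ := idem_split h
  refine ⟨r, ?_⟩
  rw [← h1, Matrix.trace_mul_comm, h2]; simp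

noncomputable def rk (E : Mat ι) : ℤ := ⌊E.trace.re⌋
theorem rk_cast {E : Mat ι} (h : E * E = E) : E.trace = (rk E : ℤ) := by
  obtain ⟨r, hr⟩ := idem_trace h
  rw [rk, hr]; simp
theorem rk_of {E : Mat ι} {r : ℤ} (h : E.trace = r) : rk E = r := by rw [rk, h]; simp

noncomputable def rkI : IdemInv Unit ℤ where
  F ι _ _ E := rk (E ())
  htpy ι _ _ H hc hi := by
    have h1 : Continuous fun t : ℝ => (H ((), t)).trace.re := by
      have : Continuous fun t : ℝ => H ((), t) := hc.comp (by fun_prop)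
      exact Complex.continuous_re.comp this.matrix_trace
    have h2 : Continuous fun t : ℝ => rk (H ((), t)) := by
      refine (Int.isClosedEmbedding_coe_real.isEmbedding.isInducing.continuous_iff).2 ?_
      refine h1.congr fun t => ?_
      have := rk_cast (hi ((), t))
      simp only [Function.comp]
      rw [this]; simp
    exact PreconnectedSpace.constant inferInstance h2
  ri ι κ _ _ _ _ e u hu hi := by
    apply rk_of
    rw [← rk_cast (hi ())]
    simp only [ri, Matrix.trace, Matrix.diag, Matrix.submatrix_apply]
    exact Equiv.sum_comp e.symm (fun i => u () i i)
  ds ι κ _ _ _ _ u v cu iu cv iv := by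
    apply rk_of
    push_cast
    rw [← rk_cast (iu ()), ← rk_cast (iv ()), ds]
    simp [Matrix.trace, Matrix.diag, Fintype.sum_sum_type]
  zero ι _ _ := by simp [rk]

noncomputable def deg0 : K1 (Unit × T1) →+ ℤ := hat rkI

noncomputable def gen0 : K1 (Unit × T1) := zc fun _ : Unit => (1 : Mat Unit)

theorem zc_const_eq (r : ℕ) : zc (fun _ : Unit => (1 : Mat (Fin r))) = r • gen0 := by
  induction r with
  | zero =>
    rw [show (1 : Mat (Fin 0)) = 0 from Subsingleton.elim _ _, zc_zero, zero_smul]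
  | succ r ih =>
    let e : Fin r ⊕ Unit ≃ Fin (r+1) := (Equiv.sumCongr (Equiv.refl _) finOneEquiv.symm).trans finSumFinEquiv
    have h := zc_ri (X := Unit) (E := fun _ => (1 : Mat (Fin r ⊕ Unit))) continuous_const (by simp) e
    simp only [ri_one] at h
    rw [h]
    have h3 := zc_ds (X := Unit) (E := fun _ => (1 : Mat (Fin r))) (E' := fun _ => (1 : Mat Unit)) continuous_const (by simp) continuous_const (by simp)
    simp only [ds_one] at h3
    rw [h3, ih, succ_nsmul]; rfl

theorem deg0_gen : deg0 gen0 = 1 := by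
  rw [deg0, gen0, hat_zc _ continuous_const (by simp)]
  exact rk_of (by simp)

theorem deg0_spec (c : K1 (Unit × T1)) : c = deg0 c • gen0 := by
  have : ∃ z : ℤ, c = z • gen0 := by
    obtain ⟨κ, _, _, E, c', n, m, hE, hi, rfl⟩ := sf c
    rw [K1_unit c', map_zero, add_zero, zc_const_eq]
    obtain ⟨r, x, y, h1, h2⟩ := idem_split (hi ())
    have : zc E = zc (fun _ : Unit => (1 : Mat (Fin r))) := by
      refine kc_equiv (Cor_zc hE hi) (Cor_zc continuous_const (by simp)) (x := fun _ => x) (y := fun _ => y) continuous_const continuous_const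
        (fun p => h1) (fun p => h2) (by simp) (by simp) (by simp) (by simp)
    rw [this, zc_const_eq]
    exact ⟨r - n * m, by rw [sub_smul, mul_smul]; simp⟩
  obtain ⟨z, rfl⟩ := this
  rw [map_zsmul, deg0_gen]; simp

theorem deg0_Psi {p : ℕ} [Fact p.Prime] (c : K1 (Unit × T1)) : deg0 (Psi p c) = p * deg0 c := by
  have h : Psi p gen0 = p • gen0 := by
    have : gen0 = cls (fun q : Unit × T1 => zz q.2 • (1 : Mat Unit)) := kc_one_right
    rw [this, Psi_div GLc_zz]
    have h1 : ec p Unit 1 = 0 := by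
      have : ∀ k, sh p Unit k = 1 := fun k => by
        ext f g
        rw [Subsingleton.elim f g]
        simp [sh, pm]
        exact Subsingleton.elim _ _
      have h2 := sum_χ (-1 : ZMod p)
      rw [if_neg (by simp)] at h2
      simp only [neg_mul, one_mul] at h2
      show ep (sh p Unit) 1 = 0
      simp only [ep, this, one_mul, ← Finset.sum_smul, h2, zero_smul, smul_zero]
    rw [h1, kc_zero]; simp
  rw [deg0_spec c]
  simp only [map_zsmul, h, map_nsmul, deg0_gen]
  simp [mul_comm]

def T : ℕ → Type
  | 0 => Unit
  | n+1 => T n × T1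

instance T.top : ∀ n, TopologicalSpace (T n)
  | 0 => inferInstanceAs (TopologicalSpace Unit)
  | n+1 => @instTopologicalSpaceProd _ _ (T.top n) _
instance T.compact : ∀ n, CompactSpace (T n)
  | 0 => inferInstanceAs (CompactSpace Unit)
  | n+1 => by have := T.compact n; exact inferInstanceAs (CompactSpace (T n × T1))
instance T.t2 : ∀ n, T2Space (T n)
  | 0 => inferInstanceAs (T2Space Unit)
  | n+1 => by have := T.t2 n; exact inferInstanceAs (T2Space (T n × T1))

/-- fat wedge -/
def fw : ∀ n, T n → Prop
  | 0, _ => False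
  | n+1, x => fw n x.1 ∨ x.2 = 0

theorem isClosed_fw : ∀ n, IsClosed {x | fw n x}
  | 0 => isClosed_empty
  | n+1 => ((isClosed_fw n).preimage (continuous_fst (X := T n) (Y := T1))).union
      (isClosed_singleton.preimage (continuous_snd (X := T n) (Y := T1)))

def Van (n : ℕ) (c : K1 (T n)) : Prop :=
  ∀ (Z : Type) [TopologicalSpace Z] [CompactSpace Z] (f : C(Z, T n)), (∀ z, fw n (f z)) → K1.map f c = 0

theorem Van.of_one {n : ℕ} {u : T n → Mat ι} (hu : GLc u) (h : ∀ x, fw n x → u x = 1) : Van n (cls u) := by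
  intro Z _ _ f hf
  rw [K1.map_cls f hu]
  simp only [h _ (hf _), cls_one]

theorem Van.sub {n : ℕ} {c d : K1 (T n)} (hc : Van n c) (hd : Van n d) : Van n (c - d) := fun Z _ _ f hf => by
  rw [map_sub, hc Z f hf, hd Z f hf, sub_zero]

theorem Van.Psi {n : ℕ} {c : K1 (T n)} (hc : Van n c) (p : ℕ) [Fact p.Prime] : Van n (PK.Psi p c) := fun Z _ _ f hf => by
  rw [Psi_map, hc Z f hf, map_zero]

theorem Van.sus {n : ℕ} {c : K1 (T (n+2))} (hc : Van (n+2) c) : Van n (PK.sus (T n) c) := fun Z _ _ f hf => by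
  refine (sus_map (X := Z) (Y := T n) f c).trans ?_
  have : K1.map (m2 f) c = 0 := by
    refine hc _ _ fun z => ?_
    exact Or.inl (Or.inl (hf _))
  exact (congrArg _ this).trans (map_zero _)

theorem Van.inj {n : ℕ} {c : K1 (T (n+2))} (hc : Van (n+2) c) (h : PK.sus (T n) c = 0) : c = 0 := by
  refine inj_sus c ?_ ?_ h
  · exact hc (T n × T1) _ fun z => Or.inr rfl
  · exact hc (T n × T1) _ fun z => Or.inl (Or.inr rfl)

noncomputable def degT : ∀ m, K1 (T (2*m+1)) →+ ℤ
  | 0 => deg0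
  | m+1 => (degT m).comp (sus (T (2*m+1)))

theorem van_even : ∀ m (c : K1 (T (2*m))), Van (2*m) c → c = 0
  | 0, c, _ => K1_unit c
  | m+1, c, h => Van.inj (n := 2*m) h (van_even m _ (Van.sus (n := 2*m) h))

theorem van_odd : ∀ m (c : K1 (T (2*m+1))), Van (2*m+1) c → degT m c = 0 → c = 0
  | 0, c, _, hd => by
    have h := deg0_spec c
    rw [show deg0 c = 0 from hd, zero_smul] at h
    exact h
  | m+1, c, h, hd => Van.inj (n := 2*m+1) h (van_odd m _ (Van.sus (n := 2*m+1) h) hd)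

theorem degT_Psi {p : ℕ} [Fact p.Prime] : ∀ m (c : K1 (T (2*m+1))), degT m (Psi p c) = p^(m+1) * degT m c
  | 0, c => by rw [pow_one]; exact deg0_Psi c
  | m+1, c => by
    show degT m (sus (T (2*m+1)) (Psi p c)) = p^(m+2) * degT m (sus (T (2*m+1)) c)
    have h : sus (T (2*m+1)) (Psi p c) = p • Psi p (sus (T (2*m+1)) c) := sus_Psi (X := T (2*m+1)) c
    rw [h, map_nsmul, degT_Psi m]
    simp; ring
end deg
end PK

namespace PK
open Topology
section F1
variable {X Y Z W K A B : Type} [TopologicalSpace X] [TopologicalSpace Y] [TopologicalSpace Z] [TopologicalSpace W]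
  [TopologicalSpace K] [TopologicalSpace A] [TopologicalSpace B]
variable {ι κ : Type} [Fintype ι] [DecidableEq ι] [Fintype κ] [DecidableEq κ]

theorem cont_desc [LocallyCompactSpace K] {r : Z → Z → Prop} {f : Quot r × K → W}
    (hf : Continuous fun p : Z × K => f (Quot.mk r p.1, p.2)) : Continuous f := by
  have h := (isQuotientMap_quot_mk (r := r)).continuous_lift_prod_left (g := f) hf
  exact h

theorem cont_sum {f : (A ⊕ B) × K → W} (h1 : Continuous fun p : A × K => f (Sum.inl p.1, p.2))
    (h2 : Continuous fun p : B × K => f (Sum.inr p.1, p.2)) : Continuous f := by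
  have h : Continuous (f ∘ (Homeomorph.sumProdDistrib (X := A) (Y := B) (Z := K)).symm) := by
    rw [continuous_sum_dom]
    exact ⟨h1, h2⟩
  have h' := h.comp (Homeomorph.sumProdDistrib (X := A) (Y := B) (Z := K)).continuous
  convert h' using 1
  ext p
  simp

theorem cI_ge {t : ℝ} (h : 1 ≤ t) : cI t = 1 := by simp [cI, h]
theorem cI_le0 {t : ℝ} (h : t ≤ 0) : cI t = 0 := by simp [cI, h]

/-- zero the `i`th coordinate -/
def zi : ∀ n, ℕ → T n → T n
  | 0, _, x => x
  | n+1, 0, x => (x.1, 0)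
  | n+1, i+1, x => (zi n i x.1, x.2)

theorem continuous_zi : ∀ n i, Continuous (zi n i)
  | 0, _ => continuous_id
  | n+1, 0 => (continuous_fst (X := T n) (Y := T1)).prodMk continuous_const
  | n+1, i+1 => ((continuous_zi n i).comp (continuous_fst (X := T n) (Y := T1))).prodMk continuous_snd

theorem zi_comm : ∀ n i j x, zi n i (zi n j x) = zi n j (zi n i x)
  | 0, _, _, _ => rfl
  | n+1, 0, 0, x => rfl
  | n+1, 0, j+1, x => rfl
  | n+1, i+1, 0, x => rfl
  | n+1, i+1, j+1, x => by
    show ((zi n i (zi n j x.1), x.2) : T n × T1) = (zi n j (zi n i x.1), x.2)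
    rw [zi_comm n i j]

theorem zi_idem : ∀ n i x, zi n i (zi n i x) = zi n i x
  | 0, _, _ => rfl
  | n+1, 0, x => rfl
  | n+1, i+1, x => by
    show ((zi n i (zi n i x.1), x.2) : T n × T1) = (zi n i x.1, x.2)
    rw [zi_idem n i]

theorem fw_zi : ∀ n i x, i < n → fw n (zi n i x)
  | 0, _, _, h => by omega
  | n+1, 0, x, _ => Or.inr rfl
  | n+1, i+1, x, h => Or.inl (fw_zi n i x.1 (by omega))

theorem exists_zi : ∀ n x, fw n x → ∃ i, i < n ∧ zi n i x = x
  | 0, _, h => h.elim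
  | n+1, x, h => by
    rcases h with h | h
    · obtain ⟨i, hi, e⟩ := exists_zi n x.1 h
      exact ⟨i+1, by omega, by show ((zi n i x.1, x.2) : T n × T1) = x; rw [e]; rfl⟩
    · exact ⟨0, by omega, by show ((x.1, 0) : T n × T1) = x; rw [← h]; rfl⟩

theorem relnull {n : ℕ} {U : T n → Mat ι} (hU : GLc U) (h1 : ∀ x, fw n x → U x = 1) (h0 : cls U = 0) :
    ∃ (m : ℕ) (H : T n × ℝ → Mat (ι ⊕ Fin m)), GLc H ∧ (∀ x, H (x, 0) = ds (U x) 1) ∧ (∀ x, H (x, 1) = 1) ∧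
      ∀ x t, fw n x → H (x, t) = 1 := by
  obtain ⟨m, H, hH, H0, H1⟩ := cls_eq_zero hU h0
  refine ⟨m, ?_⟩
  have key : ∀ k, ∃ H : T n × ℝ → Mat (ι ⊕ Fin m), GLc H ∧ (∀ x, H (x, 0) = ds (U x) 1) ∧ (∀ x, H (x, 1) = 1) ∧
      ∀ i, i < k → i < n → ∀ x t, H (zi n i x, t) = 1 := by
    intro k
    induction k with
    | zero => exact ⟨H, hH, H0, H1, fun i hi => by omega⟩
    | succ k ih =>
      obtain ⟨H, hH, H0, H1, H2⟩ := ih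
      by_cases hk : k < n
      · refine ⟨fun p => H p * (H (zi n k p.1, p.2))⁻¹, hH.mul (hH.inv.comp (f := fun p : T n × ℝ => (zi n k p.1, p.2)) ?_), ?_, ?_, ?_⟩
        · exact ((continuous_zi n k).comp continuous_fst).prodMk continuous_snd
        · intro x
          simp only [H0, h1 _ (fw_zi n k x hk), ds_one, inv_one, mul_one]
        · intro x; simp only [H1, inv_one, mul_one]
        · intro i hi hin x t
          simp only
          rcases Nat.lt_succ_iff_lt_or_eq.1 hi with h | rfl
          · rw [zi_comm n k i, H2 i h hin, H2 i h hin, inv_one, mul_one]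
          · rw [zi_idem]; exact mul_inv' (hH.2 _)
      · exact ⟨H, hH, H0, H1, fun i hi hin => H2 i (by omega) hin⟩
  obtain ⟨H, hH, H0, H1, H2⟩ := key n
  refine ⟨H, hH, H0, H1, fun x t hx => ?_⟩
  obtain ⟨i, hi, e⟩ := exists_zi n x hx
  rw [← e]; exact H2 i hi hi x t

/-- reduced mapping cone -/
inductive ConeR {G X : Type} [One G] (i : G → X) : (X ⊕ G × ℝ) → (X ⊕ G × ℝ) → Prop
  | top (g : G) (t : ℝ) (h : 1 ≤ t) : ConeR i (Sum.inr (g, t)) (Sum.inl (i g))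
  | bot (g : G) (t : ℝ) (h : t ≤ 0) : ConeR i (Sum.inr (g, t)) (Sum.inl (i 1))
  | one (t : ℝ) : ConeR i (Sum.inr (1, t)) (Sum.inl (i 1))

def Cone {G X : Type} [One G] (i : G → X) : Type := Quot (ConeR i)

variable {G : Type} [TopologicalSpace G] [One G]
instance (i : G → X) : TopologicalSpace (Cone i) := inferInstanceAs (TopologicalSpace (Quot (ConeR i)))

def cpt (i : G → X) (p : G × ℝ) : Cone i := Quot.mk _ (Sum.inr p)
def cπ (i : G → X) : C(X, Cone i) := ⟨fun x => Quot.mk _ (Sum.inl x), continuous_quot_mk.comp continuous_inl⟩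
theorem continuous_cpt (i : G → X) : Continuous (cpt i) := continuous_quot_mk.comp continuous_inr
theorem cpt_top (i : G → X) (g : G) (t : ℝ) (h : 1 ≤ t) : cpt i (g, t) = cπ i (i g) := Quot.sound (.top g t h)
theorem cpt_bot (i : G → X) (g : G) (t : ℝ) (h : t ≤ 0) : cpt i (g, t) = cπ i (i 1) := Quot.sound (.bot g t h)
theorem cpt_one (i : G → X) (t : ℝ) : cpt i (1, t) = cπ i (i 1) := Quot.sound (.one t)
theorem cone_ind (i : G → X) (P : Cone i → Prop) (h1 : ∀ x, P (cπ i x)) (h2 : ∀ p, P (cpt i p)) (c : Cone i) : P c := by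
  induction c using Quot.ind with
  | mk a => cases a with
    | inl x => exact h1 x
    | inr p => exact h2 p

/-- descend a family to the cone -/
theorem cone_desc [LocallyCompactSpace K] (i : G → X) (f : X × K → W) (g : (G × ℝ) × K → W) (hf : Continuous f) (hg : Continuous g)
    (h1 : ∀ a t k, 1 ≤ t → g ((a, t), k) = f (i a, k)) (h2 : ∀ a t k, t ≤ 0 → g ((a, t), k) = f (i 1, k))
    (h3 : ∀ t k, g ((1, t), k) = f (i 1, k)) :
    ∃ F : Cone i × K → W, Continuous F ∧ (∀ x k, F (cπ i x, k) = f (x, k)) ∧ ∀ p k, F (cpt i p, k) = g (p, k) := by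
  refine ⟨fun q => Quot.lift (fun z : X ⊕ G × ℝ => Sum.elim (fun x => f (x, q.2)) (fun p => g (p, q.2)) z) ?_ q.1, ?_, fun x k => rfl, fun p k => rfl⟩
  · rintro a b (⟨g, t, h⟩ | ⟨g, t, h⟩ | t)
    · exact h1 _ _ _ h
    · exact h2 _ _ _ h
    · exact h3 _ _
  · refine cont_desc (r := ConeR i) ?_
    exact cont_sum hf hg

theorem cls_const (A : Mat ι) (hA : IsUnit A) : cls (fun _ : X => A) = 0 := by
  have h : K1.map (⟨fun _ => (), continuous_const⟩ : C(X, Unit)) (cls fun _ : Unit => A) = cls (fun _ : X => A) :=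
    K1.map_cls _ (GLc.const hA)
  rw [← h, K1_unit (cls _), map_zero]

theorem cone_ex (i : C(G, X)) (c : K1 X) (h : K1.map i c = 0) : ∃ d : K1 (Cone i), K1.map (cπ i) d = c := by
  obtain ⟨n, U, hU, rfl⟩ := exists_cls c
  set U' : X → Mat (Fin n) := fun x => U x * (U (i 1))⁻¹ with hU'
  have hu : GLc U' := hU.mul (GLc.const (hU.inv.2 (i 1)))
  have e : cls U' = cls U := by
    rw [hU', cls_mul hU (GLc.const (hU.inv.2 (i 1))), cls_const _ (hU.inv.2 _), add_zero]
  rw [← e] at h ⊢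
  have h1 : U' (i 1) = 1 := mul_inv' (hU.2 _)
  rw [K1.map_cls i hu] at h
  obtain ⟨m, H, hH, H0, H1⟩ := cls_eq_zero (hu.comp i.continuous) h
  obtain ⟨F, Fc, F1, F2⟩ := cone_desc (K := Unit) i (fun p => ds (U' p.1) (1 : Mat (Fin m)))
    (fun p => H (p.1.1, 1 - cI p.1.2) * (H (1, 1 - cI p.1.2))⁻¹)
    (continuous_ds (hu.1.comp continuous_fst) continuous_const)
    ((hH.comp (f := fun p : (G × ℝ) × Unit => (p.1.1, 1 - cI p.1.2)) (by have := continuous_cI; fun_prop)).mul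
     (hH.inv.comp (f := fun p : (G × ℝ) × Unit => (1, 1 - cI p.1.2)) (by have := continuous_cI; fun_prop))).1
    (by
      intro a t k ht
      have : cI t = 1 := by simp [cI, ht]
      simp only [this, sub_self, H0, h1, ds_one, inv_one, mul_one])
    (by
      intro a t k ht
      have : cI t = 0 := by simp [cI, ht]; 
      simp only [this, sub_zero, H1, h1, ds_one, inv_one, mul_one])
    (by
      intro t k
      simp only [h1, ds_one]
      exact mul_inv' (hH.2 _))
  have hF : GLc fun c => F (c, ()) := by
    refine ⟨Fc.comp (by fun_prop), cone_ind i _ (fun x => ?_) fun p => ?_⟩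
    · show IsUnit (F (cπ i x, ())); rw [F1]; exact isUnit_ds (hu.2 _) isUnit_one
    · show IsUnit (F (cpt i p, ())); rw [F2]; exact (hH.2 _).mul (hH.inv.2 _)
  refine ⟨cls fun c => F (c, ()), ?_⟩
  rw [K1.map_cls _ hF]
  simp only [F1]
  exact cls_ds_one hu

/-- vanishing of based loops -/
def LoopNull (G : Type) [TopologicalSpace G] [One G] : Prop :=
  ∀ (ι : Type) [Fintype ι] [DecidableEq ι] (L : G × ℝ → Mat ι), GLc L → (∀ g t, t ≤ 0 → L (g, t) = 1) → (∀ g t, 1 ≤ t → L (g, t) = 1) → (∀ t, L (1, t) = 1) →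
    ∃ (m : ℕ) (M : (G × ℝ) × ℝ → Mat (ι ⊕ Fin m)), GLc M ∧ (∀ p, M (p, 0) = ds (L p) 1) ∧ (∀ p, M (p, 1) = 1) ∧
      (∀ g t r, t ≤ 0 → M ((g, t), r) = 1) ∧ (∀ g t r, 1 ≤ t → M ((g, t), r) = 1) ∧ ∀ t r, M ((1, t), r) = 1

theorem cone_inj (hL : LoopNull G) (i : C(G, X)) (d : K1 (Cone i)) (h : K1.map (cπ i) d = 0) : d = 0 := by
  obtain ⟨n, U0, hU0, rfl⟩ := exists_cls d
  set b := cπ i (i 1) with hb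
  obtain ⟨U, hU⟩ : ∃ U : Cone i → Mat (Fin n), U = fun x => U0 x * (U0 b)⁻¹ := ⟨_, rfl⟩
  have hu : GLc U := hU ▸ hU0.mul (GLc.const (hU0.inv.2 b))
  have e : cls U = cls U0 := by
    rw [hU, cls_mul hU0 (GLc.const (hU0.inv.2 b)), cls_const _ (hU0.inv.2 _), add_zero]
  rw [← e] at h ⊢
  have h1 : U b = 1 := by rw [hU]; exact mul_inv' (hU0.2 _)
  clear_value b
  rw [K1.map_cls _ hu] at h
  obtain ⟨m, H', hH', H0', H1'⟩ := cls_eq_zero (hu.comp (cπ i).continuous) h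
  obtain ⟨H, hHd⟩ : ∃ H : X × ℝ → Mat (Fin n ⊕ Fin m), H = fun p => H' p * (H' (i 1, p.2))⁻¹ := ⟨_, rfl⟩
  have hH : GLc H := by
    rw [hHd]
    exact hH'.mul (hH'.inv.comp (f := fun p : X × ℝ => (i 1, p.2)) (by fun_prop))
  have H0 : ∀ x, H (x, 0) = ds (U (cπ i x)) 1 := by
    intro x; simp only [hHd, H0', ← hb, h1, ds_one, inv_one, mul_one]
  have H1 : ∀ x, H (x, 1) = 1 := by
    intro x; simp only [hHd, H1', inv_one, mul_one]
  have Hb : ∀ t, H (i 1, t) = 1 := by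
    intro t; simp only [hHd]; exact mul_inv' (hH'.2 _)
  have cc := continuous_cI
  have ic := i.continuous
  have hHi : GLc fun p : G × ℝ => H (i p.1, 1 - cI p.2) := hH.comp (f := fun p : G × ℝ => (i p.1, 1 - cI p.2)) (by fun_prop)
  obtain ⟨m', M, hM, M0, M1, Ma, Mb, Mc⟩ := hL _ (fun p => ds (U (cpt i p)) (1 : Mat (Fin m)) * (H (i p.1, 1 - cI p.2))⁻¹)
    (((hu.comp (continuous_cpt i)).ds GLc.one).mul hHi.inv)
    (by
      intro g t ht
      simp only [cpt_bot i g t ht, ← hb, h1, ds_one, cI_le0 ht, sub_zero, H1, inv_one, mul_one])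
    (by
      intro g t ht
      simp only [cpt_top i g t ht, cI_ge ht, sub_self, H0]
      exact mul_inv' (isUnit_ds (hu.2 _) isUnit_one))
    (by
      intro t
      simp only [cpt_one i t, ← hb, h1, ds_one, Hb, inv_one, mul_one])
  obtain ⟨F, Fc, F1, F2⟩ := cone_desc (K := ℝ) i (fun p => ds (ds (U (cπ i p.1)) (1 : Mat (Fin m))) (1 : Mat (Fin m')))
    (fun p => M p * ds (H (i p.1.1, 1 - cI p.1.2)) 1)
    (((hu.comp (cπ i).continuous).ds GLc.one).ds GLc.one |>.comp continuous_fst).1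
    (hM.mul ((hHi.comp continuous_fst).ds GLc.one)).1
    (by intro a t k ht; simp only [Mb _ _ _ ht, cI_ge ht, sub_self, H0, one_mul])
    (by intro a t k ht; simp only [Ma _ _ _ ht, cI_le0 ht, sub_zero, H1, one_mul, ← hb, h1, ds_one])
    (by intro t k; simp only [Mc, Hb, ← hb, h1, ds_one, mul_one])
  obtain ⟨F', Fc', F1', F2'⟩ := cone_desc (K := ℝ) i (fun p => ds (H (p.1, cI p.2)) (1 : Mat (Fin m')))
    (fun p => ds (H (i p.1.1, 1 - cI p.1.2 * (1 - cI p.2))) 1)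
    ((hH.comp (f := fun p : X × ℝ => (p.1, cI p.2)) (by fun_prop)).ds GLc.one).1
    ((hH.comp (f := fun p : (G × ℝ) × ℝ => (i p.1.1, 1 - cI p.1.2 * (1 - cI p.2))) (by fun_prop)).ds GLc.one).1
    (by intro a t k ht; simp only [cI_ge ht, one_mul, sub_sub_cancel])
    (by intro a t k ht; simp only [cI_le0 ht, zero_mul, sub_zero, H1, Hb])
    (by intro t k; simp only [Hb])
  have hF : GLc F := by
    refine ⟨Fc, fun q => ?_⟩
    obtain ⟨q, k⟩ := q
    revert q
    refine cone_ind i _ (fun x => ?_) fun p => ?_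
    · rw [F1]; exact isUnit_ds (isUnit_ds (hu.2 _) isUnit_one) isUnit_one
    · rw [F2]; exact (hM.2 _).mul (isUnit_ds (hH.2 _) isUnit_one)
  have hF' : GLc F' := by
    refine ⟨Fc', fun q => ?_⟩
    obtain ⟨q, k⟩ := q
    revert q
    refine cone_ind i _ (fun x => ?_) fun p => ?_
    · rw [F1']; exact isUnit_ds (hH.2 _) isUnit_one
    · rw [F2']; exact isUnit_ds (hH.2 _) isUnit_one
  have t1 : Htpy (fun c => ds (ds (U c) (1 : Mat (Fin m))) (1 : Mat (Fin m'))) (fun c => F (c, 1)) := by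
    refine ⟨F, hF, ?_, fun x => rfl⟩
    refine cone_ind i _ (fun x => ?_) fun p => ?_
    · rw [F1]
    · rw [F2]; simp only [M0, ds_mul, one_mul]
      rw [mul_assoc, inv_mul' (hH.2 _), mul_one]
  have t2 : Htpy (fun c => F (c, 1)) (fun c => 1) := by
    refine ⟨F', hF', ?_, ?_⟩
    · refine cone_ind i _ (fun x => ?_) fun p => ?_
      · rw [F1']; beta_reduce; rw [F1]; simp only [cI_zero, H0]
      · rw [F2']; beta_reduce; rw [F2]; simp only [cI_zero, M1, sub_zero, mul_one, one_mul]
    · refine cone_ind i _ (fun x => ?_) fun p => ?_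
      · rw [F1']; simp only [cI_one, H1, ds_one]
      · rw [F2']; simp only [cI_one, sub_self, mul_zero, sub_zero, H1, ds_one]
  have := cls_htpy (t1.trans t2)
  rw [cls_one, cls_ds_one (hu.ds GLc.one), cls_ds_one hu] at this
  exact this
end F1
end PK

namespace PK
open Topology
section F2
variable {X Y Z W K : Type} [TopologicalSpace X] [TopologicalSpace Y] [TopologicalSpace Z] [TopologicalSpace W]
  [TopologicalSpace K]
variable {ι κ : Type} [Fintype ι] [DecidableEq ι] [Fintype κ] [DecidableEq κ]

abbrev G : Type := SU 2
/-- fundamental representation -/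
def V (g : G) : Mat (Fin 2) := g.1.1

theorem continuous_V : Continuous V := continuous_subtype_val.comp continuous_subtype_val
theorem V_one : V 1 = 1 := rfl
theorem V_mul (g h : G) : V (g * h) = V g * V h := rfl
theorem V_inj {g h : G} (e : V g = V h) : g = h := Subtype.ext (Subtype.ext e)
theorem V_det (g : G) : (V g).det = 1 := g.2
theorem V_mul_star (g : G) : V g * star (V g) = 1 := (Matrix.mem_unitaryGroup_iff).1 g.1.2
theorem V_unit (g : G) : IsUnit (V g) := isUnit_mk (V_mul_star g)
theorem GLc_V : GLc V := ⟨continuous_V, V_unit⟩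
theorem V_inv (g : G) : V g⁻¹ = (V g)⁻¹ := by
  symm; apply Matrix.inv_eq_left_inv; rw [← V_mul]; simp [V_one]
theorem continuous_G {f : X → G} (h : Continuous fun x => V (f x)) : Continuous f :=
  Continuous.subtype_mk (Continuous.subtype_mk h _) _

theorem V_star (g : G) : star (V g) = !![V g 1 1, -V g 0 1; -V g 1 0, V g 0 0] := by
  have h : (V g)⁻¹ = star (V g) := Matrix.inv_eq_right_inv (V_mul_star g)
  rw [← h, Matrix.inv_def, V_det, Matrix.adjugate_fin_two]; simp
theorem V11 (g : G) : V g 1 1 = star (V g 0 0) := by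
  have := congrFun (congrFun (V_star g) 0) 0
  simp [Matrix.star_apply] at this; simp [this]
theorem V10 (g : G) : V g 1 0 = -star (V g 0 1) := by
  have := congrFun (congrFun (V_star g) 1) 0
  simp [Matrix.star_apply] at this; simp [this]
theorem V_norm (g : G) : (V g 0 0).re^2 + (V g 0 0).im^2 + ((V g 0 1).re^2 + (V g 0 1).im^2) = 1 := by
  have h := V_det g
  rw [Matrix.det_fin_two, V11, V10] at h
  have := congrArg Complex.re h
  simp at this; linarith
theorem V_ext {g h : G} (h0 : V g 0 0 = V h 0 0) (h1 : V g 0 1 = V h 0 1) : g = h := by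
  apply V_inj
  ext i j
  fin_cases i <;> fin_cases j <;> simp [h0, h1, V11, V10]

/-- unit quaternion -/
def mkG (a b c d : ℝ) (h : a^2+b^2+(c^2+d^2) = 1) : G :=
  ⟨⟨!![⟨a,b⟩, ⟨c,d⟩; -star (⟨c,d⟩ : ℂ), star (⟨a,b⟩ : ℂ)], by
    rw [Matrix.mem_unitaryGroup_iff]
    ext i j
    fin_cases i <;> fin_cases j <;> simp [Matrix.mul_apply, Matrix.star_apply, Fin.sum_univ_two, Complex.ext_iff] <;>
      first | (constructor <;> linarith) | linarith⟩, by
    show Matrix.det _ = 1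
    simp [Matrix.det_fin_two, Complex.ext_iff]
    constructor <;> linarith⟩
theorem mkG00 (a b c d : ℝ) (h) : V (mkG a b c d h) 0 0 = ⟨a,b⟩ := rfl
theorem mkG01 (a b c d : ℝ) (h) : V (mkG a b c d h) 0 1 = ⟨c,d⟩ := rfl

def nm (y : ℝ × ℝ × ℝ) : ℝ := max |y.1| (max |y.2.1| |y.2.2|)
theorem nm_smul (c : ℝ) (hc : 0 ≤ c) (y : ℝ × ℝ × ℝ) : nm (c * y.1, c * y.2.1, c * y.2.2) = c * nm y := by
  simp only [nm, abs_mul, abs_of_nonneg hc, mul_max_of_nonneg _ _ hc]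
theorem nm_nonneg (y : ℝ × ℝ × ℝ) : 0 ≤ nm y := (abs_nonneg _).trans (le_max_left _ _)
theorem nm_zero : nm 0 = 0 := by simp [nm]
def sq3 (y : ℝ × ℝ × ℝ) : ℝ := y.1^2 + y.2.1^2 + y.2.2^2
def NN (y : ℝ × ℝ × ℝ) : ℝ := sq3 y + (1 - nm y)^2
theorem sq3_nonneg (y) : 0 ≤ sq3 y := by unfold sq3; positivity
theorem NN_pos (y) : 0 < NN y := by
  have h := sq3_nonneg y
  unfold NN
  by_contra hn
  have h1 : (1 - nm y)^2 = 0 := by nlinarith [sq_nonneg (1 - nm y)]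
  have h2 : sq3 y = 0 := by nlinarith
  unfold sq3 at h2
  have a1 : y.1 = 0 := by nlinarith [sq_nonneg y.1, sq_nonneg y.2.1, sq_nonneg y.2.2]
  have a2 : y.2.1 = 0 := by nlinarith [sq_nonneg y.1, sq_nonneg y.2.1, sq_nonneg y.2.2]
  have a3 : y.2.2 = 0 := by nlinarith [sq_nonneg y.1, sq_nonneg y.2.1, sq_nonneg y.2.2]
  have : y = 0 := Prod.ext a1 (Prod.ext a2 a3)
  rw [this, nm_zero] at h1; norm_num at h1

noncomputable def QQ (y : ℝ × ℝ × ℝ) : G :=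
  mkG ((sq3 y - (1 - nm y)^2) / NN y) (2 * (1 - nm y) * y.1 / NN y) (2 * (1 - nm y) * y.2.1 / NN y) (2 * (1 - nm y) * y.2.2 / NN y) (by
    have := (NN_pos y).ne'
    field_simp
    unfold NN sq3; ring)

theorem continuous_QQ : Continuous QQ := by
  have h1 : Continuous nm := by unfold nm; fun_prop
  have h2 : Continuous sq3 := by unfold sq3; fun_prop
  have h3 : Continuous NN := by unfold NN; fun_prop
  have e1 : Continuous fun y => (sq3 y - (1 - nm y)^2) / NN y := by
    refine Continuous.div (by fun_prop) h3 fun y => (NN_pos y).ne'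
  have e2 : Continuous fun y => (2 * (1 - nm y) * y.1 / NN y) := Continuous.div (by fun_prop) h3 fun y => (NN_pos y).ne'
  have e3 : Continuous fun y => (2 * (1 - nm y) * y.2.1 / NN y) := Continuous.div (by fun_prop) h3 fun y => (NN_pos y).ne'
  have e4 : Continuous fun y => (2 * (1 - nm y) * y.2.2 / NN y) := Continuous.div (by fun_prop) h3 fun y => (NN_pos y).ne'
  have mkc : ∀ {a b : ℝ × ℝ × ℝ → ℝ}, Continuous a → Continuous b → Continuous fun y => (⟨a y, b y⟩ : ℂ) := by
    intro a b ha hb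
    have : (fun y => (⟨a y, b y⟩ : ℂ)) = fun y => (a y : ℂ) + (b y : ℂ) * Complex.I := by
      funext y; simp [Complex.ext_iff]
    rw [this]; fun_prop
  refine continuous_G (continuous_matrix fun i j => ?_)
  fin_cases i <;> fin_cases j
  · exact mkc e1 e2
  · exact mkc e3 e4
  · exact (mkc e3 e4).star.neg
  · exact (mkc e1 e2).star

theorem QQ_one {y} (h : nm y = 1) : QQ y = 1 := by
  have hn : NN y = sq3 y := by simp [NN, h]
  have := (NN_pos y).ne'
  apply V_ext
  · rw [QQ, mkG00, V_one]; simp [h, ← hn, this, Complex.ext_iff]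
  · rw [QQ, mkG01, V_one]; simp [h, Complex.ext_iff]

theorem QQ_inv {y} (h : nm y < 1) : (V (QQ y) 0 0).re = 1 - 2 * (1 - nm y)^2 / NN y ∧ QQ y ≠ 1 := by
  have hp := NN_pos y
  have e : (V (QQ y) 0 0).re = 1 - 2 * (1 - nm y)^2 / NN y := by
    rw [QQ, mkG00]; simp only; field_simp; unfold NN; ring
  refine ⟨e, fun h1 => ?_⟩
  rw [h1, V_one] at e
  have : 0 < 2 * (1 - nm y)^2 / NN y := by have : 0 < 1 - nm y := by linarith
                                           positivity
  simp at e; linarith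

theorem QQ_inj {y z} (hy : nm y < 1) (hz : nm z < 1) (h : QQ y = QQ z) : y = z := by
  have hp := NN_pos y
  have hq := NN_pos z
  obtain ⟨e1, -⟩ := QQ_inv hy
  obtain ⟨e2, -⟩ := QQ_inv hz
  rw [h, e2] at e1
  have p1 : 0 < 1 - nm y := by linarith
  have p2 : 0 < 1 - nm z := by linarith
  have e0 : (1 - nm y)^2 / NN y = (1 - nm z)^2 / NN z := by
    have : 2 * (1 - nm y)^2 / NN y = 2 * (1 - nm z)^2 / NN z := by linarith
    rw [mul_div_assoc, mul_div_assoc] at this; linarith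
  have key : ∀ a b : ℝ, 2 * (1 - nm y) * a / NN y = 2 * (1 - nm z) * b / NN z → a / (1 - nm y) = b / (1 - nm z) := by
    intro a b hab
    have h1 : 2 * (1 - nm y) * a / NN y = 2 * (a / (1 - nm y)) * ((1 - nm y)^2 / NN y) := by field_simp
    have h2 : 2 * (1 - nm z) * b / NN z = 2 * (b / (1 - nm z)) * ((1 - nm z)^2 / NN z) := by field_simp
    rw [h1, h2, e0] at hab
    have : (1 - nm z)^2 / NN z ≠ 0 := by positivity
    have := mul_right_cancel₀ this hab
    linarith
  have c1 := key y.1 z.1 (by have := congrArg (fun g => (V g 0 0).im) h; exact this)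
  have c2 := key y.2.1 z.2.1 (by have := congrArg (fun g => (V g 0 1).re) h; exact this)
  have c3 := key y.2.2 z.2.2 (by have := congrArg (fun g => (V g 0 1).im) h; exact this)
  have n1 := nm_smul (1 - nm y)⁻¹ (by positivity) y
  have n2 := nm_smul (1 - nm z)⁻¹ (by positivity) z
  simp only [div_eq_inv_mul] at c1 c2 c3
  rw [c1, c2, c3, n2] at n1
  have : nm y = nm z := by
    field_simp at n1; linarith
  rw [this] at c1 c2 c3
  have ne : (1 - nm z)⁻¹ ≠ 0 := by positivity
  exact Prod.ext (mul_left_cancel₀ ne c1) (Prod.ext (mul_left_cancel₀ ne c2) (mul_left_cancel₀ ne c3))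

theorem QQ_surj (g : G) (hg : g ≠ 1) : ∃ y, nm y < 1 ∧ QQ y = g := by
  have hn := V_norm g
  obtain ⟨A, hA⟩ : ∃ A, A = (V g 0 0).re := ⟨_, rfl⟩
  obtain ⟨b, hb⟩ : ∃ A, A = (V g 0 0).im := ⟨_, rfl⟩
  obtain ⟨c, hc⟩ : ∃ A, A = (V g 0 1).re := ⟨_, rfl⟩
  obtain ⟨d, hd⟩ : ∃ A, A = (V g 0 1).im := ⟨_, rfl⟩
  have hA1 : A < 1 := by
    rw [← hA, ← hb, ← hc, ← hd] at hn
    by_contra hh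
    have hh : 1 ≤ A := by linarith
    have : A = 1 := by nlinarith [sq_nonneg b, sq_nonneg c, sq_nonneg d]
    have b0 : b = 0 := by nlinarith [sq_nonneg b, sq_nonneg c, sq_nonneg d]
    have c0 : c = 0 := by nlinarith [sq_nonneg b, sq_nonneg c, sq_nonneg d]
    have d0 : d = 0 := by nlinarith [sq_nonneg b, sq_nonneg c, sq_nonneg d]
    apply hg
    apply V_ext
    · rw [V_one]; simp [Complex.ext_iff, ← hA, ← hb, this, b0]
    · rw [V_one]; simp [Complex.ext_iff, ← hc, ← hd, c0, d0]
  rw [← hA, ← hb, ← hc, ← hd] at hn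
  obtain ⟨t, ht⟩ : ∃ t : ℝ × ℝ × ℝ, t = (b/(1-A), c/(1-A), d/(1-A)) := ⟨_, rfl⟩
  have hm := nm_nonneg t
  obtain ⟨q, hq⟩ : ∃ q, q = (1 + nm t)⁻¹ := ⟨_, rfl⟩
  have q0 : 0 < q := by rw [hq]; positivity
  have hnm := nm_smul q q0.le t
  have e1 : 1 - nm (q * t.1, q * t.2.1, q * t.2.2) = q := by
    rw [hnm, hq]; field_simp; ring
  have pA : 1 - A ≠ 0 := by intro h; linarith
  have es : sq3 (q * t.1, q * t.2.1, q * t.2.2) = q^2 * ((1 + A) / (1 - A)) := by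
    simp only [sq3, ht]; field_simp; nlinarith
  have eN : NN (q * t.1, q * t.2.1, q * t.2.2) = 2 * q^2 / (1 - A) := by
    rw [NN, e1, es]; field_simp; ring
  refine ⟨(q * t.1, q * t.2.1, q * t.2.2), by linarith, V_ext ?_ ?_⟩
  · rw [QQ, mkG00]; simp only [e1, es, eN, Complex.ext_iff, ← hA, ← hb]
    constructor
    · field_simp; ring
    · simp only [ht]; field_simp
  · rw [QQ, mkG01]; simp only [e1, es, eN, Complex.ext_iff, ← hc, ← hd]
    constructor
    · simp only [ht]; field_simp
    · simp only [ht]; field_simp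
end F2
end PK

namespace PK
open Topology
section F3
variable {X Y Z W K : Type} [TopologicalSpace X] [TopologicalSpace Y] [TopologicalSpace Z] [TopologicalSpace W]
  [TopologicalSpace K]
variable {ι κ : Type} [Fintype ι] [DecidableEq ι] [Fintype κ] [DecidableEq κ]

def snoc {n : ℕ} (x : T n) (t : T1) : T (n+1) := (x, t)
theorem continuous_snoc {n : ℕ} {f : X → T n} {g : X → T1} (hf : Continuous f) (hg : Continuous g) : Continuous fun x => snoc (f x) (g x) :=
  Continuous.prodMk hf hg

theorem cont_T3 {f : ℝ × ℝ × ℝ → W} (hf : Continuous f) (h1 : ∀ b c, f (0, b, c) = f (1, b, c))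
    (h2 : ∀ a c, f (a, 0, c) = f (a, 1, c)) (h3 : ∀ a b, f (a, b, 0) = f (a, b, 1)) :
    Continuous fun x : T 3 => f (rep x.1.1.2, rep x.1.2, rep x.2) := by
  have s1 : Continuous fun q : (ℝ × ℝ) × T1 => f (q.1.1, q.1.2, rep q.2) :=
    continuous_rep (X := ℝ × ℝ) (f := fun p : (ℝ × ℝ) × ℝ => f (p.1.1, p.1.2, p.2)) (by fun_prop) (fun p => h3 _ _)
  have s2 : Continuous fun q : (ℝ × T1) × T1 => f (q.1.1, rep q.2, rep q.1.2) :=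
    continuous_rep (X := ℝ × T1) (f := fun p : (ℝ × T1) × ℝ => f (p.1.1, p.2, rep p.1.2))
      (s1.comp (f := fun p : (ℝ × T1) × ℝ => ((p.1.1, p.2), p.1.2)) (by fun_prop)) (fun p => h2 _ _)
  have s3 : Continuous fun q : (T1 × T1) × T1 => f (rep q.2, rep q.1.1, rep q.1.2) :=
    continuous_rep (X := T1 × T1) (f := fun p : (T1 × T1) × ℝ => f (p.2, rep p.1.1, rep p.1.2))
      (s2.comp (f := fun p : (T1 × T1) × ℝ => ((p.2, p.1.2), p.1.1)) (by fun_prop)) (fun p => h1 _ _)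
  exact s3.comp (f := fun x : ((Unit × T1) × T1) × T1 => ((x.1.2, x.2), x.1.1.2)) (by fun_prop)

noncomputable def yy (t : ℝ) : ℝ := 2 * cI t - 1
theorem abs_yy (t : ℝ) : |yy t| ≤ 1 := by
  rw [abs_le]; unfold yy; constructor <;> linarith [cI_nonneg t, cI_le t]
theorem yy_zero : yy 0 = -1 := by simp [yy, cI_zero]
theorem yy_one : yy 1 = 1 := by simp [yy, cI_one]; norm_num
theorem continuous_yy : Continuous yy := by unfold yy; have := continuous_cI; fun_prop

/-- the collapse map -/
noncomputable def kapf (x : T 3) : G := (fun t : ℝ × ℝ × ℝ => QQ (yy t.1, yy t.2.1, yy t.2.2)) (rep x.1.1.2, rep x.1.2, rep x.2)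

theorem nm_yy (a b c : ℝ) : nm (yy a, yy b, yy c) ≤ 1 := max_le (abs_yy _) (max_le (abs_yy _) (abs_yy _))
theorem nm_yy1 (a b c : ℝ) (h : |yy a| = 1 ∨ |yy b| = 1 ∨ |yy c| = 1) : nm (yy a, yy b, yy c) = 1 := by
  refine le_antisymm (nm_yy _ _ _) ?_
  rcases h with h | h | h
  · exact h.symm.le.trans (le_max_left _ _)
  · exact (h.symm.le.trans (le_max_left _ _)).trans (le_max_right _ _)
  · exact (h.symm.le.trans (le_max_right _ _)).trans (le_max_right _ _)

theorem continuous_kapf : Continuous kapf := by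
  have h0 : |yy 0| = 1 := by rw [yy_zero]; simp
  have h1 : |yy 1| = 1 := by rw [yy_one]; simp
  refine cont_T3 (f := fun t : ℝ × ℝ × ℝ => QQ (yy t.1, yy t.2.1, yy t.2.2)) (continuous_QQ.comp (by have := continuous_yy; fun_prop)) ?_ ?_ ?_
  · intro b c; simp only; rw [QQ_one (nm_yy1 _ _ _ (Or.inl h0)), QQ_one (nm_yy1 _ _ _ (Or.inl h1))]
  · intro b c; simp only; rw [QQ_one (nm_yy1 _ _ _ (Or.inr (Or.inl h0))), QQ_one (nm_yy1 _ _ _ (Or.inr (Or.inl h1)))]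
  · intro b c; simp only; rw [QQ_one (nm_yy1 _ _ _ (Or.inr (Or.inr h0))), QQ_one (nm_yy1 _ _ _ (Or.inr (Or.inr h1)))]

noncomputable def kap : C(T 3, G) := ⟨kapf, continuous_kapf⟩

theorem yy_rep {x : T1} : yy (rep x) = 2 * rep x - 1 := by
  rw [yy, cI_of (rep_nonneg x) (rep_lt x).le]
theorem abs_yy_rep {x : T1} (h : x ≠ 0) : |yy (rep x)| < 1 := by
  rw [yy_rep, abs_lt]
  have h0 : rep x ≠ 0 := fun h0 => h (by rw [← coe_rep x, h0]; simp)
  have := lt_of_le_of_ne (rep_nonneg x) h0.symm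
  constructor <;> linarith [rep_lt x]
theorem kap_fw (x : T 3) (h : fw 3 x) : kap x = 1 := by
  have h0 : |yy (rep 0)| = 1 := by rw [rep_zero, yy_zero]; simp
  refine QQ_one (nm_yy1 _ _ _ ?_)
  rcases h with ((h | h) | h) | h
  · exact h.elim
  · rw [h]; exact Or.inl h0
  · rw [h]; exact Or.inr (Or.inl h0)
  · rw [h]; exact Or.inr (Or.inr h0)
theorem nm_nfw (x : T 3) (h : ¬ fw 3 x) : nm (yy (rep x.1.1.2), yy (rep x.1.2), yy (rep x.2)) < 1 := by
  refine max_lt (abs_yy_rep fun e => h ?_) (max_lt (abs_yy_rep fun e => h ?_) (abs_yy_rep fun e => h ?_))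
  · exact Or.inl (Or.inl (Or.inr e))
  · exact Or.inl (Or.inr e)
  · exact Or.inr e
theorem kap_nfw (x : T 3) (h : ¬ fw 3 x) : kap x ≠ 1 := (QQ_inv (nm_nfw x h)).2
theorem kap_inj (x y : T 3) (hx : ¬ fw 3 x) (h : kap x = kap y) : x = y := by
  have hy : ¬ fw 3 y := fun hy => kap_nfw x hx (h.trans (kap_fw y hy))
  have e := QQ_inj (nm_nfw x hx) (nm_nfw y hy) h
  have r : ∀ a b : T1, yy (rep a) = yy (rep b) → a = b := by
    intro a b h
    rw [yy_rep, yy_rep] at h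
    rw [← coe_rep a, ← coe_rep b, show rep a = rep b by linarith]
  have e1 := r _ _ (congrArg Prod.fst e)
  have e2 := r _ _ (congrArg (fun p => p.2.1) e)
  have e3 := r _ _ (congrArg (fun p => p.2.2) e)
  exact Prod.ext (Prod.ext (Prod.ext rfl e1) e2) e3
theorem kap_surj (g : G) : ∃ x, kap x = g := by
  by_cases hg : g = 1
  · exact ⟨((((), 0), 0), 0), by rw [hg]; exact kap_fw _ (Or.inr rfl)⟩
  · obtain ⟨y, hy, rfl⟩ := QQ_surj g hg
    have hy' : |y.1| < 1 ∧ |y.2.1| < 1 ∧ |y.2.2| < 1 := by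
      simp only [nm, max_lt_iff] at hy; exact ⟨hy.1, hy.2.1, hy.2.2⟩
    have r : ∀ a : ℝ, |a| < 1 → yy (rep (((a + 1)/2 : ℝ) : T1)) = a := by
      intro a ha
      rw [abs_lt] at ha
      rw [yy_rep, rep_coe (by linarith) (by linarith)]; ring
    refine ⟨((((), (((y.1+1)/2 : ℝ) : T1)), (((y.2.1+1)/2 : ℝ) : T1)), (((y.2.2+1)/2 : ℝ) : T1)), ?_⟩
    show QQ (yy (rep (((y.1+1)/2 : ℝ) : T1)), yy (rep (((y.2.1+1)/2 : ℝ) : T1)), yy (rep (((y.2.2+1)/2 : ℝ) : T1))) = QQ y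
    rw [r _ hy'.1, r _ hy'.2.1, r _ hy'.2.2]

instance : CompactSpace G := ⟨by
  have : (Set.univ : Set G) = Set.range kap := (Set.range_eq_univ.2 kap_surj).symm
  rw [this]; exact isCompact_range kap.continuous⟩
instance : T2Space G := inferInstance

theorem kap_quot : IsQuotientMap (Prod.map kap (id : K → K)) := by
  have : IsProperMap (Prod.map kap (id : K → K)) := (kap.continuous.isProperMap).prodMap isProperMap_id
  exact this.isClosedMap.isQuotientMap this.continuous (Function.Surjective.prodMap kap_surj Function.surjective_id)

theorem kap_desc (f : T 3 × K → W) (hf : Continuous f) (h : ∀ x y k, fw 3 x → fw 3 y → f (x, k) = f (y, k)) :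
    ∃ F : G × K → W, Continuous F ∧ ∀ x k, F (kap x, k) = f (x, k) := by
  choose s hs using kap_surj
  have key : ∀ x k, f (s (kap x), k) = f (x, k) := by
    intro x k
    by_cases hx : fw 3 x
    · refine h _ _ _ ?_ hx
      by_contra hn
      exact kap_nfw _ hn ((hs _).trans (kap_fw x hx))
    · rw [kap_inj x (s (kap x)) hx (hs _).symm |>.symm]
  refine ⟨fun q => f (s q.1, q.2), ?_, key⟩
  rw [kap_quot.continuous_iff]
  convert hf using 1
  funext q; exact key _ _

theorem loopNull_G : LoopNull G := by
  intro ι _ _ L hL La Lb Lc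
  have hU : GLc fun q : T 4 => L (kap q.1, rep q.2) := by
    refine ⟨?_, fun q => hL.2 _⟩
    exact continuous_rep (X := T 3) (f := fun p : T 3 × ℝ => L (kap p.1, p.2))
      (hL.1.comp ((kap.continuous.comp continuous_fst).prodMk continuous_snd)) (fun x => by
        simp only; rw [La _ _ le_rfl, Lb _ _ le_rfl])
  have h1 : ∀ x : T 4, fw 4 x → L (kap x.1, rep x.2) = 1 := by
    rintro x (h | h)
    · rw [kap_fw _ h, Lc]
    · rw [h, rep_zero, La _ _ le_rfl]
  obtain ⟨m, H, hH, H0, H1, H2⟩ := relnull hU h1 (van_even 2 _ (Van.of_one hU h1))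
  have hc : Continuous fun q : T 3 × (ℝ × ℝ) => ((snoc q.1 ((cI q.2.1 : ℝ) : T1), q.2.2) : T 4 × ℝ) := by
    have := continuous_cI
    have h2 : Continuous fun t : ℝ => (t : T1) := AddCircle.continuous_mk' 1
    exact (continuous_snoc continuous_fst (by fun_prop)).prodMk (by fun_prop)
  have hH' : GLc fun q : T 3 × (ℝ × ℝ) => H (snoc q.1 ((cI q.2.1 : ℝ) : T1), q.2.2) := hH.comp hc
  obtain ⟨F, Fc, hF⟩ := kap_desc _ hH'.1 (by
    intro x y k hx hy
    simp only; rw [H2 (snoc x _) _ (Or.inl hx), H2 (snoc y _) _ (Or.inl hy)])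
  refine ⟨m, fun q => F (q.1.1, (q.1.2, q.2)), ⟨Fc.comp (by fun_prop), ?_⟩, ?_, ?_, ?_, ?_, ?_⟩
  · rintro ⟨⟨g, t⟩, r⟩
    obtain ⟨x, rfl⟩ := kap_surj g
    beta_reduce
    simp only [hF]; exact hH.2 _
  · rintro ⟨g, t⟩
    obtain ⟨x, rfl⟩ := kap_surj g
    simp only [hF, H0]
    congr 1
    show L (kap x, rep ((cI t : ℝ) : T1)) = L (kap x, t)
    by_cases h0 : t ≤ 0
    · rw [La _ _ h0, cI_le0 h0]; exact h1 (x, ((0:ℝ) : T1)) (Or.inr (by simp))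
    by_cases h1' : 1 ≤ t
    · rw [Lb _ _ h1', cI_ge h1', show ((1:ℝ) : T1) = 0 from T1_one]; exact h1 (x, 0) (Or.inr rfl)
    · rw [cI_of (by linarith) (by linarith), rep_coe (by linarith) (by linarith)]
  · rintro ⟨g, t⟩
    obtain ⟨x, rfl⟩ := kap_surj g
    simp only [hF, H1]
  · intro g t r ht
    obtain ⟨x, rfl⟩ := kap_surj g
    simp only [hF]; refine H2 _ _ (Or.inr ?_); show ((cI t : ℝ) : T1) = 0; simp [cI_le0 ht]
  · intro g t r ht
    obtain ⟨x, rfl⟩ := kap_surj g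
    simp only [hF]; refine H2 _ _ (Or.inr ?_); show ((cI t : ℝ) : T1) = 0; rw [cI_ge ht]; exact T1_one
  · intro t r
    have h := kap_fw ((((), 0), 0), 0) (Or.inr rfl)
    rw [← h]; exact (hF _ (t, r)).trans (H2 (snoc ((((), 0), 0), 0) _) _ (Or.inl (Or.inr rfl)))

theorem K1G_inj (d : K1 G) (h : degT 1 (K1.map kap d) = 0) : d = 0 := by
  obtain ⟨n, U0, hU0, rfl⟩ := exists_cls d
  obtain ⟨U, hU⟩ : ∃ U : G → Mat (Fin n), U = fun x => U0 x * (U0 1)⁻¹ := ⟨_, rfl⟩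
  have hu : GLc U := hU ▸ hU0.mul (GLc.const (hU0.inv.2 1))
  have e : cls U = cls U0 := by
    rw [hU, cls_mul hU0 (GLc.const (hU0.inv.2 1)), cls_const _ (hU0.inv.2 _), add_zero]
  have U1 : U 1 = 1 := by rw [hU]; exact mul_inv' (hU0.2 _)
  rw [← e] at h ⊢
  rw [K1.map_cls _ hu] at h
  have hk : GLc fun x => U (kap x) := hu.comp kap.continuous
  have h1 : ∀ x, fw 3 x → U (kap x) = 1 := fun x hx => by rw [kap_fw x hx, U1]
  obtain ⟨m, H, hH, H0, H1, H2⟩ := relnull hk h1 (van_odd 1 _ (Van.of_one hk h1) h)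
  obtain ⟨F, Fc, hF⟩ := kap_desc H hH.1 (fun x y k hx hy => by rw [H2 _ _ hx, H2 _ _ hy])
  have t : Htpy (fun g => ds (U g) (1 : Mat (Fin m))) (fun _ => 1) := by
    refine ⟨F, ⟨Fc, ?_⟩, ?_, ?_⟩
    · rintro ⟨g, t⟩
      obtain ⟨x, rfl⟩ := kap_surj g
      rw [hF]; exact hH.2 _
    · intro g
      obtain ⟨x, rfl⟩ := kap_surj g
      rw [hF, H0]
    · intro g
      obtain ⟨x, rfl⟩ := kap_surj g
      rw [hF, H1]
  have := cls_htpy t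
  rwa [cls_one, cls_ds_one hu] at this

theorem Psi_G {p : ℕ} [Fact p.Prime] (d : K1 G) : Psi p d = (p^2) • d := by
  have h : degT 1 (K1.map kap (Psi p d - (p^2) • d)) = 0 := by
    rw [map_sub, map_sub, Psi_map, degT_Psi, map_nsmul, map_nsmul]; simp
  exact sub_eq_zero.1 (K1G_inj _ h)
theorem K1G_torsion (n : ℕ) (hn : n ≠ 0) (d : K1 G) (h : n • d = 0) : d = 0 := by
  have h2 : n • degT 1 (K1.map kap d) = 0 := by rw [← map_nsmul, ← map_nsmul, h, map_zero, map_zero]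
  refine K1G_inj d ?_
  simpa [hn] using h2
end F3
end PK

namespace PK
open Topology
section G1
variable {X Y Z W K : Type} [TopologicalSpace X] [TopologicalSpace Y] [TopologicalSpace Z] [TopologicalSpace W]
  [TopologicalSpace K]
variable {ι κ : Type} [Fintype ι] [DecidableEq ι] [Fintype κ] [DecidableEq κ]

theorem GLc_loop {F : X × ℝ → Mat ι} (hF : GLc F) (h : ∀ x, F (x, 0) = F (x, 1)) : GLc fun q : X × T1 => F (q.1, rep q.2) :=
  ⟨continuous_rep hF.1 h, fun q => hF.2 _⟩

theorem loop_htpy {F : (X × ℝ) × ℝ → Mat ι} (hF : GLc F) (h0 : ∀ p, F (p, 0) = 1) (h1 : ∀ p, F (p, 1) = 1) :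
    cls (fun q : X × T1 => F ((q.1, 0), rep q.2)) = cls (fun q : X × T1 => F ((q.1, 1), rep q.2)) := by
  have h := GLc_loop hF (fun p => (h0 p).trans (h1 p).symm)
  exact cls_htpy ⟨fun r : (X × T1) × ℝ => F ((r.1.1, r.2), rep r.1.2),
    h.comp (f := fun r : (X × T1) × ℝ => ((r.1.1, r.2), r.1.2)) (by fun_prop), fun _ => rfl, fun _ => rfl⟩

/-- matrix commutator -/
noncomputable def cmt (A B : Mat ι) : Mat ι := A * B * A⁻¹ * B⁻¹
theorem cmt_one {A B : Mat ι} (hA : IsUnit A) (hB : IsUnit B) (h : A * B = B * A) : cmt A B = 1 := by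
  rw [cmt, h, mul_assoc B A, mul_inv' hA, mul_one, mul_inv' hB]
theorem cmt_unit {A B : Mat ι} (hA : IsUnit A) (hB : IsUnit B) : IsUnit (cmt A B) :=
  ((hA.mul hB).mul (isUnit_mk (inv_mul' hA))).mul (isUnit_mk (inv_mul' hB))
theorem GLc.cmt {A B : X → Mat ι} (hA : GLc A) (hB : GLc B) : GLc fun x => cmt (A x) (B x) :=
  ((hA.mul hB).mul hA.inv).mul hB.inv
theorem cmt_mul_left {A A' B : Mat ι} (hA : IsUnit A) : cmt (A * A') B = A * cmt A' B * A⁻¹ * cmt A B * 1 := by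
  simp only [cmt, Matrix.mul_inv_rev, mul_one]
  by_cases hB : IsUnit B
  · calc A * A' * B * (A'⁻¹ * A⁻¹) * B⁻¹ = A * (A' * B * A'⁻¹) * A⁻¹ * B⁻¹ := by noncomm_ring
      _ = A * (A' * B * A'⁻¹ * (B⁻¹ * ((A⁻¹ * A) * B))) * A⁻¹ * B⁻¹ := by rw [inv_mul' hA, one_mul, inv_mul' hB, mul_one]
      _ = _ := by noncomm_ring
  · have : B⁻¹ = 0 := by
      rw [Matrix.inv_def, Ring.inverse_non_unit, zero_smul]
      rwa [← Matrix.isUnit_iff_isUnit_det]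
    simp [this]

noncomputable def ro (t : ℝ) (A : Mat ι) : Mat (ι ⊕ ι) := rot ι t * ds A 1 * rot ι (-t)
theorem ro_mul (t : ℝ) (A B : Mat ι) : ro t (A * B) = ro t A * ro t B := by
  have : ds (A * B) (1 : Mat ι) = ds A 1 * ds B 1 := by rw [ds_mul, one_mul]
  rw [ro, ro, ro, this]
  calc rot ι t * (ds A 1 * ds B 1) * rot ι (-t) = rot ι t * ds A 1 * 1 * ds B 1 * rot ι (-t) := by noncomm_ring
    _ = _ := by rw [← rot_neg_mul t]; noncomm_ring
theorem ro_one (t : ℝ) : ro t (1 : Mat ι) = 1 := by rw [ro, ds_one, mul_one, rot_mul_neg]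
theorem ro_zero (A : Mat ι) : ro 0 A = ds A 1 := by simp [ro]
theorem ro_at_one (A : Mat ι) : ro 1 A = ds 1 A := rot_one_conj A 1
theorem GLc.ro {A : X → Mat ι} (hA : GLc A) {f : X → ℝ} (hf : Continuous f) : GLc fun x => ro (f x) (A x) :=
  ((GLc_rot hf).mul (hA.ds GLc.one)).mul (GLc_rot hf.neg)
theorem ro_unit (t : ℝ) {A : Mat ι} (h : IsUnit A) : IsUnit (ro t A) := by
  refine isUnit_mk (B := ro t A⁻¹) ?_
  rw [← ro_mul, mul_inv' h, ro_one]
theorem ro_inv (t : ℝ) {A : Mat ι} (h : IsUnit A) : (ro t A)⁻¹ = ro t A⁻¹ :=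
  Matrix.inv_eq_right_inv (by rw [← ro_mul, mul_inv' h, ro_one])
theorem ds_inv {A : Mat ι} {B : Mat κ} (h : IsUnit A) (h' : IsUnit B) : (ds A B)⁻¹ = ds A⁻¹ B⁻¹ :=
  Matrix.inv_eq_right_inv (by rw [ds_mul, mul_inv' h, mul_inv' h', ds_one])
theorem cmt_ds {A B : Mat ι} {A' B' : Mat κ} (hA : IsUnit A) (hB : IsUnit B) (hA' : IsUnit A') (hB' : IsUnit B') :
    cmt (ds A A') (ds B B') = ds (cmt A B) (cmt A' B') := by
  simp only [cmt, ds_inv hA hA', ds_inv hB hB', ds_mul]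

noncomputable def can (A B : Mat ι) (t : ℝ) : Mat (ι ⊕ ι) := cmt (ro t A) (ds B 1)
theorem can_zero {A B : Mat ι} (hA : IsUnit A) (hB : IsUnit B) : can A B 0 = ds (cmt A B) 1 := by
  rw [can, ro_zero, cmt_ds hA hB isUnit_one isUnit_one, cmt_one isUnit_one isUnit_one rfl]
theorem can_one {A B : Mat ι} (hA : IsUnit A) (hB : IsUnit B) : can A B 1 = 1 := by
  rw [can, ro_at_one, cmt_ds isUnit_one hB hA isUnit_one, cmt_one isUnit_one hB (by simp), cmt_one hA isUnit_one (by simp), ds_one]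
theorem GLc.can {A B : X → Mat ι} (hA : GLc A) (hB : GLc B) {f : X → ℝ} (hf : Continuous f) : GLc fun x => can (A x) (B x) (f x) :=
  GLc.cmt (hA.ro hf) (hB.ds GLc.one)

noncomputable def cn (A B : X → Mat ι) : K1 (X × T1) := cls fun q : X × T1 => can (A q.1) (B q.1) (rep q.2)

theorem can_comm_zero {A B : Mat ι} (hA : IsUnit A) (hB : IsUnit B) (h : A * B = B * A) : can A B 0 = 1 := by
  rw [can_zero hA hB, cmt_one hA hB h, ds_one]

theorem GLc_cn {A B : X → Mat ι} (hA : GLc A) (hB : GLc B) (h : ∀ x, A x * B x = B x * A x) :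
    GLc fun q : X × T1 => can (A q.1) (B q.1) (rep q.2) :=
  GLc_loop (F := fun p : X × ℝ => can (A p.1) (B p.1) p.2) ((hA.comp continuous_fst).can (hB.comp continuous_fst) continuous_snd)
    fun x => by simp only [can_comm_zero (hA.2 x) (hB.2 x) (h x), can_one (hA.2 x) (hB.2 x)]

theorem cn_mul {A A' B : X → Mat ι} (hA : GLc A) (hA' : GLc A') (hB : GLc B) (h : ∀ x, A x * B x = B x * A x)
    (h' : ∀ x, A' x * B x = B x * A' x) : cn (fun x => A x * A' x) B = cn A B + cn A' B := by
  have key := loop_htpy (X := X) (F := fun q : (X × ℝ) × ℝ => ro (q.2 * q.1.2) (A q.1.1) * can (A' q.1.1) (B q.1.1) q.2 * (ro (q.2 * q.1.2) (A q.1.1))⁻¹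
      * can (A q.1.1) (B q.1.1) q.2) ?_ ?_ ?_
  · have e1 : ∀ q : X × T1, can (A q.1 * A' q.1) (B q.1) (rep q.2) = ro (rep q.2 * 1) (A q.1) * can (A' q.1) (B q.1) (rep q.2) * (ro (rep q.2 * 1) (A q.1))⁻¹
      * can (A q.1) (B q.1) (rep q.2) := by
      intro q
      rw [mul_one, can, ro_mul, cmt_mul_left (ro_unit _ (hA.2 _)), mul_one]; rfl
    rw [cn, show (fun q : X × T1 => can (A q.1 * A' q.1) (B q.1) (rep q.2)) = _ from funext e1]
    simp only at key
    rw [← key]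
    have c := GLc_cn hA hB h
    have c' := GLc_cn hA' hB h'
    have hd : GLc fun q : X × T1 => ds (A q.1) (1 : Mat ι) := (hA.comp continuous_fst).ds GLc.one
    simp only [mul_zero, ro_zero]
    rw [cls_mul ((hd.mul c').mul hd.inv) c, cls_conj c' hd.1 hd.inv.1 (fun q => mul_inv' (hd.2 q)), add_comm]
    rfl
  · have cA : GLc fun q : (X × ℝ) × ℝ => A q.1.1 := hA.comp (by fun_prop)
    have cA' : GLc fun q : (X × ℝ) × ℝ => A' q.1.1 := hA'.comp (by fun_prop)
    have cB : GLc fun q : (X × ℝ) × ℝ => B q.1.1 := hB.comp (by fun_prop)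
    have r : GLc fun q : (X × ℝ) × ℝ => ro (q.2 * q.1.2) (A q.1.1) := cA.ro (by fun_prop)
    exact ((r.mul (cA'.can cB (by fun_prop))).mul r.inv).mul (cA.can cB (by fun_prop))
  · intro p
    simp only [can_comm_zero (hA.2 _) (hB.2 _) (h _), can_comm_zero (hA'.2 _) (hB.2 _) (h' _), mul_one]
    exact mul_inv' (ro_unit _ (hA.2 _))
  · intro p
    simp only [can_one (hA.2 _) (hB.2 _), can_one (hA'.2 _) (hB.2 _), mul_one]
    exact mul_inv' (ro_unit _ (hA.2 _))

theorem cn_one {B : X → Mat ι} (hB : GLc B) : cn (fun _ => 1) B = 0 := by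
  rw [cn]
  simp only [can, ro_one]
  have : ∀ q : X × T1, cmt 1 (ds (B q.1) (1 : Mat ι)) = 1 := fun q => cmt_one isUnit_one (isUnit_ds (hB.2 _) isUnit_one) (by simp)
  simp only [this, cls_one]

theorem cn_inv {A B : X → Mat ι} (hA : GLc A) (hB : GLc B) (h : ∀ x, A x * B x = B x * A x) :
    cn (fun x => (A x)⁻¹) B = - cn A B := by
  rw [eq_neg_iff_add_eq_zero, ← cn_mul hA.inv hA hB ?_ h]
  · rw [← cn_one hB]; congr 1; funext x; exact inv_mul' (hA.2 x)
  · intro x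
    calc (A x)⁻¹ * B x = (A x)⁻¹ * (B x * A x) * (A x)⁻¹ := by rw [mul_assoc, mul_assoc, mul_inv' (hA.2 x), mul_one]
      _ = ((A x)⁻¹ * A x) * B x * (A x)⁻¹ := by rw [← h x]; noncomm_ring
      _ = _ := by rw [inv_mul' (hA.2 x), one_mul]

/-- deformation of the path -/
theorem cn_path {A : X × ℝ → Mat ι} {B : X → Mat ι} (hA : GLc A) (hB : GLc B) (h : ∀ x, A (x, 1) * B x = B x * A (x, 1)) :
    cls (fun q : X × T1 => can (A (q.1, 0)) (B q.1) (rep q.2) * (ds (cmt (A (q.1, rep q.2)) (B q.1)) (1 : Mat ι))⁻¹)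
      = cn (fun x => A (x, 1)) B := by
  have cB : GLc fun q : (X × ℝ) × ℝ => B q.1.1 := hB.comp (by fun_prop)
  have cA : GLc fun q : (X × ℝ) × ℝ => A (q.1.1, q.1.2) := hA.comp (f := fun q : (X × ℝ) × ℝ => (q.1.1, q.1.2)) (by fun_prop)
  have cA' : GLc fun q : (X × ℝ) × ℝ => A (q.1.1, q.1.2 + (1 - q.1.2) * q.2) :=
    hA.comp (f := fun q : (X × ℝ) × ℝ => (q.1.1, q.1.2 + (1 - q.1.2) * q.2)) (by fun_prop)
  have key := loop_htpy (X := X) (F := fun q : (X × ℝ) × ℝ => can (A (q.1.1, q.1.2)) (B q.1.1) q.2 *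
      (ds (cmt (A (q.1.1, q.1.2 + (1 - q.1.2) * q.2)) (B q.1.1)) (1 : Mat ι))⁻¹) 
      ((cA.can cB continuous_snd).mul ((cA'.cmt cB).ds GLc.one).inv) ?_ ?_
  · simp only [zero_add, sub_zero, one_mul, sub_self, zero_mul, add_zero, cmt_one (hA.2 _) (hB.2 _) (h _), ds_one, inv_one, mul_one] at key
    exact key
  · rintro ⟨x, u⟩
    simp only [mul_zero, add_zero, can_zero (hA.2 _) (hB.2 _)]
    exact mul_inv' (isUnit_ds (cmt_unit (hA.2 _) (hB.2 _)) isUnit_one)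
  · rintro ⟨x, u⟩
    simp only [mul_one, add_sub_cancel, can_one (hA.2 _) (hB.2 _), cmt_one (hA.2 _) (hB.2 _) (h _), ds_one, inv_one]
end G1
end PK

namespace PK
open Topology
section G1b
variable {X Y Z W K : Type} [TopologicalSpace X] [TopologicalSpace Y] [TopologicalSpace Z] [TopologicalSpace W]
  [TopologicalSpace K]
variable {ι κ : Type} [Fintype ι] [DecidableEq ι] [Fintype κ] [DecidableEq κ]

theorem rep_cI {f : ℝ → Z} (h : f 0 = f 1) (t : ℝ) : f (rep ((cI t : ℝ) : T1)) = f (cI t) := by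
  rcases lt_or_eq_of_le (cI_le t) with h1 | h1
  · rw [rep_coe (cI_nonneg t) h1]
  · rw [h1, T1_one, rep_zero, h]

def swp : C((X × T1) × T1, (X × T1) × T1) := ⟨fun q => ((q.1.1, q.2), q.1.2), by fun_prop⟩

theorem cr_conj (z : ℂ) {E W W' : Mat ι} (h : W * W' = 1) : W * cr (z • 1) E * W' = cr (z • 1) (W * E * W') := by
  simp only [cr, mul_add, add_mul, mul_sub, sub_mul, mul_one, h, Matrix.mul_smul, Matrix.smul_mul]

theorem kc_inv {U E : X → Mat ι} (h : Cor U E) : kc (fun x => (U x)⁻¹) E = - kc U E := by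
  have hi : Cor (fun x => (U x)⁻¹) E := ⟨h.hU.inv, h.hE, h.idem, h.inv_comm⟩
  rw [eq_neg_iff_add_eq_zero, ← kc_mul hi h]
  simp only [inv_mul' (h.hU.2 _), kc_one_left]

theorem can_conj {A g : Mat ι} (hA : IsUnit A) (hg : IsUnit g) (t : ℝ) : rot ι (-t) * can A g t * rot ι t
    = ds A 1 * (ro (-t) g * (ds A 1)⁻¹ * (ro (-t) g)⁻¹) := by
  rw [can, cmt, ro_inv _ hA, ro_inv _ hg, ds_inv hA isUnit_one, ds_inv hg isUnit_one]
  simp only [ro, neg_neg, inv_one]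
  calc _ = (rot ι (-t) * rot ι t) * ds A 1 * rot ι (-t) * ds g 1 * rot ι t * ds A⁻¹ 1 * rot ι (-t) * ds g⁻¹ 1 * rot ι t := by noncomm_ring
    _ = ds A 1 * rot ι (-t) * ds g 1 * rot ι t * ds A⁻¹ 1 * rot ι (-t) * ds g⁻¹ 1 * rot ι t := by rw [rot_neg_mul, one_mul]
    _ = _ := by noncomm_ring

set_option maxHeartbeats 400000 in
theorem sus_cn [CompactSpace X] {g P : X → Mat ι} (h : Cor g P) :
    sus X (K1.map swp (cn (fun p : X × T1 => cr (zz p.2 • 1) (P p.1)) (fun p => g p.1))) = kc g P := by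
  have hz := Cor_zc h.hE h.idem
  have cA : GLc fun p : X × T1 => cr (zz p.2 • 1) (P p.1) := hz.glc
  have cB : GLc fun p : X × T1 => g p.1 := h.hU.comp continuous_fst
  have cz : ∀ (z : ℂ) x, cr (z • 1) (P x) * g x = g x * cr (z • 1) (P x) := by
    intro z x
    simp only [cr, Matrix.mul_smul, Matrix.smul_mul, mul_one, add_mul, mul_add, sub_mul, mul_sub, h.comm, one_mul]
  have hP : Continuous fun x => ds (P x) (0 : Mat ι) := continuous_ds h.hE continuous_const
  have hPi : ∀ x, ds (P x) (0 : Mat ι) * ds (P x) 0 = ds (P x) 0 := fun x => by rw [ds_mul, h.idem, mul_zero]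
  -- the moving projection
  let Wf : X × ℝ → Mat (ι ⊕ ι) := fun p => ro (-p.2) (g p.1)
  have hW : GLc Wf := (h.hU.comp continuous_fst).ro (by fun_prop)
  let Ef : X × ℝ → Mat (ι ⊕ ι) := fun p => Wf p * ds (P p.1) 0 * (Wf p)⁻¹
  have hEf : Continuous Ef := (hW.1.mul (hP.comp continuous_fst)).mul hW.inv.1
  have hEi : ∀ p, Ef p * Ef p = Ef p := fun p => by
    calc Ef p * Ef p = Wf p * ds (P p.1) 0 * ((Wf p)⁻¹ * Wf p) * ds (P p.1) 0 * (Wf p)⁻¹ := by simp only [Ef]; noncomm_ring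
      _ = Wf p * (ds (P p.1) 0 * ds (P p.1) 0) * (Wf p)⁻¹ := by rw [inv_mul' (hW.2 _)]; noncomm_ring
      _ = _ := by rw [hPi]
  have W0 : ∀ x, Wf (x, 0) = ds (g x) 1 := fun x => by simp only [Wf, neg_zero, ro_zero]
  have W1 : ∀ x, Wf (x, 1) = ds 1 (g x) := fun x => by
    simp only [Wf, ro]
    rw [neg_neg, ← rot_one_conj 1 (g x)]
    calc _ = (rot ι (-1) * rot ι 1) * ds 1 (g x) * (rot ι (-1) * rot ι 1) := by noncomm_ring
      _ = _ := by rw [rot_neg_mul]; simp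
  have E0 : ∀ x, Ef (x, 0) = ds (P x) 0 := fun x => by
    simp only [Ef]
    rw [W0, ds_inv (h.hU.2 x) isUnit_one, ds_mul, ds_mul, ← h.comm, mul_assoc, mul_inv' (h.hU.2 x), mul_one]; simp
  have E1 : ∀ x, Ef (x, 1) = ds (P x) 0 := fun x => by
    simp only [Ef]
    rw [W1, ds_inv isUnit_one (h.hU.2 x), ds_mul, ds_mul]; simp
  let E : X × T1 → Mat (ι ⊕ ι) := fun q => Ef (q.1, rep q.2)
  have hE : Continuous E := continuous_rep hEf (fun x => (E0 x).trans (E1 x).symm)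
  have hEi' : ∀ q, E q * E q = E q := fun q => hEi _
  have hL : Lift E (fun p => Wf (p.1, cI p.2) * (ds (g p.1) (1 : Mat ι))⁻¹) := by
    refine ⟨(hW.comp (f := fun p : X × ℝ => (p.1, cI p.2)) (continuous_fst.prodMk (continuous_cI.comp continuous_snd))).mul
      ((h.hU.comp continuous_fst).ds GLc.one).inv, ?_, ?_⟩
    · intro x
      simp only [cI_zero, W0]
      exact mul_inv' (isUnit_ds (h.hU.2 x) isUnit_one)
    · intro x t
      have e : E (x, ((cI t : ℝ) : T1)) = Ef (x, cI t) :=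
        rep_cI (f := fun s => Ef (x, s)) ((E0 x).trans (E1 x).symm) t
      have e0 : E (x, 0) = ds (P x) 0 := by simp only [E, rep_zero, E0]
      rw [e, e0]
      simp only [Ef]
      have c : (ds (g x) (1 : Mat ι))⁻¹ * ds (P x) 0 = ds (P x) 0 * (ds (g x) (1 : Mat ι))⁻¹ := by
        rw [ds_inv (h.hU.2 x) isUnit_one, ds_mul, ds_mul, h.inv_comm]; simp
      calc _ = Wf (x, cI t) * ((ds (g x) (1 : Mat ι))⁻¹ * ds (P x) 0) := by noncomm_ring
        _ = Wf (x, cI t) * ds (P x) 0 * 1 * (ds (g x) (1 : Mat ι))⁻¹ := by rw [c]; noncomm_ring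
        _ = _ := by rw [← inv_mul' (hW.2 (x, cI t))]; noncomm_ring
  have hcl : clF E = - kc g P := by
    rw [clF_eq hL hE hEi']
    have e0 : ∀ x, E (x, 0) = ds (P x) 0 := fun x => by simp only [E, rep_zero, E0]
    have e1 : ∀ x, Wf (x, cI 1) * (ds (g x) (1 : Mat ι))⁻¹ = ds (g x)⁻¹ (g x) := fun x => by
      rw [cI_one, W1, ds_inv (h.hU.2 x) isUnit_one, ds_mul]; simp
    simp only [e0, e1]
    have hi : Cor (fun x => (g x)⁻¹) P := ⟨h.hU.inv, h.hE, h.idem, h.inv_comm⟩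
    have h0 : Cor g (fun _ => (0 : Mat ι)) := ⟨h.hU, continuous_const, by simp, by simp⟩
    rw [kc_ds hi h0, kc_zero, add_zero, kc_inv h]
  -- the class
  have key := loop_htpy (X := X × T1) (F := fun q : ((X × T1) × ℝ) × ℝ => rot ι (-(q.1.2 * q.2)) * can (cr (zz q.1.1.2 • 1) (P q.1.1.1)) (g q.1.1.1) q.2
      * rot ι (q.1.2 * q.2)) ?_ ?_ ?_
  · simp only [zero_mul, neg_zero, one_mul] at key
    have r0 : rot ι 0 = 1 := by have := rot_mul_neg (ι := ι) 0; simp [rot]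
    simp only [r0, one_mul, mul_one] at key
    rw [cn, key]
    have hP1 : Continuous fun q : X × T1 => ds (P q.1) (0 : Mat ι) := hP.comp continuous_fst
    have z1 := (Cor_zc hP1 (fun q => hPi _)).glc
    have z2 := (Cor_zc hE hEi').glc
    have e : ∀ q : (X × T1) × T1, rot ι (-rep q.2) * can (cr (zz q.1.2 • 1) (P q.1.1)) (g q.1.1) (rep q.2) * rot ι (rep q.2)
        = cr (zz q.1.2 • 1) (ds (P q.1.1) (0 : Mat ι)) * (cr (zz q.1.2 • 1) (E (q.1.1, q.2)))⁻¹ := by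
      intro q
      rw [can_conj (cA.2 _) (h.hU.2 _)]
      have hd : ds (cr (zz q.1.2 • 1) (P q.1.1)) (1 : Mat ι) = cr (zz q.1.2 • 1) (ds (P q.1.1) (0 : Mat ι)) := by
        have := cr_ds (zz q.1.2 • 1) (P q.1.1) (zz q.1.2 • 1) (0 : Mat ι)
        rw [cr_zero] at this
        rw [← this]; congr 1
        rw [← ds_smul, ds_one]
      rw [hd]
      congr 1
      have hw : Wf (q.1.1, rep q.2) * (Wf (q.1.1, rep q.2))⁻¹ = 1 := mul_inv' (hW.2 _)
      have := cr_conj (zz q.1.2) (E := ds (P q.1.1) (0 : Mat ι)) hw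
      simp only [E, Ef]
      rw [← this, Matrix.mul_inv_rev, Matrix.mul_inv_rev, Matrix.nonsing_inv_nonsing_inv _ ((Matrix.isUnit_iff_isUnit_det _).1 (hW.2 _)), ← mul_assoc]
    simp only [e]
    have gl : GLc fun q : (X × T1) × T1 => cr (zz q.1.2 • 1) (ds (P q.1.1) (0 : Mat ι)) * (cr (zz q.1.2 • 1) (E (q.1.1, q.2)))⁻¹ :=
      (z1.comp (swp (X := X)).continuous).mul (z2.comp (swp (X := X)).continuous).inv
    rw [K1.map_cls _ gl]
    have := cls_mul z1 z2.inv
    rw [cls_inv z2, ← sub_eq_add_neg] at this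
    refine (congrArg _ this).trans ?_
    rw [map_sub]
    refine (congrArg₂ _ (sus_zc hP1 (fun q => hPi _)) (sus_zc hE hEi')).trans ?_
    rw [clF_const hP hPi, hcl]; simp
  · have f1 : GLc fun q : ((X × T1) × ℝ) × ℝ => can (cr (zz q.1.1.2 • 1) (P q.1.1.1)) (g q.1.1.1) q.2 :=
      (cA.comp (f := fun q : ((X × T1) × ℝ) × ℝ => q.1.1) (by fun_prop)).can (cB.comp (f := fun q : ((X × T1) × ℝ) × ℝ => q.1.1) (by fun_prop)) (by fun_prop)
    exact ((GLc_rot (by fun_prop)).mul f1).mul (GLc_rot (by fun_prop))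
  · intro p
    simp only [can_comm_zero (cA.2 p.1) (h.hU.2 _) (cz _ _), mul_one]
    exact rot_neg_mul _
  · intro p
    simp only [can_one (cA.2 p.1) (h.hU.2 _), mul_one]
    exact rot_neg_mul _
end G1b
end PK

namespace PK
open Topology
section G1c
variable {X Y Z W K : Type} [TopologicalSpace X] [TopologicalSpace Y] [TopologicalSpace Z] [TopologicalSpace W]
  [TopologicalSpace K]
variable {ι κ : Type} [Fintype ι] [DecidableEq ι] [Fintype κ] [DecidableEq κ]

theorem cr_ds0 (z : ℂ) (E : Mat ι) : ds (cr (z • 1) E) (1 : Mat κ) = cr (z • 1) (ds E (0 : Mat κ)) := by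
  have := cr_ds (z • 1) E (z • 1) (0 : Mat κ)
  rw [cr_zero] at this
  rw [← this]; congr 1
  rw [← ds_smul, ds_one]

/-- `1 ⊗ M` -/
def bl (ι : Type) [Fintype ι] [DecidableEq ι] (M : Mat (Fin 2)) : Mat (ι ⊕ ι) :=
  Matrix.fromBlocks (M 0 0 • 1) (M 0 1 • 1) (M 1 0 • 1) (M 1 1 • 1)
theorem bl_mul (M N : Mat (Fin 2)) : bl ι (M * N) = bl ι M * bl ι N := by
  simp only [bl, Matrix.fromBlocks_multiply, Matrix.mul_apply, Fin.sum_univ_two, Matrix.smul_mul, Matrix.mul_smul, smul_smul, mul_one, add_smul, mul_comm]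
theorem bl_one : bl ι 1 = 1 := by simp [bl]
theorem bl_add (M N : Mat (Fin 2)) : bl ι (M + N) = bl ι M + bl ι N := by
  simp [bl, Matrix.fromBlocks_add, add_smul]
theorem bl_smul (z : ℂ) (M : Mat (Fin 2)) : bl ι (z • M) = z • bl ι M := by
  simp [bl, Matrix.fromBlocks_smul, smul_smul]
theorem bl_sub (M N : Mat (Fin 2)) : bl ι (M - N) = bl ι M - bl ι N := by
  have : M - N = M + (-1 : ℂ) • N := by simp [sub_eq_add_neg]
  rw [this, bl_add, bl_smul]; simp [sub_eq_add_neg]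
theorem bl_cr (z : ℂ) (E : Mat (Fin 2)) : bl ι (cr (z • 1) E) = cr (z • 1) (bl ι E) := by
  simp [cr, bl_add, bl_smul, bl_sub, bl_one]
theorem bl_comm (g : Mat ι) (M : Mat (Fin 2)) : bl ι M * ds g g = ds g g * bl ι M := by
  simp [bl, ds, Matrix.fromBlocks_multiply]
theorem bl_inv {M : Mat (Fin 2)} (h : IsUnit M) : (bl ι M)⁻¹ = bl ι M⁻¹ :=
  Matrix.inv_eq_right_inv (by rw [← bl_mul, mul_inv' h, bl_one])
theorem bl_unit {M : Mat (Fin 2)} (h : IsUnit M) : IsUnit (bl ι M) :=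
  isUnit_mk (B := bl ι M⁻¹) (by rw [← bl_mul, mul_inv' h, bl_one])
theorem continuous_bl : Continuous (bl ι) := by
  unfold bl
  exact Continuous.matrix_fromBlocks (by fun_prop) (by fun_prop) (by fun_prop) (by fun_prop)

noncomputable def r2 (t : ℝ) : Mat (Fin 2) :=
  !![(Real.cos (Real.pi * t / 2) : ℂ), -(Real.sin (Real.pi * t / 2) : ℂ); (Real.sin (Real.pi * t / 2) : ℂ), (Real.cos (Real.pi * t / 2) : ℂ)]
theorem bl_r2 (t : ℝ) : bl ι (r2 t) = rot ι t := by
  simp [bl, r2, rot]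
theorem r2_mul (t : ℝ) : r2 t * r2 (-t) = 1 := by
  have h := cs_sq (Real.pi * t / 2)
  simp only [r2, mul_neg, neg_div, Real.cos_neg, Real.sin_neg, Matrix.mul_fin_two, Matrix.one_fin_two]
  push_cast at h ⊢
  ext i j
  fin_cases i <;> fin_cases j <;> simp
  · linear_combination h
  · ring
  · ring
  · linear_combination h
theorem continuous_r2 : Continuous r2 := by
  unfold r2
  refine continuous_matrix fun i j => ?_
  fin_cases i <;> fin_cases j <;> simp <;> fun_prop
theorem r2_star (t : ℝ) : star (r2 t) = r2 (-t) := by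
  ext i j
  fin_cases i <;> fin_cases j <;> simp [r2, Matrix.star_apply, neg_div, ← Complex.ofReal_mul, ← Complex.ofReal_div, -Complex.ofReal_cos, -Complex.ofReal_sin, Complex.conj_ofReal] <;> simp

def e0 : Mat (Fin 2) := !![1, 0; 0, 0]
theorem e0_idem : e0 * e0 = e0 := by ext i j; fin_cases i <;> fin_cases j <;> simp [e0, Matrix.mul_apply]
theorem cr_e0 (z : ℂ) : cr (z • 1) e0 = !![z, 0; 0, 1] := by
  ext i j
  fin_cases i <;> fin_cases j <;> simp [cr, e0]
theorem bl_e0 : bl ι e0 = ds 1 0 := by simp [bl, e0, ds]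
theorem cr_smul_mul {E : Mat ι} (h : E * E = E) (z w : ℂ) : cr (z • 1) E * cr (w • 1) E = cr ((z * w) • 1) E := by
  rw [cr_mul h (by simp)]; simp [smul_smul, mul_comm]
  
noncomputable def Kz (z : ℂ) (t : ℝ) : Mat (Fin 2) := r2 t * cr (z • 1) e0 * r2 (-t)
theorem Kz_mul (z w : ℂ) (t : ℝ) : Kz z t * Kz w t = Kz (z * w) t := by
  have h := r2_mul (-t)
  rw [neg_neg] at h
  calc Kz z t * Kz w t = r2 t * cr (z • 1) e0 * (r2 (-t) * r2 t) * cr (w • 1) e0 * r2 (-t) := by simp only [Kz]; noncomm_ring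
    _ = r2 t * (cr (z • 1) e0 * cr (w • 1) e0) * r2 (-t) := by rw [h]; noncomm_ring
    _ = _ := by rw [cr_smul_mul e0_idem, Kz]
theorem Kz_one (t : ℝ) : Kz 1 t = 1 := by rw [Kz, one_smul, cr_one_left, mul_one, r2_mul]
theorem Kz_inv {z : ℂ} (h : z ≠ 0) (t : ℝ) : Kz z t * Kz z⁻¹ t = 1 := by rw [Kz_mul, mul_inv_cancel₀ h, Kz_one]
theorem Kz_inv' {z : ℂ} (h : z ≠ 0) (t : ℝ) : Kz z⁻¹ t * Kz z t = 1 := by rw [Kz_mul, inv_mul_cancel₀ h, Kz_one]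
theorem bl_Kz (z : ℂ) (t : ℝ) : bl ι (Kz z t) = ro t (z • 1) := by
  rw [Kz, bl_mul, bl_mul, bl_r2, bl_r2, bl_cr, bl_e0, ro, ← cr_ds0, cr_one_right]
theorem Kz_zero (z : ℂ) : Kz z 0 = !![z, 0; 0, 1] := by
  have : r2 0 = 1 := by simp [r2, Matrix.one_fin_two]
  rw [Kz, cr_e0, neg_zero, this]; simp
theorem Kz_at_one (z : ℂ) : Kz z 1 = !![1, 0; 0, z] := by
  rw [Kz, cr_e0]
  simp [r2, neg_div]
theorem continuous_Kz : Continuous fun p : ℂ × ℝ => Kz p.1 p.2 := by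
  simp only [Kz, cr_e0]
  refine ((continuous_r2.comp continuous_snd).mul ?_).mul (continuous_r2.comp continuous_snd.neg)
  refine continuous_matrix fun i j => ?_
  fin_cases i <;> fin_cases j <;> simp <;> fun_prop

noncomputable def Pz (z : ℂ) (t : ℝ) : Mat (Fin 2) := Kz z t * e0 * Kz z⁻¹ t
theorem Pz_idem {z : ℂ} (h : z ≠ 0) (t : ℝ) : Pz z t * Pz z t = Pz z t := by
  calc Pz z t * Pz z t = Kz z t * e0 * (Kz z⁻¹ t * Kz z t) * e0 * Kz z⁻¹ t := by simp only [Pz]; noncomm_ring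
    _ = Kz z t * (e0 * e0) * Kz z⁻¹ t := by rw [Kz_inv' h]; noncomm_ring
    _ = _ := by rw [e0_idem, Pz]
theorem Pz_zero {z : ℂ} (h : z ≠ 0) : Pz z 0 = e0 := by
  rw [Pz, Kz_zero, Kz_zero]; ext i j; fin_cases i <;> fin_cases j <;> simp [e0, h, Matrix.mul_apply]
theorem Pz_at_one {z : ℂ} (h : z ≠ 0) : Pz z 1 = e0 := by
  rw [Pz, Kz_at_one, Kz_at_one]; ext i j; fin_cases i <;> fin_cases j <;> simp [e0, h, Matrix.mul_apply]
theorem Pz_one (t : ℝ) : Pz 1 t = e0 := by simp [Pz, Kz_one]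
/-- projection over the two-torus -/
noncomputable def Pt (x t : T1) : Mat (Fin 2) := Pz (zz x) (rep t)
theorem continuous_Pt : Continuous fun p : T1 × T1 => Pt p.1 p.2 := by
  have := continuous_Kz
  refine continuous_rep (f := fun p : T1 × ℝ => Pz (zz p.1) p.2) ?_ fun x => (Pz_zero (zz_ne x)).trans (Pz_at_one (zz_ne x)).symm
  unfold Pz
  have c1 : Continuous fun p : T1 × ℝ => Kz (zz p.1) p.2 := this.comp (f := fun p : T1 × ℝ => (zz p.1, p.2)) ((continuous_zz.comp continuous_fst).prodMk continuous_snd)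
  have c2 : Continuous fun p : T1 × ℝ => Kz (zz p.1)⁻¹ p.2 :=
    this.comp (f := fun p : T1 × ℝ => ((zz p.1)⁻¹, p.2)) (((continuous_zz.comp continuous_fst).inv₀ (fun p => zz_ne _)).prodMk continuous_snd)
  exact (c1.mul continuous_const).mul c2
theorem Pt_idem (x t : T1) : Pt x t * Pt x t = Pt x t := Pz_idem (zz_ne x) _
theorem Pt_zero (x : T1) : Pt x 0 = e0 := by rw [Pt, rep_zero, Pz_zero (zz_ne x)]
theorem Pt_zero' (t : T1) : Pt 0 t = e0 := by rw [Pt, zz_zero, Pz_one]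

noncomputable def zm (x t s : T1) : Mat (Fin 2) := cr (zz s • 1) (Pt x t) * (cr (zz s • 1) e0)⁻¹
theorem cr_star {z : ℂ} (hz : ‖z‖ = 1) {E : Mat (Fin 2)} (h : star E = E) (hi : E * E = E) : cr (z • 1) E ∈ Matrix.unitaryGroup (Fin 2) ℂ := by
  rw [Matrix.mem_unitaryGroup_iff]
  have : star (cr (z • 1) E) = cr (star z • 1) E := by simp [cr, star_add, star_sub, star_mul, h]
  rw [this, cr_smul_mul hi]
  have : z * star z = 1 := by
    have := Complex.mul_conj' z; rw [hz] at this; simpa using this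
  rw [this, one_smul, cr_one_left]
theorem Pt_star (x t : T1) : star (Pt x t) = Pt x t := by
  have hk : ∀ z t, star (Kz z t) = Kz (star z) t := by
    intro z t
    have : star (cr (z • 1) e0) = cr (star z • 1) e0 := by
      rw [cr_e0, cr_e0]; ext i j; fin_cases i <;> fin_cases j <;> simp [Matrix.star_apply]
    rw [Kz, star_mul, star_mul, r2_star, r2_star, this, neg_neg, Kz, mul_assoc]
  have he : star e0 = e0 := by ext i j; fin_cases i <;> fin_cases j <;> simp [e0, Matrix.star_apply]
  have hz : star (zz x) = (zz x)⁻¹ := by rw [Complex.star_def, Complex.inv_eq_conj (zz_norm x)]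
  rw [Pt, Pz, star_mul, star_mul, hk, hk, he, ← mul_assoc, hz, star_inv₀, hz, inv_inv]
theorem det_cr_Pt (x t : T1) (z : ℂ) : (cr (z • 1) (Pt x t)).det = z := by
  have := cr_conj z (E := e0) (Kz_inv (zz_ne x) (rep t))
  rw [Pt, Pz, ← this, Matrix.det_mul, Matrix.det_mul, mul_right_comm, ← Matrix.det_mul, Kz_inv (zz_ne x), cr_e0]; simp
theorem zm_mem (x t s : T1) : zm x t s ∈ Matrix.unitaryGroup (Fin 2) ℂ := by
  have h0 : cr (zz s • 1) e0 ∈ Matrix.unitaryGroup (Fin 2) ℂ := by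
    rw [← Pt_zero 0]; exact cr_star (zz_norm s) (Pt_star _ _) (Pt_idem _ _)
  have := mul_mem (cr_star (zz_norm s) (Pt_star x t) (Pt_idem x t)) (Unitary.star_mem h0)
  rwa [zm, Matrix.inv_eq_right_inv ((Matrix.mem_unitaryGroup_iff).1 h0)]
theorem cz_unit (x t s : T1) : IsUnit (cr (zz s • 1) (Pt x t)) :=
  isUnit_mk (B := cr ((zz s)⁻¹ • 1) (Pt x t)) (by rw [cr_smul_mul (Pt_idem x t), mul_inv_cancel₀ (zz_ne s), one_smul, cr_one_left])
theorem zm_det (x t s : T1) : (zm x t s).det = 1 := by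
  have h0 : (cr (zz s • 1) e0).det = zz s := by rw [← Pt_zero 0]; exact det_cr_Pt _ _ _
  rw [zm, Matrix.det_mul, det_cr_Pt, Matrix.det_nonsing_inv, h0, Ring.inverse_eq_inv', mul_inv_cancel₀ (zz_ne s)]
noncomputable def kz0 (x t s : T1) : G := ⟨⟨zm x t s, zm_mem x t s⟩, zm_det x t s⟩
theorem V_kz0 (x t s : T1) : V (kz0 x t s) = zm x t s := rfl
theorem GLc_cz : GLc fun p : (T1 × T1) × T1 => cr (zz p.2 • 1) (Pt p.1.1 p.1.2) :=
  (Cor_zc (X := T1 × T1) (E := fun p => Pt p.1 p.2) continuous_Pt (fun p => Pt_idem _ _)).glc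
theorem GLc_ce : GLc fun p : (T1 × T1) × T1 => cr (zz p.2 • 1) e0 :=
  (Cor_zc (X := T1 × T1) (E := fun p => e0) continuous_const (fun p => e0_idem)).glc
theorem GLc_zm : GLc fun p : (T1 × T1) × T1 => zm p.1.1 p.1.2 p.2 := GLc_cz.mul GLc_ce.inv
theorem zm_one (x t s : T1) (h : x = 0 ∨ t = 0 ∨ s = 0) : zm x t s = 1 := by
  have he := cz_unit 0 0 s
  rw [Pt_zero] at he
  rcases h with rfl | rfl | rfl
  · rw [zm, Pt_zero', mul_inv' he]
  · rw [zm, Pt_zero, mul_inv' he]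
  · rw [zm, zz_zero, one_smul, cr_one_left, cr_one_left]; simp

noncomputable def kz : C(T 3, G) := ⟨fun a => kz0 a.1.1.2 a.1.2 a.2, continuous_G
  (GLc_zm.1.comp (f := fun a : ((Unit × T1) × T1) × T1 => ((a.1.1.2, a.1.2), a.2)) (by fun_prop))⟩
theorem kz_fw (a : T 3) (h : fw 3 a) : kz a = 1 := by
  apply V_inj
  refine zm_one _ _ _ ?_
  rcases h with (((h | h) | h) | h)
  · exact h.elim
  · exact Or.inl h
  · exact Or.inr (Or.inl h)
  · exact Or.inr (Or.inr h)
end G1c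
end PK

namespace PK
open Topology
section G1d
variable {X Y Z W K : Type} [TopologicalSpace X] [TopologicalSpace Y] [TopologicalSpace Z] [TopologicalSpace W]
  [TopologicalSpace K]
variable {ι κ : Type} [Fintype ι] [DecidableEq ι] [Fintype κ] [DecidableEq κ]

theorem deg_kz : degT 1 (K1.map kz (cls V)) = -1 := by
  have hc : Continuous fun q : (Unit × T1) × T1 => Pt q.1.2 q.2 :=
    continuous_Pt.comp (f := fun q : (Unit × T1) × T1 => (q.1.2, q.2)) (by fun_prop)
  have hi : ∀ q : (Unit × T1) × T1, Pt q.1.2 q.2 * Pt q.1.2 q.2 = Pt q.1.2 q.2 := fun q => Pt_idem _ _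
  have hc0 : Continuous fun q : (Unit × T1) => e0 := continuous_const
  have z1 := (Cor_zc hc hi).glc
  have z2 := (Cor_zc (X := (Unit × T1) × T1) (E := fun q => e0) continuous_const (fun _ => e0_idem)).glc
  have hL : Lift (fun q : (Unit × T1) × T1 => Pt q.1.2 q.2) (fun p => Kz (zz p.1.2) (cI p.2) * Kz (zz p.1.2)⁻¹ 0) := by
    refine ⟨GLc.of_inv (v := fun p => Kz (zz p.1.2) 0 * Kz (zz p.1.2)⁻¹ (cI p.2)) ?_ ?_, ?_, ?_⟩
    · have c1 : Continuous fun p : (Unit × T1) × ℝ => Kz (zz p.1.2) (cI p.2) :=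
        continuous_Kz.comp (f := fun p : (Unit × T1) × ℝ => (zz p.1.2, cI p.2))
          ((continuous_zz.comp (by fun_prop)).prodMk (continuous_cI.comp continuous_snd))
      have c2 : Continuous fun p : (Unit × T1) × ℝ => Kz (zz p.1.2)⁻¹ 0 :=
        continuous_Kz.comp (f := fun p : (Unit × T1) × ℝ => ((zz p.1.2)⁻¹, 0))
          (((continuous_zz.comp (by fun_prop)).inv₀ (fun p => zz_ne _)).prodMk continuous_const)
      exact c1.mul c2
    · intro p
      calc _ = Kz (zz p.1.2) (cI p.2) * (Kz (zz p.1.2)⁻¹ 0 * Kz (zz p.1.2) 0) * Kz (zz p.1.2)⁻¹ (cI p.2) := by noncomm_ring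
        _ = 1 := by rw [Kz_inv' (zz_ne _), mul_one, Kz_inv (zz_ne _)]
    · intro x
      simp only [cI_zero]
      exact Kz_inv (zz_ne _) _
    · intro x t
      have e : Pt x.2 ((cI t : ℝ) : T1) = Pz (zz x.2) (cI t) :=
        rep_cI (f := fun s => Pz (zz x.2) s) ((Pz_zero (zz_ne _)).trans (Pz_at_one (zz_ne _)).symm) t
      simp only [e, Pt_zero]
      have c : Kz (zz x.2)⁻¹ 0 * e0 = e0 * Kz (zz x.2)⁻¹ 0 := by
        rw [Kz_zero]; ext i j; fin_cases i <;> fin_cases j <;> simp [e0, Matrix.mul_apply]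
      rw [Pz]
      calc _ = Kz (zz x.2) (cI t) * (Kz (zz x.2)⁻¹ 0 * e0) := by noncomm_ring
        _ = Kz (zz x.2) (cI t) * e0 * 1 * Kz (zz x.2)⁻¹ 0 := by rw [c]; noncomm_ring
        _ = _ := by rw [← Kz_inv' (zz_ne x.2) (cI t)]; noncomm_ring
  have e1 : K1.map kz (cls V) = zc (fun q : (Unit × T1) × T1 => Pt q.1.2 q.2) - zc (fun q : (Unit × T1) × T1 => e0) := by
    rw [K1.map_cls _ GLc_V, sub_eq_add_neg]
    refine Eq.trans ?_ ((cls_mul z1 z2.inv).trans (congrArg₂ _ rfl (cls_inv z2)))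
    rfl
  have e2 : clF (fun q : (Unit × T1) × T1 => Pt q.1.2 q.2) = - zc (fun q : Unit => e0) := by
    rw [clF_eq hL hc hi]
    have c0 := Cor_zc (X := Unit) (E := fun q => e0) continuous_const (fun _ => e0_idem)
    rw [zc, ← kc_inv c0]
    simp only [cI_one, Pt_zero]
    refine kc_congr fun x => ?_
    have : (zz x.2 • (1 : Mat (Fin 2)))⁻¹ = (zz x.2)⁻¹ • 1 := Matrix.inv_eq_right_inv (by simp [smul_smul, zz_ne])
    rw [this, Kz_zero, Kz_at_one]
    ext i j; fin_cases i <;> fin_cases j <;> simp [e0, Matrix.mul_apply]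
  show deg0 (sus (Unit × T1) (K1.map kz (cls V))) = -1
  rw [e1]
  refine (congrArg deg0 (map_sub _ _ _)).trans ?_
  rw [sus_zc hc hi, sus_zc (E := fun q : (Unit × T1) × T1 => e0) continuous_const (fun _ => e0_idem)]
  have := clF_const hc0 (fun _ => e0_idem)
  rw [this, e2, sub_zero, map_neg, deg0, hat_zc _ continuous_const (fun _ => e0_idem)]
  congr 1
  exact rk_of (by simp [e0, Matrix.trace_fin_two])

theorem cr_conj' {D e k k' : Mat ι} (h : k * k' = 1) (hc : k' * D = D * k') : cr D (k * e * k') = k * cr D e * k' := by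
  calc cr D (k * e * k') = k * e * (k' * D) + (1 - k * e * k') := by rw [cr]; noncomm_ring
    _ = k * e * (D * k') + (k * k' - k * e * k') := by rw [hc, h]
    _ = _ := by rw [cr]; noncomm_ring
theorem cr_d10 (g : Mat ι) : cr (ds g g) (ds 1 0) = ds g (1 : Mat ι) := by
  rw [cr_ds, cr_one_right, cr_zero]

theorem cr_can {g : Mat ι} (hg : IsUnit g) (x t : T1) :
    cr (ds g g) (bl ι (Pt x t)) = can (zz x • 1) g (rep t) * ds g 1 := by
  have hz : IsUnit (zz x • (1 : Mat ι)) := GLc_zz.2 (x, x)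
  have hK : bl ι (Kz (zz x) (rep t)) * bl ι (Kz (zz x)⁻¹ (rep t)) = 1 := by rw [← bl_mul, Kz_inv (zz_ne _), bl_one]
  have hzi : (zz x • (1 : Mat ι))⁻¹ = (zz x)⁻¹ • 1 := Matrix.inv_eq_right_inv (by simp [smul_smul, zz_ne])
  have hK' : bl ι (Kz (zz x)⁻¹ (rep t)) = (ro (rep t) (zz x • (1 : Mat ι)))⁻¹ := by
    rw [bl_Kz, ro_inv _ hz, hzi]
  rw [can, cmt, ← hK', ← bl_Kz, mul_assoc, inv_mul' (isUnit_ds hg isUnit_one), mul_one, Pt, Pz, bl_mul, bl_mul, bl_e0]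
  rw [cr_conj' hK (bl_comm g _), cr_d10]

abbrev B2 (X : Type) : Type := (X × T1) × T1
theorem sus_pr2 [CompactSpace X] {g : X → Mat ι} (hg : GLc g) : sus X (cls fun p : B2 X => g p.1.1) = 0 := by
  have h1 : GLc fun p : X × T1 => g p.1 := hg.comp continuous_fst
  have := sus_pr (cls fun p : X × T1 => g p.1)
  rwa [K1.map_cls _ h1] at this

theorem sus_cn1 [CompactSpace X] {g : X → Mat ι} (hg : GLc g) :
    sus X (cls fun p : B2 X => can (zz p.2 • 1) (g p.1.1) (rep p.1.2)) = cls g := by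
  have h := sus_cn (Cor.one hg)
  simp only [cr_one_right] at h
  rw [cn, K1.map_cls _ (GLc_cn GLc_zz (hg.comp continuous_fst) (fun p => by simp))] at h
  rw [kc_one_right] at h
  exact h

set_option maxHeartbeats 400000 in
theorem sigma1 [CompactSpace X] {g : X → Mat ι} (hg : GLc g) :
    sus (B2 X) (K1.map swp (cn (fun p : B2 X × T1 => ds (bl ι (zm p.1.2 p.1.1.2 p.2)) (1 : Mat κ))
      (fun p => ds (ds (g p.1.1.1) (g p.1.1.1)) 1)))
      = kc (fun p : B2 X => ds (g p.1.1) (g p.1.1)) (fun p => bl ι (Pt p.2 p.1.2)) - kc (fun p : B2 X => ds (g p.1.1) (g p.1.1)) (fun p => bl ι e0) := by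
  have cg : GLc fun p : B2 X => g p.1.1 := hg.comp (by fun_prop)
  have cP : Cor (fun p : B2 X => ds (g p.1.1) (g p.1.1)) (fun p => bl ι (Pt p.2 p.1.2)) :=
    ⟨cg.ds cg, continuous_bl.comp (continuous_Pt.comp (f := fun p : B2 X => (p.2, p.1.2)) (by fun_prop)),
      fun p => by rw [← bl_mul, Pt_idem], fun p => bl_comm _ _⟩
  have cE : Cor (fun p : B2 X => ds (g p.1.1) (g p.1.1)) (fun p => bl ι e0) :=
    ⟨cg.ds cg, continuous_const, fun p => by rw [← bl_mul, e0_idem], fun p => bl_comm _ _⟩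
  have c1 : Cor (fun p : B2 X => (1 : Mat κ)) (fun p => 0) := ⟨GLc.one, continuous_const, by simp, by simp⟩
  have ext : ∀ {P : B2 X → Mat (ι ⊕ ι)}, Cor (fun p : B2 X => ds (g p.1.1) (g p.1.1)) P →
      Cor (fun p : B2 X => ds (ds (g p.1.1) (g p.1.1)) (1 : Mat κ)) (fun p => ds (P p) 0) := fun {P} h =>
    ⟨h.hU.ds GLc.one, continuous_ds h.hE continuous_const, fun p => by rw [ds_mul, h.idem, mul_zero],
      fun p => by rw [ds_mul, ds_mul, h.comm]; simp⟩
  have sP := sus_cn (ext cP)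
  have sE := sus_cn (ext cE)
  rw [kc_ds cP c1, kc_zero, add_zero] at sP
  rw [kc_ds cE c1, kc_zero, add_zero] at sE
  have gP := (Cor_zc (ext cP).hE (ext cP).idem).glc
  have gE := (Cor_zc (ext cE).hE (ext cE).idem).glc
  have gB : GLc fun p : B2 X × T1 => ds (ds (g p.1.1.1) (g p.1.1.1)) (1 : Mat κ) := (ext cP).hU.comp continuous_fst
  have comm : ∀ (z : ℂ) {P B : Mat ((ι ⊕ ι) ⊕ κ)}, P * B = B * P → cr (z • 1) P * B = B * cr (z • 1) P := by
    intro z P B h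
    simp only [cr, Matrix.mul_smul, Matrix.smul_mul, mul_one, add_mul, mul_add, sub_mul, mul_sub, h, one_mul]
  have hA : ∀ p : B2 X × T1, ds (bl ι (zm p.1.2 p.1.1.2 p.2)) (1 : Mat κ)
      = cr (zz p.2 • 1) (ds (bl ι (Pt p.1.2 p.1.1.2)) 0) * (cr (zz p.2 • 1) (ds (bl ι e0) 0))⁻¹ := by
    intro p
    have he : IsUnit (cr (zz p.2 • 1) e0) := GLc_ce.2 ((0, 0), p.2)
    have e1 : (cr (zz p.2 • 1) (ds (bl ι e0) (0 : Mat κ)))⁻¹ = ds (bl ι (cr (zz p.2 • 1) e0)⁻¹) 1 := by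
      rw [← cr_ds0, ← bl_cr, ds_inv (bl_unit he) isUnit_one, bl_inv he, inv_one]
    rw [e1, zm, bl_mul, ← cr_ds0, ← bl_cr, ds_mul, one_mul]
  have hcm : ∀ p : B2 X × T1, (cr (zz p.2 • 1) (ds (bl ι e0) (0 : Mat κ)))⁻¹ * ds (ds (g p.1.1.1) (g p.1.1.1)) (1 : Mat κ)
      = ds (ds (g p.1.1.1) (g p.1.1.1)) (1 : Mat κ) * (cr (zz p.2 • 1) (ds (bl ι e0) (0 : Mat κ)))⁻¹ := by
    intro p
    have h1 := comm (zz p.2) ((ext cE).comm p.1)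
    have h2 := gE.2 p
    simp only at h1 h2
    calc _ = (cr (zz p.2 • 1) (ds (bl ι e0) (0 : Mat κ)))⁻¹ * (ds (ds (g p.1.1.1) (g p.1.1.1)) (1 : Mat κ) * cr (zz p.2 • 1) (ds (bl ι e0) (0 : Mat κ)))
          * (cr (zz p.2 • 1) (ds (bl ι e0) (0 : Mat κ)))⁻¹ := by rw [mul_assoc, mul_assoc, mul_inv' h2, mul_one]
      _ = _ := by rw [← h1, ← mul_assoc, inv_mul' h2, one_mul]
  have hcn : cn (fun p : B2 X × T1 => ds (bl ι (zm p.1.2 p.1.1.2 p.2)) (1 : Mat κ)) (fun p => ds (ds (g p.1.1.1) (g p.1.1.1)) 1)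
      = cn (fun p : B2 X × T1 => cr (zz p.2 • 1) (ds (bl ι (Pt p.1.2 p.1.1.2)) (0 : Mat κ))) (fun p => ds (ds (g p.1.1.1) (g p.1.1.1)) 1)
       - cn (fun p : B2 X × T1 => cr (zz p.2 • 1) (ds (bl ι e0) (0 : Mat κ))) (fun p => ds (ds (g p.1.1.1) (g p.1.1.1)) 1) := by
    rw [sub_eq_add_neg, ← cn_inv gE gB (fun p => comm _ ((ext cE).comm p.1)), ← cn_mul gP gE.inv gB (fun p => comm _ ((ext cP).comm p.1)) hcm]
    congr 1
    exact funext hA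
  rw [hcn, map_sub, map_sub, sP, sE]

set_option maxHeartbeats 400000 in
theorem sigma_eval [CompactSpace X] {g : X → Mat ι} (hg : GLc g) :
    sus X (sus (B2 X) (K1.map swp (cn (fun p : B2 X × T1 => ds (bl ι (zm p.1.2 p.1.1.2 p.2)) (1 : Mat κ))
      (fun p => ds (ds (g p.1.1.1) (g p.1.1.1)) 1)))) = cls g := by
  rw [sigma1 hg, map_sub]
  have cg : GLc fun p : B2 X => g p.1.1 := hg.comp (by fun_prop)
  have t2 : sus X (kc (fun p : B2 X => ds (g p.1.1) (g p.1.1)) (fun p => bl ι e0)) = 0 := by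
    simp only [bl_e0]
    have c0 : Cor (fun p : B2 X => g p.1.1) (fun p => 0) := ⟨cg, continuous_const, by simp, by simp⟩
    rw [kc_ds (Cor.one cg) c0, kc_zero, add_zero, kc_one_right]
    exact sus_pr2 hg
  rw [t2, sub_zero]
  have gc0 : GLc fun q : (X × T1) × T1 => can (zz q.1.2 • 1) (g q.1.1) (rep q.2) :=
    GLc_cn (X := X × T1) (A := fun p => zz p.2 • (1 : Mat ι)) (B := fun p => g p.1) GLc_zz (hg.comp continuous_fst) (fun p => by simp)
  have gc : GLc fun p : B2 X => can (zz p.2 • 1) (g p.1.1) (rep p.1.2) :=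
    gc0.comp (f := fun p : B2 X => ((p.1.1, p.2), p.1.2)) (by fun_prop)
  have e4 : kc (fun p : B2 X => ds (g p.1.1) (g p.1.1)) (fun p => bl ι (Pt p.2 p.1.2))
      = cls fun p : B2 X => can (zz p.2 • 1) (g p.1.1) (rep p.1.2) * ds (g p.1.1) 1 :=
    congrArg cls (funext fun p => cr_can (hg.2 _) _ _)
  rw [e4, cls_mul gc (cg.ds GLc.one), cls_ds_one cg, map_add, sus_cn1 hg]
  refine (congrArg _ (sus_pr2 hg)).trans (add_zero _)
end G1d
end PK

namespace PK
open Topology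
section G2
variable {X Y Z W K : Type} [TopologicalSpace X] [TopologicalSpace Y] [TopologicalSpace Z] [TopologicalSpace W]
  [TopologicalSpace K]
variable {ι κ : Type} [Fintype ι] [DecidableEq ι] [Fintype κ] [DecidableEq κ]

abbrev F4 := Fin 2 ⊕ Fin 2
abbrev N4 := ZMod 2 → F4

def eN : N4 ≃ F4 × F4 where
  toFun f := (f 0, f 1)
  invFun p := fun j => if j = 0 then p.1 else p.2
  left_inv f := by
    funext j
    have : ∀ j : ZMod 2, j = 0 ∨ j = 1 := by decide
    rcases this j with rfl | rfl <;> simp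
  right_inv p := by simp

theorem sum_N4 (φ : N4 → ℂ) : ∑ f, φ f = ∑ a, ∑ b, φ (eN.symm (a, b)) := by
  rw [← Equiv.sum_comp eN.symm, Fintype.sum_prod_type]

theorem χ_two : χ (1 : ZMod 2) = -1 := by
  have := sum_χ (p := 2) 1
  rw [show (Finset.univ : Finset (ZMod 2)) = {0, 1} from by decide, Finset.sum_pair (by decide), if_neg (by decide), mul_zero, mul_one, χ_zero] at this
  linear_combination this

theorem ec_two (M : Mat F4) (f g : N4) :
    (ec 2 F4 1 * tens (ZMod 2) M) f g = (1/2 : ℂ) * (M (f 0) (g 0) * M (f 1) (g 1) - M (f 1) (g 0) * M (f 0) (g 1)) := by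
  have hp : ∀ φ : ZMod 2 → ℂ, ∏ j, φ j = φ 0 * φ 1 := by
    intro φ
    rw [show (Finset.univ : Finset (ZMod 2)) = {0, 1} from by decide, Finset.prod_pair (by decide)]
  have hs : ∀ k : ZMod 2, (sh 2 F4 k * tens (ZMod 2) M) f g = M (f k) (g 0) * M (f (1 + k)) (g 1) := by
    intro k
    rw [sh, Matrix.mul_apply]
    simp only [pm_apply, ite_mul, one_mul, zero_mul]
    rw [Finset.sum_ite_eq' Finset.univ, if_pos (Finset.mem_univ _), show tens (ZMod 2) M (f ∘ ⇑(Equiv.addRight k)) g = ∏ j, M (f (j + k)) (g j) from rfl, hp, zero_add]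
  rw [ec, ep, show (Finset.univ : Finset (ZMod 2)) = {0, 1} from by decide, Finset.sum_pair (by decide)]
  rw [show -((1 : ZMod 2) * 1) = 1 from by decide, χ_two, mul_zero, neg_zero, χ_zero]
  simp only [Matrix.smul_mul, Matrix.add_mul, Matrix.smul_apply, Matrix.add_apply, hs]
  rw [show (1 + 1 : ZMod 2) = 0 from by decide]
  simp
  ring

def cix (k i : Fin 2) : F4 := if k = 0 then Sum.inl i else Sum.inr i

def Jf : F4 → F4 → F4 → ℂ
  | Sum.inl i, Sum.inr k, c => if c = cix k i then 1 else 0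
  | Sum.inr k, Sum.inl i, c => if c = cix k i then -1 else 0
  | _, _, _ => 0

def Jm : Matrix N4 F4 ℂ := fun f c => Jf (f 0) (f 1) c
noncomputable def Jp : Matrix F4 N4 ℂ := fun c f => (1/2) * Jf (f 0) (f 1) c

theorem Jp_Jm : Jp * Jm = 1 := by
  ext c d
  rw [Matrix.mul_apply, sum_N4]
  simp only [Jp, Jm, eN, Equiv.coe_fn_symm_mk, if_pos, one_ne_zero, if_false, Fintype.sum_sum_type, Jf, Fin.sum_univ_two]
  rcases c with c | c <;> rcases d with d | d <;> fin_cases c <;> fin_cases d <;> simp [cix] <;> norm_num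

noncomputable def La (M : Mat F4) : Mat N4 := cr (tens (ZMod 2) M) (ec 2 F4 1)

theorem bl_cix (a b : Mat (Fin 2)) (k i l j : Fin 2) : (bl (Fin 2) b * ds a a) (cix k i) (cix l j) = b k l * a i j := by
  rw [bl, ds, Matrix.fromBlocks_multiply]
  fin_cases k <;> fin_cases l <;> simp [cix]

theorem La_ds {a b : Mat (Fin 2)} (ha : a.det = 1) (hb : b.det = 1) :
    La (ds a b) = Jm * (bl (Fin 2) b * ds a a) * Jp + (1 - Jm * Jp) := by
  have e1 : ec 2 F4 1 = ec 2 F4 1 * tens (ZMod 2) (ds 1 1 : Mat F4) := by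
    rw [ds_one, show tens (ZMod 2) (1 : Mat F4) = 1 from tensF_one, mul_one]
  have hJ : ∀ N : Mat F4, ∀ f g, (Jm * N * Jp) f g = (1/2) * ∑ d, (∑ c, Jf (f 0) (f 1) c * N c d) * Jf (g 0) (g 1) d := by
    intro N f g
    simp only [Matrix.mul_apply, Jm, Jp, Finset.mul_sum]
    refine Finset.sum_congr rfl fun d _ => ?_
    ring
  have h1 : Jm * Jp = Jm * (bl (Fin 2) 1 * ds (1 : Mat (Fin 2)) (1 : Mat (Fin 2))) * Jp := by rw [bl_one, ds_one, mul_one, Matrix.mul_one]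
  rw [Matrix.det_fin_two] at ha hb
  suffices h : ∀ f g, (ec 2 F4 1 * tens (ZMod 2) (ds a b)) f g - (ec 2 F4 1 * tens (ZMod 2) (ds 1 1 : Mat F4)) f g
      = (Jm * (bl (Fin 2) b * ds a a) * Jp) f g - (Jm * (bl (Fin 2) 1 * ds (1 : Mat (Fin 2)) (1 : Mat (Fin 2))) * Jp) f g by
    have h2 : ec 2 F4 1 * tens (ZMod 2) (ds a b) - ec 2 F4 1 = Jm * (bl (Fin 2) b * ds a a) * Jp - Jm * Jp := by
      rw [h1]
      refine Eq.trans ?_ (Matrix.ext h)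
      conv_lhs => arg 2; rw [e1]
      rfl
    rw [La, cr, eq_comm, add_sub_left_comm, ← h2]
    abel
  intro f g
  rw [ec_two, ec_two, hJ, hJ]
  generalize f 0 = f0
  generalize f 1 = f1
  generalize g 0 = g0
  generalize g 1 = g1
  rcases f0 with f0 | f0 <;> rcases f1 with f1 | f1 <;> rcases g0 with g0 | g0 <;> rcases g1 with g1 | g1 <;>
    simp [Jf, ds, ite_mul, mul_ite, bl_cix, Finset.sum_ite_eq', -Fintype.sum_sum_type, mul_comm]
  case inl.inl.inl.inl =>
    fin_cases f0 <;> fin_cases f1 <;> fin_cases g0 <;> fin_cases g1 <;> simp [mul_comm] <;>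
      first | linear_combination (1/2 : ℂ) * ha | linear_combination (-1/2 : ℂ) * ha
  case inr.inr.inr.inr =>
    fin_cases f0 <;> fin_cases f1 <;> fin_cases g0 <;> fin_cases g1 <;> simp [mul_comm] <;>
      first | linear_combination (1/2 : ℂ) * hb | linear_combination (-1/2 : ℂ) * hb
  all_goals
    have h3 := bl_cix a b
    have h4 := bl_cix 1 1
    rw [ds_one, mul_one] at h4
    rw [ds] at h3
    rw [h3, h4]
    ring

noncomputable def Sm : Mat (F4 ⊕ N4) := Matrix.fromBlocks 0 Jp Jm (1 - Jm * Jp)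
theorem Jp_Q : Jp * (1 - Jm * Jp) = 0 := by
  rw [Matrix.mul_sub, ← Matrix.mul_assoc, Jp_Jm, Matrix.mul_one, Matrix.one_mul, sub_self]
theorem Q_Jm : (1 - Jm * Jp) * Jm = 0 := by
  rw [Matrix.sub_mul, Matrix.mul_assoc, Jp_Jm, Matrix.mul_one, Matrix.one_mul, sub_self]
theorem Q_Q : (1 - Jm * Jp) * (1 - Jm * Jp) = 1 - Jm * Jp := by
  rw [Matrix.mul_sub (1 - Jm * Jp), ← Matrix.mul_assoc, Q_Jm, Matrix.zero_mul, mul_one, sub_zero]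
theorem Sm_sq : Sm * Sm = 1 := by
  rw [Sm, Matrix.fromBlocks_multiply, Jp_Jm, Jp_Q, Q_Jm, Q_Q]
  simp

noncomputable def Lm (M : Mat F4) : Mat (F4 ⊕ N4) := Sm * ds 1 (La M) * Sm
theorem La_mul (M N : Mat F4) : La (M * N) = La M * La N := by
  rw [La, La, La, cr_mul (rep_sh.ep_idem _) (ec_tens _ _), tens_mul]
theorem La_one : La 1 = 1 := by
  rw [La, show tens (ZMod 2) (1 : Mat F4) = 1 from tensF_one, cr_one_left]
theorem Lm_mul (M N : Mat F4) : Lm (M * N) = Lm M * Lm N := by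
  rw [Lm, Lm, Lm, La_mul]
  calc Sm * ds 1 (La M * La N) * Sm = Sm * (ds 1 (La M) * 1 * ds 1 (La N)) * Sm := by rw [mul_one, ds_mul, mul_one]
    _ = _ := by rw [← Sm_sq]; noncomm_ring
theorem Lm_one : Lm 1 = 1 := by rw [Lm, La_one, ds_one, mul_one, Sm_sq]
theorem Lm_unit {M : Mat F4} (h : IsUnit M) : IsUnit (Lm M) :=
  isUnit_mk (B := Lm M⁻¹) (by rw [← Lm_mul, mul_inv' h, Lm_one])
theorem Lm_inv {M : Mat F4} (h : IsUnit M) : (Lm M)⁻¹ = Lm M⁻¹ :=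
  Matrix.inv_eq_right_inv (by rw [← Lm_mul, mul_inv' h, Lm_one])
theorem Lm_cmt {M N : Mat F4} (h : IsUnit M) (h' : IsUnit N) : Lm (cmt M N) = cmt (Lm M) (Lm N) := by
  simp only [cmt, Lm_mul, Lm_inv h, Lm_inv h']
theorem GLc_La {u : X → Mat F4} (h : GLc u) : GLc fun x => La (u x) := (Cor.ec1 h 1).glc
theorem GLc_Lm {u : X → Mat F4} (h : GLc u) : GLc fun x => Lm (u x) :=
  ((GLc.const (isUnit_mk Sm_sq)).mul (GLc.one.ds (GLc_La h))).mul (GLc.const (isUnit_mk Sm_sq))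
theorem cls_Lm {u : X → Mat F4} (h : GLc u) : cls (fun x => Lm (u x)) = kc (fun x => tens (ZMod 2) (u x)) (fun _ => ec 2 F4 1) := by
  rw [show (fun x => Lm (u x)) = fun x => Sm * ds 1 (La (u x)) * Sm from rfl,
    cls_conj (g := fun _ => Sm) (k := fun _ => Sm) (GLc.one.ds (GLc_La h)) continuous_const continuous_const (fun _ => Sm_sq),
    cls_ds GLc.one (GLc_La h), cls_one, zero_add]
  rfl
theorem Lm_ds {a b : Mat (Fin 2)} (ha : a.det = 1) (hb : b.det = 1) : Lm (ds a b) = ds (bl (Fin 2) b * ds a a) 1 := by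
  rw [Lm, La_ds ha hb]
  generalize bl (Fin 2) b * ds a a = N
  have h1 : Jp * (Jm * N * Jp + (1 - Jm * Jp)) = N * Jp := by
    rw [Matrix.mul_add, Jp_Q, add_zero, ← Matrix.mul_assoc, ← Matrix.mul_assoc, Jp_Jm, Matrix.one_mul]
  have h2 : (1 - Jm * Jp) * (Jm * N * Jp + (1 - Jm * Jp)) = 1 - Jm * Jp := by
    rw [Matrix.mul_add, Q_Q, ← Matrix.mul_assoc, ← Matrix.mul_assoc, Q_Jm, Matrix.zero_mul, Matrix.zero_mul, zero_add]
  rw [Sm, ds, ds, Matrix.fromBlocks_multiply, Matrix.fromBlocks_multiply, h1, h2]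
  simp only [Matrix.mul_zero, Matrix.zero_mul, zero_add, add_zero, Matrix.mul_one, Q_Jm, Q_Q, Matrix.mul_assoc, Jp_Jm, Jp_Q]
  simp
end G2
end PK

namespace PK
open Topology
section G2b
variable {X Y Z W K : Type} [TopologicalSpace X] [TopologicalSpace Y] [TopologicalSpace Z] [TopologicalSpace W]
  [TopologicalSpace K]
variable {ι κ : Type} [Fintype ι] [DecidableEq ι] [Fintype κ] [DecidableEq κ]

abbrev F20 := F4 ⊕ N4
def eE : (F4 ⊕ F4) ⊕ (N4 ⊕ N4) ≃ F20 ⊕ F20 where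
  toFun
    | Sum.inl (Sum.inl (Sum.inl i)) => Sum.inl (Sum.inl (Sum.inl i))
    | Sum.inl (Sum.inl (Sum.inr i)) => Sum.inr (Sum.inl (Sum.inl i))
    | Sum.inl (Sum.inr (Sum.inl i)) => Sum.inl (Sum.inl (Sum.inr i))
    | Sum.inl (Sum.inr (Sum.inr i)) => Sum.inr (Sum.inl (Sum.inr i))
    | Sum.inr (Sum.inl n) => Sum.inl (Sum.inr n)
    | Sum.inr (Sum.inr n) => Sum.inr (Sum.inr n)
  invFun
    | Sum.inl (Sum.inl (Sum.inl i)) => Sum.inl (Sum.inl (Sum.inl i))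
    | Sum.inr (Sum.inl (Sum.inl i)) => Sum.inl (Sum.inl (Sum.inr i))
    | Sum.inl (Sum.inl (Sum.inr i)) => Sum.inl (Sum.inr (Sum.inl i))
    | Sum.inr (Sum.inl (Sum.inr i)) => Sum.inl (Sum.inr (Sum.inr i))
    | Sum.inl (Sum.inr n) => Sum.inr (Sum.inl n)
    | Sum.inr (Sum.inr n) => Sum.inr (Sum.inr n)
  left_inv := by rintro (((i | i) | (i | i)) | (i | i)) <;> rfl
  right_inv := by rintro (((i | i) | i) | ((i | i) | i)) <;> rfl

def eta (M : Mat F4) : Mat (F20 ⊕ F20) := ri eE (ds (ds M M) 1)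
theorem eta_mul (M N : Mat F4) : eta (M * N) = eta M * eta N := by
  rw [eta, eta, eta, ← ri_mul, ds_mul, ds_mul, mul_one]
theorem eta_one : eta 1 = 1 := by rw [eta, ds_one, ds_one, ri_one]
theorem eta_unit {M : Mat F4} (h : IsUnit M) : IsUnit (eta M) :=
  isUnit_mk (B := eta M⁻¹) (by rw [← eta_mul, mul_inv' h, eta_one])
theorem eta_inv {M : Mat F4} (h : IsUnit M) : (eta M)⁻¹ = eta M⁻¹ :=
  Matrix.inv_eq_right_inv (by rw [← eta_mul, mul_inv' h, eta_one])
theorem eta_cmt {M N : Mat F4} (h : IsUnit M) (h' : IsUnit N) : eta (cmt M N) = cmt (eta M) (eta N) := by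
  simp only [cmt, eta_mul, eta_inv h, eta_inv h']
theorem GLc_eta {u : X → Mat F4} (h : GLc u) : GLc fun x => eta (u x) := ((h.ds h).ds GLc.one).ri _
theorem cls_eta {u : X → Mat F4} (h : GLc u) : cls (fun x => eta (u x)) = 2 • cls u := by
  rw [show (fun x => eta (u x)) = fun x => ri eE (ds (ds (u x) (u x)) 1) from rfl, cls_ri ((h.ds h).ds GLc.one),
    cls_ds (h.ds h) GLc.one, cls_ds h h, cls_one, add_zero, two_nsmul]
theorem eta_blocks (P Q R S : Mat (Fin 2)) : eta (Matrix.fromBlocks P Q R S) =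
    Matrix.fromBlocks (ds (ds P P) 1) (ds (ds Q Q) 0) (ds (ds R R) 0) (ds (ds S S) 1) := by
  ext (((i | i) | i) | ((i | i) | i)) (((j | j) | j) | ((j | j) | j)) <;> simp [eta, ri, eE, ds, Matrix.one_apply]
theorem eta_ds (B : Mat (Fin 2)) : eta (ds B 1) = ds (ds (ds B B) 1) 1 := by
  rw [ds, eta_blocks]
  simp [ds]
theorem ro_eq (t : ℝ) (A : Mat ι) : ∃ c s : ℂ, c * c + s * s = 1 ∧ ∀ (ι : Type) [Fintype ι] [DecidableEq ι] (A : Mat ι),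
    ro t A = Matrix.fromBlocks ((c * c) • A + (s * s) • 1) ((c * s) • (A + (-1 : ℂ) • 1)) ((c * s) • (A + (-1 : ℂ) • 1)) ((s * s) • A + (c * c) • 1) := by
  refine ⟨Real.cos (Real.pi * t / 2), Real.sin (Real.pi * t / 2), cs_sq _, fun ι _ _ A => ?_⟩
  rw [ro, rot, rot, ds]
  simp only [mul_neg, neg_div, Real.cos_neg, Real.sin_neg, Matrix.fromBlocks_multiply]
  congr 1
  all_goals
    ext i j
    simp
    ring
theorem eta_ro (t : ℝ) (a : Mat (Fin 2)) : eta (ro t a) = ro t (ds (ds a a) (1 : Mat N4)) := by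
  obtain ⟨c, s, h, hr⟩ := ro_eq t a
  rw [hr, hr, eta_blocks]
  have h1 : (1 : Mat N4) = (c * c) • 1 + (s * s) • 1 := by rw [← add_smul, h, one_smul]
  have h1' : (1 : Mat N4) = (s * s) • 1 + (c * c) • 1 := by rw [← add_smul, add_comm, h, one_smul]
  have h0 : (0 : Mat N4) = (c * s) • (1 + (-1 : ℂ) • 1) := by simp
  congr 1
  · conv_lhs => rw [h1]
    rw [← ds_add, ← ds_add, ← ds_smul, ← ds_smul, ← ds_smul, ← ds_smul, ds_one, ds_one]
  · rw [h0, ← ds_smul, ← ds_smul, ← ds_add, ← ds_add, ← ds_smul, ← ds_smul, ds_one, ds_one]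
  · rw [h0, ← ds_smul, ← ds_smul, ← ds_add, ← ds_add, ← ds_smul, ← ds_smul, ds_one, ds_one]
  · conv_lhs => rw [h1']
    rw [← ds_add, ← ds_add, ← ds_smul, ← ds_smul, ← ds_smul, ← ds_smul, ds_one, ds_one]

noncomputable def u4 (M : Mat F4) : Mat (F20 ⊕ F20) := eta M * (ds (Lm M) 1)⁻¹
theorem GLc_u4 {u : X → Mat F4} (h : GLc u) : GLc fun x => u4 (u x) :=
  (GLc_eta h).mul ((GLc_Lm h).ds GLc.one).inv
theorem cls_u4 {u : X → Mat F4} (h : GLc u) : 2 • cls (fun x => u4 (u x)) = Psi 2 (cls u) - 4 • cls u := by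
  have h1 := (GLc_Lm h).ds (GLc.one (ι := F20))
  rw [show (fun x => u4 (u x)) = fun x => eta (u x) * (ds (Lm (u x)) 1)⁻¹ from rfl, cls_mul (GLc_eta h) h1.inv, cls_inv h1,
    cls_ds (GLc_Lm h) GLc.one, cls_one, cls_Lm h, cls_eta h, Psi_div h]
  simp only [Fintype.card_sum, Fintype.card_fin, show (2 - 1 : ℕ) = 1 from rfl, pow_one]
  module
theorem u4_ds {a : Mat (Fin 2)} (ha : a.det = 1) : u4 (ds a 1) = 1 := by
  have hu : IsUnit a := by rw [Matrix.isUnit_iff_isUnit_det, ha]; exact isUnit_one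
  rw [u4, eta_ds, Lm_ds ha (by simp), bl_one, one_mul]
  exact mul_inv' (isUnit_ds (isUnit_ds (isUnit_ds hu hu) isUnit_one) isUnit_one)
theorem u4_one : u4 1 = 1 := by rw [← u4_ds (a := 1) (by simp), ds_one]

theorem cls_u4can {a b : X → Mat (Fin 2)} (ha : GLc a) (hb : GLc b) (da : ∀ x, (a x).det = 1) (db : ∀ x, (b x).det = 1) :
    cls (fun q : X × T1 => u4 (can (a q.1) (b q.1) (rep q.2))) =
      cn (fun x => ds (bl (Fin 2) (a x)) (1 : Mat N4)) (fun x => ds (ds (b x) (b x)) 1) := by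
  have hA : GLc fun p : X × ℝ => Lm (ro p.2 (a p.1)) := GLc_Lm ((ha.comp continuous_fst).ro continuous_snd)
  have hB : GLc fun x => ds (ds (b x) (b x)) (1 : Mat N4) := (hb.ds hb).ds GLc.one
  have e0 : ∀ x, Lm (ro 0 (a x)) = ds (ds (a x) (a x)) 1 := fun x => by
    rw [ro_zero, Lm_ds (da x) (by simp), bl_one, one_mul]
  have e1 : ∀ x, Lm (ro 1 (a x)) = ds (bl (Fin 2) (a x)) 1 := fun x => by
    rw [ro_at_one, Lm_ds (by simp) (da x), ds_one, mul_one]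
  have key := cn_path hA hB (fun x => by
    show Lm (ro 1 (a x)) * _ = _ * Lm (ro 1 (a x))
    rw [e1, ds_mul, ds_mul, bl_comm])
  simp only [e0, e1] at key
  rw [← key]
  congr 1
  funext q
  rw [u4, can, eta_cmt (ro_unit _ (ha.2 _)) (isUnit_ds (hb.2 _) isUnit_one), Lm_cmt (ro_unit _ (ha.2 _)) (isUnit_ds (hb.2 _) isUnit_one),
    eta_ro, eta_ds, Lm_ds (db _) (by simp), bl_one, one_mul]
  rfl
end G2b
end PK

namespace PK
open Topology
section H1
variable {X X' Y Z Z' W K : Type} [TopologicalSpace X] [TopologicalSpace X'] [TopologicalSpace Y] [TopologicalSpace Z] [TopologicalSpace Z'] [TopologicalSpace W]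
  [TopologicalSpace K]
variable {ι κ : Type} [Fintype ι] [DecidableEq ι] [Fintype κ] [DecidableEq κ]

/-- mapping cone of `φ`, with `B` collapsed -/
inductive MCR {Z : Type} (φ : Z → G) (B : Z → Prop) : (G ⊕ Z × ℝ) → (G ⊕ Z × ℝ) → Prop
  | top (z : Z) (t : ℝ) (h : 1 ≤ t) : MCR φ B (Sum.inr (z, t)) (Sum.inl (φ z))
  | bot (z : Z) (t : ℝ) (h : t ≤ 0) : MCR φ B (Sum.inr (z, t)) (Sum.inl 1)
  | bas (z : Z) (t : ℝ) (h : B z) : MCR φ B (Sum.inr (z, t)) (Sum.inl 1)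

def MC {Z : Type} (φ : Z → G) (B : Z → Prop) : Type := Quot (MCR φ B)
instance (φ : Z → G) (B : Z → Prop) : TopologicalSpace (MC φ B) := inferInstanceAs (TopologicalSpace (Quot (MCR φ B)))

variable (φ : Z → G) (B : Z → Prop) (φ' : Z' → G) (B' : Z' → Prop)
def mpt (p : Z × ℝ) : MC φ B := Quot.mk _ (Sum.inr p)
def mπ : C(G, MC φ B) := ⟨fun x => Quot.mk _ (Sum.inl x), continuous_quot_mk.comp continuous_inl⟩
theorem continuous_mpt : Continuous (mpt φ B) := continuous_quot_mk.comp continuous_inr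
variable {B}
theorem mpt_top (z : Z) (t : ℝ) (h : 1 ≤ t) : mpt φ B (z, t) = mπ φ B (φ z) := Quot.sound (.top z t h)
theorem mpt_bot (z : Z) (t : ℝ) (h : t ≤ 0) : mpt φ B (z, t) = mπ φ B 1 := Quot.sound (.bot z t h)
theorem mpt_bas (z : Z) (t : ℝ) (h : B z) : mpt φ B (z, t) = mπ φ B 1 := Quot.sound (.bas z t h)
variable {φ} {φ'} {B'}
theorem mc_ind (P : MC φ B → Prop) (h1 : ∀ x, P (mπ φ B x)) (h2 : ∀ p, P (mpt φ B p)) (c : MC φ B) : P c := by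
  induction c using Quot.ind with
  | mk a => cases a with
    | inl x => exact h1 x
    | inr p => exact h2 p

theorem mc_desc [LocallyCompactSpace K] (f : G × K → W) (g : (Z × ℝ) × K → W) (hf : Continuous f) (hg : Continuous g)
    (h1 : ∀ a t k, 1 ≤ t → g ((a, t), k) = f (φ a, k)) (h2 : ∀ a t k, t ≤ 0 → g ((a, t), k) = f (1, k))
    (h3 : ∀ a t k, B a → g ((a, t), k) = f (1, k)) :
    ∃ F : MC φ B × K → W, Continuous F ∧ (∀ x k, F (mπ φ B x, k) = f (x, k)) ∧ ∀ p k, F (mpt φ B p, k) = g (p, k) := by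
  refine ⟨fun q => Quot.lift (fun z : G ⊕ Z × ℝ => Sum.elim (fun x => f (x, q.2)) (fun p => g (p, q.2)) z) ?_ q.1, ?_, fun x k => rfl, fun p k => rfl⟩
  · rintro a b (⟨g, t, h⟩ | ⟨g, t, h⟩ | ⟨g, t, h⟩)
    · exact h1 _ _ _ h
    · exact h2 _ _ _ h
    · exact h3 _ _ _ h
  · exact cont_desc (r := MCR φ B) (cont_sum hf hg)

theorem mc_desc1 (f : G → W) (g : Z × ℝ → W) (hf : Continuous f) (hg : Continuous g)
    (h1 : ∀ a t, 1 ≤ t → g (a, t) = f (φ a)) (h2 : ∀ a t, t ≤ 0 → g (a, t) = f 1)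
    (h3 : ∀ a t, B a → g (a, t) = f 1) :
    ∃ F : C(MC φ B, W), (∀ x, F (mπ φ B x) = f x) ∧ ∀ p, F (mpt φ B p) = g p := by
  obtain ⟨F, Fc, F1, F2⟩ := mc_desc (K := Unit) (φ := φ) (B := B) (fun p => f p.1) (fun p => g p.1) (by fun_prop) (by fun_prop)
    (fun a t k h => h1 a t h) (fun a t k h => h2 a t h) (fun a t k h => h3 a t h)
  exact ⟨⟨fun c => F (c, ()), by fun_prop⟩, fun x => F1 x _, fun p => F2 p _⟩

theorem cone_desc1 (i : C(G, X)) (f : X → W) (g : G × ℝ → W) (hf : Continuous f) (hg : Continuous g)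
    (h1 : ∀ a t, 1 ≤ t → g (a, t) = f (i a)) (h2 : ∀ a t, t ≤ 0 → g (a, t) = f (i 1))
    (h3 : ∀ t, g (1, t) = f (i 1)) :
    ∃ F : C(Cone i, W), (∀ x, F (cπ i x) = f x) ∧ ∀ p, F (cpt i p) = g p := by
  obtain ⟨F, Fc, F1, F2⟩ := cone_desc (K := Unit) i (fun p => f p.1) (fun p => g p.1) (by fun_prop) (by fun_prop)
    (fun a t k h => h1 a t h) (fun a t k h => h2 a t h) (fun t k => h3 t)
  exact ⟨⟨fun c => F (c, ()), by fun_prop⟩, fun x => F1 x _, fun p => F2 p _⟩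

instance mc_compact [CompactSpace Z] : CompactSpace (MC φ B) := by
  let S : G ⊕ (Z × Set.Icc (0:ℝ) 1) → MC φ B := Sum.elim (fun g => mπ φ B g) (fun p => mpt φ B (p.1, p.2))
  have hS : Continuous S := by
    refine continuous_sum_dom.2 ⟨(mπ φ B).continuous, ?_⟩
    exact (continuous_mpt φ B).comp (f := fun p : Z × Set.Icc (0:ℝ) 1 => (p.1, (p.2 : ℝ))) (by fun_prop)
  refine ⟨?_⟩
  have : Set.range S = Set.univ := by
    refine Set.eq_univ_of_forall (mc_ind _ (fun g => ⟨Sum.inl g, rfl⟩) ?_)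
    rintro ⟨z, t⟩
    rcases le_total t 0 with h | h
    · exact ⟨Sum.inl 1, (mpt_bot φ z t h).symm⟩
    rcases le_total 1 t with h' | h'
    · exact ⟨Sum.inl (φ z), (mpt_top φ z t h').symm⟩
    · exact ⟨Sum.inr (z, ⟨t, h, h'⟩), rfl⟩
  rw [← this]
  exact isCompact_range hS

theorem exists_mmap (α : C(Z, Z')) (h : ∀ z, φ' (α z) = φ z) (hB : ∀ z, B z → B' (α z)) :
    ∃ F : C(MC φ B, MC φ' B'), (∀ x, F (mπ φ B x) = mπ φ' B' x) ∧ ∀ p, F (mpt φ B p) = mpt φ' B' (α p.1, p.2) := by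
  have := continuous_mpt φ' B'
  exact mc_desc1 (fun x => mπ φ' B' x) (fun p => mpt φ' B' (α p.1, p.2)) (by fun_prop) (by fun_prop)
    (fun a t ht => by simp only [mpt_top φ' (α a) t ht, h]) (fun a t ht => mpt_bot φ' _ t ht) (fun a t ht => mpt_bas φ' _ t (hB a ht))

noncomputable def mmap (α : C(Z, Z')) (h : ∀ z, φ' (α z) = φ z) (hB : ∀ z, B z → B' (α z)) : C(MC φ B, MC φ' B') :=
  (exists_mmap α h hB).choose
theorem mmap_π (α : C(Z, Z')) (h : ∀ z, φ' (α z) = φ z) (hB : ∀ z, B z → B' (α z)) (x : G) : mmap α h hB (mπ φ B x) = mπ φ' B' x :=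
  (exists_mmap α h hB).choose_spec.1 x
theorem mmap_pt (α : C(Z, Z')) (h : ∀ z, φ' (α z) = φ z) (hB : ∀ z, B z → B' (α z)) (p : Z × ℝ) :
    mmap α h hB (mpt φ B p) = mpt φ' B' (α p.1, p.2) :=
  (exists_mmap α h hB).choose_spec.2 p

theorem exists_kmap {i : C(G, X)} {i' : C(G, X')} (f : C(X, X')) (h : ∀ g, f (i g) = i' g) :
    ∃ F : C(Cone i, Cone i'), (∀ x, F (cπ i x) = cπ i' (f x)) ∧ ∀ p, F (cpt i p) = cpt i' p :=
  cone_desc1 i (fun x => cπ i' (f x)) (cpt i') (by fun_prop) (continuous_cpt i')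
    (fun a t ht => by simp only [cpt_top i' a t ht, h]) (fun a t ht => by simp only [cpt_bot i' a t ht, h])
    (fun t => by simp only [cpt_one, h])
noncomputable def kmap {i : C(G, X)} {i' : C(G, X')} (f : C(X, X')) (h : ∀ g, f (i g) = i' g) : C(Cone i, Cone i') :=
  (exists_kmap f h).choose
theorem kmap_π {i : C(G, X)} {i' : C(G, X')} (f : C(X, X')) (h : ∀ g, f (i g) = i' g) (x : X) : kmap f h (cπ i x) = cπ i' (f x) :=
  (exists_kmap f h).choose_spec.1 x
theorem kmap_pt {i : C(G, X)} {i' : C(G, X')} (f : C(X, X')) (h : ∀ g, f (i g) = i' g) (p : G × ℝ) : kmap f h (cpt i p) = cpt i' p :=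
  (exists_kmap f h).choose_spec.2 p
theorem kmap_nat {i : C(G, X)} {i' : C(G, X')} (f : C(X, X')) (h : ∀ g, f (i g) = i' g) (d : K1 (Cone i')) :
    K1.map (cπ i) (K1.map (kmap f h) d) = K1.map f (K1.map (cπ i') d) := by
  rw [K1.map_comp, K1.map_comp]
  exact K1.map_congr (fun x => kmap_π f h x) d

variable (φ B)
open Classical in
noncomputable def qp (p : Z × ℝ) : Cone (mπ φ B) :=
  if p.2 ≤ 1/2 then cpt (mπ φ B) (φ p.1, 2 * p.2) else cπ (mπ φ B) (mpt φ B (p.1, 2 - 2 * p.2))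
variable {φ}
theorem continuous_qp (hφ : Continuous φ) : Continuous (qp φ B) := by
  unfold qp
  have h1 := continuous_cpt (mπ φ B)
  have h2 := continuous_mpt φ B
  refine Continuous.if_le (by fun_prop) (by fun_prop) continuous_snd continuous_const fun p hp => ?_
  rw [hp, cpt_top _ _ _ (by norm_num), mpt_top _ _ _ (by norm_num)]
theorem qp_loop (z : Z) : qp φ B (z, 0) = qp φ B (z, 1) := by
  rw [qp, qp, if_pos (by norm_num), if_neg (by norm_num)]
  simp only
  rw [cpt_bot _ _ _ (by norm_num), mpt_bot _ _ _ (by norm_num)]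
noncomputable def qm (φ : C(Z, G)) : C(Z × T1, Cone (mπ φ B)) :=
  ⟨fun q => qp φ B (q.1, rep q.2), continuous_rep (continuous_qp B φ.continuous) (qp_loop B)⟩

theorem qm_nat (φ : C(Z, G)) (φ' : C(Z', G)) (α : C(Z, Z')) (h : ∀ z, φ' (α z) = φ z) (hB : ∀ z, B z → B' (α z)) (q : Z × T1) :
    kmap (i := mπ φ B) (i' := mπ φ' B') (mmap α h hB) (mmap_π α h hB) (qm B φ q) = qm B' φ' (α q.1, q.2) := by
  show kmap (i := mπ φ B) (i' := mπ φ' B') (mmap α h hB) (mmap_π α h hB) (qp φ B (q.1, rep q.2)) = qp φ' B' (α q.1, rep q.2)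
  rw [qp, qp]
  split_ifs
  · rw [kmap_pt, h]
  · rw [kmap_π, mmap_pt]

def t3 (x t s : T1) : T 3 := ((((), x), t), s)
theorem continuous_t3 {f g h : X → T1} (hf : Continuous f) (hg : Continuous g) (hh : Continuous h) : Continuous fun x => t3 (f x) (g x) (h x) :=
  ((continuous_const (y := ())).prodMk hf |>.prodMk hg).prodMk hh

def rho (X : Type) [TopologicalSpace X] : C((B2 X × T1) × T1, (T 3 × X) × T1) :=
  ⟨fun q => ((t3 q.1.1.2 q.1.1.1.2 q.1.2, q.1.1.1.1), q.2), by
    have := continuous_t3 (X := (B2 X × T1) × T1) (f := fun q => q.1.1.2) (g := fun q => q.1.1.1.2) (h := fun q => q.1.2) (by fun_prop) (by fun_prop) (by fun_prop)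
    fun_prop⟩

noncomputable def Sg (X : Type) [TopologicalSpace X] [CompactSpace X] : K1 ((T 3 × X) × T1) →+ K1 X :=
  (sus X).comp ((sus (B2 X)).comp ((K1.map swp).comp (K1.map (rho X))))

theorem Sg_map [CompactSpace X] [CompactSpace Y] (f : C(X, Y)) (F : C((T 3 × X) × T1, (T 3 × Y) × T1))
    (hF : ∀ q, F q = ((q.1.1, f q.1.2), q.2)) (c : K1 ((T 3 × Y) × T1)) :
    K1.map f (Sg Y c) = Sg X (K1.map F c) := by
  show K1.map f (sus Y (sus (B2 Y) (K1.map swp (K1.map (rho Y) c)))) = sus X (sus (B2 X) (K1.map swp (K1.map (rho X) (K1.map F c))))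
  rw [sus_map, sus_map]
  congr 2
  simp only [K1.map_comp]
  exact K1.map_congr (fun q => by show _ = F (rho X (swp q)); rw [hF]; rfl) c

theorem Sg_Psi {p : ℕ} [Fact p.Prime] [CompactSpace X] (c : K1 ((T 3 × X) × T1)) : Sg X (Psi p c) = p^2 • Psi p (Sg X c) := by
  show sus X (sus (B2 X) (K1.map swp (K1.map (rho X) (Psi p c)))) = p^2 • Psi p (sus X (sus (B2 X) (K1.map swp (K1.map (rho X) c))))
  rw [Psi_map, Psi_map, sus_Psi, map_nsmul, sus_Psi, smul_smul, sq]

noncomputable def Th [CompactSpace X] (φ : C(T 3 × X, G)) (A : T 3 × X → Prop) : K1 (Cone (mπ φ A)) →+ K1 X := (Sg X).comp (K1.map (qm A φ))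
theorem Th_Psi {p : ℕ} [Fact p.Prime] [CompactSpace X] (φ : C(T 3 × X, G)) (A : T 3 × X → Prop) (d : K1 (Cone (mπ φ A))) :
    Th φ A (Psi p d) = p^2 • Psi p (Th φ A d) := by
  show Sg X (K1.map _ (Psi p d)) = _
  rw [Psi_map, Sg_Psi]; rfl
theorem Th_nat [CompactSpace X] [CompactSpace Y] (φ : C(T 3 × X, G)) (A : T 3 × X → Prop) (φ' : C(T 3 × Y, G)) (A' : T 3 × Y → Prop)
    (f : C(X, Y)) (α : C(T 3 × X, T 3 × Y)) (hα : ∀ z, α z = (z.1, f z.2))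
    (h : ∀ z, φ' (α z) = φ z) (hB : ∀ z, A z → A' (α z)) (d : K1 (Cone (mπ φ' A'))) :
    K1.map f (Th φ' A' d) = Th φ A (K1.map (kmap (i := mπ φ A) (i' := mπ φ' A') (mmap α h hB) (mmap_π α h hB)) d) := by
  let F : C((T 3 × X) × T1, (T 3 × Y) × T1) := ⟨fun q => (α q.1, q.2), by fun_prop⟩
  show K1.map f (Sg Y (K1.map (qm A' φ') d)) = Sg X (K1.map (qm A φ) _)
  rw [Sg_map f F (fun q => by show (α q.1, q.2) = _; rw [hα]), K1.map_comp, K1.map_comp]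
  congr 1
  exact K1.map_congr (fun q => (qm_nat A φ φ' α h hB q).symm) d
end H1
end PK

namespace PK
open Topology
section H2
variable {X X' Y Z Z' W K : Type} [TopologicalSpace X] [TopologicalSpace X'] [TopologicalSpace Y] [TopologicalSpace Z] [TopologicalSpace Z'] [TopologicalSpace W]
  [TopologicalSpace K]
variable {ι κ : Type} [Fintype ι] [DecidableEq ι] [Fintype κ] [DecidableEq κ]

theorem V_cmt (g h : G) : V (g * h * g⁻¹ * h⁻¹) = cmt (V g) (V h) := by
  simp only [cmt, V_mul, V_inv]
theorem can_one_left (B : Mat ι) (hB : IsUnit B) (t : ℝ) : can 1 B t = 1 := by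
  rw [can, ro_one, cmt_one isUnit_one (isUnit_ds hB isUnit_one) (by simp)]
theorem can_one_right (A : Mat ι) (hA : IsUnit A) (t : ℝ) : can A 1 t = 1 := by
  rw [can, ds_one, cmt_one (ro_unit t hA) isUnit_one (by simp)]

noncomputable def f1 : C(T 3 × G, G) := ⟨fun z => kz z.1 * z.2 * (kz z.1)⁻¹ * z.2⁻¹, by fun_prop⟩
def b1 (z : T 3 × G) : Prop := fw 3 z.1 ∨ z.2 = 1
noncomputable abbrev Y1 := MC f1 b1

theorem GLc_can1 {s : X → ℝ} (hs : Continuous s) {a : X → T 3} (ha : Continuous a) {g : X → G} (hg : Continuous g) :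
    GLc fun x => can (V (kz (a x))) (V (g x)) (s x) :=
  (GLc_V.comp (kz.continuous.comp ha)).can (GLc_V.comp hg) hs

theorem can1_b1 {z : T 3 × G} (h : b1 z) (t : ℝ) : can (V (kz z.1)) (V z.2) t = 1 := by
  rcases h with h | h
  · rw [kz_fw _ h, V_one, can_one_left _ (V_unit _)]
  · rw [h, V_one, can_one_right _ (V_unit _)]
theorem can1_top (z : T 3 × G) : can (V (kz z.1)) (V z.2) 0 = ds (V (f1 z)) 1 := by
  rw [can_zero (V_unit _) (V_unit _), ← V_cmt]; rfl

theorem exists_T4 : ∃ F : C(Y1, Mat F4), (∀ x, F (mπ f1 b1 x) = ds (V x) 1) ∧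
    ∀ p, F (mpt f1 b1 p) = can (V (kz p.1.1)) (V p.1.2) (1 - cI p.2) := by
  have := continuous_cI
  refine mc_desc1 (fun x => ds (V x) (1 : Mat (Fin 2))) (fun p : (T 3 × G) × ℝ => can (V (kz p.1.1)) (V p.1.2) (1 - cI p.2)) (GLc_V.ds GLc.one).1
    (GLc_can1 (by fun_prop) (by fun_prop) (by fun_prop)).1 ?_ ?_ ?_
  · intro z t ht
    simp only [cI_ge ht, sub_self, can1_top]
  · intro z t ht
    simp only [cI_le0 ht, sub_zero, can_one (V_unit _) (V_unit _), V_one, ds_one]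
  · intro z t hz
    simp only [can1_b1 hz, V_one, ds_one]
noncomputable def T4 : C(Y1, Mat F4) := exists_T4.choose
theorem T4_π (x : G) : T4 (mπ f1 b1 x) = ds (V x) 1 := exists_T4.choose_spec.1 x
theorem T4_pt (p : (T 3 × G) × ℝ) : T4 (mpt f1 b1 p) = can (V (kz p.1.1)) (V p.1.2) (1 - cI p.2) := exists_T4.choose_spec.2 p
theorem GLc_T4 : GLc (T4 : Y1 → Mat F4) := ⟨T4.continuous, mc_ind _ (fun x => by rw [T4_π]; exact isUnit_ds (V_unit _) isUnit_one)
  fun p => by rw [T4_pt]; exact (GLc_can1 (X := Unit) (s := fun _ => 1 - cI p.2) (a := fun _ => p.1.1) (g := fun _ => p.1.2) continuous_const continuous_const continuous_const).2 ()⟩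

theorem exists_U4 : ∃ F : C(Cone (mπ f1 b1), Mat (F20 ⊕ F20)), (∀ x, F (cπ _ x) = u4 (T4 x)) ∧ ∀ p, F (cpt _ p) = 1 := by
  have h : ∀ x, u4 (T4 (mπ f1 b1 x)) = 1 := fun x => by rw [T4_π, u4_ds (V_det _)]
  exact cone_desc1 (mπ f1 b1) (fun x => u4 (T4 x)) (fun _ => 1) (GLc_u4 GLc_T4).1 continuous_const
    (fun a t ht => (h a).symm) (fun a t ht => (h 1).symm) (fun t => (h 1).symm)
noncomputable def U4 : C(Cone (mπ f1 b1), Mat (F20 ⊕ F20)) := exists_U4.choose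
theorem U4_π (x : Y1) : U4 (cπ _ x) = u4 (T4 x) := exists_U4.choose_spec.1 x
theorem U4_pt (p : G × ℝ) : U4 (cpt _ p) = 1 := exists_U4.choose_spec.2 p
theorem GLc_U4 : GLc (U4 : Cone (mπ f1 b1) → Mat (F20 ⊕ F20)) := ⟨U4.continuous, cone_ind _ _ (fun x => by rw [U4_π]; exact (GLc_u4 GLc_T4).2 x)
  fun p => by rw [U4_pt]; exact isUnit_one⟩

theorem U4_qp (p : (T 3 × G) × ℝ) : U4 (qp f1 b1 p) = u4 (can (V (kz p.1.1)) (V p.1.2) (cI (2 * p.2 - 1))) := by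
  rw [qp]
  split_ifs with h
  · rw [U4_pt, cI_le0 (by linarith), can1_top, u4_ds (V_det _)]
  · rw [U4_π, T4_pt]
    congr 2
    simp only [cI]
    rw [not_le] at h
    rcases le_total p.2 1 with h' | h'
    · rw [min_eq_left (by linarith), min_eq_left (by linarith), max_eq_right (by linarith), max_eq_right (by linarith)]; ring
    · rw [min_eq_left (by linarith), min_eq_right (by linarith), max_eq_left (by linarith), max_eq_right (by linarith)]; ring

theorem Th_U4 : Th f1 b1 (cls U4) = cls V := by
  show Sg G (K1.map (qm b1 f1) (cls U4)) = _
  rw [K1.map_cls _ GLc_U4]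
  have e : (fun q : (T 3 × G) × T1 => U4 (qm b1 f1 q)) = fun q => u4 (can (V (kz q.1.1)) (V q.1.2) (cI (2 * rep q.2 - 1))) :=
    funext fun q => U4_qp (q.1, rep q.2)
  rw [e]
  have cc := continuous_cI
  have key := loop_htpy (X := T 3 × G) (F := fun q => u4 (can (V (kz q.1.1.1)) (V q.1.1.2) (cI ((2 - cI q.1.2) * q.2 - (1 - cI q.1.2)))))
    (GLc_u4 (GLc_can1 (by fun_prop) (by fun_prop) (by fun_prop))) ?_ ?_
  · simp only [cI_zero, cI_one, sub_zero, sub_self, show (2 - 1 : ℝ) = 1 from by norm_num, one_mul] at key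
    rw [key]
    have e2 : ∀ t : T1, cI (rep t) = rep t := fun t => cI_of (rep_nonneg t) (rep_lt t).le
    simp only [e2]
    have hk : GLc fun z : T 3 × G => V (kz z.1) := GLc_V.comp (kz.continuous.comp continuous_fst)
    have hV : GLc fun z : T 3 × G => V z.2 := GLc_V.comp continuous_snd
    rw [cls_u4can hk hV (fun _ => V_det _) (fun _ => V_det _)]
    have hA : GLc fun z : T 3 × G => ds (bl (Fin 2) (V (kz z.1))) (1 : Mat N4) :=
      GLc.ds ⟨continuous_bl.comp hk.1, fun z => bl_unit (hk.2 z)⟩ GLc.one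
    have hB : GLc fun z : T 3 × G => ds (ds (V z.2) (V z.2)) (1 : Mat N4) := (hV.ds hV).ds GLc.one
    have hg := GLc_cn (A := fun z : T 3 × G => ds (bl (Fin 2) (V (kz z.1))) (1 : Mat N4)) (B := fun z => ds (ds (V z.2) (V z.2)) 1) hA hB
      (fun z => by rw [ds_mul, ds_mul, bl_comm])
    show sus G (sus (B2 G) (K1.map swp (K1.map (rho G) (cn _ _)))) = _
    rw [cn, K1.map_cls _ hg]
    exact sigma_eval (κ := N4) GLc_V
  · rintro ⟨x, u⟩
    simp only [mul_zero, zero_sub]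
    rw [cI_le0 (by linarith [cI_le u]), can1_top, u4_ds (V_det _)]
  · rintro ⟨x, u⟩
    simp only [mul_one]
    rw [cI_ge (by linarith), can_one (V_unit _) (V_unit _), u4_one]
end H2
end PK

namespace PK
open Topology
section H3
variable {X X' Y Z Z' W K : Type} [TopologicalSpace X] [TopologicalSpace X'] [TopologicalSpace Y] [TopologicalSpace Z] [TopologicalSpace Z'] [TopologicalSpace W]
  [TopologicalSpace K]
variable {ι κ : Type} [Fintype ι] [DecidableEq ι] [Fintype κ] [DecidableEq κ]

def c3 (x y z : G) : G := z * (y * x * y⁻¹ * x⁻¹) * z⁻¹ * (y * x * y⁻¹ * x⁻¹)⁻¹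

/-- a normalised null homotopy of the iterated commutator -/
structure NH (h : ((G × G) × G) × ℝ → G) : Prop where
  cont : Continuous h
  top : ∀ x y z t, 1 ≤ t → h (((x, y), z), t) = c3 x y z
  bot : ∀ p t, t ≤ 0 → h (p, t) = 1
  o1 : ∀ y z t, h (((1, y), z), t) = 1
  o2 : ∀ x z t, h (((x, 1), z), t) = 1
  o3 : ∀ x y t, h (((x, y), 1), t) = 1

theorem exists_NH (k : ((G × G) × G) × ℝ → G) (hk : Continuous k) (y0 : G) (h0 : ∀ x y z, k (((x, y), z), 0) = c3 x y z)
    (h1 : ∀ p, k (p, 1) = y0) : ∃ h, NH h := by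
  have cc := continuous_cI
  let kA : ((G × G) × G) × ℝ → G := fun q => k (q.1, 1 - cI q.2) * (k (((1, q.1.1.2), q.1.2), 1 - cI q.2))⁻¹
  let kB : ((G × G) × G) × ℝ → G := fun q => kA q * (kA (((q.1.1.1, 1), q.1.2), q.2))⁻¹
  let kC : ((G × G) × G) × ℝ → G := fun q => kB q * (kB ((q.1.1, 1), q.2))⁻¹
  have cA : Continuous kA := by fun_prop
  have cB : Continuous kB := by fun_prop
  have cC : Continuous kC := by fun_prop
  have tA : ∀ x y z t, 1 ≤ t → kA (((x, y), z), t) = c3 x y z := fun x y z t ht => by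
    simp only [kA, cI_ge ht, sub_self, h0]; simp [c3]
  have tB : ∀ x y z t, 1 ≤ t → kB (((x, y), z), t) = c3 x y z := fun x y z t ht => by
    simp only [kB, tA _ _ _ _ ht]; simp [c3]
  have bA : ∀ p t, t ≤ 0 → kA (p, t) = 1 := fun p t ht => by
    simp only [kA, cI_le0 ht, sub_zero, h1]; simp
  have bB : ∀ p t, t ≤ 0 → kB (p, t) = 1 := fun p t ht => by
    simp only [kB, bA _ _ ht]; simp
  have oA : ∀ y z t, kA (((1, y), z), t) = 1 := fun y z t => by simp [kA]
  have oB : ∀ y z t, kB (((1, y), z), t) = 1 := fun y z t => by simp [kB, oA]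
  have oB2 : ∀ y z t, kB (((y, 1), z), t) = 1 := fun y z t => by simp [kB]
  exact ⟨kC, cC, fun x y z t ht => by simp only [kC, tB _ _ _ _ ht]; simp [c3], fun p t ht => by simp only [kC, bB _ _ ht]; simp,
    fun y z t => by simp [kC, oB], fun y z t => by simp [kC, oB2], fun x y t => by simp [kC]⟩

theorem NH.cl {h : ((G × G) × G) × ℝ → G} (hh : NH h) (p : (G × G) × G) (t : ℝ) : h (p, cI t) = h (p, t) := by
  obtain ⟨⟨x, y⟩, z⟩ := p
  rcases le_total t 0 with ht | ht
  · rw [hh.bot _ _ ht, cI_le0 ht, hh.bot _ _ le_rfl]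
  rcases le_total 1 t with ht' | ht'
  · rw [hh.top _ _ _ _ ht', cI_ge ht', hh.top _ _ _ _ le_rfl]
  · rw [cI_of ht ht']

noncomputable def w3 : C(T 3 × T 3, G) := ⟨fun z => f1 (z.1, kz z.2), by fun_prop⟩
def bw (z : T 3 × T 3) : Prop := fw 3 z.1 ∨ fw 3 z.2
abbrev Cw := MC w3 bw
noncomputable def αf : C(T 3 × T 3, T 3 × G) := ⟨fun z => (z.1, kz z.2), by fun_prop⟩
theorem αf_b (z : T 3 × T 3) (h : bw z) : b1 (αf z) := h.imp id fun h => kz_fw _ h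
noncomputable def fC : C(Cw, Y1) := mmap (φ' := f1) (B' := b1) αf (fun _ => rfl) αf_b

variable {h : ((G × G) × G) × ℝ → G}

theorem exists_ph (hh : NH h) : ∃ F : C(T 3 × Cw, G), (∀ b g, F (b, mπ w3 bw g) = f1 (b, g)) ∧
    ∀ b a x r, F (b, mpt w3 bw ((a, x), r)) = h (((kz x, kz a), kz b), r) := by
  have hc := hh.cont
  obtain ⟨F, Fc, F1, F2⟩ := mc_desc (K := T 3) (φ := w3) (B := bw) (fun q : G × T 3 => f1 (q.2, q.1))
    (fun q => h (((kz q.1.1.2, kz q.1.1.1), kz q.2), q.1.2)) (by fun_prop) (by fun_prop)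
    (fun a t b ht => by simp only [hh.top _ _ _ _ ht]; rfl)
    (fun a t b ht => by simp only [hh.bot _ _ ht]; simp [f1])
    (fun a t b hb => by
      have : f1 (b, 1) = 1 := by simp [f1]
      simp only [this]
      rcases hb with hb | hb
      · rw [kz_fw _ hb, hh.o2]
      · rw [kz_fw _ hb, hh.o1])
  exact ⟨⟨fun z => F (z.2, z.1), by fun_prop⟩, fun b g => F1 g b, fun b a x r => F2 ((a, x), r) b⟩
noncomputable def ph (hh : NH h) : C(T 3 × Cw, G) := (exists_ph hh).choose
theorem ph_π (hh : NH h) (b : T 3) (g : G) : ph hh (b, mπ w3 bw g) = f1 (b, g) := (exists_ph hh).choose_spec.1 b g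
theorem ph_pt (hh : NH h) (b a x : T 3) (r : ℝ) : ph hh (b, mpt w3 bw ((a, x), r)) = h (((kz x, kz a), kz b), r) :=
  (exists_ph hh).choose_spec.2 b a x r
def bY (z : T 3 × Cw) : Prop := fw 3 z.1 ∨ z.2 = mπ w3 bw 1
abbrev Y3 (hh : NH h) := MC (ph hh) bY
noncomputable def αj : C(T 3 × G, T 3 × Cw) := ⟨fun z => (z.1, mπ w3 bw z.2), by fun_prop⟩
theorem αj_b (z : T 3 × G) (h : b1 z) : bY (αj z) := h.imp id fun h => congrArg (mπ w3 bw) h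
theorem αj_φ (hh : NH h) (z : T 3 × G) : ph hh (αj z) = f1 z := ph_π hh z.1 z.2
noncomputable def jY (hh : NH h) : C(Y1, Y3 hh) := mmap (φ' := ph hh) (B' := bY) αj (αj_φ hh) αj_b

def ap3 {n : ℕ} (y : T n) (a : T 3) : T (n+3) := snoc (snoc (snoc y a.1.1.2) a.1.2) a.2
def pr3 {n : ℕ} (y : T (n+3)) : T n := y.1.1.1
def ls3 {n : ℕ} (y : T (n+3)) : T 3 := t3 y.1.1.2 y.1.2 y.2
theorem continuous_ap3 {n : ℕ} {f : X → T n} {g : X → T 3} (hf : Continuous f) (hg : Continuous g) : Continuous fun x => ap3 (f x) (g x) := by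
  have h1 : Continuous fun a : ((Unit × T1) × T1) × T1 => a.1.1.2 := by fun_prop
  have h2 : Continuous fun a : ((Unit × T1) × T1) × T1 => a.1.2 := by fun_prop
  have h3 : Continuous fun a : ((Unit × T1) × T1) × T1 => a.2 := by fun_prop
  exact continuous_snoc (continuous_snoc (continuous_snoc hf (h1.comp hg)) (h2.comp hg)) (h3.comp hg)
theorem continuous_pr3 {n : ℕ} : Continuous (pr3 (n := n)) := by
  have h1 : Continuous fun a : ((T n × T1) × T1) × T1 => a.1.1.1 := by fun_prop
  exact h1
theorem continuous_ls3 {n : ℕ} : Continuous (ls3 (n := n)) :=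
  continuous_t3 (X := ((T n × T1) × T1) × T1) (f := fun a => a.1.1.2) (g := fun a => a.1.2) (h := fun a => a.2) (by fun_prop) (by fun_prop) (by fun_prop)
theorem pr3_ap3 {n : ℕ} (y : T n) (a : T 3) : pr3 (ap3 y a) = y := rfl
theorem ls3_ap3 {n : ℕ} (y : T n) (a : T 3) : ls3 (ap3 y a) = a := rfl
theorem fw_ap3 {n : ℕ} (y : T n) (a : T 3) (h : fw n y ∨ fw 3 a) : fw (n+3) (ap3 y a) := by
  rcases h with h | (((h | h) | h) | h)
  · exact Or.inl (Or.inl (Or.inl h))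
  · exact h.elim
  · exact Or.inl (Or.inl (Or.inr h))
  · exact Or.inl (Or.inr h)
  · exact Or.inr h
theorem fw_pr3 {n : ℕ} (y : T (n+3)) (h : fw (n+3) y) : fw n (pr3 y) ∨ fw 3 (ls3 y) := by
  rcases h with ((h | h) | h) | h
  · exact Or.inl h
  · exact Or.inr (Or.inl (Or.inl (Or.inr h)))
  · exact Or.inr (Or.inl (Or.inr h))
  · exact Or.inr (Or.inr h)

theorem rep_cI2 {f : X × ℝ → W} (h : ∀ x, f (x, 0) = f (x, 1)) (x : X) (t : ℝ) : f (x, rep ((cI t : ℝ) : T1)) = f (x, cI t) := by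
  rcases lt_or_ge (cI t) 1 with ht | ht
  · rw [rep_coe (cI_nonneg t) ht]
  · have e : cI t = 1 := le_antisymm (cI_le t) ht
    rw [e, show ((1:ℝ) : T1) = 0 from AddCircle.coe_period 1, rep_zero, h]
end H3
end PK

namespace PK
open Topology
section H3b
variable {X X' Y Z Z' W K : Type} [TopologicalSpace X] [TopologicalSpace X'] [TopologicalSpace Y] [TopologicalSpace Z] [TopologicalSpace Z'] [TopologicalSpace W]
  [TopologicalSpace K]
variable {ι κ : Type} [Fintype ι] [DecidableEq ι] [Fintype κ] [DecidableEq κ]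
variable {h : ((G × G) × G) × ℝ → G}

noncomputable def U0 (h : ((G × G) × G) × ℝ → G) (q : T 9 × ℝ) : Mat F4 :=
  can (V (kz (pr3 (n := 0 + 3) (pr3 (n := 6) q.1)))) (V (w3 (ls3 (n := 3) (pr3 (n := 6) q.1), ls3 (n := 6) q.1))) (1 - q.2) *
    (ds (V (h (((kz (ls3 (n := 6) q.1), kz (ls3 (n := 3) (pr3 (n := 6) q.1))), kz (pr3 (n := 0 + 3) (pr3 (n := 6) q.1))), q.2))) 1)⁻¹

theorem GLc_U0 (hh : NH h) : GLc (U0 h) := by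
  have hc := hh.cont
  have c1 : Continuous (pr3 (n := 0 + 3)) := continuous_pr3
  have c2 : Continuous (pr3 (n := 6)) := continuous_pr3
  have c3 : Continuous (ls3 (n := 3)) := continuous_ls3
  have c4 : Continuous (ls3 (n := 6)) := continuous_ls3
  have c5 : Continuous fun q : T 9 × ℝ => pr3 (n := 0 + 3) (pr3 (n := 6) q.1) := c1.comp (c2.comp continuous_fst)
  have c6 : Continuous fun q : T 9 × ℝ => ls3 (n := 3) (pr3 (n := 6) q.1) := c3.comp (c2.comp continuous_fst)
  have c7 : Continuous fun q : T 9 × ℝ => ls3 (n := 6) q.1 := c4.comp continuous_fst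
  refine (GLc_can1 (by fun_prop) c5 (w3.continuous.comp (c6.prodMk c7))).mul (GLc.inv ((GLc_V.comp (hc.comp ?_)).ds GLc.one))
  exact (((kz.continuous.comp c7).prodMk (kz.continuous.comp c6)).prodMk (kz.continuous.comp c5)).prodMk continuous_snd

theorem U0_zero (hh : NH h) (x : T 9) : U0 h (x, 0) = 1 := by
  simp only [U0, sub_zero, can_one (V_unit _) (V_unit _), hh.bot _ 0 le_rfl, V_one, ds_one, inv_one, mul_one]
theorem U0_one (hh : NH h) (x : T 9) : U0 h (x, 1) = 1 := by
  simp only [U0, sub_self, hh.top _ _ _ 1 le_rfl]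
  rw [can_zero (V_unit _) (V_unit _), ← V_cmt]
  exact mul_inv' (isUnit_ds (V_unit _) isUnit_one)
theorem U0_fw (hh : NH h) (x : T 9) (t : ℝ) (hx : fw 9 x) : U0 h (x, t) = 1 := by
  have e1 : ∀ b, f1 (b, 1) = 1 := fun b => by simp [f1]
  have e2 : ∀ b g, fw 3 b → f1 (b, g) = 1 := fun b g hb => by simp [f1, kz_fw b hb]
  rcases fw_pr3 (n := 6) x hx with hx | hx
  · rcases fw_pr3 (n := 3) _ hx with hx | hx
    · have := kz_fw _ hx
      simp only [U0, this, V_one, can_one_left _ (V_unit _), hh.o3, ds_one, inv_one, mul_one]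
    · have := kz_fw _ hx
      simp only [U0, w3, ContinuousMap.coe_mk, e2 _ _ hx, this, V_one, can_one_right _ (V_unit _), hh.o2, ds_one, inv_one, mul_one]
  · have := kz_fw _ hx
    simp only [U0, w3, ContinuousMap.coe_mk, this, e1, V_one, can_one_right _ (V_unit _), hh.o1, ds_one, inv_one, mul_one]

noncomputable def U1 (h : ((G × G) × G) × ℝ → G) (y : T 10) : Mat F4 := U0 h (y.1, rep y.2)
theorem GLc_U1 (hh : NH h) : GLc (U1 h) :=
  GLc_loop (X := T 9) (GLc_U0 hh) fun x => by rw [U0_zero hh, U0_one hh]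
theorem U1_fw (hh : NH h) (y : T 10) (hy : fw 10 y) : U1 h y = 1 := by
  rcases hy with hy | hy
  · exact U0_fw hh _ _ hy
  · rw [U1, hy, rep_zero, U0_zero hh]
theorem exists_H (hh : NH h) : ∃ (m : ℕ) (H : T 10 × ℝ → Mat (F4 ⊕ Fin m)), GLc H ∧ (∀ x, H (x, 0) = ds (U1 h x) 1) ∧ (∀ x, H (x, 1) = 1) ∧
      ∀ x t, fw 10 x → H (x, t) = 1 :=
  relnull (GLc_U1 hh) (U1_fw hh) (van_even 5 _ (Van.of_one (n := 10) (GLc_U1 hh) (U1_fw hh)))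

noncomputable def ten (b a x : T 3) (t : ℝ) : T 10 := snoc (ap3 (ap3 b a) x) ((cI t : ℝ) : T1)
theorem continuous_ten {b a x : X → T 3} {t : X → ℝ} (hb : Continuous b) (ha : Continuous a) (hx : Continuous x) (ht : Continuous t) :
    Continuous fun q => ten (b q) (a q) (x q) (t q) :=
  continuous_snoc (continuous_ap3 (continuous_ap3 hb ha) hx) ((AddCircle.continuous_mk' 1).comp (continuous_cI.comp ht))
theorem U1_ten (hh : NH h) (b a x : T 3) (t : ℝ) : U1 h (ten b a x t) =
    can (V (kz b)) (V (w3 (a, x))) (1 - cI t) * (ds (V (h (((kz x, kz a), kz b), t))) 1)⁻¹ := by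
  rw [← hh.cl]
  exact rep_cI2 (f := U0 h) (fun x => by rw [U0_zero hh, U0_one hh]) (ap3 (ap3 b a) x) t
theorem ten_fw (b a x : T 3) (t : ℝ) (hf : (fw 3 b ∨ bw (a, x)) ∨ (t ≤ 0 ∨ 1 ≤ t)) : fw 10 (ten b a x t) := by
  rcases hf with (hf | hf | hf) | (hf | hf)
  · exact Or.inl (fw_ap3 _ _ (Or.inl (fw_ap3 _ _ (Or.inl hf))))
  · exact Or.inl (fw_ap3 _ _ (Or.inl (fw_ap3 _ _ (Or.inr hf))))
  · exact Or.inl (fw_ap3 _ _ (Or.inr hf))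
  · refine Or.inr ?_
    show ((cI t : ℝ) : T1) = 0
    rw [cI_le0 hf]; rfl
  · refine Or.inr ?_
    show ((cI t : ℝ) : T1) = 0
    rw [cI_ge hf]; exact AddCircle.coe_period 1

theorem exists_TY (hh : NH h) : ∃ (m : ℕ) (F : C(Y3 hh, Mat (F4 ⊕ Fin m))), GLc F ∧ (∀ g, F (mπ _ _ g) = ds (ds (V g) 1) 1) ∧
    ∀ b g t, F (mpt _ _ ((b, mπ w3 bw g), t)) = ds (can (V (kz b)) (V g) (1 - cI t)) 1 := by
  obtain ⟨m, H, hH, H0, H1, Hf⟩ := exists_H hh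
  have cc := continuous_cI
  have hc := hh.cont
  have f11 : ∀ b, f1 (b, 1) = 1 := fun b => by simp [f1]
  let E : ((T 3 × T 3) × ℝ) × (T 3 × ℝ) → Mat (F4 ⊕ Fin m) := fun q => H (ten q.2.1 q.1.1.1 q.1.1.2 q.2.2, 1 - cI q.1.2) *
    ds (ds (V (h (((kz q.1.1.2, kz q.1.1.1), kz q.2.1), min (cI q.2.2) (cI q.1.2)))) 1) 1
  have gE : GLc E := by
    refine (hH.comp ((continuous_ten ?_ ?_ ?_ ?_).prodMk ?_)).mul (((GLc_V.comp (hc.comp ?_)).ds GLc.one).ds GLc.one) <;> fun_prop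
  have g2 : GLc fun q : G × (T 3 × ℝ) => ds (can (V (kz q.2.1)) (V q.1) (1 - cI q.2.2)) (1 : Mat (Fin m)) :=
    (GLc_can1 (by fun_prop) (by fun_prop) (by fun_prop)).ds GLc.one
  have E3 : ∀ a t (k : T 3 × ℝ), bw a → E ((a, t), k) = 1 := by
    rintro ⟨a, x⟩ t ⟨b, s⟩ hb
    simp only [E]
    rw [Hf _ _ (ten_fw _ _ _ _ (Or.inl (Or.inr hb)))]
    rcases hb with hb | hb
    · rw [kz_fw _ hb, hh.o2, V_one, ds_one, ds_one, one_mul]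
    · rw [kz_fw _ hb, hh.o1, V_one, ds_one, ds_one, one_mul]
  obtain ⟨F, Fc, F1, F2⟩ := mc_desc (K := T 3 × ℝ) (φ := w3) (B := bw) _ E g2.1 gE.1
    (by
      rintro ⟨a, x⟩ t ⟨b, s⟩ ht
      simp only [E]
      rw [cI_ge ht, sub_self, H0, U1_ten hh, min_eq_left (cI_le s), hh.cl, ds_mul, mul_assoc, inv_mul' (isUnit_ds (V_unit _) isUnit_one), mul_one, mul_one])
    (by
      rintro ⟨a, x⟩ t ⟨b, s⟩ ht
      simp only [E]
      rw [cI_le0 ht, sub_zero, H1, min_eq_right (cI_nonneg s), hh.bot _ _ le_rfl, V_one, can_one_right _ (V_unit _)]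
      simp only [ds_one, one_mul])
    (by
      rintro a t k ha
      rw [E3 a t k ha, V_one, can_one_right _ (V_unit _), ds_one])
  obtain ⟨F', F1', F2'⟩ := mc_desc1 (φ := ph hh) (B := bY) (fun g => ds (ds (V g) (1 : Mat (Fin 2))) (1 : Mat (Fin m)))
    (fun q => F (q.1.2, (q.1.1, q.2))) ((GLc_V.ds GLc.one).ds GLc.one).1 (by fun_prop)
    (by
      rintro ⟨b, c⟩ t ht
      simp only
      induction c using mc_ind with
      | h1 g => rw [F1, ph_π, cI_ge ht, sub_self]; exact congrArg (fun z => ds z 1) (can1_top (b, g))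
      | h2 p =>
        obtain ⟨⟨a, x⟩, r⟩ := p
        rw [F2, ph_pt]
        simp only [E]
        rw [Hf _ _ (ten_fw _ _ _ _ (Or.inr (Or.inr ht))), one_mul, cI_ge ht, min_eq_right (cI_le r), hh.cl])
    (by
      rintro ⟨b, c⟩ t ht
      simp only [V_one, ds_one]
      induction c using mc_ind with
      | h1 g => rw [F1, cI_le0 ht, sub_zero, can_one (V_unit _) (V_unit _), ds_one]
      | h2 p =>
        obtain ⟨⟨a, x⟩, r⟩ := p
        rw [F2]
        simp only [E]
        rw [Hf _ _ (ten_fw _ _ _ _ (Or.inr (Or.inl ht))), one_mul, cI_le0 ht, min_eq_left (cI_nonneg r), hh.bot _ _ le_rfl, V_one, ds_one, ds_one])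
    (by
      rintro ⟨b, c⟩ t hb
      simp only [V_one, ds_one]
      rcases hb with hb | hb
      · simp only at hb
        induction c using mc_ind with
        | h1 g => rw [F1, kz_fw _ hb, V_one, can_one_left _ (V_unit _), ds_one]
        | h2 p =>
          obtain ⟨⟨a, x⟩, r⟩ := p
          rw [F2]
          simp only [E]
          rw [Hf _ _ (ten_fw _ _ _ _ (Or.inl (Or.inl hb))), one_mul, kz_fw _ hb, hh.o3, V_one, ds_one, ds_one]
      · simp only at hb
        rw [hb, F1, V_one, can_one_right _ (V_unit _), ds_one])
  refine ⟨m, F', ⟨F'.continuous, mc_ind _ (fun g => ?_) ?_⟩, F1', fun b g t => ?_⟩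
  · rw [F1']; exact isUnit_ds (isUnit_ds (V_unit _) isUnit_one) isUnit_one
  · rintro ⟨⟨b, c⟩, t⟩
    rw [F2']
    simp only
    induction c using mc_ind with
    | h1 g => rw [F1]; exact g2.2 (g, (b, t))
    | h2 p => rw [F2]; exact gE.2 _
  · rw [F2', F1]

theorem jY_π (hh : NH h) (g : G) : jY hh (mπ f1 b1 g) = mπ (ph hh) bY g := mmap_π (φ' := ph hh) (B' := bY) αj (αj_φ hh) αj_b g
theorem jY_pt (hh : NH h) (p : (T 3 × G) × ℝ) : jY hh (mpt f1 b1 p) = mpt (ph hh) bY ((p.1.1, mπ w3 bw p.1.2), p.2) :=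
  mmap_pt (φ' := ph hh) (B' := bY) αj (αj_φ hh) αj_b p
theorem exists_tY (hh : NH h) : ∃ c, K1.map (jY hh) c = cls T4 := by
  obtain ⟨m, F, h1, h2, h3⟩ := exists_TY hh
  refine ⟨cls F, ?_⟩
  rw [K1.map_cls _ h1]
  have e : (fun y => F (jY hh y)) = fun y => ds (T4 y) 1 := by
    funext y
    induction y using mc_ind with
    | h1 g => rw [jY_π, h2, T4_π]
    | h2 p => rw [jY_pt, T4_pt, h3 p.1.1 p.1.2 p.2]
  rw [e, cls_ds_one GLc_T4]
noncomputable def tY (hh : NH h) : K1 (Y3 hh) := (exists_tY hh).choose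
theorem tY_j (hh : NH h) : K1.map (jY hh) (tY hh) = cls T4 := (exists_tY hh).choose_spec
theorem T4_G : K1.map (mπ f1 b1) (cls T4) = cls V := by
  rw [K1.map_cls _ GLc_T4]
  simp only [T4_π]
  exact cls_ds_one GLc_V
theorem tY_G (hh : NH h) : K1.map (mπ (ph hh) bY) (tY hh) = cls V := by
  rw [← T4_G, ← tY_j hh, K1.map_comp]
  exact K1.map_congr (fun g => (jY_π hh g).symm) _
end H3b
end PK

namespace PK
open Topology
section H4
variable {X X' Y Z Z' W K : Type} [TopologicalSpace X] [TopologicalSpace X'] [TopologicalSpace Y] [TopologicalSpace Z] [TopologicalSpace Z'] [TopologicalSpace W]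
  [TopologicalSpace K]
variable {ι κ : Type} [Fintype ι] [DecidableEq ι] [Fintype κ] [DecidableEq κ]
variable {h : ((G × G) × G) × ℝ → G}

theorem Psi_half {p : ℕ} [Fact p.Prime] (c : K1 X) : ∃ d, Psi p c = p • d := by
  obtain ⟨n, u, hu, rfl⟩ := exists_cls c
  exact ⟨_, Psi_div hu⟩

noncomputable def Dw : K1 (Cone (mπ w3 bw)) →+ ℤ := (degT 1).comp (Th (X := T 3) w3 bw)
theorem Dw_Psi {p : ℕ} [Fact p.Prime] (d : K1 (Cone (mπ w3 bw))) : Dw (Psi p d) = (p:ℤ)^4 * Dw d := by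
  show degT 1 (Th w3 bw (Psi p d)) = (p:ℤ)^4 * degT 1 (Th w3 bw d)
  rw [Th_Psi, map_nsmul, degT_Psi]
  simp only [nsmul_eq_mul]
  push_cast
  ring

theorem fC_π (g : G) : fC (mπ w3 bw g) = mπ f1 b1 g := mmap_π (φ' := f1) (B' := b1) αf (fun _ => rfl) αf_b g
noncomputable def kf : C(Cone (mπ w3 bw), Cone (mπ f1 b1)) := kmap fC fC_π
theorem Dw_U4 : Dw (K1.map kf (cls U4)) = -1 := by
  have := Th_nat (X := T 3) (Y := G) w3 bw f1 b1 kz αf (fun _ => rfl) (fun _ => rfl) αf_b (cls U4)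
  rw [Th_U4] at this
  rw [← deg_kz, this]
  rfl

noncomputable def kj (hh : NH h) : C(Cone (mπ f1 b1), Cone (mπ (ph hh) bY)) := kmap (jY hh) (jY_π hh)
theorem kj_nat (hh : NH h) (d : K1 (Cone (mπ (ph hh) bY))) : K1.map (cπ (mπ f1 b1)) (K1.map (kj hh) d) = K1.map (jY hh) (K1.map (cπ (mπ (ph hh) bY)) d) :=
  kmap_nat (jY hh) (jY_π hh) d
theorem Th_j (hh : NH h) (d : K1 (Cone (mπ (ph hh) bY))) : K1.map (mπ w3 bw) (Th (ph hh) bY d) = Th f1 b1 (K1.map (kj hh) d) :=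
  Th_nat f1 b1 (ph hh) bY (mπ w3 bw) αj (fun _ => rfl) (αj_φ hh) αj_b d

theorem U4_cπ : (2:ℕ) • K1.map (cπ (mπ f1 b1)) (cls U4) = Psi 2 (cls T4) - (4:ℕ) • cls T4 := by
  rw [K1.map_cls _ GLc_U4, ← cls_u4 GLc_T4]
  congr 2
  funext y
  exact U4_π y

theorem jY_U4 (hh : NH h) : K1.map (jY hh) (Psi 2 (tY hh) - (4:ℕ) • tY hh) = (2:ℕ) • K1.map (cπ (mπ f1 b1)) (cls U4) := by
  rw [U4_cπ, ← tY_j hh, ← Psi_map, map_sub, map_nsmul]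

theorem torsU {X : Type} [TopologicalSpace X] (i : C(G, X)) (c d : K1 (Cone i)) (h : (2:ℕ) • K1.map (cπ i) c = (2:ℕ) • K1.map (cπ i) d) :
    (2:ℕ) • (c - d) = 0 := by
  refine cone_inj loopNull_G i _ ?_
  rw [map_nsmul, map_sub, smul_sub, h, sub_self]

theorem torsG {A : Type} [AddCommGroup A] (F : A →+ K1 G) (c d : A) (h : (2:ℕ) • (c - d) = 0) : F c = F d := by
  rw [← sub_eq_zero]
  refine K1G_torsion 2 (by norm_num) _ ?_
  rw [← map_sub, ← map_nsmul, h, map_zero]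

theorem algA1 (hh : NH h) (N1 : K1 (Cone (mπ (ph hh) bY))) (hN : (2:ℕ) • K1.map (cπ (mπ (ph hh) bY)) N1 = Psi 2 (tY hh) - (4:ℕ) • tY hh) :
    K1.map (mπ w3 bw) (Th (ph hh) bY N1) = cls V := by
  have h1 : (2:ℕ) • K1.map (jY hh) (K1.map (cπ (mπ (ph hh) bY)) N1) = (2:ℕ) • K1.map (cπ (mπ f1 b1)) (cls U4) :=
    (map_nsmul (K1.map (jY hh)) 2 _).symm.trans ((congrArg (K1.map (jY hh)) hN).trans (jY_U4 hh))
  have h2 : (2:ℕ) • K1.map (cπ (mπ f1 b1)) (K1.map (kj hh) N1) = (2:ℕ) • K1.map (cπ (mπ f1 b1)) (cls U4) :=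
    (congrArg (fun z => (2:ℕ) • z) (kj_nat hh N1)).trans h1
  exact (Th_j hh N1).trans ((torsG (Th f1 b1) _ _ (torsU (mπ f1 b1) _ _ h2)).trans Th_U4)

theorem algA (hh : NH h) : ∃ n μ : K1 Cw, K1.map (mπ w3 bw) n = cls V ∧ K1.map (mπ w3 bw) μ = (4:ℕ) • cls V ∧
    (18:ℕ) • n + (12:ℕ) • Psi 2 μ = (12:ℕ) • μ + (18:ℕ) • Psi 3 n := by
  obtain ⟨N0, hN0⟩ := Psi_half (p := 2) (tY hh)
  obtain ⟨M0, hM0⟩ := Psi_half (p := 3) (tY hh)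
  obtain ⟨N, hN⟩ : ∃ N, (2:ℕ) • N = Psi 2 (tY hh) - (4:ℕ) • tY hh := ⟨N0 - (2:ℕ) • tY hh, by rw [hN0]; module⟩
  obtain ⟨M, hM⟩ : ∃ M, (3:ℕ) • M = Psi 3 (tY hh) - (9:ℕ) • tY hh := ⟨M0 - (3:ℕ) • tY hh, by rw [hM0]; module⟩
  have hNG : K1.map (mπ (ph hh) bY) N = 0 := by
    refine K1G_torsion 2 (by norm_num) _ ?_
    rw [← map_nsmul, hN, map_sub, Psi_map, map_nsmul, Psi_G]
    norm_num
  have hMG : K1.map (mπ (ph hh) bY) M = 0 := by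
    refine K1G_torsion 3 (by norm_num) _ ?_
    rw [← map_nsmul, hM, map_sub, Psi_map, map_nsmul, Psi_G]
    norm_num
  obtain ⟨N1, hN1⟩ := cone_ex _ _ hNG
  obtain ⟨M1, hM1⟩ := cone_ex _ _ hMG
  have hn : K1.map (mπ w3 bw) (Th (ph hh) bY N1) = cls V := algA1 hh N1 (by rw [hN1, hN])
  have key : (18:ℕ) • N1 + (3:ℕ) • Psi 2 M1 = (12:ℕ) • M1 + (2:ℕ) • Psi 3 N1 := by
    rw [← sub_eq_zero]
    refine cone_inj loopNull_G _ _ ?_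
    simp only [map_sub, map_add, map_nsmul, Psi_map, hN1, hM1]
    have h1 := congrArg (Psi 2) hM
    have h2 := congrArg (Psi 3) hN
    simp only [map_sub, map_nsmul] at h1 h2
    have h3 := Psi_comm (tY hh)
    linear_combination (norm := module) (9:ℕ) • hN + h1 - (4:ℕ) • hM - h2 + h3
  have key2 := congrArg (Th (ph hh) bY) key
  simp only [map_add, map_nsmul, Th_Psi] at key2
  have key3 : (18:ℕ) • Th (ph hh) bY N1 + (12:ℕ) • Psi 2 (Th (ph hh) bY M1) = (12:ℕ) • Th (ph hh) bY M1 + (18:ℕ) • Psi 3 (Th (ph hh) bY N1) := by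
    linear_combination (norm := module) key2
  refine ⟨_, _, hn, ?_, key3⟩
  have k4 := congrArg (K1.map (mπ w3 bw)) key3
  simp only [map_add, map_nsmul, Psi_map, hn, Psi_G] at k4
  rw [← sub_eq_zero]
  refine K1G_torsion 36 (by norm_num) _ ?_
  linear_combination (norm := module) k4

theorem contra (hh : NH h) : False := by
  obtain ⟨n, μ, hn, hμ, key⟩ := algA hh
  have hT : K1.map (mπ w3 bw) (K1.map fC (cls T4)) = cls V := by
    rw [K1.map_comp, ← T4_G]
    exact K1.map_congr fC_π _
  obtain ⟨j, hj⟩ := cone_ex (mπ w3 bw) (μ - (4:ℕ) • n) (by rw [map_sub, map_nsmul, hn, hμ, sub_self])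
  obtain ⟨i, hi⟩ := cone_ex (mπ w3 bw) (n - K1.map fC (cls T4)) (by rw [map_sub, hn, hT, sub_self])
  obtain ⟨a, ha⟩ := cone_ex (mπ w3 bw) (Psi 2 n - (4:ℕ) • n) (by rw [map_sub, map_nsmul, Psi_map, hn, Psi_G]; norm_num)
  obtain ⟨b, hb⟩ := cone_ex (mπ w3 bw) (Psi 3 n - (9:ℕ) • n) (by rw [map_sub, map_nsmul, Psi_map, hn, Psi_G]; norm_num)
  have e1 : a = Psi 2 i - (4:ℕ) • i + (2:ℕ) • K1.map kf (cls U4) := by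
    rw [← sub_eq_zero]
    refine cone_inj loopNull_G _ _ ?_
    have hU := congrArg (K1.map fC) U4_cπ
    simp only [map_sub, map_nsmul, Psi_map] at hU
    rw [← kmap_nat fC fC_π] at hU
    simp only [map_sub, map_add, map_nsmul, Psi_map, ha, hi, kf]
    linear_combination (norm := module) -hU
  have e2 : (12:ℕ) • Psi 2 j - (12:ℕ) • j + (48:ℕ) • a - (18:ℕ) • b = 0 := by
    refine cone_inj loopNull_G _ _ ?_
    simp only [map_sub, map_add, map_nsmul, Psi_map, ha, hb, hj]
    linear_combination (norm := module) key
  have e3 : Psi 3 a - (9:ℕ) • a = Psi 2 b - (4:ℕ) • b := by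
    rw [← sub_eq_zero]
    refine cone_inj loopNull_G _ _ ?_
    simp only [map_sub, map_add, map_nsmul, Psi_map, ha, hb]
    have := Psi_comm n
    linear_combination (norm := module) -this
  have d1 := congrArg Dw e1
  have d2 := congrArg Dw e2
  have d3 := congrArg Dw e3
  simp only [map_sub, map_add, map_nsmul, Dw_Psi, Dw_U4, map_zero, nsmul_eq_mul] at d1 d2 d3
  push_cast at d1 d2 d3
  omega
end H4
end PK

/-- **Theorem (Porter).** The iterated commutator map
`c₃ : SU(2)³ → SU(2)`, `(g₁,g₂,g₃) ↦ [g₃,[g₂,g₁]]` with `[x,y] = x y x⁻¹ y⁻¹`,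
is continuous and not null-homotopic. -/
theorem iteratedCommutator₃_SU2_not_nullHomotopic :
    Continuous (fun g : SU 2 × SU 2 × SU 2 =>
      g.2.2 * (g.2.1 * g.1 * g.2.1⁻¹ * g.1⁻¹) * g.2.2⁻¹ *
        (g.2.1 * g.1 * g.2.1⁻¹ * g.1⁻¹)⁻¹) ∧
    ∀ c : C(SU 2 × SU 2 × SU 2, SU 2),
      (∀ g₁ g₂ g₃ : SU 2, c (g₁, g₂, g₃)
          = g₃ * (g₂ * g₁ * g₂⁻¹ * g₁⁻¹) * g₃⁻¹ * (g₂ * g₁ * g₂⁻¹ * g₁⁻¹)⁻¹) →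
        ¬∃ y : SU 2, c.Homotopic (ContinuousMap.const (SU 2 × SU 2 × SU 2) y) := by
  refine ⟨by fun_prop, ?_⟩
  rintro c hc ⟨y, ⟨F⟩⟩
  obtain ⟨h, hh⟩ := PK.exists_NH (fun q => F (Set.projIcc (0:ℝ) 1 zero_le_one q.2, (q.1.1.1, q.1.1.2, q.1.2)))
    (by have := continuous_projIcc (a := (0:ℝ)) (b := 1) (h := zero_le_one); fun_prop) y
    (fun x y z => by simp only [Set.projIcc_left]; exact (F.apply_zero _).trans (hc _ _ _))
    (fun p => by simp only [Set.projIcc_right]; exact F.apply_one _)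
  exact PK.contra hh
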